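/- Let (R, m, K) be a commutative Noetherian regular local ring of mixed characteristic p > 0 (that is, R has characteristic 0 and its residue field K has characteristic p). Then for every finite list of ideals I₁, …, I_t ⊆ R and natural numbers i₁, …, i_t, the set of associated primes P of the iterated local cohomology module H^{i₁}_{I₁}(H^{i₂}_{I₂}(⋯ H^{i_t}_{I_t}(R) ⋯)) such that p ∉ P is finite. -/

import Mathlib

/-- A Noetherian local ring is *regular* if its Krull dimension equals the dimension of its
cotangent space (the minimal number of generators of the maximal ideal). -/
def IsRegularLocal (A : Type*) [CommRing A] [IsLocalRing A] : Prop :=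
  IsNoetherianRing A ∧
    ringKrullDim A =
      Module.finrank (IsLocalRing.ResidueField A) (IsLocalRing.CotangentSpace A)

/-- The iterated local cohomology module
`H^{i₁}_{I₁}(H^{i₂}_{I₂}(⋯ H^{i_t}_{I_t}(M) ⋯))`, where
`l = [(I₁, i₁), (I₂, i₂), …, (I_t, i_t)]`. -/
noncomputable def iteratedLocalCohomology {R : Type} [CommRing R]
    (l : List (Ideal R × ℕ)) (M : ModuleCat R) : ModuleCat R :=
  l.foldr (fun q N => (localCohomology q.1 q.2).obj N) M

noncomputable section
namespace LC
open IsLocalRing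

section LocalCohomology
open CategoryTheory Limits Opposite
variable {R : Type} [CommRing R] (I : Ideal R)

abbrev Q : ℕᵒᵖ ⥤ ModuleCat.{0} R := localCohomology.ringModIdeals (localCohomology.idealPowersDiagram I)

def res (n : ℕ) : ProjectiveResolution ((Q I).obj (op n)) := projectiveResolution _

def P : ℕᵒᵖ ⥤ ChainComplex (ModuleCat.{0} R) ℕ :=
  Functor.ofOpSequence (X := fun n => (res I n).complex) fun n =>
    ProjectiveResolution.lift ((Q I).map (homOfLE (Nat.le_succ n)).op) (res I (n+1)) (res I n)

def π : P I ⟶ Q I ⋙ ChainComplex.single₀ (ModuleCat.{0} R) :=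
  NatTrans.ofOpSequence (fun n => (res I n).π) fun n => by
    simp only [P, Functor.ofOpSequence_map_homOfLE_succ]
    exact ProjectiveResolution.lift_commutes _ _ _

def D (M : ModuleCat.{0} R) : (ℕᵒᵖ)ᵒᵖ ⥤ CochainComplex (ModuleCat.{0} R) ℕ :=
  (P I ⋙ ((linearYoneda R (ModuleCat.{0} R)).obj M).rightOp.mapHomologicalComplex _).op ⋙
    HomologicalComplex.unopFunctor _ _

lemma paste {V : Type*} [Category V] {A B C A' B' C' : V} (f : A ⟶ A') (a : A ⟶ B) (a' : A' ⟶ B')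
    (g : B ⟶ B') (h1 : a ≫ g = f ≫ a') (c : C ≅ B) (c' : C' ≅ B') (k : C ⟶ C')
    (h2 : k ≫ c'.hom = c.hom ≫ g) : f ≫ (a' ≫ c'.inv) = (a ≫ c.inv) ≫ k := by
  rw [← Category.assoc, ← h1, Iso.comp_inv_eq, Category.assoc, Category.assoc, h2, Iso.inv_hom_id_assoc]

lemma homologyUnop_naturality {K L : ChainComplex (ModuleCat.{0} R)ᵒᵖ ℕ} (ψ : K ⟶ L) (i : ℕ) :
    HomologicalComplex.homologyMap ((HomologicalComplex.unopFunctor _ _).map ψ.op) i ≫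
      (K.homologyUnop i).hom =
    (L.homologyUnop i).hom ≫ (HomologicalComplex.homologyMap ψ i).unop :=
  (congrArg Quiver.Hom.unop (HomologicalComplex.homologyOp_hom_naturality
    ((HomologicalComplex.unopFunctor _ _).map ψ.op) i)).symm

lemma comm_zero {n m : ℕᵒᵖ} (f : n ⟶ m) :
    ((P I).map f).f 0 ≫ (res I m.unop).π.f 0 = (res I n.unop).π.f 0 ≫ (Q I).map f := by
  have := HomologicalComplex.congr_hom ((π I).naturality f) 0
  exact this.trans (by simp; rfl)

def isoH (M : ModuleCat.{0} R) (i : ℕ) :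
    (localCohomology.diagram (localCohomology.idealPowersDiagram I) i).flip.obj M ≅
      D I M ⋙ HomologicalComplex.homologyFunctor _ _ i :=
  NatIso.ofComponents (fun n => (res I n.unop.unop).isoExt i M) (by
    intro n m f
    have h1 := congrArg Quiver.Hom.unop <| ProjectiveResolution.isoLeftDerivedObj_inv_naturality
      ((Q I).map f.unop) (res I m.unop.unop) (res I n.unop.unop) ((P I).map f.unop)
      (comm_zero I f.unop) ((linearYoneda R (ModuleCat.{0} R)).obj M).rightOp i
    have h2 := homologyUnop_naturality
      ((((linearYoneda R (ModuleCat.{0} R)).obj M).rightOp.mapHomologicalComplex _).map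
        ((P I).map f.unop)) i
    exact paste _ _ _ _ h1.symm (HomologicalComplex.homologyUnop _ i)
      (HomologicalComplex.homologyUnop _ i) _ h2)

def isoG (M : ModuleCat.{0} R) (i : ℕ) :
    (localCohomology I i).obj M ≅
      colimit (D I M ⋙ HomologicalComplex.homologyFunctor _ _ i) :=
  colimitObjIsoColimitCompEvaluation _ _ ≪≫ HasColimit.isoOfNatIso (isoH I M i)

abbrev J := (ℕᵒᵖ)ᵒᵖ
def Dmap {M M' : ModuleCat.{0} R} (g : M ⟶ M') : D I M ⟶ D I M' where
  app n :=
    { f i := ModuleCat.ofHom (Linear.rightComp (C := ModuleCat.{0} R) R ((res I n.unop.unop).complex.X i) g)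
      comm' i j _ := by ext x; exact (Category.assoc (obj := ModuleCat.{0} R) _ _ _).symm }
  naturality n m f := by
    ext i x
    exact (Category.assoc (obj := ModuleCat.{0} R) _ _ _)

def DD (M : ModuleCat.{0} R) : CochainComplex (J ⥤ ModuleCat.{0} R) ℕ where
  X i := D I M ⋙ HomologicalComplex.eval _ _ i
  d i j := { app n := ((D I M).obj n).d i j
             naturality n m f := ((D I M).map f).comm i j }
  shape i j h := by ext n : 2; exact ((D I M).obj n).shape i j h
  d_comp_d' i j k _ _ := by ext n : 2; exact ((D I M).obj n).d_comp_d i j k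

def DDmap {M M' : ModuleCat.{0} R} (g : M ⟶ M') : DD I M ⟶ DD I M' where
  f i := { app n := ((Dmap I g).app n).f i
           naturality n m f := by
            exact HomologicalComplex.congr_hom ((Dmap I g).naturality f) i }
  comm' i j _ := by ext n : 2; exact ((Dmap I g).app n).comm i j

def DDhom (M : ModuleCat.{0} R) (i : ℕ) :
    (DD I M).homology i ≅ D I M ⋙ HomologicalComplex.homologyFunctor _ _ i :=
  NatIso.ofComponents (fun n => (((DD I M).sc i).mapHomologyIso ((evaluation _ _).obj n)).symm) (by
    intro n m f
    have := NatTrans.app_homology ((evaluation J (ModuleCat.{0} R)).map f) ((DD I M).sc i)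
    have e := congrArg (fun t => t ≫ (((DD I M).sc i).mapHomologyIso ((evaluation _ _).obj m)).inv) this
    simp only [Category.assoc, Iso.hom_inv_id, Category.comp_id] at e
    exact e)

/-- The complex computing local cohomology. -/
def CM : ModuleCat.{0} R → CochainComplex (ModuleCat.{0} R) ℕ := fun M =>
  ((colim (J := J) (C := ModuleCat.{0} R)).mapHomologicalComplex _).obj (DD I M)

def CMmap {M M' : ModuleCat.{0} R} (g : M ⟶ M') : CM I M ⟶ CM I M' :=
  ((colim (J := J) (C := ModuleCat.{0} R)).mapHomologicalComplex _).map (DDmap I g)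

def isoCM (M : ModuleCat.{0} R) (i : ℕ) :
    (localCohomology I i).obj M ≅ (CM I M).homology i :=
  isoG I M i ≪≫ (colim.mapIso (DDhom I M i)).symm ≪≫
    (((DD I M).sc i).mapHomologyIso (colim (J := J) (C := ModuleCat.{0} R))).symm

lemma comp_assoc_zero {A X Y Z : ModuleCat.{0} R} (x : A ⟶ X) (f : X ⟶ Y) (g : Y ⟶ Z)
    (h : f ≫ g = 0) : (x ≫ f) ≫ g = 0 := by
  rw [Category.assoc, h, comp_zero]

lemma exists_projective_lift {A X Y : ModuleCat.{0} R} (hA : Projective A) (g : X ⟶ Y) [Epi g]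
    (x : A ⟶ Y) : ∃ y : A ⟶ X, y ≫ g = x :=
  ⟨Projective.factorThru x g, Projective.factorThru_comp x g⟩

lemma exact_of_evaluation (S : ShortComplex (J ⥤ ModuleCat.{0} R))
    (h : ∀ n : J, (S.map ((evaluation _ _).obj n)).Exact) : S.Exact := by
  rw [ShortComplex.exact_iff_isZero_homology]
  refine (Functor.isZero_iff _).2 fun n => ?_
  exact IsZero.of_iso ((ShortComplex.exact_iff_isZero_homology _).1 (h n))
    (S.mapHomologyIso ((evaluation J (ModuleCat.{0} R)).obj n)).symm

def SM (S : ShortComplex (ModuleCat.{0} R)) : ShortComplex (CochainComplex (ModuleCat.{0} R) ℕ) :=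
  ShortComplex.mk (CMmap I S.f) (CMmap I S.g) (by
    have h : DDmap I S.f ≫ DDmap I S.g = 0 := by
      ext i n x
      exact comp_assoc_zero _ _ _ S.zero
    have := congrArg ((colim (J := J) (C := ModuleCat.{0} R)).mapHomologicalComplex
      (ComplexShape.up ℕ)).map h
    rw [Functor.map_comp, Functor.map_zero] at this
    exact this)

def SD (S : ShortComplex (ModuleCat.{0} R)) (i : ℕ) : ShortComplex (J ⥤ ModuleCat.{0} R) :=
  ShortComplex.mk ((DDmap I S.f).f i) ((DDmap I S.g).f i) (by
    ext n x
    exact comp_assoc_zero _ _ _ S.zero)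

lemma SD_shortExact {S : ShortComplex (ModuleCat.{0} R)} (hS : S.ShortExact) (i : ℕ) :
    (SD I S i).ShortExact := by
  have hmono := hS.mono_f
  have hepi := hS.epi_g
  have key : ∀ n : J, ((SD I S i).map ((evaluation _ _).obj n)).ShortExact := by
    intro n
    have := (res I n.unop.unop).projective i
    refine ShortComplex.ShortExact.mk' ?_ ?_ ?_
    · rw [ShortComplex.moduleCat_exact_iff]
      intro (x : _ ⟶ S.X₂) (hx : x ≫ S.g = 0)
      exact ⟨hS.exact.lift x hx, hS.exact.lift_f x hx⟩
    · rw [ModuleCat.mono_iff_injective]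
      intro (x : _ ⟶ S.X₁) (y : _ ⟶ S.X₁) (h : x ≫ S.f = y ≫ S.f)
      exact (cancel_mono S.f).1 h
    · rw [ModuleCat.epi_iff_surjective]
      intro (x : (res I n.unop.unop).complex.X i ⟶ S.X₃)
      exact exists_projective_lift this S.g x
  refine ShortComplex.ShortExact.mk' ?_ ?_ ?_
  · exact exact_of_evaluation _ fun n => (key n).exact
  · exact (NatTrans.mono_iff_mono_app _).2 fun n => (key n).mono_f
  · exact (NatTrans.epi_iff_epi_app _).2 fun n => (key n).epi_g

lemma SM_shortExact {S : ShortComplex (ModuleCat.{0} R)} (hS : S.ShortExact) :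
    (SM I S).ShortExact :=
  HomologicalComplex.shortExact_of_degreewise_shortExact _ fun i =>
    (SD_shortExact I hS i).map_of_exact (colim (J := J) (C := ModuleCat.{0} R))

lemma smul_π_eq_zero {n : ℕ} {r : R} (hr : r ∈ I ^ n) :
    (r • 𝟙 (res I n).complex) ≫ (res I n).π = 0 := by
  rw [Linear.smul_comp, Category.id_comp]
  ext x
  change r • ((res I n).π.f 0).hom x = 0
  generalize ((res I n).π.f 0).hom x = y
  change r • (show R ⧸ I ^ n from y) = 0
  obtain ⟨y, rfl⟩ := Ideal.Quotient.mk_surjective (show R ⧸ I ^ n from y)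
  rw [← Ideal.Quotient.mk_eq_mk, ← Submodule.Quotient.mk_smul, Submodule.Quotient.mk_eq_zero]
  exact Ideal.mul_mem_right _ _ hr

lemma exists_smul_eq (n : ℕ) {r : R} (hr : r ∈ I ^ n) {N : ModuleCat.{0} R} (i : ℕ)
    (x : (res I n).complex.X (i + 1) ⟶ N) (hx : (res I n).complex.d (i + 2) (i + 1) ≫ x = 0) :
    ∃ y, r • x = (res I n).complex.d (i + 1) i ≫ y := by
  let h := ProjectiveResolution.liftHomotopyZero (r • 𝟙 (res I n).complex) (smul_π_eq_zero I hr)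
  have e := h.comm (i + 1)
  rw [dNext_eq h.hom (show (ComplexShape.down ℕ).Rel (i+1) i from rfl),
    prevD_eq h.hom (show (ComplexShape.down ℕ).Rel (i+2) (i+1) from rfl)] at e
  refine ⟨h.hom i (i+1) ≫ x, ?_⟩
  have e' := congrArg (· ≫ x) e
  simp only [Preadditive.add_comp, Category.assoc, hx, comp_zero, add_zero,
    HomologicalComplex.zero_f] at e'
  rw [← e']
  simp

lemma smul_eq_zero_of_cocycle (n : ℕ) {r : R} (hr : r ∈ I ^ n) {N : ModuleCat.{0} R}
    (x : (res I n).complex.X 0 ⟶ N) (hx : (res I n).complex.d 1 0 ≫ x = 0) :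
    r • x = 0 := by
  let h := ProjectiveResolution.liftHomotopyZero (r • 𝟙 (res I n).complex) (smul_π_eq_zero I hr)
  have e := h.comm 0
  rw [dNext_eq_zero h.hom _ (by simp),
    prevD_eq h.hom (show (ComplexShape.down ℕ).Rel 1 0 from rfl)] at e
  have e' := congrArg (· ≫ x) e
  simp only [Preadditive.add_comp, Category.assoc, hx, comp_zero, add_zero, zero_comp,
    HomologicalComplex.zero_f] at e'
  rw [← e']
  simp

/-- Degreewise acyclicity of `Hom(P, N)` for the chosen resolutions of the `R ⧸ I ^ m`. -/
def Acyc (N : ModuleCat.{0} R) : ℕ → Prop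
  | 0 => ∀ m, ∀ x : (res I m).complex.X 0 ⟶ N, (res I m).complex.d 1 0 ≫ x = 0 → x = 0
  | i + 1 => ∀ m, ∀ x : (res I m).complex.X (i + 1) ⟶ N,
      (res I m).complex.d (i + 2) (i + 1) ≫ x = 0 →
      ∃ y, (res I m).complex.d (i + 1) i ≫ y = x

lemma Acyc.isZero {i : ℕ} {N : ModuleCat.{0} R} (hN : Acyc I N i) :
    IsZero ((localCohomology I i).obj N) := by
  refine IsZero.of_iso ?_ (isoG I N i)
  have key : ∀ n : J, IsZero ((D I N ⋙ HomologicalComplex.homologyFunctor _ _ i).obj n) := by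
    intro n
    refine (HomologicalComplex.exactAt_iff_isZero_homology _ _).1 ?_
    generalize hm : n.unop.unop = m
    change HomologicalComplex.ExactAt ((res I (n.unop.unop)).complex.linearYonedaObj R N) i
    rw [hm]
    rcases i with _ | i
    · rw [HomologicalComplex.exactAt_iff' _ 0 0 1 (by simp) (by simp),
        ShortComplex.moduleCat_exact_iff]
      intro (x : (res I m).complex.X 0 ⟶ N) (hx : (res I m).complex.d 1 0 ≫ x = 0)
      exact ⟨0, by rw [map_zero]; exact (hN m x hx).symm⟩
    · rw [HomologicalComplex.exactAt_iff' _ i (i+1) (i+2) (by simp) (by simp),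
        ShortComplex.moduleCat_exact_iff]
      intro (x : (res I m).complex.X (i+1) ⟶ N) (hx : (res I m).complex.d (i+2) (i+1) ≫ x = 0)
      exact hN m x hx
  exact IsColimit.isZero_pt (colimit.isColimit _) ((Functor.isZero_iff _).2 key)

lemma acyc_of_bijective {f : R} (hf : f ∈ I) (N : ModuleCat.{0} R)
    (hN : Function.Bijective fun x : N => f • x) (i : ℕ) : Acyc I N i := by
  have key : ∀ m : ℕ, ∃ e : N ≅ N, e.hom = f ^ m • 𝟙 N := by
    intro m
    refine ⟨(LinearEquiv.ofBijective (LinearMap.lsmul R N (f ^ m)) (by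
      have : (LinearMap.lsmul R N (f ^ m) : N → N) = (fun x : N => f • x)^[m] := by
        rw [smul_iterate]; rfl
      rw [this]
      exact hN.iterate m)).toModuleIso, rfl⟩
  rcases i with _ | i
  · intro m x hx
    obtain ⟨e, he⟩ := key m
    have := smul_eq_zero_of_cocycle I m (Ideal.pow_mem_pow hf m) x hx
    have h2 : x ≫ e.hom = 0 := by rw [he, Linear.comp_smul, Category.comp_id, this]
    rw [← cancel_mono e.hom, h2, zero_comp]
  · intro m x hx
    obtain ⟨e, he⟩ := key m
    obtain ⟨y, hy⟩ := exists_smul_eq I m (Ideal.pow_mem_pow hf m) i x hx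
    have h2 : x ≫ e.hom = (res I m).complex.d (i + 1) i ≫ y := by
      rw [he, Linear.comp_smul, Category.comp_id, hy]
    have h3 : (res I m).complex.d (i + 1) i ≫ (y ≫ e.inv) = x := by
      rw [← Category.assoc, ← h2, Category.assoc, e.hom_inv_id, Category.comp_id]
    exact ⟨y ≫ e.inv, h3⟩

lemma acyc_pi {κ : Type} (N : κ → Type) [∀ j, AddCommGroup (N j)] [∀ j, Module R (N j)] (i : ℕ)
    (hN : ∀ j, Acyc I (ModuleCat.of R (N j)) i) : Acyc I (ModuleCat.of R (∀ j, N j)) i := by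
  rcases i with _ | i
  · intro m x hx
    ext t j
    have := hN j m (x ≫ ModuleCat.ofHom (LinearMap.proj j)) (by rw [← Category.assoc, hx, zero_comp])
    exact congrArg (fun (u : _ ⟶ ModuleCat.of R (N j)) => u t) this
  · intro m x hx
    have h := fun j => hN j m (x ≫ ModuleCat.ofHom (LinearMap.proj j))
      (by rw [← Category.assoc, hx, zero_comp])
    choose y hy using h
    refine ⟨ModuleCat.ofHom (LinearMap.pi fun j => (y j).hom), ?_⟩
    ext t j
    exact congrArg (fun (u : _ ⟶ ModuleCat.of R (N j)) => u t) (hy j)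

lemma acyc_of_injective (N : ModuleCat.{0} R) [Injective N] (i : ℕ) : Acyc I N (i + 1) := by
  intro m x hx
  have h := (res I m).complex_exactAt_succ i
  rw [HomologicalComplex.exactAt_iff' _ (i+2) (i+1) i (by simp) (by simp)] at h
  exact ⟨h.descToInjective x hx, h.comp_descToInjective x hx⟩

def KM (M : ModuleCat.{0} R) : J ⥤ ModuleCat.{0} R :=
  (Q I).op ⋙ (linearYoneda R (ModuleCat.{0} R)).obj M

def KMmap {M M' : ModuleCat.{0} R} (g : M ⟶ M') : KM I M ⟶ KM I M' :=
  Functor.whiskerLeft _ ((linearYoneda R (ModuleCat.{0} R)).map g)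

def β (M : ModuleCat.{0} R) : KM I M ⟶ (DD I M).X 0 where
  app n := ((linearYoneda R (ModuleCat.{0} R)).obj M).map ((res I n.unop.unop).π.f 0).op
  naturality n m f := by
    refine (Functor.map_comp ((linearYoneda R (ModuleCat.{0} R)).obj M) ((Q I).op.map f) _).symm.trans ?_
    refine Eq.trans ?_ (Functor.map_comp ((linearYoneda R (ModuleCat.{0} R)).obj M) _ (((P I).map f.unop).f 0).op)
    exact congrArg (fun t => ((linearYoneda R (ModuleCat.{0} R)).obj M).map (Quiver.Hom.op t)) (comm_zero I f.unop).symm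

lemma comp_assoc_zero' {A X Y Z : ModuleCat.{0} R} (x : Y ⟶ Z) (f : A ⟶ X) (g : X ⟶ Y)
    (h : f ≫ g = 0) : f ≫ g ≫ x = 0 := by
  rw [← Category.assoc, h, zero_comp]

def Sβ (M : ModuleCat.{0} R) : ShortComplex (J ⥤ ModuleCat.{0} R) :=
  ShortComplex.mk (β I M) ((DD I M).d 0 1) (by
    ext n (x : (Q I).obj n.unop ⟶ M)
    exact comp_assoc_zero' _ _ _ (res I n.unop.unop).complex_d_comp_π_f_zero)

lemma Sβ_exact (M : ModuleCat.{0} R) : (Sβ I M).Exact := by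
  refine exact_of_evaluation _ fun n => ?_
  rw [ShortComplex.moduleCat_exact_iff]
  intro (x : (res I n.unop.unop).complex.X 0 ⟶ M)
    (hx : (res I n.unop.unop).complex.d 1 0 ≫ x = 0)
  have := (res I n.unop.unop).exact₀
  have hepi : Epi ((res I n.unop.unop).π.f 0) := inferInstance
  refine ⟨ShortComplex.Exact.desc (S := ShortComplex.mk _ _ (res I n.unop.unop).complex_d_comp_π_f_zero) this x hx, ?_⟩
  exact ShortComplex.Exact.g_desc (S := ShortComplex.mk _ _ (res I n.unop.unop).complex_d_comp_π_f_zero) this x hx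

instance mono_β (M : ModuleCat.{0} R) : Mono (β I M) := by
  refine (NatTrans.mono_iff_mono_app _).2 fun n => ?_
  rw [ModuleCat.mono_iff_injective]
  have hepi : Epi ((res I n.unop.unop).π.f 0) := inferInstance
  intro (x : (Q I).obj n.unop ⟶ M) (y : (Q I).obj n.unop ⟶ M) h
  exact (cancel_epi ((res I n.unop.unop).π.f 0)).1 h

/-- Every element is killed by a power of `I`. -/
def Tors (M : Type) [AddCommGroup M] [Module R M] : Prop := ∀ x : M, ∃ n, ∀ r ∈ I ^ n, r • x = 0

def evK (M : ModuleCat.{0} R) : KM I M ⟶ (Functor.const _).obj M where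
  app n := ModuleCat.ofHom
    (LinearMap.mk (AddHom.mk (fun x : (ModuleCat.of R (R ⧸ I ^ n.unop.unop) ⟶ M) =>
      x.hom (Ideal.Quotient.mk _ 1)) (by intros; rfl)) (by intros; rfl))
  naturality n m f := rfl

def evT (M : ModuleCat.{0} R) : colimit (KM I M) ⟶ M := colimit.desc _ ⟨M, evK I M⟩

lemma ι_evT (M : ModuleCat.{0} R) (n : J) : colimit.ι (KM I M) n ≫ evT I M = (evK I M).app n :=
  colimit.ι_desc _ _

lemma evT_naturality {M M' : ModuleCat.{0} R} (g : M ⟶ M') :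
    colim.map (KMmap I g) ≫ evT I M' = evT I M ≫ g := by
  refine colimit.hom_ext fun n => ?_
  rw [← Category.assoc, ← Category.assoc, ι_evT, colim_map, ι_colimMap, Category.assoc, ι_evT]
  rfl

lemma evK_injective (M : ModuleCat.{0} R) (n : J) : Function.Injective ((evK I M).app n) := by
  intro (x : ModuleCat.of R (R ⧸ I ^ n.unop.unop) ⟶ M) (y : ModuleCat.of R (R ⧸ I ^ n.unop.unop) ⟶ M) h
  refine ModuleCat.hom_ext (Submodule.linearMap_qext _ (LinearMap.ext_ring ?_))
  exact h

lemma isIso_evT {M : ModuleCat.{0} R} (hM : Tors I M) : IsIso (evT I M) := by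
  rw [ConcreteCategory.isIso_iff_bijective]
  constructor
  · rw [injective_iff_map_eq_zero]
    intro z hz
    obtain ⟨n, x, rfl⟩ := Concrete.colimit_exists_rep _ z
    have h1 : (evK I M).app n x = 0 := by
      rw [← ι_evT]; exact hz
    rw [evK_injective I M n (h1.trans (map_zero _).symm), map_zero]
  · intro t
    obtain ⟨n, hn⟩ := hM t
    let x : ModuleCat.of R (R ⧸ I ^ n) ⟶ M := ModuleCat.ofHom
      (Submodule.liftQ (I ^ n) (LinearMap.toSpanSingleton R M t) (fun r hr => hn r hr))
    refine ⟨colimit.ι (KM I M) (op (op n)) x, ?_⟩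
    have : (evK I M).app (op (op n)) x = t := by
      change (1 : R) • t = t
      rw [one_smul]
    rw [← ι_evT] at this
    exact this

def toCyc (M : ModuleCat.{0} R) : colimit (KM I M) ⟶ (CM I M).cycles 0 :=
  (CM I M).liftCycles (colim.map (β I M)) 1 (by simp) (by
    exact ((Sβ I M).map (colim (J := J) (C := ModuleCat.{0} R))).zero)

lemma toCyc_i (M : ModuleCat.{0} R) : toCyc I M ≫ (CM I M).iCycles 0 = colim.map (β I M) :=
  (CM I M).liftCycles_i _ _ _ _

instance (M : ModuleCat.{0} R) : IsIso (toCyc I M) := by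
  have hm : Mono ((toCyc I M) ≫ (CM I M).iCycles 0) := by rw [toCyc_i]; exact inferInstanceAs (Mono ((colim (J := J) (C := ModuleCat.{0} R)).map (β I M)))
  rw [ConcreteCategory.isIso_iff_bijective]
  constructor
  · rw [← ModuleCat.mono_iff_injective]
    exact mono_of_mono _ ((CM I M).iCycles 0)
  · intro z
    have ex := ((Sβ_exact I M).map (colim (J := J) (C := ModuleCat.{0} R)))
    rw [ShortComplex.moduleCat_exact_iff] at ex
    obtain ⟨k, hk⟩ := ex ((CM I M).iCycles 0 z) (by
      exact congrArg (fun (t : _ ⟶ (CM I M).X 1) => t z) ((CM I M).iCycles_d 0 1))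
    refine ⟨k, (ModuleCat.mono_iff_injective ((CM I M).iCycles 0)).1 inferInstance ?_⟩
    rw [← hk]
    exact congrArg (fun (t : _ ⟶ (CM I M).X 0) => t k) (toCyc_i I M)

lemma toCyc_naturality {M M' : ModuleCat.{0} R} (g : M ⟶ M') :
    toCyc I M ≫ HomologicalComplex.cyclesMap (CMmap I g) 0 = colim.map (KMmap I g) ≫ toCyc I M' := by
  rw [← cancel_mono ((CM I M').iCycles 0), Category.assoc, Category.assoc,
    HomologicalComplex.cyclesMap_i, toCyc_i, ← Category.assoc, toCyc_i]
  have h : β I M ≫ (DDmap I g).f 0 = KMmap I g ≫ β I M' := by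
    ext n x
    rfl
  have h2 := congrArg (colim (J := J) (C := ModuleCat.{0} R)).map h
  rw [Functor.map_comp, Functor.map_comp] at h2
  exact h2

instance isIso_hπ (M : ModuleCat.{0} R) : IsIso ((CM I M).homologyπ 0) :=
  (CM I M).isIso_homologyπ 0 0 (by simp) ((CM I M).shape 0 0 (by simp))

def isoTors {M : ModuleCat.{0} R} (hM : Tors I M) : (CM I M).homology 0 ≅ M :=
  have := isIso_evT I hM
  (asIso ((CM I M).homologyπ 0)).symm ≪≫ (asIso (toCyc I M)).symm ≪≫ asIso (evT I M)

lemma epi_homologyMap {M M' : ModuleCat.{0} R} (g : M ⟶ M') [Epi g] (hM : Tors I M) (hM' : Tors I M') :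
    Epi (HomologicalComplex.homologyMap (CMmap I g) 0) := by
  have := isIso_evT I hM
  have := isIso_evT I hM'
  have h1 : Epi (colim.map (KMmap I g)) := by
    have : colim.map (KMmap I g) = (evT I M ≫ g) ≫ inv (evT I M') := by
      rw [← evT_naturality]; simp
    rw [this]; infer_instance
  have h2 : Epi (HomologicalComplex.cyclesMap (CMmap I g) 0) := by
    have : HomologicalComplex.cyclesMap (CMmap I g) 0 = inv (toCyc I M) ≫ colim.map (KMmap I g) ≫ toCyc I M' := by
      rw [← toCyc_naturality]; simp
    rw [this]; infer_instance
  have h3 := HomologicalComplex.homologyπ_naturality (CMmap I g) 0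
  have h4 : Epi ((CM I M).homologyπ 0 ≫ HomologicalComplex.homologyMap (CMmap I g) 0) := by
    rw [h3]; infer_instance
  exact epi_of_epi ((CM I M).homologyπ 0) _

/-- The `I`-power torsion submodule. -/
def Γ (M : Type) [AddCommGroup M] [Module R M] : Submodule R M where
  carrier := {x | ∃ n, ∀ r ∈ I ^ n, r • x = 0}
  zero_mem' := ⟨0, fun _ _ => smul_zero _⟩
  add_mem' := by
    rintro x y ⟨n, hn⟩ ⟨m, hm⟩
    refine ⟨n + m, fun r hr => ?_⟩
    rw [smul_add, hn r (Ideal.pow_le_pow_right (Nat.le_add_right _ _) hr),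
      hm r (Ideal.pow_le_pow_right (Nat.le_add_left _ _) hr), add_zero]
  smul_mem' := by
    rintro c x ⟨n, hn⟩
    exact ⟨n, fun r hr => by rw [smul_comm, hn r hr, smul_zero]⟩

lemma tors_Γ (M : Type) [AddCommGroup M] [Module R M] : Tors I (Γ I M) := by
  rintro ⟨x, n, hn⟩
  exact ⟨n, fun r hr => Subtype.ext (hn r hr)⟩

lemma Tors.quot {M : Type} [AddCommGroup M] [Module R M] (hM : Tors I M) (N : Submodule R M) :
    Tors I (M ⧸ N) := by
  intro x
  obtain ⟨x, rfl⟩ := Submodule.Quotient.mk_surjective _ x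
  obtain ⟨n, hn⟩ := hM x
  exact ⟨n, fun r hr => by rw [← Submodule.Quotient.mk_smul, hn r hr, Submodule.Quotient.mk_zero]⟩

lemma exists_pow_uniform [IsNoetherianRing R] {M : Type} [AddCommGroup M] [Module R M]
    (hM : Tors I M) (N : Submodule R M) (hN : N.FG) : ∃ n, ∀ r ∈ I ^ n, ∀ x ∈ N, r • x = 0 := by
  induction N, hN using Submodule.fg_induction with
  | singleton x =>
    obtain ⟨n, hn⟩ := hM x
    refine ⟨n, fun r hr y hy => ?_⟩
    obtain ⟨c, rfl⟩ := Submodule.mem_span_singleton.1 hy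
    rw [smul_comm, hn r hr, smul_zero]
  | sup N₁ N₂ _ _ h1 h2 =>
    obtain ⟨n, hn⟩ := h1
    obtain ⟨m, hm⟩ := h2
    refine ⟨n + m, fun r hr y hy => ?_⟩
    obtain ⟨a, ha, b, hb, rfl⟩ := Submodule.mem_sup.1 hy
    rw [smul_add, hn r (Ideal.pow_le_pow_right (Nat.le_add_right _ _) hr) a ha,
      hm r (Ideal.pow_le_pow_right (Nat.le_add_left _ _) hr) b hb, add_zero]

lemma injective_Γ [IsNoetherianRing R] (E : Type) [AddCommGroup E] [Module R E]
    [hE : Module.Injective R E] : Module.Injective R (Γ I E) := by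
  refine Module.Baer.injective fun A g => ?_
  obtain ⟨n, hn⟩ := exists_pow_uniform I (tors_Γ I E) (LinearMap.range g)
    (by rw [LinearMap.range_eq_map]
        exact Submodule.FG.map _ ((isNoetherian_def.1 inferInstance) ⊤))
  obtain ⟨k, hk⟩ := Ideal.exists_pow_inf_eq_pow_smul I (N := A) (M := R)
  have hAR : I ^ (n + k) ⊓ A ≤ I ^ n • A := by
    have := hk (n + k) (Nat.le_add_left _ _)
    rw [Nat.add_sub_cancel] at this
    have h2 : I ^ (n + k) • (⊤ : Submodule R R) = I ^ (n + k) := by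
      simp
    rw [h2] at this
    rw [this]
    exact Submodule.smul_mono le_rfl inf_le_right
  -- `g` kills `I ^ (n + k) ∩ A`
  have hg : ∀ x : A, (x : R) ∈ I ^ (n + k) → g x = 0 := by
    intro x hx
    have h1 : (x : R) ∈ I ^ n • A := hAR ⟨hx, x.2⟩
    have h2 : ∀ y ∈ I ^ n • A, ∀ hy : y ∈ A, g ⟨y, hy⟩ = 0 := by
      intro y hy
      induction hy using Submodule.smul_induction_on' with
      | smul r hr a ha =>
        intro hy
        have : (⟨r • a, hy⟩ : A) = r • ⟨a, ha⟩ := rfl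
        rw [this, map_smul]
        exact hn r hr _ ⟨_, rfl⟩
      | add x hx y hy h1 h2 =>
        intro hxy
        have hx' : x ∈ A := Submodule.smul_le_right hx
        have hy' : y ∈ A := Submodule.smul_le_right hy
        have : (⟨x + y, hxy⟩ : A) = ⟨x, hx'⟩ + ⟨y, hy'⟩ := rfl
        rw [this, map_add, h1 hx', h2 hy', add_zero]
    exact h2 x h1 x.2
  let L : Submodule R A := Submodule.comap (Submodule.subtype A) (I ^ (n + k) : Ideal R)
  let ι : (A ⧸ L) →ₗ[R] (R ⧸ I ^ (n + k)) := Submodule.mapQ L (I ^ (n + k)) (Submodule.subtype A) le_rfl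
  have hι : Function.Injective ι := by
    rw [← LinearMap.ker_eq_bot]
    simp only [ι, Submodule.mapQ, Submodule.ker_liftQ, LinearMap.ker_comp, Submodule.ker_mkQ]
    exact Submodule.mkQ_map_self L
  let g' : (A ⧸ L) →ₗ[R] E := L.liftQ ((Γ I E).subtype ∘ₗ g) (fun x hx => by
    rw [LinearMap.mem_ker, LinearMap.comp_apply, hg x hx, map_zero])
  obtain ⟨h, hh⟩ := hE.out ι hι g'
  refine ⟨LinearMap.codRestrict (Γ I E) (h ∘ₗ (I ^ (n + k)).mkQ) (fun c => ⟨n + k, fun r hr => ?_⟩), ?_⟩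
  · rw [← map_smul]
    have : r • c ∈ I ^ (n + k) := Ideal.mul_mem_right _ _ hr
    rw [LinearMap.comp_apply, Submodule.mkQ_apply, (Submodule.Quotient.mk_eq_zero _).2 this, map_zero]
  · intro x hx
    apply Subtype.ext
    exact hh (Submodule.Quotient.mk ⟨x, hx⟩)

lemma isZero_CM_iff (M : ModuleCat.{0} R) (i : ℕ) :
    IsZero ((CM I M).homology i) ↔ IsZero ((localCohomology I i).obj M) :=
  (isoCM I M i).symm.isZero_iff

/-- The short exact sequence of a submodule. -/
abbrev subSC {M : Type} [AddCommGroup M] [Module R M] (N : Submodule R M) :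
    ShortComplex (ModuleCat.{0} R) :=
  ShortComplex.mk (ModuleCat.ofHom N.subtype) (ModuleCat.ofHom N.mkQ) (by
    ext x; simp)

lemma subSC_shortExact {M : Type} [AddCommGroup M] [Module R M] (N : Submodule R M) :
    (subSC N).ShortExact := by
  refine ShortComplex.ShortExact.mk' ?_ ?_ ?_
  · rw [ShortComplex.moduleCat_exact_iff]
    intro x hx
    exact ⟨⟨x, (Submodule.Quotient.mk_eq_zero _).1 hx⟩, rfl⟩
  · rw [ModuleCat.mono_iff_injective]; exact Subtype.val_injective
  · rw [ModuleCat.epi_iff_surjective]; exact N.mkQ_surjective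

lemma isZero_of_injective (N : ModuleCat.{0} R) [Injective N] (i : ℕ) :
    IsZero ((CM I N).homology (i + 1)) :=
  (isZero_CM_iff I N _).2 (acyc_of_injective I N i).isZero

lemma isZero_of_linearEquiv {M M' : ModuleCat.{0} R} (e : M ≅ M') (i : ℕ)
    (h : IsZero ((CM I M').homology i)) : IsZero ((CM I M).homology i) := by
  rw [isZero_CM_iff] at h ⊢
  exact h.of_iso ((localCohomology I i).mapIso e)

lemma exists_torsion_embedding [IsNoetherianRing R] (T : Type) [AddCommGroup T] [Module R T]
    (hT : Tors I T) : ∃ (E : Type) (_ : AddCommGroup E) (_ : Module R E) (N : Submodule R E),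
      Tors I E ∧ Module.Injective R E ∧ Nonempty (T ≃ₗ[R] N) := by
  let E₀ : ModuleCat.{0} R := Injective.under (ModuleCat.of R T)
  have hinst : Injective E₀ := inferInstanceAs (Injective (Injective.under (ModuleCat.of R T)))
  let ι₀ := Injective.ι (ModuleCat.of R T)
  have hinj : Function.Injective ι₀.hom := (ModuleCat.mono_iff_injective ι₀).1 inferInstance
  have hE₀ : Module.Injective R E₀ := Module.injective_module_of_injective_object R E₀ (inj := hinst)
  let j : T →ₗ[R] Γ I E₀ := LinearMap.codRestrict _ ι₀.hom fun t => by
    obtain ⟨n, hn⟩ := hT t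
    exact ⟨n, fun r hr => by rw [← map_smul, hn r hr, map_zero]⟩
  have hj : Function.Injective j := fun x y h => hinj (congrArg Subtype.val h)
  exact ⟨Γ I E₀, inferInstance, inferInstance, LinearMap.range j, tors_Γ I _, injective_Γ I _,
    ⟨LinearEquiv.ofInjective j hj⟩⟩

lemma up_rel (i : ℕ) : (ComplexShape.up ℕ).Rel i (i + 1) := rfl

lemma isZero_tors [IsNoetherianRing R] (i : ℕ) : ∀ (T : Type) [AddCommGroup T] [Module R T],
    Tors I T → IsZero ((CM I (ModuleCat.of R T)).homology (i + 1)) := by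
  induction i with
  | zero =>
    intro T _ _ hT
    obtain ⟨E, _, _, N, hE, hinj, ⟨e⟩⟩ := exists_torsion_embedding I T hT
    refine isZero_of_linearEquiv I (M' := ModuleCat.of R N) e.toModuleIso _ ?_
    have hS := SM_shortExact I (subSC_shortExact N)
    have := Module.injective_object_of_injective_module R E
    have hepi0 : Epi (ModuleCat.ofHom N.mkQ) := (subSC_shortExact N).epi_g
    have hepi : Epi (HomologicalComplex.homologyMap (SM I (subSC N)).g 0) :=
      epi_homologyMap I (ModuleCat.ofHom N.mkQ) hE (hE.quot I N)
    have h1 := hS.homology_exact₁ 0 1 (up_rel 0)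
    have h2 : hS.δ 0 1 (up_rel 0) = 0 := by
      rw [← cancel_epi (HomologicalComplex.homologyMap (SM I (subSC N)).g 0), hS.comp_δ, comp_zero]
    exact h1.isZero_of_both_zeros h2 ((isZero_of_injective I (ModuleCat.of R E) 0).eq_of_tgt _ _)
  | succ i ih =>
    intro T _ _ hT
    obtain ⟨E, _, _, N, hE, hinj, ⟨e⟩⟩ := exists_torsion_embedding I T hT
    refine isZero_of_linearEquiv I (M' := ModuleCat.of R N) e.toModuleIso _ ?_
    have hS := SM_shortExact I (subSC_shortExact N)
    have := Module.injective_object_of_injective_module R E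
    have h1 := hS.homology_exact₁ (i+1) (i+2) (up_rel _)
    exact h1.isZero_of_both_zeros ((ih (E ⧸ N) (hE.quot I N)).eq_of_src _ _)
      ((isZero_of_injective I (ModuleCat.of R E) (i+1)).eq_of_tgt _ _)

lemma mono_homologyMap_zero {M M' : ModuleCat.{0} R} (g : M ⟶ M')
    [Mono (CMmap I g)] : Mono (HomologicalComplex.homologyMap (CMmap I g) 0) := by
  have h1 : Mono ((CMmap I g).f 0) := inferInstance
  have h2 : Mono (HomologicalComplex.cyclesMap (CMmap I g) 0) := by
    have : Mono (HomologicalComplex.cyclesMap (CMmap I g) 0 ≫ (CM I M').iCycles 0) := by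
      rw [HomologicalComplex.cyclesMap_i]; infer_instance
    exact mono_of_mono _ ((CM I M').iCycles 0)
  have h3 := HomologicalComplex.homologyπ_naturality (CMmap I g) 0
  have h4 : HomologicalComplex.homologyMap (CMmap I g) 0 =
      inv ((CM I M).homologyπ 0) ≫ HomologicalComplex.cyclesMap (CMmap I g) 0 ≫
        (CM I M').homologyπ 0 := by
    rw [← h3]; simp
  rw [h4]; infer_instance

lemma isZero_zero_of_torsionFree (M : ModuleCat.{0} R)
    (hM : ∀ x : M, (∃ n, ∀ r ∈ I ^ n, r • x = 0) → x = 0) : IsZero ((CM I M).homology 0) := by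
  have h : IsZero (colimit (KM I M)) := by
    refine IsColimit.isZero_pt (colimit.isColimit _) ((Functor.isZero_iff _).2 fun n => ?_)
    refine @ModuleCat.isZero_of_subsingleton _ _ _ ⟨fun a b => ?_⟩
    have key : ∀ a : (KM I M).obj n, a = 0 := by
      intro a
      apply evK_injective I M n
      rw [map_zero]
      refine hM _ ⟨n.unop.unop, fun r hr => ?_⟩
      rw [← map_smul]
      change (show (ModuleCat.of R (R ⧸ I ^ n.unop.unop) ⟶ M) from r • a).hom _ = 0
      change r • (show (ModuleCat.of R (R ⧸ I ^ n.unop.unop) ⟶ M) from a).hom _ = 0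
      rw [← map_smul]
      have : r • (Ideal.Quotient.mk (I ^ n.unop.unop) 1) = 0 := by
        rw [← Ideal.Quotient.mk_eq_mk, ← Submodule.Quotient.mk_smul, Submodule.Quotient.mk_eq_zero]
        exact Ideal.mul_mem_right _ _ hr
      rw [this, map_zero]
    rw [key a, key b]
  refine h.of_iso ?_
  exact (asIso ((CM I M).homologyπ 0)).symm ≪≫ (asIso (toCyc I M)).symm

/-- The canonical map from `M` to the product of its localizations at the `f j`. -/
def locMap {κ : Type} (f : κ → R) (M : Type) [AddCommGroup M] [Module R M] :
    M →ₗ[R] (∀ j, LocalizedModule (Submonoid.powers (f j)) M) :=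
  LinearMap.pi fun j => LocalizedModule.mkLinearMap (Submonoid.powers (f j)) M

lemma bijective_smul_localized (f : R) (M : Type) [AddCommGroup M] [Module R M] :
    Function.Bijective fun x : LocalizedModule (Submonoid.powers f) M => f • x :=
  (Module.End.isUnit_iff _).1 (IsLocalizedModule.map_units
    (LocalizedModule.mkLinearMap (Submonoid.powers f) M) ⟨f, Submonoid.mem_powers f⟩)

lemma isZero_locTarget {κ : Type} (f : κ → R) (hf : ∀ j, f j ∈ I) (M : Type) [AddCommGroup M]
    [Module R M] (i : ℕ) : IsZero ((CM I (ModuleCat.of R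
      (∀ j, LocalizedModule (Submonoid.powers (f j)) M))).homology i) :=
  (isZero_CM_iff I _ _).2 (acyc_pi I _ i fun j =>
    acyc_of_bijective I (hf j) _ (bijective_smul_localized (f j) M) i).isZero

lemma tors_ker_locMap {κ : Type} [Finite κ] (f : κ → R) (hf : Ideal.span (Set.range f) = I) (M : Type)
    [AddCommGroup M] [Module R M] : Tors I (LinearMap.ker (locMap f M)) := by
  rintro ⟨x, hx⟩
  have h : ∀ j, ∃ n, f j ^ n • x = 0 := by
    intro j
    have h1 : LocalizedModule.mkLinearMap (Submonoid.powers (f j)) M x = 0 := congrFun hx j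
    rw [IsLocalizedModule.eq_zero_iff (Submonoid.powers (f j))] at h1
    obtain ⟨⟨_, n, rfl⟩, hn⟩ := h1
    exact ⟨n, hn⟩
  -- the annihilator of `x` has radical containing `I`
  have h2 : I ≤ Ideal.radical (LinearMap.ker (LinearMap.toSpanSingleton R M x)) := by
    rw [← hf, Ideal.span_le]
    rintro _ ⟨j, rfl⟩
    obtain ⟨n, hn⟩ := h j
    exact ⟨n, hn⟩
  obtain ⟨n, hn⟩ := Ideal.exists_pow_le_of_le_radical_of_fg h2
    (by rw [← hf]; exact ⟨(Set.finite_range f).toFinset, by simp⟩)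
  exact ⟨n, fun r hr => Subtype.ext (hn hr)⟩

lemma locMap_range_torsionFree {κ : Type} (f : κ → R) (hf : ∀ j, f j ∈ I) (M : Type)
    [AddCommGroup M] [Module R M] (x : LinearMap.range (locMap f M))
    (hx : ∃ n, ∀ r ∈ I ^ n, r • x = 0) : x = 0 := by
  obtain ⟨n, hn⟩ := hx
  apply Subtype.ext
  funext j
  have h1 : f j ^ n • (x : ∀ j, LocalizedModule (Submonoid.powers (f j)) M) j = 0 := by
    have := congrArg Subtype.val (hn _ (Ideal.pow_mem_pow (hf j) n))
    exact congrFun this j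
  have h2 : Function.Injective
      fun x : LocalizedModule (Submonoid.powers (f j)) M => (f j) ^ n • x := by
    have := (bijective_smul_localized (f j) M).injective.iterate n
    rwa [smul_iterate] at this
  exact h2 (h1.trans (smul_zero _).symm)

/-- A class of modules closed under isomorphism and under kernels and cokernels of
`M → ∏ M_{f j}` is closed under local cohomology. -/
theorem localCohomology_mem_class [IsNoetherianRing R] {κ : Type} [Finite κ] (f : κ → R)
    (hf : Ideal.span (Set.range f) = I) (C : ∀ (M : Type) [AddCommGroup M] [Module R M], Prop)
    (hiso : ∀ (M N : Type) [AddCommGroup M] [Module R M] [AddCommGroup N] [Module R N],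
      (M ≃ₗ[R] N) → C M → C N)
    (hker : ∀ (M : Type) [AddCommGroup M] [Module R M], C M → C (LinearMap.ker (locMap f M)))
    (hcoker : ∀ (M : Type) [AddCommGroup M] [Module R M], C M →
      C ((∀ j, LocalizedModule (Submonoid.powers (f j)) M) ⧸ LinearMap.range (locMap f M)))
    (i : ℕ) : ∀ (M : ModuleCat.{0} R), C M → C ((localCohomology I i).obj M) := by
  have hfI : ∀ j, f j ∈ I := fun j => hf ▸ Ideal.subset_span ⟨j, rfl⟩
  suffices H : ∀ (M : Type) [AddCommGroup M] [Module R M], C M →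
      C ((CM I (ModuleCat.of R M)).homology i) from
    fun M hM => hiso _ _ (isoCM I M i).symm.toLinearEquiv (H M hM)
  -- compare `M` with its image in the product
  have step1 : ∀ (M : Type) [AddCommGroup M] [Module R M] (i : ℕ),
      Nonempty ((CM I (ModuleCat.of R M)).homology (i + 1) ≅
        (CM I (ModuleCat.of R (LinearMap.range (locMap f M)))).homology (i + 1)) := by
    intro M _ _ i
    let N := LinearMap.ker (locMap f M)
    have hS := SM_shortExact I (subSC_shortExact N)
    have h1 := hS.homology_exact₂ (i + 1)
    have h2 := hS.homology_exact₃ (i + 1) (i + 2) (up_rel _)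
    have z1 := isZero_tors I i N (tors_ker_locMap I f hf M)
    have z2 := isZero_tors I (i + 1) N (tors_ker_locMap I f hf M)
    have hm : Mono (HomologicalComplex.homologyMap (SM I (subSC N)).g (i + 1)) :=
      h1.mono_g (z1.eq_of_src _ _)
    have he : Epi (HomologicalComplex.homologyMap (SM I (subSC N)).g (i + 1)) :=
      h2.epi_f (z2.eq_of_tgt _ _)
    have hi := isIso_of_mono_of_epi (HomologicalComplex.homologyMap (SM I (subSC N)).g (i + 1))
    have e : ModuleCat.of R (M ⧸ N) ≅ ModuleCat.of R (LinearMap.range (locMap f M)) :=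
      (locMap f M).quotKerEquivRange.toModuleIso
    exact ⟨@asIso _ _ _ _ (HomologicalComplex.homologyMap (SM I (subSC N)).g (i + 1)) hi ≪≫
      (isoCM I (ModuleCat.of R (M ⧸ N)) (i + 1)).symm ≪≫
      (localCohomology I (i + 1)).mapIso e ≪≫ isoCM I _ _⟩
  have step2 : ∀ (M : Type) [AddCommGroup M] [Module R M] (i : ℕ),
      Nonempty ((CM I (ModuleCat.of R ((∀ j, LocalizedModule (Submonoid.powers (f j)) M) ⧸
        LinearMap.range (locMap f M)))).homology i ≅
        (CM I (ModuleCat.of R (LinearMap.range (locMap f M)))).homology (i + 1)) := by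
    intro M _ _ i
    have hS := SM_shortExact I (subSC_shortExact (LinearMap.range (locMap f M)))
    exact ⟨hS.δIso i (i + 1) (up_rel _) (isZero_locTarget I f hfI M i)
      (isZero_locTarget I f hfI M (i + 1))⟩
  induction i with
  | zero =>
    intro M _ _ hM
    let N := LinearMap.ker (locMap f M)
    have hS := SM_shortExact I (subSC_shortExact N)
    have h1 := hS.homology_exact₂ 0
    have z : IsZero ((CM I (ModuleCat.of R (M ⧸ N))).homology 0) := by
      refine isZero_of_linearEquiv I (M' := ModuleCat.of R (LinearMap.range (locMap f M)))
        (locMap f M).quotKerEquivRange.toModuleIso _ ?_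
      exact isZero_zero_of_torsionFree I _ (locMap_range_torsionFree I f hfI M)
    have hm0 : Mono (CMmap I (ModuleCat.ofHom N.subtype)) := hS.mono_f
    have hm : Mono (HomologicalComplex.homologyMap (SM I (subSC N)).f 0) :=
      mono_homologyMap_zero I (ModuleCat.ofHom N.subtype)
    have he : Epi (HomologicalComplex.homologyMap (SM I (subSC N)).f 0) :=
      h1.epi_f (z.eq_of_tgt _ _)
    have hi := isIso_of_mono_of_epi (HomologicalComplex.homologyMap (SM I (subSC N)).f 0)
    let e := (isoTors I (M := ModuleCat.of R N) (tors_ker_locMap I f hf M)).symm ≪≫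
      @asIso _ _ _ _ (HomologicalComplex.homologyMap (SM I (subSC N)).f 0) hi
    exact hiso _ _ e.toLinearEquiv (hker M hM)
  | succ i ih =>
    intro M _ _ hM
    obtain ⟨e1⟩ := step1 M i
    obtain ⟨e2⟩ := step2 M i
    exact hiso _ _ (e2 ≪≫ e1.symm).toLinearEquiv (ih _ (hcoker M hM))

end LocalCohomology

section Connections
variable {S : Type} [CommRing S] {ι : Type}

/-- A family of additive operators on `N`, each satisfying the Leibniz rule. -/
structure Conn (δ : ι → Derivation ℤ S S) (N : Type) [AddCommGroup N] [Module S N] where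
  toFun : ι → N →+ N
  leib : ∀ i (s : S) (n : N), toFun i (s • n) = s • toFun i n + δ i s • n

variable {δ : ι → Derivation ℤ S S}
variable {N : Type} [AddCommGroup N] [Module S N] {M : Type} [AddCommGroup M] [Module S M]

/-- The free ring generated by `S` and the operators. -/
abbrev Op (S ι : Type) [CommRing S] := FreeAlgebra ℤ (S ⊕ ι)

/-- The action of the free ring on a module with operators. -/
def Conn.act (c : Conn δ N) : Op S ι →ₐ[ℤ] Module.End ℤ N :=
  FreeAlgebra.lift ℤ (Sum.elim (fun s => (DistribSMul.toAddMonoidHom N s).toIntLinearMap)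
    (fun i => (c.toFun i).toIntLinearMap))

abbrev Conn.mod (c : Conn δ N) : Module (Op S ι) N :=
  Module.compHom N c.act.toRingHom

/-- Ascending chain condition on stable submodules. -/
def Conn.ACC (c : Conn δ N) : Prop := @IsNoetherian (Op S ι) N _ _ c.mod

def Conn.Stable (c : Conn δ N) (L : Submodule S N) : Prop := ∀ i, ∀ x ∈ L, c.toFun i x ∈ L

/-- Horizontal maps. -/
def Conn.Hor (c : Conn δ N) (c' : Conn δ M) (h : N →ₗ[S] M) : Prop :=
  ∀ i x, h (c.toFun i x) = c'.toFun i (h x)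

lemma Conn.smul_mem (c : Conn δ N) (L : AddSubgroup N) (h1 : ∀ (s : S), ∀ x ∈ L, s • x ∈ L)
    (h2 : ∀ i, ∀ x ∈ L, c.toFun i x ∈ L) (a : Op S ι) : ∀ x ∈ L, c.act a x ∈ L := by
  induction a using FreeAlgebra.induction with
  | grade0 r => intro x hx; simp only [AlgHom.commutes]; exact L.zsmul_mem hx r
  | grade1 v =>
    intro x hx
    rcases v with s | i
    · simpa [Conn.act] using h1 s x hx
    · simpa [Conn.act] using h2 i x hx
  | mul a b ha hb => intro x hx; rw [map_mul]; exact ha _ (hb _ hx)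
  | add a b ha hb => intro x hx; rw [map_add]; exact L.add_mem (ha _ hx) (hb _ hx)

lemma Conn.act_comm (c : Conn δ N) (c' : Conn δ M) (h : N →ₗ[S] M) (hh : c.Hor c' h)
    (a : Op S ι) : ∀ x, h (c.act a x) = c'.act a (h x) := by
  induction a using FreeAlgebra.induction with
  | grade0 r => intro x; simp only [AlgHom.commutes]; exact map_zsmul h r x
  | grade1 v =>
    intro x
    rcases v with s | i
    · simp [Conn.act]
    · simpa [Conn.act] using hh i x
  | mul a b ha hb => intro x; simp only [map_mul]; exact (ha _).trans (congrArg _ (hb _))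
  | add a b ha hb =>
    intro x; simp only [map_add, LinearMap.add_apply]; rw [ha, hb]

def Conn.toLin (c : Conn δ N) (c' : Conn δ M) (h : N →ₗ[S] M) (hh : c.Hor c' h) :
    @LinearMap (Op S ι) (Op S ι) _ _ (RingHom.id _) N M _ _ c.mod c'.mod :=
  let := c.mod; let := c'.mod
  { toFun := h, map_add' := h.map_add, map_smul' := fun a x => c.act_comm c' h hh a x }

lemma Conn.ACC.of_injective {c : Conn δ N} {c' : Conn δ M} (H : c'.ACC) (h : N →ₗ[S] M)
    (hh : c.Hor c' h) (hi : Function.Injective h) : c.ACC := by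
  let := c.mod; let := c'.mod
  have : IsNoetherian (Op S ι) M := H
  exact isNoetherian_of_injective (c.toLin c' h hh) hi

lemma Conn.ACC.of_surjective {c : Conn δ N} {c' : Conn δ M} (H : c.ACC) (h : N →ₗ[S] M)
    (hh : c.Hor c' h) (hi : Function.Surjective h) : c'.ACC := by
  let := c.mod; let := c'.mod
  have : IsNoetherian (Op S ι) N := H
  exact isNoetherian_of_surjective (c.toLin c' h hh) (LinearMap.range_eq_top.2 hi)

def Conn.pi {κ : Type} {N : κ → Type} [∀ j, AddCommGroup (N j)] [∀ j, Module S (N j)]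
    (c : ∀ j, Conn δ (N j)) : Conn δ (∀ j, N j) where
  toFun i := { toFun := fun x j => (c j).toFun i (x j)
               map_zero' := by ext; simp
               map_add' := fun x y => by ext; simp }
  leib i s n := by ext j; exact (c j).leib i s (n j)

lemma Conn.ACC.pi {κ : Type} [Finite κ] {N : κ → Type} [∀ j, AddCommGroup (N j)]
    [∀ j, Module S (N j)] {c : ∀ j, Conn δ (N j)} (H : ∀ j, (c j).ACC) : (Conn.pi c).ACC := by
  let _ := fun j => (c j).mod
  have : ∀ j, IsNoetherian (Op S ι) (N j) := H
  have key : IsNoetherian (Op S ι) (∀ j, N j) := inferInstance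
  have e : (Pi.module _ _ _ : Module (Op S ι) (∀ j, N j)) = (Conn.pi c).mod :=
    Module.ext' _ _ fun a x => by
      ext j
      exact ((Conn.pi c).act_comm (c j) (LinearMap.proj j) (fun _ _ => rfl) a x).symm
  unfold Conn.ACC
  rw [← e]
  exact key

def Conn.toSub (c : Conn δ N) (L : Submodule S N) (hL : c.Stable L) :
    @Submodule (Op S ι) N _ _ c.mod :=
  let := c.mod
  { carrier := L
    add_mem' := L.add_mem
    zero_mem' := L.zero_mem
    smul_mem' := fun a x hx => c.smul_mem L.toAddSubgroup (fun s x hx => L.smul_mem s hx) hL a x hx }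

/-- Noetherian induction on stable submodules. -/
lemma Conn.ACC.induction {c : Conn δ N} (H : c.ACC) (C : Submodule S N → Prop)
    (h : ∀ L, c.Stable L → (∀ L', c.Stable L' → L < L' → C L') → C L) :
    ∀ L, c.Stable L → C L := by
  let := c.mod
  have : IsNoetherian (Op S ι) N := H
  have wf : WellFounded ((· > ·) : Submodule (Op S ι) N → _ → Prop) := wellFounded_gt
  intro L hL
  generalize hA : c.toSub L hL = A
  induction A using wf.induction generalizing L with
  | _ A ih =>
    subst hA
    refine h L hL fun L' hL' hlt => ih (c.toSub L' hL') ?_ L' hL' rfl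
    exact hlt

def Conn.ofSub (c : Conn δ N) (A : @Submodule (Op S ι) N _ _ c.mod) : Submodule S N :=
  let := c.mod
  { carrier := A
    add_mem' := A.add_mem
    zero_mem' := A.zero_mem
    smul_mem' := fun s x hx => by
      have := A.smul_mem (FreeAlgebra.ι ℤ (Sum.inl s)) hx
      change c.act _ x ∈ A at this
      simpa [Conn.act] using this }

lemma Conn.ofSub_stable (c : Conn δ N) (A : @Submodule (Op S ι) N _ _ c.mod) :
    c.Stable (c.ofSub A) := by
  let := c.mod
  intro i x hx
  have := A.smul_mem (FreeAlgebra.ι ℤ (Sum.inr i)) hx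
  change c.act _ x ∈ A at this
  simp only [Conn.act, FreeAlgebra.lift_ι_apply] at this
  exact this

/-- Chains of stable submodules stabilise. -/
lemma Conn.ACC.of_chain {c : Conn δ N}
    (h : ∀ f : ℕ →o Submodule S N, (∀ n, c.Stable (f n)) → ∃ n, ∀ m, n ≤ m → f n = f m) :
    c.ACC := by
  let := c.mod
  refine monotone_stabilizes_iff_noetherian.1 fun f => ?_
  obtain ⟨n, hn⟩ := h ⟨fun n => c.ofSub (f n), fun a b hab => f.monotone hab⟩
    (fun n => c.ofSub_stable _)
  refine ⟨n, fun m hm => ?_⟩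
  have := hn m hm
  exact SetLike.coe_injective (congrArg (fun L : Submodule S N => (L : Set N)) this)

/-- ACC from: stable submodules are finitely generated in a weak sense. -/
def Conn.sub (c : Conn δ N) (L : Submodule S N) (hL : c.Stable L) : Conn δ L where
  toFun i := ((c.toFun i).comp L.subtype.toAddMonoidHom).codRestrict L.toAddSubgroup
    (fun x => hL i x x.2)
  leib i s n := Subtype.ext (c.leib i s n)

def Conn.quot (c : Conn δ N) (L : Submodule S N) (hL : c.Stable L) : Conn δ (N ⧸ L) where
  toFun i := QuotientAddGroup.map L.toAddSubgroup L.toAddSubgroup (c.toFun i)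
    (fun x hx => hL i x hx)
  leib i s n := by
    obtain ⟨n, rfl⟩ := L.mkQ_surjective n
    exact congrArg L.mkQ (c.leib i s n)

lemma Conn.sub_hor (c : Conn δ N) (L : Submodule S N) (hL : c.Stable L) :
    (c.sub L hL).Hor c L.subtype := fun _ _ => rfl
lemma Conn.quot_hor (c : Conn δ N) (L : Submodule S N) (hL : c.Stable L) :
    c.Hor (c.quot L hL) L.mkQ := fun _ _ => rfl

lemma Conn.ker_stable {c : Conn δ N} {c' : Conn δ M} {h : N →ₗ[S] M} (hh : c.Hor c' h) :
    c.Stable (LinearMap.ker h) := by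
  intro i x hx
  rw [LinearMap.mem_ker] at *
  rw [hh, hx, map_zero]

lemma Conn.range_stable {c : Conn δ N} {c' : Conn δ M} {h : N →ₗ[S] M} (hh : c.Hor c' h) :
    c'.Stable (LinearMap.range h) := by
  rintro i _ ⟨x, rfl⟩
  exact ⟨c.toFun i x, hh i x⟩

def Conn.ofEquiv (c : Conn δ N) (e : N ≃ₗ[S] M) : Conn δ M where
  toFun i := (e.toLinearMap.toAddMonoidHom.comp (c.toFun i)).comp e.symm.toLinearMap.toAddMonoidHom
  leib i s n := by
    simp [c.leib]

lemma Conn.ofEquiv_hor (c : Conn δ N) (e : N ≃ₗ[S] M) : c.Hor (c.ofEquiv e) e.toLinearMap := by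
  intro i x
  simp [Conn.ofEquiv]

end Connections

section Loc
variable {S : Type} [CommRing S] {ι : Type} {δ : ι → Derivation ℤ S S}

/-- `N × N` with module structure twisted by a derivation. -/
def Tw (_d : Derivation ℤ S S) (N : Type) := N × N

instance (d : Derivation ℤ S S) (N : Type) [AddCommGroup N] : AddCommGroup (Tw d N) :=
  inferInstanceAs (AddCommGroup (N × N))

instance (d : Derivation ℤ S S) (N : Type) [AddCommGroup N] [Module S N] : Module S (Tw d N) where
  smul s x := (s • x.1, s • x.2 + d s • x.1)
  one_smul x := Prod.ext (one_smul _ _) (by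
    change (1 : S) • x.2 + d 1 • x.1 = x.2
    simp)
  mul_smul s t x := Prod.ext (mul_smul _ _ _) (by
    change (s * t) • x.2 + d (s * t) • x.1 = s • (t • x.2 + d t • x.1) + d s • (t • x.1)
    simp only [Derivation.leibniz, smul_eq_mul, smul_add, add_smul, mul_smul]
    rw [smul_comm t (d s) x.1]; abel)
  smul_zero s := Prod.ext (smul_zero _) (by
    change s • (0 : N) + d s • (0 : N) = 0
    simp)
  smul_add s x y := Prod.ext (smul_add _ _ _) (by
    change s • (x.2 + y.2) + d s • (x.1 + y.1) = (s • x.2 + d s • x.1) + (s • y.2 + d s • y.1)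
    simp only [smul_add]; abel)
  add_smul s t x := Prod.ext (add_smul _ _ _) (by
    change (s + t) • x.2 + d (s + t) • x.1 = (s • x.2 + d s • x.1) + (t • x.2 + d t • x.1)
    simp only [add_smul, map_add]; abel)
  zero_smul x := Prod.ext (zero_smul _ _) (by
    change (0 : S) • x.2 + d 0 • x.1 = 0
    simp)

variable {N N' : Type} [AddCommGroup N] [Module S N] [AddCommGroup N'] [Module S N']
variable (X : Submonoid S) (φ : N →ₗ[S] N') [IsLocalizedModule X φ]

lemma Tw.isUnit (d : Derivation ℤ S S) (s : S)
    (h : IsUnit (algebraMap S (Module.End S N') s)) :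
    IsUnit (algebraMap S (Module.End S (Tw d N')) s) := by
  rw [Module.End.isUnit_iff] at h ⊢
  constructor
  · intro x y hxy
    have h1 : s • x.1 = s • y.1 := congrArg Prod.fst hxy
    have h2 : s • x.2 + d s • x.1 = s • y.2 + d s • y.1 := congrArg Prod.snd hxy
    have e1 : x.1 = y.1 := h.1 h1
    rw [e1] at h2
    exact Prod.ext e1 (h.1 (add_right_cancel h2))
  · intro y
    obtain ⟨a, ha⟩ := h.2 y.1
    obtain ⟨b, hb⟩ := h.2 (y.2 - d s • a)
    refine ⟨(a, b), Prod.ext ha ?_⟩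
    change s • b + d s • a = y.2
    change s • b = _ at hb
    rw [hb]; abel

def locTw (d : Derivation ℤ S S) (D : N →+ N) (hD : ∀ (s : S) n, D (s • n) = s • D n + d s • n) :
    N' →ₗ[S] Tw d N' :=
  IsLocalizedModule.lift X φ
    { toFun := fun n => (φ n, φ (D n))
      map_add' := fun x y => by
        rw [map_add, map_add, map_add]; rfl
      map_smul' := fun s x => by
        refine Prod.ext (map_smul _ _ _) ?_
        change φ (D (s • x)) = s • φ (D x) + d s • φ x
        rw [hD, map_add, map_smul, map_smul] }
    (fun x => Tw.isUnit d x (IsLocalizedModule.map_units φ x))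

lemma locTw_apply (d : Derivation ℤ S S) (D : N →+ N) (hD) (n : N) :
    locTw X φ d D hD (φ n) = (φ n, φ (D n)) :=
  IsLocalizedModule.lift_apply _ _ _ _ _

lemma locTw_fst (d : Derivation ℤ S S) (D : N →+ N) (hD) (y : N') :
    (locTw X φ d D hD y).1 = y := by
  let f : Tw d N' →ₗ[S] N' :=
    { toFun := fun x => x.1, map_add' := fun _ _ => rfl, map_smul' := fun _ _ => rfl }
  have : f ∘ₗ locTw X φ d D hD = LinearMap.id := by
    refine IsLocalizedModule.linearMap_ext X φ φ ?_
    ext n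
    exact congrArg Prod.fst (locTw_apply X φ d D hD n)
  exact LinearMap.congr_fun this y

/-- The extension of the operators to a localization. -/
def Conn.loc (c : Conn δ N) : Conn δ N' where
  toFun i :=
    { toFun := fun y => (locTw X φ (δ i) (c.toFun i) (c.leib i) y).2
      map_zero' := by rw [map_zero]; rfl
      map_add' := fun x y => by rw [map_add]; rfl }
  leib i s n := by
    change (locTw X φ (δ i) (c.toFun i) (c.leib i) (s • n)).2 = _
    rw [map_smul]
    change s • (locTw X φ (δ i) (c.toFun i) (c.leib i) n).2 +
      δ i s • (locTw X φ (δ i) (c.toFun i) (c.leib i) n).1 = _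
    rw [locTw_fst]; rfl

lemma Conn.loc_hor (c : Conn δ N) : c.Hor (c.loc X φ) φ := by
  intro i n
  exact (congrArg Prod.snd (locTw_apply X φ (δ i) (c.toFun i) (c.leib i) n)).symm

variable {P : Type} [AddCommGroup P] [Module S P]

/-- A map out of a localization is horizontal if it is so on the original module, provided the
localizing elements act injectively on the target. -/
lemma Conn.Hor.of_loc {c : Conn δ N} {c' : Conn δ N'} {e : Conn δ P} (hc : c.Hor c' φ)
    {h : N' →ₗ[S] P} (hh : c.Hor e (h ∘ₗ φ))
    (hP : ∀ x : X, Function.Injective fun y : P => (x : S) • y) : c'.Hor e h := by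
  intro i y
  obtain ⟨⟨n, s⟩, hy⟩ := IsLocalizedModule.surj X φ y
  have hy : (s : S) • y = φ n := hy
  have h1 : (s : S) • c'.toFun i y + δ i s • y = φ (c.toFun i n) := by
    rw [← c'.leib, hy, hc]
  have h2 : (s : S) • e.toFun i (h y) + δ i s • (h y) = h (φ (c.toFun i n)) := by
    rw [← e.leib, ← map_smul, hy]; exact (hh i n).symm
  apply hP s
  change (s : S) • _ = (s : S) • _
  rw [← map_smul, eq_sub_of_add_eq h1, eq_sub_of_add_eq h2, map_sub, map_smul]

lemma smul_inj_of_loc (φ : N →ₗ[S] N') [IsLocalizedModule X φ] (x : X) :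
    Function.Injective fun y : N' => (x : S) • y :=
  ((Module.End.isUnit_iff _).1 (IsLocalizedModule.map_units φ x)).1

end Loc

section Good
variable {S : Type} [CommRing S] {ι : Type} {δ : ι → Derivation ℤ S S}

/-- The operators satisfy the ascending chain condition after inverting any element. -/
def Conn.Good {N : Type} [AddCommGroup N] [Module S N] (c : Conn δ N) : Prop :=
  ∀ (g : S) (N' : Type) [AddCommGroup N'] [Module S N'] (φ : N →ₗ[S] N')
    [IsLocalizedModule (Submonoid.powers g) φ] (c' : Conn δ N'), c.Hor c' φ → c'.ACC

variable {N M : Type} [AddCommGroup N] [Module S N] [AddCommGroup M] [Module S M]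

lemma Conn.Good.acc {c : Conn δ N} (H : c.Good) : c.ACC := by
  have : IsLocalizedModule (Submonoid.powers (1 : S)) (LinearMap.id : N →ₗ[S] N) := by
    have : IsLocalizedModule (⊥ : Submonoid S) (LinearMap.id : N →ₗ[S] N) := by
      refine ⟨fun x => ?_, fun y => ⟨(y, 1), by simp⟩, fun h => ⟨1, by simpa using h⟩⟩
      obtain ⟨x, hx⟩ := x
      obtain rfl : x = 1 := hx
      simp
    rwa [Submonoid.powers_one]
  exact H 1 N LinearMap.id c (fun _ _ => rfl)

lemma Conn.Good.of_injective {c : Conn δ N} {e : Conn δ M} (H : e.Good) (h : N →ₗ[S] M)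
    (hh : c.Hor e h) (hi : Function.Injective h) : c.Good := by
  intro g N' _ _ φ _ c' hc
  let X := Submonoid.powers g
  let ψ := LocalizedModule.mkLinearMap X M
  let h' := IsLocalizedModule.map X φ ψ h
  have hcomp : h' ∘ₗ φ = ψ ∘ₗ h := LinearMap.ext fun x => IsLocalizedModule.map_apply X φ ψ h x
  refine (H g _ ψ (e.loc X ψ) (e.loc_hor X ψ)).of_injective h' ?_
    (IsLocalizedModule.map_injective X φ ψ h hi)
  refine Conn.Hor.of_loc X φ hc ?_ (smul_inj_of_loc X ψ)
  rw [hcomp]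
  intro i x
  exact (congrArg ψ (hh i x)).trans (e.loc_hor X ψ i _)

lemma Conn.Good.of_surjective {c : Conn δ N} {e : Conn δ M} (H : c.Good) (h : N →ₗ[S] M)
    (hh : c.Hor e h) (hi : Function.Surjective h) : e.Good := by
  intro g N' _ _ ψ _ c' hc
  let X := Submonoid.powers g
  let φ := LocalizedModule.mkLinearMap X N
  let h' := IsLocalizedModule.map X φ ψ h
  have hcomp : h' ∘ₗ φ = ψ ∘ₗ h := LinearMap.ext fun x => IsLocalizedModule.map_apply X φ ψ h x
  refine (H g _ φ (c.loc X φ) (c.loc_hor X φ)).of_surjective h' ?_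
    (IsLocalizedModule.map_surjective X φ ψ h hi)
  refine Conn.Hor.of_loc X φ (c.loc_hor X φ) ?_ (smul_inj_of_loc X ψ)
  rw [hcomp]
  intro i x
  exact (congrArg ψ (hh i x)).trans (hc i _)

lemma isLocalizedModule_comp_powers {N' N'' : Type} [AddCommGroup N'] [Module S N']
    [AddCommGroup N''] [Module S N''] (g f : S) (φ : N →ₗ[S] N') (ψ : N' →ₗ[S] N'')
    [IsLocalizedModule (Submonoid.powers g) φ] [IsLocalizedModule (Submonoid.powers f) ψ] :
    IsLocalizedModule (Submonoid.powers (g * f)) (ψ ∘ₗ φ) := by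
  have u1 : ∀ n : ℕ, Function.Bijective fun y : N' => g ^ n • y := fun n =>
    (Module.End.isUnit_iff _).1
      (IsLocalizedModule.map_units φ (⟨g ^ n, n, rfl⟩ : Submonoid.powers g))
  have u2 : ∀ n : ℕ, Function.Bijective fun y : N'' => f ^ n • y := fun n =>
    (Module.End.isUnit_iff _).1
      (IsLocalizedModule.map_units ψ (⟨f ^ n, n, rfl⟩ : Submonoid.powers f))
  have u3 : Function.Bijective fun y : N'' => g • y := by
    have hb : Function.Bijective (LinearMap.lsmul S N' g) := by
      have h1 := u1 1; simp only [pow_one] at h1; exact h1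
    have hm : IsLocalizedModule.map (Submonoid.powers f) ψ ψ (LinearMap.lsmul S N' g) =
        LinearMap.lsmul S N'' g := by
      refine IsLocalizedModule.linearMap_ext (Submonoid.powers f) ψ ψ ?_
      ext x
      simp
    have := And.intro (IsLocalizedModule.map_injective (Submonoid.powers f) ψ ψ _ hb.1)
      (IsLocalizedModule.map_surjective (Submonoid.powers f) ψ ψ _ hb.2)
    rw [hm] at this
    exact this
  refine ⟨?_, ?_, ?_⟩
  · rintro ⟨_, n, rfl⟩
    have h : IsUnit (algebraMap S (Module.End S N'') (g * f)) := by
      rw [Module.End.isUnit_iff]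
      have := u3.comp (by simpa using u2 1 : Function.Bijective fun y : N'' => f • y)
      convert this using 1
      ext y
      exact mul_smul g f y
    simpa using h.pow n
  · intro y
    obtain ⟨⟨z, ⟨_, m, rfl⟩⟩, hz⟩ := IsLocalizedModule.surj (Submonoid.powers f) ψ y
    obtain ⟨⟨x, ⟨_, k, rfl⟩⟩, hx⟩ := IsLocalizedModule.surj (Submonoid.powers g) φ z
    have hz : f ^ m • y = ψ z := hz
    have hx : g ^ k • z = φ x := hx
    refine ⟨⟨(f ^ k * g ^ m) • x, ⟨(g * f) ^ (m + k), m + k, rfl⟩⟩, ?_⟩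
    change (g * f) ^ (m + k) • y = ψ (φ ((f ^ k * g ^ m) • x))
    have e : (g * f) ^ (m + k) = (f ^ k * g ^ m) * g ^ k * f ^ m := by ring
    rw [e, mul_smul, hz, mul_smul, ← map_smul ψ (g ^ k), hx, map_smul, map_smul]
  · intro x y h
    obtain ⟨⟨_, m, rfl⟩, hm⟩ := IsLocalizedModule.exists_of_eq (S := Submonoid.powers f) (f := ψ) h
    have hm : f ^ m • φ x = f ^ m • φ y := hm
    rw [← map_smul, ← map_smul] at hm
    obtain ⟨⟨_, k, rfl⟩, hk⟩ := IsLocalizedModule.exists_of_eq (S := Submonoid.powers g) (f := φ) hm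
    have hk : g ^ k • f ^ m • x = g ^ k • f ^ m • y := hk
    refine ⟨⟨(g * f) ^ (m + k), m + k, rfl⟩, ?_⟩
    change (g * f) ^ (m + k) • x = (g * f) ^ (m + k) • y
    have e : (g * f) ^ (m + k) = (f ^ k * g ^ m) * (g ^ k * f ^ m) := by ring
    rw [e, mul_smul, mul_smul (g ^ k), hk, ← mul_smul (g ^ k), ← mul_smul]

lemma Conn.Good.localized {N' : Type} [AddCommGroup N'] [Module S N'] {c : Conn δ N}
    {c' : Conn δ N'} (H : c.Good) (g : S) (φ : N →ₗ[S] N')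
    [IsLocalizedModule (Submonoid.powers g) φ] (hc : c.Hor c' φ) : c'.Good := by
  intro f N'' _ _ ψ _ c'' hc'
  have := isLocalizedModule_comp_powers g f φ ψ
  refine H (g * f) N'' (ψ ∘ₗ φ) c'' fun i x => ?_
  exact (congrArg ψ (hc i x)).trans (hc' i _)

lemma Conn.Good.pi {κ : Type} [Finite κ] {N : κ → Type} [∀ j, AddCommGroup (N j)]
    [∀ j, Module S (N j)] {c : ∀ j, Conn δ (N j)} (H : ∀ j, (c j).Good) : (Conn.pi c).Good := by
  intro g N' _ _ φ _ c' hc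
  let X := Submonoid.powers g
  let ψ := fun j => LocalizedModule.mkLinearMap X (N j)
  let Ψ : (∀ j, N j) →ₗ[S] (∀ j, LocalizedModule X (N j)) := .pi fun j => ψ j ∘ₗ .proj j
  have : IsLocalizedModule X Ψ := inferInstance
  let e := IsLocalizedModule.linearEquiv X Ψ φ
  have h1 : (Conn.pi fun j => (c j).loc X (ψ j)).ACC :=
    Conn.ACC.pi fun j => H j g _ (ψ j) _ ((c j).loc_hor X (ψ j))
  have h2 : (Conn.pi c).Hor (Conn.pi fun j => (c j).loc X (ψ j)) Ψ := fun i x => by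
    ext j
    exact (c j).loc_hor X (ψ j) i (x j)
  refine h1.of_surjective e.toLinearMap (Conn.Hor.of_loc X Ψ h2 ?_ (smul_inj_of_loc X φ))
    e.surjective
  have : e.toLinearMap ∘ₗ Ψ = φ := by
    ext x : 1
    exact IsLocalizedModule.linearEquiv_apply X Ψ φ x
  rw [this]
  exact hc

end Good

section Ass
variable {S : Type} [CommRing S] [IsNoetherianRing S]

lemma mem_associatedPrimes_iff {N : Type} [AddCommGroup N] [Module S N] (P : Ideal S) :
    P ∈ associatedPrimes S N ↔ P.IsPrime ∧ ∃ x : N, ∀ a, a ∈ P ↔ a • x = 0 := by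
  rw [AssociatedPrimes.mem_iff, isAssociatedPrime_iff]
  refine and_congr_right fun _ => exists_congr fun x => ?_
  rw [Ideal.ext_iff]
  refine forall_congr' fun a => ?_
  rw [Submodule.mem_colon_singleton, Submodule.mem_bot]

/-- The associated primes of `N ⧸ L`. -/
def assQ {N : Type} [AddCommGroup N] [Module S N] (L : Submodule S N) : Set (Ideal S) :=
  {P | P.IsPrime ∧ ∃ x : N, ∀ a, a ∈ P ↔ a • x ∈ L}

omit [IsNoetherianRing S] in
lemma derivation_pow_mem (d : Derivation ℤ S S) (P : Ideal S) (n : ℕ) :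
    ∀ a ∈ P ^ (n + 1), d a ∈ P ^ n := by
  induction n with
  | zero => intro a _; simp
  | succ n ih =>
    intro a ha
    rw [pow_succ] at ha
    refine Submodule.mul_induction_on ha (fun x hx y hy => ?_) (fun x y hx hy => ?_)
    · rw [Derivation.leibniz, smul_eq_mul, smul_eq_mul]
      refine Ideal.add_mem _ (Ideal.mul_mem_right _ _ hx) ?_
      rw [mul_comm, pow_succ]
      exact Ideal.mul_mem_mul (ih x hx) hy
    · rw [map_add]; exact Ideal.add_mem _ hx hy

variable {ι : Type} {δ : ι → Derivation ℤ S S} {N : Type} [AddCommGroup N] [Module S N]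

/-- The preimage of the `P`-power torsion of `N ⧸ L`. -/
def tors (P : Ideal S) (L : Submodule S N) : Submodule S N where
  carrier := {x | ∃ n, ∀ a ∈ P ^ n, a • x ∈ L}
  zero_mem' := ⟨0, fun a _ => by rw [smul_zero]; exact L.zero_mem⟩
  add_mem' := by
    rintro x y ⟨n, hn⟩ ⟨m, hm⟩
    refine ⟨n + m, fun a ha => ?_⟩
    rw [smul_add]
    exact L.add_mem (hn a (Ideal.pow_le_pow_right (Nat.le_add_right _ _) ha))
      (hm a (Ideal.pow_le_pow_right (Nat.le_add_left _ _) ha))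
  smul_mem' := by
    rintro s x ⟨n, hn⟩
    refine ⟨n, fun a ha => ?_⟩
    rw [smul_comm]
    exact L.smul_mem _ (hn a ha)

omit [IsNoetherianRing S] in
lemma tors_stable {c : Conn δ N} {P : Ideal S} {L : Submodule S N} (hL : c.Stable L) :
    c.Stable (tors P L) := by
  rintro i x ⟨n, hn⟩
  refine ⟨n + 1, fun a ha => ?_⟩
  have h1 := hL i _ (hn a (Ideal.pow_le_pow_right (Nat.le_succ _) ha))
  rw [c.leib] at h1
  exact (L.add_mem_iff_left (hn _ (derivation_pow_mem (δ i) P n a ha))).1 h1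

lemma Conn.ACC.finite_assQ {c : Conn δ N} (H : c.ACC) :
    ∀ L, c.Stable L → (assQ L).Finite := by
  refine H.induction (fun L => (assQ L).Finite) fun L hL ih => ?_
  by_cases hne : (assQ L).Nonempty
  swap
  · rw [Set.not_nonempty_iff_eq_empty.1 hne]; exact Set.finite_empty
  obtain ⟨P, hP, hmax⟩ := set_has_maximal_iff_noetherian.2 ‹IsNoetherianRing S› (assQ L) hne
  have hlt : L < tors P L := by
    refine lt_of_le_of_ne (fun x hx => ⟨0, fun a _ => L.smul_mem a hx⟩) fun h => ?_
    obtain ⟨hp, x, hx⟩ := hP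
    have : x ∈ tors P L := ⟨1, fun a ha => (hx a).1 (by simpa using ha)⟩
    rw [← h] at this
    exact hp.ne_top ((Ideal.eq_top_iff_one _).2 ((hx 1).2 (by simpa using this)))
  refine ((ih _ (tors_stable hL) hlt).insert P).subset ?_
  rintro Q ⟨hQ, x, hx⟩
  by_cases h : ∀ a, a • x ∈ tors P L → a ∈ Q
  · exact Or.inr ⟨hQ, x, fun a => ⟨fun ha => hlt.le ((hx a).1 ha), h a⟩⟩
  · push Not at h
    obtain ⟨s, ⟨n, hn⟩, hs⟩ := h
    have hle : P ≤ Q := by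
      refine (Ideal.IsPrime.pow_le_iff (P := Q) (n := n + 1) n.succ_ne_zero).1 fun a ha => ?_
      have := hn a (Ideal.pow_le_pow_right (Nat.le_succ _) ha)
      rw [← mul_smul] at this
      exact (hQ.mem_or_mem ((hx _).2 this)).resolve_right hs
    left
    by_contra hne'
    exact hmax Q ⟨hQ, x, hx⟩ (lt_of_le_of_ne hle (Ne.symm hne'))

lemma Conn.ACC.finite_associatedPrimes {c : Conn δ N} (H : c.ACC) :
    (associatedPrimes S N).Finite := by
  refine (H.finite_assQ ⊥ fun i x hx => ?_).subset fun P hP => ?_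
  · rw [Submodule.mem_bot] at *; rw [hx, map_zero]
  · rw [mem_associatedPrimes_iff] at hP
    simpa [assQ] using hP

end Ass

section Flat
open TensorProduct
variable {R S : Type} [CommRing R] [CommRing S] [Algebra R S] {ι : Type}
  (δ : ι → Derivation ℤ S S)

variable (R) in
/-- `S ⊗ M` carries operators extending `δ` with good chain conditions. -/
def GoodBC (M : Type) [AddCommGroup M] [Module R M] : Prop :=
  ∃ c : Conn δ (S ⊗[R] M), c.Good

variable {δ}
lemma GoodBC.of_equiv {M N : Type} [AddCommGroup M] [Module R M] [AddCommGroup N] [Module R N]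
    (e : (S ⊗[R] M) ≃ₗ[S] (S ⊗[R] N)) (h : GoodBC R δ M) : GoodBC R δ N := by
  obtain ⟨c, hc⟩ := h
  exact ⟨c.ofEquiv e, hc.of_surjective _ (c.ofEquiv_hor e) e.surjective⟩

lemma GoodBC.of_equiv' {M N : Type} [AddCommGroup M] [Module S M] [AddCommGroup N] [Module R N]
    (e : M ≃ₗ[S] (S ⊗[R] N)) {c : Conn δ M} (hc : c.Good) : GoodBC R δ N :=
  ⟨c.ofEquiv e, hc.of_surjective _ (c.ofEquiv_hor e) e.surjective⟩

lemma isLocalizedModule_baseChange (f : R) {M M' : Type} [AddCommGroup M] [Module R M]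
    [AddCommGroup M'] [Module R M'] (φ : M →ₗ[R] M') [IsLocalizedModule (Submonoid.powers f) φ] :
    IsLocalizedModule (Submonoid.powers (algebraMap R S f)) (φ.baseChange S) := by
  have h0 := IsLocalizedModule.rTensor (R := R) (A := R) (N := S) (Submonoid.powers f) φ
  have h1 : IsLocalizedModule (Submonoid.powers f) (φ.lTensor S) := by
    have := IsLocalizedModule.of_linearEquiv (Submonoid.powers f)
      (AlgebraTensorModule.rTensor R S φ) (TensorProduct.comm R M' S)
    have := IsLocalizedModule.of_linearEquiv_right (Submonoid.powers f)
      ((TensorProduct.comm R M' S).toLinearMap ∘ₗ AlgebraTensorModule.rTensor R S φ)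
      (TensorProduct.comm R S M)
    convert this using 1
    ext s m
    simp
  have hs : ∀ (n : ℕ) (M : Type) [AddCommGroup M] [Module R M] (y : S ⊗[R] M),
    (algebraMap R S f ^ n) • y = f ^ n • y := fun n M _ _ y => by
      rw [← map_pow, algebraMap_smul]
  refine ⟨?_, ?_, ?_⟩
  · rintro ⟨_, n, rfl⟩
    rw [Module.End.isUnit_iff]
    have := (Module.End.isUnit_iff _).1 (h1.map_units ⟨f ^ n, n, rfl⟩)
    convert this using 1
    ext y
    exact hs n M' y
  · intro y
    obtain ⟨⟨x, ⟨_, n, rfl⟩⟩, hx⟩ := h1.surj y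
    exact ⟨⟨x, ⟨_, n, rfl⟩⟩, (hs n M' y).trans hx⟩
  · intro x y h
    obtain ⟨⟨_, n, rfl⟩, hn⟩ := h1.exists_of_eq (x₁ := x) (x₂ := y) h
    exact ⟨⟨_, n, rfl⟩, (hs n M x).trans (Eq.trans hn (hs n M y).symm)⟩

variable [Module.Flat R S] {κ : Type} [Finite κ] (f : κ → R)
  {M : Type} [AddCommGroup M] [Module R M]

/-- The localization map after base change. -/
def bcMap (S : Type) [CommRing S] [Algebra R S] (f : κ → R) (M : Type) [AddCommGroup M]
    [Module R M] : (S ⊗[R] M) →ₗ[S]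
      (∀ j, S ⊗[R] LocalizedModule (Submonoid.powers (f j)) M) :=
  LinearMap.pi fun j => (LocalizedModule.mkLinearMap (Submonoid.powers (f j)) M).baseChange S

omit [Module.Flat R S] [Finite κ] in
lemma piRight_locMap [Fintype κ] [DecidableEq κ] (x : S ⊗[R] M) :
    TensorProduct.piRight R S S (fun j => LocalizedModule (Submonoid.powers (f j)) M)
      ((locMap f M).baseChange S x) = bcMap S f M x := by
  induction x with
  | zero => simp
  | tmul s m => ext j; simp [bcMap, locMap]
  | add x y hx hy => rw [map_add, map_add, hx, hy, map_add]

omit [Module.Flat R S] in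
lemma bcMap_hor (h : GoodBC R δ M) : ∃ (c : Conn δ (S ⊗[R] M))
    (e : Conn δ (∀ j, S ⊗[R] LocalizedModule (Submonoid.powers (f j)) M)),
    c.Good ∧ e.Good ∧ c.Hor e (bcMap S f M) := by
  obtain ⟨c, hc⟩ := h
  let φ := fun j => (LocalizedModule.mkLinearMap (Submonoid.powers (f j)) M).baseChange S
  have hl : ∀ j, IsLocalizedModule (Submonoid.powers (algebraMap R S (f j))) (φ j) := fun j =>
    isLocalizedModule_baseChange (f j) _
  refine ⟨c, Conn.pi fun j => c.loc (Submonoid.powers (algebraMap R S (f j))) (φ j), hc, Conn.Good.pi fun j =>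
    hc.localized (algebraMap R S (f j)) (φ j) (c.loc_hor _ _), fun i x => ?_⟩
  ext j
  exact c.loc_hor (Submonoid.powers (algebraMap R S (f j))) (φ j) i x

lemma GoodBC.ker (h : GoodBC R δ M) : GoodBC R δ (LinearMap.ker (locMap f M)) := by
  classical
  cases nonempty_fintype κ
  obtain ⟨c, e, hc, he, hh⟩ := bcMap_hor f h
  have hst := Conn.ker_stable hh
  have hG : (c.sub _ hst).Good := hc.of_injective _ (c.sub_hor _ hst) Subtype.val_injective
  let g := (LinearMap.ker (locMap f M)).subtype.baseChange S
  have hinj : Function.Injective g :=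
    Module.Flat.lTensor_preserves_injective_linearMap (M := S) _ Subtype.val_injective
  have hex : Function.Exact g ((locMap f M).baseChange S) :=
    Module.Flat.lTensor_exact S (LinearMap.exact_subtype_ker_map _)
  have hr : ∀ y, y ∈ LinearMap.ker (bcMap S f M) ↔ y ∈ Set.range g := fun y => by
    rw [← hex y, LinearMap.mem_ker, ← piRight_locMap]
    exact LinearEquiv.map_eq_zero_iff _
  let g' := g.codRestrict (LinearMap.ker (bcMap S f M)) (fun x => (hr _).2 ⟨x, rfl⟩)
  let E := LinearEquiv.ofBijective g' ⟨fun x y hxy => hinj (congrArg Subtype.val hxy), fun y => by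
    obtain ⟨x, hx⟩ := (hr y).1 y.2
    exact ⟨x, Subtype.ext hx⟩⟩
  exact GoodBC.of_equiv' E.symm hG

omit [Module.Flat R S] in
lemma GoodBC.coker (h : GoodBC R δ M) :
    GoodBC R δ ((∀ j, LocalizedModule (Submonoid.powers (f j)) M) ⧸ LinearMap.range (locMap f M)) := by
  classical
  cases nonempty_fintype κ
  obtain ⟨c, e, hc, he, hh⟩ := bcMap_hor f h
  have hst := Conn.range_stable hh
  have hG : (e.quot _ hst).Good := he.of_surjective _ (e.quot_hor _ hst) (Submodule.mkQ_surjective _)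
  let q := (LinearMap.range (locMap f M)).mkQ.baseChange S
  have hex : Function.Exact ((locMap f M).baseChange S) q :=
    lTensor_exact S (LinearMap.exact_map_mkQ_range _) (Submodule.mkQ_surjective _)
  have hqs : Function.Surjective q := LinearMap.lTensor_surjective S (Submodule.mkQ_surjective _)
  let E := TensorProduct.piRight R S S (fun j => LocalizedModule (Submonoid.powers (f j)) M)
  let ρ := q ∘ₗ E.symm.toLinearMap
  have hρ : LinearMap.ker ρ = LinearMap.range (bcMap S f M) := by
    ext y
    rw [LinearMap.mem_ker, LinearMap.mem_range]
    change q (E.symm y) = 0 ↔ _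
    rw [hex]
    refine exists_congr fun x => ?_
    rw [← piRight_locMap, LinearEquiv.eq_symm_apply]
  let F := (Submodule.quotEquivOfEq _ _ hρ.symm).trans
    (ρ.quotKerEquivOfSurjective (hqs.comp E.symm.surjective))
  exact GoodBC.of_equiv' F hG

lemma GoodBC.localCohomology [IsNoetherianRing R] (I : Ideal R) (i : ℕ) (M : ModuleCat.{0} R)
    (h : GoodBC R δ M) : GoodBC R δ ((localCohomology I i).obj M) := by
  obtain ⟨n, f, hf⟩ := Submodule.fg_iff_exists_fin_generating_family.1
    (IsNoetherian.noetherian I)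
  exact localCohomology_mem_class I f hf (fun M _ _ => GoodBC R δ M)
    (fun M N _ _ _ _ e h => GoodBC.of_equiv (e.baseChange R S M N) h)
    (fun M _ _ h => GoodBC.ker f h) (fun M _ _ h => GoodBC.coker f h) i M h

lemma GoodBC.finite [IsNoetherianRing R] [IsNoetherianRing S] (h : GoodBC R δ M) :
    {P ∈ associatedPrimes R M | ∃ Q : Ideal S, Q.IsPrime ∧ Q.comap (algebraMap R S) = P}.Finite := by
  obtain ⟨c, hc⟩ := h
  refine (hc.acc.finite_associatedPrimes.image (Ideal.comap (algebraMap R S))).subset ?_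
  rintro P ⟨hP, Q, hQ, rfl⟩
  obtain ⟨hp, x, hx⟩ := (mem_associatedPrimes_iff _).1 hP
  set P := Q.comap (algebraMap R S)
  have hPQ : P.map (algebraMap R S) ≤ Q := Ideal.map_comap_le
  have hann : (⊥ : Submodule S (S ⊗[R] M)).colon {(1 : S) ⊗ₜ[R] x} ≤ P.map (algebraMap R S) := by
    intro s hs
    rw [Submodule.mem_colon_singleton, Submodule.mem_bot, TensorProduct.smul_tmul', smul_eq_mul,
      mul_one] at hs
    have hex : Function.Exact (P.subtype) (LinearMap.toSpanSingleton R M x) := fun r => by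
      rw [LinearMap.toSpanSingleton_apply, ← hx]
      simp
    have := (Module.Flat.lTensor_exact S hex (s ⊗ₜ 1)).1 (by simpa using hs)
    obtain ⟨y, hy⟩ := this
    have key : ∀ y : S ⊗[R] P, TensorProduct.rid R S (P.subtype.lTensor S y) ∈
        P.map (algebraMap R S) := by
      intro y
      induction y with
      | zero => simp
      | tmul a b =>
        simp only [LinearMap.lTensor_tmul, Submodule.subtype_apply, TensorProduct.rid_tmul]
        rw [Algebra.smul_def]
        exact Ideal.mul_mem_right _ _ (Ideal.mem_map_of_mem _ b.2)
      | add a b ha hb => rw [map_add, map_add]; exact Ideal.add_mem _ ha hb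
    have := key y
    rw [hy] at this
    simpa using this
  have hann' : (⊥ : Submodule S (S ⊗[R] M)).colon {(1 : S) ⊗ₜ[R] x} ≤ Q := hann.trans hPQ
  obtain ⟨Q', hQ', hle⟩ := Ideal.exists_minimalPrimes_le hann'
  refine ⟨Q', ?_, ?_⟩
  · rw [AssociatedPrimes.mem_iff, isAssociatedPrime_iff]
    exact ⟨hQ'.1.1, Submodule.exists_eq_colon_of_mem_minimalPrimes hQ'⟩
  · refine le_antisymm (Ideal.comap_mono hle) fun r hr => ?_
    refine hQ'.1.2 ?_
    rw [Submodule.mem_colon_singleton, Submodule.mem_bot, algebraMap_smul,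
      ← TensorProduct.tmul_smul, (hx r).1 hr, TensorProduct.tmul_zero]

/-- The ring itself has good base change if the connection on the extension is good. -/
lemma GoodBC.self {c : Conn δ S} (hc : c.Good) : GoodBC R δ R :=
  GoodBC.of_equiv' (AlgebraTensorModule.rid R S S).symm hc

end Flat

section Lower

/-- A family, each member of which is independent of those of no larger rank, bounds the length
from below. -/
lemma card_le_length {A M F : Type} [CommRing A] [AddCommGroup M] [Module A M] (s : Finset F)
    (x : F → M) (r : F → ℕ)
    (h : ∀ i ∈ s, x i ∉ Submodule.span A (x '' {j | j ∈ s ∧ j ≠ i ∧ r j ≤ r i})) :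
    (s.card : ℕ∞) ≤ Module.length A (Submodule.span A (x '' (s : Set F))) := by
  classical
  induction s using Finset.induction_on_max_value r with
  | empty => simp
  | insert a s ha hmax ih =>
    have h1 : (s.card : ℕ∞) ≤ Module.length A (Submodule.span A (x '' (s : Set F))) := by
      refine ih fun i hi hx => h i (Finset.mem_insert_of_mem hi) ?_
      refine Submodule.span_mono (Set.image_mono ?_) hx
      rintro j ⟨hj, h2⟩
      exact ⟨Finset.mem_insert_of_mem hj, h2⟩
    have h2 : x a ∉ Submodule.span A (x '' (s : Set F)) := by
      intro hx
      refine h a (Finset.mem_insert_self _ _) (Submodule.span_mono (Set.image_mono ?_) hx)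
      intro j hj
      exact ⟨Finset.mem_insert_of_mem hj, fun e => ha (e ▸ hj), hmax j hj⟩
    set N := Submodule.span A (x '' (s : Set F))
    set N' := Submodule.span A (x '' ((insert a s : Finset F) : Set F))
    have hle : N ≤ N' := Submodule.span_mono (Set.image_mono (by
      rw [Finset.coe_insert]; exact Set.subset_insert _ _))
    have hxa : x a ∈ N' := Submodule.subset_span ⟨a, by simp, rfl⟩
    have hq : Nontrivial (N' ⧸ N.submoduleOf N') := by
      rw [Submodule.Quotient.nontrivial_iff]
      intro e
      have : (⟨x a, hxa⟩ : N') ∈ N.submoduleOf N' := by rw [e]; trivial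
      exact h2 this
    have e1 := Module.length_eq_add_of_exact (R := A) (N.submoduleOf N').subtype
      (N.submoduleOf N').mkQ Subtype.val_injective (Submodule.mkQ_surjective _)
      (LinearMap.exact_subtype_mkQ _)
    have e2 : Module.length A (N.submoduleOf N') = Module.length A N :=
      (Submodule.submoduleOfEquivOfLe hle).length_eq
    rw [Finset.card_insert_of_notMem ha, e1, e2, Nat.cast_add]
    refine add_le_add h1 ?_
    have := Module.length_pos (R := A) (M := N' ⧸ N.submoduleOf N')
    exact_mod_cast Order.one_le_iff_pos.2 this

variable {P M : Type} [CommRing P] [AddCommGroup M] [Module P M] {τ : Type} [DecidableEq τ]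

/-- Iterated operators along a list. -/
def opList (D : τ → M →+ M) (L : List τ) (x : M) : M := L.foldr (fun l y => D l y) x

/-- Elements killed by a power of an ideal. -/
def pTors (Q : Ideal P) (n : ℕ) (x : M) : Prop := ∀ q ∈ Q ^ n, q • x = 0

variable {Q : Ideal P} {D : τ → M →+ M} {d : τ → Derivation ℤ P P}
  (leib : ∀ l (p : P) (x : M), D l (p • x) = p • D l x + d l p • x)

lemma derivation_pow_mem' (e : Derivation ℤ P P) (Q : Ideal P) (n : ℕ) :
    ∀ a ∈ Q ^ (n + 1), e a ∈ Q ^ n := by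
  induction n with
  | zero => intro a _; simp
  | succ n ih =>
    intro a ha
    rw [pow_succ] at ha
    refine Submodule.mul_induction_on ha (fun x hx y hy => ?_) (fun x y hx hy => ?_)
    · rw [Derivation.leibniz, smul_eq_mul, smul_eq_mul]
      refine Ideal.add_mem _ (Ideal.mul_mem_right _ _ hx) ?_
      rw [mul_comm, pow_succ]
      exact Ideal.mul_mem_mul (ih x hx) hy
    · rw [map_add]; exact Ideal.add_mem _ hx hy

include leib in
lemma pTors_op {n : ℕ} {x : M} (hx : pTors Q n x) (l : τ) : pTors Q (n + 1) (D l x) := by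
  intro q hq
  have h := leib l q x
  rw [hx q (Ideal.pow_le_pow_right n.le_succ hq), map_zero,
    hx _ (derivation_pow_mem' (d l) Q n q hq), add_zero] at h
  exact h.symm

include leib in
lemma pTors_opList {n : ℕ} {x : M} (hx : pTors Q n x) (L : List τ) :
    pTors Q (n + L.length) (opList D L x) := by
  induction L with
  | nil => exact hx
  | cons l L ih => exact pTors_op leib ih l

variable {z : τ → P} (hz : ∀ j, z j ∈ Q) {c : P}
  (hd : ∀ l j, d l (z j) - (if l = j then c else 0) ∈ Q)

omit [DecidableEq τ] in
include hz in
lemma prod_mem_pow (s : Multiset τ) : (s.map z).prod ∈ Q ^ s.card := by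
  induction s using Multiset.induction with
  | empty => simp
  | cons j s ih =>
    rw [Multiset.map_cons, Multiset.prod_cons, Multiset.card_cons, pow_succ']
    exact Ideal.mul_mem_mul (hz j) ih

include hz hd in
lemma derivation_prod (l : τ) (s : Multiset τ) :
    d l (s.map z).prod - c * (s.count l) * ((s.erase l).map z).prod ∈ Q ^ s.card := by
  induction s using Multiset.induction with
  | empty => simp
  | cons j s ih =>
    rw [Multiset.map_cons, Multiset.prod_cons, Multiset.card_cons, Derivation.leibniz,
      smul_eq_mul, smul_eq_mul]
    have h1 : z j * (d l (s.map z).prod - c * (s.count l) * ((s.erase l).map z).prod) ∈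
        Q ^ (s.card + 1) := by
      rw [pow_succ']; exact Ideal.mul_mem_mul (hz j) ih
    have h2 : (s.map z).prod * (d l (z j) - (if l = j then c else 0)) ∈ Q ^ (s.card + 1) := by
      rw [pow_succ]; exact Ideal.mul_mem_mul (prod_mem_pow hz s) (hd l j)
    by_cases hlj : l = j
    · subst hlj
      rw [Multiset.count_cons_self, Multiset.erase_cons_head]
      rw [if_pos rfl] at h2
      have e : c * (s.count l) * (z l * ((s.erase l).map z).prod) =
          c * (s.count l) * (s.map z).prod := by
        by_cases hm : l ∈ s
        · rw [← Multiset.prod_cons, ← Multiset.map_cons, Multiset.cons_erase hm]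
        · simp [Multiset.count_eq_zero_of_notMem hm]
      convert Ideal.add_mem _ h1 h2 using 1
      push_cast
      linear_combination e
    · rw [Multiset.count_cons_of_ne hlj, Multiset.erase_cons_tail _ (Ne.symm hlj), Multiset.map_cons,
        Multiset.prod_cons]
      rw [if_neg hlj] at h2
      convert Ideal.add_mem _ h1 h2 using 1
      ring

include leib hz hd in
lemma prod_smul_op {n : ℕ} (l : τ) (s : Multiset τ) (hs : s.card = n) {y : M} (hy : pTors Q n y) :
    (s.map z).prod • D l y = -((c * s.count l) • ((s.erase l).map z).prod • y) := by
  have h := leib l (s.map z).prod y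
  have h0 : (s.map z).prod • y = 0 := hy _ (hs ▸ prod_mem_pow hz s)
  have h1 := hy _ (hs ▸ derivation_prod hz hd l s)
  rw [h0, map_zero] at h
  rw [sub_smul, sub_eq_zero] at h1
  rw [h1, mul_smul (c * _)] at h
  exact eq_neg_of_add_eq_zero_left h.symm

include leib hz hd in
lemma prod_smul_opList (L : List τ) : ∀ (s : Multiset τ), s.card = L.length →
    ∃ k n : ℕ, n ≠ 0 ∧ ∀ x : M, pTors Q 1 x →
      ((L : Multiset τ) ≠ s → (s.map z).prod • opList D L x = 0) ∧
      ((L : Multiset τ) = s → (s.map z).prod • opList D L x = ((-c) ^ k * n) • x) := by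
  induction L with
  | nil =>
    intro s hs
    have : s = 0 := by simpa using hs
    subst this
    exact ⟨0, 1, one_ne_zero, fun x _ => ⟨fun h => absurd rfl h, fun _ => by simp [opList]⟩⟩
  | cons l L ih =>
    intro s hs
    by_cases hl : l ∈ s
    · have hs' : (s.erase l).card = L.length := by
        rw [Multiset.card_erase_of_mem hl, hs]; simp
      obtain ⟨k, n, hn, H⟩ := ih _ hs'
      refine ⟨k + 1, s.count l * n, mul_ne_zero (Multiset.count_ne_zero.2 hl) hn, fun x hx => ?_⟩
      have hy := pTors_opList leib hx L
      have e := prod_smul_op leib hz hd l s (by rw [hs, List.length_cons, add_comm]) hy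
      have hiff : ((l :: L : List τ) : Multiset τ) = s ↔ (L : Multiset τ) = s.erase l := by
        rw [← Multiset.cons_coe]
        constructor
        · intro h; rw [← h, Multiset.erase_cons_head]
        · intro h; rw [h, Multiset.cons_erase hl]
      rw [hiff, ne_eq, hiff]
      change (_ → (s.map z).prod • D l (opList D L x) = 0) ∧
        (_ → (s.map z).prod • D l (opList D L x) = _)
      rw [e]
      refine ⟨fun h => ?_, fun h => ?_⟩
      · rw [(H x hx).1 h, smul_zero, neg_zero]
      · rw [(H x hx).2 h, ← neg_smul, smul_smul]
        congr 1; push_cast; ring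
    · refine ⟨0, 1, one_ne_zero, fun x hx => ⟨fun _ => ?_, fun h => ?_⟩⟩
      · have hy := pTors_opList leib hx L
        have e := prod_smul_op leib hz hd l s (by rw [hs, List.length_cons, add_comm]) hy
        change (s.map z).prod • D l (opList D L x) = 0
        rw [e, Multiset.count_eq_zero_of_notMem hl]; simp
      · exact absurd (h ▸ by simp) hl

include leib hz hd in
/-- Applying monomials in operators dual to elements of `Q` to multiples of a generator of
`P ⧸ Q` produces independent elements. -/
lemma opList_strictIndep {A : Type} [CommRing A] [Algebra A P] [Module A M] [IsScalarTower A P M]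
    [Q.IsPrime] (hc : c ∉ Q) (hN : ∀ n : ℕ, n ≠ 0 → (n : P) ∉ Q)
    {v : M} (hv : ∀ q : P, q • v = 0 ↔ q ∈ Q) (p : ℕ → P) (m : ℕ)
    (hp : ∀ a < m, ∀ w ∈ Submodule.span A (p '' {b | b < a}), p a - w ∉ Q)
    (s : Multiset τ) (a : ℕ) (ha : a < m) :
    opList D s.toList (p a • v) ∉ Submodule.span A
      ((fun i : Multiset τ × ℕ => opList D i.1.toList (p i.2 • v)) ''
        {i | i.2 < m ∧ i ≠ (s, a) ∧ i.1.card * m + i.2 ≤ s.card * m + a}) := by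
  intro hmem
  obtain ⟨k, n, hn, H⟩ := prod_smul_opList leib hz hd s.toList s (by simp)
  have hpt : ∀ b, pTors Q 1 (p b • v) := by
    intro b q hq
    rw [smul_comm, (hv q).2 (by simpa using hq), smul_zero]
  set u := (-c) ^ k * (n : P) with hu
  have huQ : u ∉ Q := by
    intro h
    rcases Ideal.IsPrime.mem_or_mem ‹_› h with h | h
    · exact hc (by simpa using Ideal.IsPrime.mem_of_pow_mem ‹_› _ h)
    · exact hN n hn h
  let ψ : M →ₗ[A] M := (LinearMap.lsmul P M (s.map z).prod).restrictScalars A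
  have h1 : ψ (opList D s.toList (p a • v)) ∈
      Submodule.span A ((fun b => u • p b • v) '' {b | b < a}) := by
    have h2 := Submodule.mem_map_of_mem (f := ψ) hmem
    rw [Submodule.map_span] at h2
    refine (Submodule.span_le.2 ?_) h2
    rintro _ ⟨_, ⟨⟨s', b⟩, ⟨hb, hne, hle⟩, rfl⟩, rfl⟩
    simp only [SetLike.mem_coe] at *
    change (s.map z).prod • opList D s'.toList (p b • v) ∈ _
    rcases lt_trichotomy s'.card s.card with hlt | heq | hgt
    · have := pTors_opList leib (hpt b) s'.toList
      rw [this _ (Ideal.pow_le_pow_right (by simp; omega) (prod_mem_pow hz s))]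
      exact Submodule.zero_mem _
    · obtain ⟨k', n', -, H'⟩ := prod_smul_opList leib hz hd s'.toList s (by simp [heq])
      by_cases hs : s' = s
      · subst hs
        rw [(H _ (hpt b)).2 (by simp)]
        refine Submodule.subset_span ⟨b, ?_, rfl⟩
        have : b ≠ a := fun e => hne (by rw [e])
        change b < a
        omega
      · rw [(H' _ (hpt b)).1 (by simpa using hs)]
        exact Submodule.zero_mem _
    · exfalso
      have : (s.card + 1) * m ≤ s'.card * m := Nat.mul_le_mul_right _ hgt
      rw [add_mul, one_mul] at this
      omega
  have h3 : ψ (opList D s.toList (p a • v)) = u • p a • v := (H _ (hpt a)).2 (by simp)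
  rw [h3] at h1
  let χ : P →ₗ[A] M := ((LinearMap.toSpanSingleton P M v).restrictScalars A) ∘ₗ
    ((LinearMap.lsmul P P u).restrictScalars A)
  have h4 : (fun b => u • p b • v) '' {b | b < a} = χ '' (p '' {b | b < a}) := by
    rw [Set.image_image]
    refine Set.image_congr fun b _ => ?_
    simp [χ, smul_smul]
  rw [h4, ← Submodule.map_span] at h1
  obtain ⟨w, hw, e⟩ := h1
  refine hp a ha w hw ?_
  have h5 : (u * (p a - w)) • v = 0 := by
    have e' : (u * w) • v = u • p a • v := by simpa [χ] using e
    rw [mul_sub, sub_smul, e', mul_smul, sub_self]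
  rcases Ideal.IsPrime.mem_or_mem ‹_› ((hv _).1 h5) with h | h
  · exact absurd h huQ
  · exact h
end Lower

section Upper
variable {A : Type} [CommRing A]

lemma length_span_singleton_le {M : Type} [AddCommGroup M] [Module A M] (I : Ideal A) (x : M)
    (h : ∀ a ∈ I, a • x = 0) :
    Module.length A (Submodule.span A {x}) ≤ Module.length A (A ⧸ I) := by
  let g : A →ₗ[A] Submodule.span A {x} :=
    (LinearMap.toSpanSingleton A M x).codRestrict _ fun a =>
      Submodule.smul_mem _ _ (Submodule.mem_span_singleton_self x)
  refine Module.length_le_of_surjective (Submodule.liftQ I g ?_) ?_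
  · intro a ha
    exact Subtype.ext (h a ha)
  · rintro ⟨y, hy⟩
    obtain ⟨a, rfl⟩ := Submodule.mem_span_singleton.1 hy
    exact ⟨Submodule.Quotient.mk a, Subtype.ext rfl⟩

lemma length_sup_pow_succ_le (J : Ideal A) (z : A) (n : ℕ) :
    Module.length A (A ⧸ (J ⊔ Ideal.span {z ^ (n + 1)})) ≤
      Module.length A (A ⧸ (J ⊔ Ideal.span {z ^ n})) + Module.length A (A ⧸ (J ⊔ Ideal.span {z})) := by
  set I := J ⊔ Ideal.span {z ^ (n + 1)}
  set I' := J ⊔ Ideal.span {z ^ n}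
  have hle : I ≤ I' := sup_le_sup_left (Ideal.span_singleton_le_span_singleton.2
    (pow_dvd_pow z n.le_succ)) _
  let x : A ⧸ I := Submodule.Quotient.mk (z ^ n)
  have e1 := Module.length_eq_add_of_exact (R := A) (Submodule.span A {x}).subtype
      (Submodule.span A {x}).mkQ Subtype.val_injective (Submodule.mkQ_surjective _)
      (LinearMap.exact_subtype_mkQ _)
  rw [e1, add_comm]
  refine add_le_add ?_ (length_span_singleton_le _ x ?_)
  · refine Module.length_le_of_surjective (Submodule.liftQ I'
      ((Submodule.span A {x}).mkQ ∘ₗ I.mkQ) ?_) ?_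
    · refine sup_le (fun a ha => ?_) ((Ideal.span_singleton_le_iff_mem _).2 ?_)
      · have : I.mkQ a = 0 := (Submodule.Quotient.mk_eq_zero _).2 (Ideal.mem_sup_left ha)
        simp only [LinearMap.mem_ker, LinearMap.comp_apply, this, map_zero]
      · exact (Submodule.Quotient.mk_eq_zero _).2 (Submodule.mem_span_singleton_self x)
    · intro y
      obtain ⟨y, rfl⟩ := Submodule.mkQ_surjective _ y
      obtain ⟨a, rfl⟩ := Submodule.mkQ_surjective _ y
      exact ⟨Submodule.Quotient.mk a, rfl⟩
  · intro a ha
    obtain ⟨j, hj, b, hb, rfl⟩ := Submodule.mem_sup.1 ha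
    obtain ⟨b, rfl⟩ := Ideal.mem_span_singleton'.1 hb
    refine (Submodule.Quotient.mk_eq_zero I).2 ?_
    change (j + b * z) * z ^ n ∈ I
    have : (j + b * z) * z ^ n = z ^ n * j + b * z ^ (n + 1) := by ring
    rw [this]
    exact Ideal.add_mem _ (Ideal.mul_mem_left _ _ (Ideal.mem_sup_left hj))
      (Ideal.mem_sup_right (Ideal.mul_mem_left _ _ (Ideal.mem_span_singleton_self _)))

lemma length_sup_pow_le (J : Ideal A) (z : A) (n : ℕ) :
    Module.length A (A ⧸ (J ⊔ Ideal.span {z ^ n})) ≤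
      n * Module.length A (A ⧸ (J ⊔ Ideal.span {z})) := by
  induction n with
  | zero =>
    have : Subsingleton (A ⧸ (J ⊔ Ideal.span {z ^ 0})) := by
      rw [Ideal.Quotient.subsingleton_iff]; simp
    rw [Module.length_eq_zero_iff.2 this]; simp
  | succ n ih =>
    refine (length_sup_pow_succ_le J z n).trans ?_
    push_cast
    rw [add_mul, one_mul]
    gcongr

lemma length_sup_span_pow_le (l : List A) (n : ℕ) : ∀ J : Ideal A,
    Module.length A (A ⧸ (J ⊔ Ideal.span {y | ∃ z ∈ l, z ^ n = y})) ≤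
      (n ^ l.length : ℕ) * Module.length A (A ⧸ (J ⊔ Ideal.span {y | y ∈ l})) := by
  induction l with
  | nil =>
    intro J
    have e1 : {y : A | ∃ z ∈ ([] : List A), z ^ n = y} = ∅ := by ext y; simp
    have e2 : {y : A | y ∈ ([] : List A)} = ∅ := by ext y; simp
    rw [e1, e2, List.length_nil, pow_zero, Nat.cast_one, one_mul]
  | cons z l ih =>
    intro J
    have e1 : {y | ∃ z' ∈ z :: l, z' ^ n = y} = insert (z ^ n) {y | ∃ z ∈ l, z ^ n = y} := by
      ext y; simp [eq_comm]
    have e2 : {y | y ∈ z :: l} = insert z {y | y ∈ l} := by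
      ext y; simp
    rw [e1, e2, Ideal.span_insert, Ideal.span_insert, ← sup_assoc, ← sup_assoc]
    refine (ih _).trans ?_
    rw [List.length_cons, pow_succ, Nat.cast_mul, mul_assoc, sup_right_comm J _ (Ideal.span {y | y ∈ l}),
      sup_right_comm J _ (Ideal.span {y | y ∈ l})]
    exact mul_le_mul_right (length_sup_pow_le (J ⊔ Ideal.span {y | y ∈ l}) z n) _

lemma length_quotient_pow_le [IsLocalRing A] (l : List A)
    (hl : Ideal.span {y | y ∈ l} = maximalIdeal A) (n : ℕ) :
    Module.length A (A ⧸ maximalIdeal A ^ n) ≤ (n ^ l.length : ℕ) := by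
  have h := length_sup_span_pow_le l n ⊥
  rw [bot_sup_eq, bot_sup_eq, hl] at h
  have h1 : Module.length A (A ⧸ maximalIdeal A) = 1 :=
    Module.length_eq_one_iff.2 (isSimpleModule_iff_isCoatom.2
      (Ideal.isMaximal_def.1 (maximalIdeal.isMaximal A)))
  rw [h1, mul_one] at h
  refine le_trans (Module.length_le_of_surjective (Submodule.factor ?_)
    (Submodule.factor_surjective _)) h
  refine Ideal.span_le.2 ?_
  rintro _ ⟨z, hz, rfl⟩
  exact Ideal.pow_mem_pow (hl ▸ Ideal.subset_span hz) _

/-- The span of a finite family of elements killed by an ideal. -/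
lemma length_span_range_le {M ι : Type} [AddCommGroup M] [Module A M] [Fintype ι] (I : Ideal A)
    (x : ι → M) (h : ∀ i, ∀ a ∈ I, a • x i = 0) :
    Module.length A (Submodule.span A (Set.range x)) ≤
      Fintype.card ι * Module.length A (A ⧸ I) := by
  classical
  let g : (ι → A ⧸ I) →ₗ[A] M := LinearMap.lsum A (fun _ => A ⧸ I) ℕ fun i =>
    Submodule.liftQ I (LinearMap.toSpanSingleton A M (x i)) fun a ha => h i a ha
  have hr : Submodule.span A (Set.range x) ≤ LinearMap.range g := by
    rw [Submodule.span_le]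
    rintro _ ⟨i, rfl⟩
    refine ⟨Pi.single i (Submodule.Quotient.mk 1), ?_⟩
    change LinearMap.lsum A (fun _ => A ⧸ I) ℕ _ _ = _
    rw [LinearMap.lsum_piSingle]
    exact one_smul _ _
  refine (Module.length_le_of_injective (Submodule.inclusion hr)
    (Submodule.inclusion_injective hr)).trans ?_
  refine (Module.length_le_of_surjective g.rangeRestrict g.surjective_rangeRestrict).trans ?_
  rw [Module.length_pi, ENat.card_eq_coe_fintype_card]
end Upper

section BFun
open Polynomial

section polyDer
variable {A : Type} [CommRing A]

/-- Absolute derivations of a ring. -/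
abbrev Der (R : Type) [CommRing R] := Derivation ℤ R R

/-- Coefficientwise extension of a derivation to polynomials. -/
def polyDer (d : Derivation ℤ A A) : Der A[X] :=
  let e : Derivation ℤ A[X] A[X] := PolynomialModule.equivPolynomialSelf.compDer d.mapCoeffs
  { toLinearMap := (AddMonoidHom.mk' (fun p => e p) (fun p q => map_add e p q)).toIntLinearMap
    map_one_eq_zero' := e.map_one_eq_zero
    leibniz' := e.leibniz }

lemma coeff_polyDer (d : Derivation ℤ A A) (p : A[X]) (n : ℕ) :
    (polyDer d p).coeff n = d (p.coeff n) := rfl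

lemma polyDer_C (d : Derivation ℤ A A) (a : A) : polyDer d (C a) = C (d a) := by
  ext n
  rw [coeff_polyDer, coeff_C, coeff_C]
  split_ifs <;> simp

lemma polyDer_X (d : Derivation ℤ A A) : polyDer d (X : A[X]) = 0 := by
  ext n
  rw [coeff_polyDer, coeff_X]
  split_ifs <;> simp

lemma natDegree_polyDer_le (d : Derivation ℤ A A) (p : A[X]) :
    (polyDer d p).natDegree ≤ p.natDegree := by
  rw [natDegree_le_iff_coeff_eq_zero]
  intro n hn
  rw [coeff_polyDer, coeff_eq_zero_of_natDegree_lt hn, map_zero]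

lemma polyDer_comp (d : Derivation ℤ A A) (p : A[X]) (q : A[X]) (hq : polyDer d q = 0) :
    polyDer d (p.comp q) = (polyDer d p).comp q := by
  induction p using Polynomial.induction_on' with
  | add p r hp hr => simp only [add_comp, map_add, hp, hr]
  | monomial n a =>
    rw [← C_mul_X_pow_eq_monomial]
    simp only [mul_comp, C_comp, pow_comp, X_comp, Derivation.leibniz, Derivation.leibniz_pow, hq,
      polyDer_C, polyDer_X, smul_zero, smul_eq_mul, zero_add, mul_zero]
end polyDer

/-- The module generated by the symbols `f ^ (s - i)`, abstractly. -/
structure BData {A : Type} [CommRing A] {ι : Type} (δ : ι → Derivation ℤ A A) (f : A)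
    (Ω : Type) [AddCommGroup Ω] [Module A[X] Ω] where
  conn : Conn (fun a => polyDer (δ a)) Ω
  t : Ω ≃+ Ω
  t_smul : ∀ (p : A[X]) u, t (p • u) = p.comp (X + 1) • t u
  t_conn : ∀ a u, t (conn.toFun a u) = conn.toFun a (t u)
  w : ℕ → Ω
  f_w : ∀ i, C f • w (i + 1) = w i
  t_w : ∀ i, t (w (i + 1)) = w i
  conn_w : ∀ a i, conn.toFun a (w i) = (C (δ a f) * (X - C (i : A))) • w (i + 1)

variable {A : Type} [CommRing A] {ι : Type} {δ : ι → Derivation ℤ A A} {f : A}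
  {Ω : Type} [AddCommGroup Ω] [Module A[X] Ω]

namespace BData
variable (B : BData δ f Ω)

lemma t_symm_smul (p : A[X]) (u : Ω) : B.t.symm (p • u) = p.comp (X - 1) • B.t.symm u := by
  apply B.t.injective
  rw [B.t_smul, AddEquiv.apply_symm_apply, AddEquiv.apply_symm_apply, comp_assoc]
  simp

lemma t_symm_conn (a : ι) (u : Ω) :
    B.t.symm (B.conn.toFun a u) = B.conn.toFun a (B.t.symm u) := by
  apply B.t.injective
  rw [B.t_conn, AddEquiv.apply_symm_apply, AddEquiv.apply_symm_apply]

/-- The smallest stable submodule containing an element. -/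
def D (u : Ω) : Submodule A[X] Ω := sInf {N | B.conn.Stable N ∧ u ∈ N}

lemma D_stable (u : Ω) : B.conn.Stable (B.D u) := by
  intro a x hx
  simp only [D, Submodule.mem_sInf] at *
  exact fun N hN => hN.1 a x (hx N hN)

lemma mem_D (u : Ω) : u ∈ B.D u := by
  simp only [D, Submodule.mem_sInf]
  exact fun N hN => hN.2

lemma D_le {u : Ω} {N : Submodule A[X] Ω} (h : B.conn.Stable N) (hu : u ∈ N) : B.D u ≤ N :=
  sInf_le ⟨h, hu⟩

/-- Preimage under the shift. -/
def comapT (N : Submodule A[X] Ω) : Submodule A[X] Ω where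
  carrier := {u | B.t u ∈ N}
  add_mem' h1 h2 := by
    simp only [Set.mem_ofPred_eq, map_add] at *; exact N.add_mem h1 h2
  zero_mem' := by simp
  smul_mem' p u h := by
    simp only [Set.mem_ofPred_eq, B.t_smul] at *; exact N.smul_mem _ h

/-- Preimage under the inverse shift. -/
def comapTs (N : Submodule A[X] Ω) : Submodule A[X] Ω where
  carrier := {u | B.t.symm u ∈ N}
  add_mem' h1 h2 := by
    simp only [Set.mem_ofPred_eq, map_add] at *; exact N.add_mem h1 h2
  zero_mem' := by simp
  smul_mem' p u h := by
    simp only [Set.mem_ofPred_eq, B.t_symm_smul] at *; exact N.smul_mem _ h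

lemma comapT_stable {N : Submodule A[X] Ω} (h : B.conn.Stable N) : B.conn.Stable (B.comapT N) := by
  intro a x hx
  change B.t _ ∈ N
  rw [B.t_conn]; exact h a _ hx

lemma comapTs_stable {N : Submodule A[X] Ω} (h : B.conn.Stable N) :
    B.conn.Stable (B.comapTs N) := by
  intro a x hx
  change B.t.symm _ ∈ N
  rw [B.t_symm_conn]; exact h a _ hx

lemma t_mem_D {u x : Ω} : B.t x ∈ B.D (B.t u) ↔ x ∈ B.D u := by
  constructor
  · intro h
    have := B.D_le (B.comapTs_stable (B.D_stable u)) (u := B.t u)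
      (by change B.t.symm _ ∈ B.D u; rw [AddEquiv.symm_apply_apply]; exact B.mem_D u) h
    change B.t.symm _ ∈ B.D u at this
    rwa [AddEquiv.symm_apply_apply] at this
  · exact fun h => B.D_le (B.comapT_stable (B.D_stable (B.t u))) (B.mem_D _) h

end BData

section Sat
variable (K : Type) [Field K] [Algebra K A]

/-- Saturation with respect to nonzero polynomials with constant coefficients. -/
def Sat (N : Submodule A[X] Ω) : Submodule A[X] Ω where
  carrier := {u | ∃ b : K[X], b ≠ 0 ∧ b.map (algebraMap K A) • u ∈ N}
  add_mem' := by
    rintro x y ⟨b, hb, hx⟩ ⟨b', hb', hy⟩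
    refine ⟨b * b', mul_ne_zero hb hb', ?_⟩
    rw [smul_add]
    refine N.add_mem ?_ ?_
    · rw [mul_comm, Polynomial.map_mul, mul_smul]; exact N.smul_mem _ hx
    · rw [Polynomial.map_mul, mul_smul]; exact N.smul_mem _ hy
  zero_mem' := ⟨1, one_ne_zero, by simp⟩
  smul_mem' := by
    rintro p x ⟨b, hb, hx⟩
    refine ⟨b, hb, ?_⟩
    rw [smul_comm]
    exact N.smul_mem _ hx

lemma le_Sat (N : Submodule A[X] Ω) : N ≤ Sat K N := fun x hx => ⟨1, one_ne_zero, by simpa⟩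

variable {K}

lemma Sat_mono {N N' : Submodule A[X] Ω} (h : N ≤ N') : Sat K N ≤ Sat K N' :=
  fun _ ⟨b, hb, hx⟩ => ⟨b, hb, h hx⟩

lemma mem_Sat_of_smul {N : Submodule A[X] Ω} {b : K[X]} (hb : b ≠ 0) {u : Ω}
    (h : b.map (algebraMap K A) • u ∈ Sat K N) : u ∈ Sat K N := by
  obtain ⟨c, hc, hx⟩ := h
  exact ⟨c * b, mul_ne_zero hc hb, by rwa [Polynomial.map_mul, mul_smul]⟩

lemma polyDer_map (hK : ∀ a (k : K), δ a (algebraMap K A k) = 0) (a : ι) (b : K[X]) :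
    polyDer (δ a) (b.map (algebraMap K A)) = 0 := by
  ext n
  rw [coeff_polyDer, coeff_map, hK, coeff_zero]

lemma Sat_stable (hK : ∀ a (k : K), δ a (algebraMap K A k) = 0)
    (c : Conn (fun a => polyDer (δ a)) Ω) {N : Submodule A[X] Ω} (h : c.Stable N) :
    c.Stable (Sat K N) := by
  rintro a x ⟨b, hb, hx⟩
  refine ⟨b, hb, ?_⟩
  have h1 := h a _ hx
  rwa [c.leib, polyDer_map hK, zero_smul, add_zero] at h1
end Sat

namespace BData
variable (B : BData δ f Ω) {K : Type} [Field K] [Algebra K A]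

lemma t_mem_Sat {N N' : Submodule A[X] Ω} (h : ∀ x, x ∈ N → B.t x ∈ N') {x : Ω}
    (hx : x ∈ Sat K N) : B.t x ∈ Sat K N' := by
  obtain ⟨b, hb, hx⟩ := hx
  refine ⟨b.comp (X + 1), ?_, ?_⟩
  · rw [ne_eq, show (X + 1 : K[X]) = X + C 1 by simp, comp_X_add_C_eq_zero_iff]; exact hb
  · have := h _ hx
    rw [B.t_smul] at this
    rwa [Polynomial.map_comp, Polynomial.map_add, map_X, Polynomial.map_one]

lemma t_symm_mem_Sat {N N' : Submodule A[X] Ω} (h : ∀ x, x ∈ N → B.t.symm x ∈ N') {x : Ω}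
    (hx : x ∈ Sat K N) : B.t.symm x ∈ Sat K N' := by
  obtain ⟨b, hb, hx⟩ := hx
  refine ⟨b.comp (X - 1), ?_, ?_⟩
  · rw [ne_eq, show (X - 1 : K[X]) = X - C 1 by simp, sub_eq_add_neg, ← C_neg,
      comp_X_add_C_eq_zero_iff]
    exact hb
  · have := h _ hx
    rw [B.t_symm_smul] at this
    rwa [Polynomial.map_comp, Polynomial.map_sub, map_X, Polynomial.map_one]

lemma t_w_zero : B.t (B.w 0) = C f • B.w 0 := by
  conv_lhs => rw [← B.f_w 0]
  rw [B.t_smul, C_comp, B.t_w]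

lemma t_C_smul (a : A) (u : Ω) : B.t (C a • u) = C a • B.t u := by rw [B.t_smul, C_comp]

lemma t_symm_C_smul (a : A) (u : Ω) : B.t.symm (C a • u) = C a • B.t.symm u := by
  rw [B.t_symm_smul, C_comp]

variable (K) in
/-- The saturated submodule generated by `f ^ k`. -/
def NN (k : ℕ) : Submodule A[X] Ω := Sat K (B.D (C f ^ k • B.w 0))

lemma t_pow (k : ℕ) : B.t (C f ^ k • B.w 0) = C f ^ (k + 1) • B.w 0 := by
  rw [← C_pow, t_C_smul, t_w_zero, smul_smul, pow_succ, C_pow]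

lemma t_mem_NN {k : ℕ} {x : Ω} : B.t x ∈ B.NN K (k + 1) ↔ x ∈ B.NN K k := by
  constructor
  · intro h
    rw [← B.t.symm_apply_apply x]
    refine B.t_symm_mem_Sat (fun y hy => ?_) h
    rw [← B.t_mem_D, AddEquiv.apply_symm_apply, t_pow]; exact hy
  · refine B.t_mem_Sat fun y hy => ?_
    rw [← t_pow]; exact B.t_mem_D.2 hy

lemma NN_succ_le (k : ℕ) : B.NN K (k + 1) ≤ B.NN K k := by
  refine Sat_mono (B.D_le (B.D_stable _) ?_)
  rw [pow_succ', mul_smul]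
  exact Submodule.smul_mem _ _ (B.mem_D _)

lemma NN_anti : Antitone (B.NN K) := antitone_nat_of_succ_le B.NN_succ_le

lemma NN_stable (hK : ∀ a (k : K), δ a (algebraMap K A k) = 0) (k : ℕ) :
    B.conn.Stable (B.NN K k) := Sat_stable hK _ (B.D_stable _)

/-- Elements multiplied into a submodule by a power of an ideal. -/
def _root_.LC.colonPow (I : Ideal A) (N : Submodule A[X] Ω) (r : ℕ) : Submodule A[X] Ω where
  carrier := {u | ∀ a ∈ I ^ r, C a • u ∈ N}
  add_mem' h1 h2 a ha := by rw [smul_add]; exact N.add_mem (h1 a ha) (h2 a ha)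
  zero_mem' a _ := by simp
  smul_mem' p u h a ha := by rw [smul_comm]; exact N.smul_mem _ (h a ha)

lemma colonPow_mono (I : Ideal A) (N : Submodule A[X] Ω) {r r' : ℕ} (h : r ≤ r') :
    colonPow I N r ≤ colonPow I N r' := fun _ hu a ha => hu a (Ideal.pow_le_pow_right h ha)

lemma conn_colonPow (I : Ideal A) {N : Submodule A[X] Ω} (hN : B.conn.Stable N) (r : ℕ) (a : ι)
    {u : Ω} (hu : u ∈ colonPow I N r) : B.conn.toFun a u ∈ colonPow I N (r + 1) := by
  intro b hb
  have h1 := hN a _ (hu b (Ideal.pow_le_pow_right r.le_succ hb))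
  rw [B.conn.leib, polyDer_C] at h1
  exact (Submodule.add_mem_iff_left _ (hu _ (derivation_pow_mem _ _ _ _ hb))).1 h1

lemma iter_smul (j : ℕ) (p : A[X]) : ∃ p' : A[X], ∀ u,
    B.t.symm^[j] (p • u) = p' • B.t.symm^[j] u := by
  induction j with
  | zero => exact ⟨p, fun u => rfl⟩
  | succ j ih =>
    obtain ⟨p', h⟩ := ih
    refine ⟨p'.comp (X - 1), fun u => ?_⟩
    rw [Function.iterate_succ_apply', Function.iterate_succ_apply', h, t_symm_smul]

lemma iter_C_smul (j : ℕ) (a : A) (u : Ω) :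
    B.t.symm^[j] (C a • u) = C a • B.t.symm^[j] u := by
  induction j with
  | zero => rfl
  | succ j ih =>
    rw [Function.iterate_succ_apply', Function.iterate_succ_apply', ih, t_symm_C_smul]

lemma iter_smul_map (j : ℕ) (b : K[X]) (hb : b ≠ 0) : ∃ b' : K[X], b' ≠ 0 ∧ ∀ u,
    B.t.symm^[j] (b.map (algebraMap K A) • u) = b'.map (algebraMap K A) • B.t.symm^[j] u := by
  induction j with
  | zero => exact ⟨b, hb, fun u => rfl⟩
  | succ j ih =>
    obtain ⟨b', hb', h⟩ := ih
    refine ⟨b'.comp (X - 1), ?_, fun u => ?_⟩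
    · rw [ne_eq, show (X - 1 : K[X]) = X - C 1 by simp, sub_eq_add_neg, ← C_neg,
        comp_X_add_C_eq_zero_iff]
      exact hb'
    · rw [Function.iterate_succ_apply', Function.iterate_succ_apply', h, t_symm_smul,
        Polynomial.map_comp, Polynomial.map_sub, map_X, Polynomial.map_one]

lemma iter_conn (j : ℕ) (a : ι) (u : Ω) :
    B.t.symm^[j] (B.conn.toFun a u) = B.conn.toFun a (B.t.symm^[j] u) := by
  induction j with
  | zero => rfl
  | succ j ih =>
    rw [Function.iterate_succ_apply', Function.iterate_succ_apply', ih, t_symm_conn]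

lemma iter_add (j : ℕ) (u v : Ω) :
    B.t.symm^[j] (u + v) = B.t.symm^[j] u + B.t.symm^[j] v := by
  induction j with
  | zero => rfl
  | succ j ih =>
    simp only [Function.iterate_succ_apply', ih, map_add]

/-- Elements of `D u` are, uniformly in the shift, only boundedly worse than `u`. -/
def bounded (I : Ideal A) (N : Submodule A[X] Ω) (hN : B.conn.Stable N) (u : Ω) :
    Submodule A[X] Ω where
  carrier := {z | ∃ q, ∀ j r, B.t.symm^[j] u ∈ colonPow I N r →
    B.t.symm^[j] z ∈ colonPow I N (r + q)}
  add_mem' := by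
    rintro x y ⟨q, hx⟩ ⟨q', hy⟩
    refine ⟨q + q', fun j r h => ?_⟩
    rw [iter_add]
    exact Submodule.add_mem _ (colonPow_mono I N (by omega) (hx j r h))
      (colonPow_mono I N (by omega) (hy j r h))
  zero_mem' := ⟨0, fun j r _ => by
    have : B.t.symm^[j] (0 : Ω) = 0 := by
      have := B.iter_C_smul j 0 0
      simpa using this
    rw [this]; exact Submodule.zero_mem _⟩
  smul_mem' := by
    rintro p x ⟨q, hx⟩
    refine ⟨q, fun j r h => ?_⟩
    obtain ⟨p', hp'⟩ := B.iter_smul j p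
    rw [hp']; exact Submodule.smul_mem _ _ (hx j r h)

lemma bounded_of_mem_D (I : Ideal A) (N : Submodule A[X] Ω) (hN : B.conn.Stable (Sat K N)) (u z : Ω)
    (hz : z ∈ Sat K (B.D u)) : ∃ q, ∀ j r, B.t.symm^[j] u ∈ colonPow I (Sat K N) r →
    B.t.symm^[j] z ∈ colonPow I (Sat K N) (r + q) := by
  obtain ⟨b, hb, hz⟩ := hz
  have h1 : B.D u ≤ B.bounded I _ hN u := by
    refine B.D_le ?_ ⟨0, fun j r h => h⟩
    rintro a x ⟨q, hx⟩
    refine ⟨q + 1, fun j r h => ?_⟩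
    rw [iter_conn]
    exact B.conn_colonPow I hN _ _ (hx j r h)
  obtain ⟨q, hq⟩ := h1 hz
  refine ⟨q, fun j r h a ha => ?_⟩
  have h2 := hq j r h a ha
  obtain ⟨b', hb', e⟩ := B.iter_smul_map j b hb
  rw [e, smul_comm] at h2
  exact mem_Sat_of_smul hb' h2

lemma iter_w (j i : ℕ) : B.t.symm^[j] (B.w i) = B.w (i + j) := by
  induction j with
  | zero => rfl
  | succ j ih =>
    rw [Function.iterate_succ_apply', ih, ← B.t_w (i + j), AddEquiv.symm_apply_apply]; rfl

/-- Linear growth: the powers of `f⁻¹` are multiplied into the `k`-th submodule by a linearly growing power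
of the ideal. -/
lemma growth [IsNoetherianRing A] (hK : ∀ a (k : K), δ a (algebraMap K A k) = 0)
    (I : Ideal A) (l : ℕ) (hl : B.w 0 ∈ colonPow I (B.NN K 1) l) :
    ∃ Λ : ℕ, ∀ i k : ℕ, B.w i ∈ colonPow I (B.NN K k) (Λ * (i + k)) := by
  obtain ⟨s, hs⟩ := IsNoetherian.noetherian (I ^ l)
  have h1 : ∀ g ∈ s, ∃ q, ∀ j r, B.t.symm^[j] (C f • B.w 0) ∈ colonPow I (B.NN K 0) r →
      B.t.symm^[j] (C g • B.w 0) ∈ colonPow I (B.NN K 0) (r + q) := by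
    intro g hg
    refine B.bounded_of_mem_D I _ (B.NN_stable hK 0) _ _ ?_
    have h2 := hl g (hs ▸ Submodule.subset_span hg)
    rwa [NN, pow_one] at h2
  choose! q hq using h1
  set Q := ∑ g ∈ s, q g
  have h3 : ∀ i, B.w i ∈ colonPow I (B.NN K 0) ((Q + l) * i) := by
    intro i
    induction i with
    | zero =>
      intro a _
      exact Submodule.smul_mem _ _ (le_Sat K _ (by simpa using B.mem_D (B.w 0)))
    | succ i ih =>
      have h4 : ∀ g ∈ I ^ l, C g • B.w (i + 1) ∈ colonPow I (B.NN K 0) ((Q + l) * i + Q) := by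
        intro g hg
        rw [← hs] at hg
        refine Submodule.span_induction (p := fun g _ => C g • B.w (i + 1) ∈
          colonPow I (B.NN K 0) ((Q + l) * i + Q)) (fun g hg => ?_) (by simp)
          (fun x y _ _ hx hy => by rw [C_add, add_smul]; exact Submodule.add_mem _ hx hy)
          (fun a x _ hx => by
            rw [smul_eq_mul, C_mul, mul_smul]; exact Submodule.smul_mem _ _ hx) hg
        have h5 := hq g hg (i + 1) ((Q + l) * i) (by
          rw [iter_C_smul, iter_w, zero_add, B.f_w]; exact ih)
        rw [iter_C_smul, iter_w, zero_add] at h5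
        refine colonPow_mono _ _ ?_ h5
        have : q g ≤ Q := Finset.single_le_sum (f := q) (fun _ _ => Nat.zero_le _) hg
        omega
      intro a ha
      rw [show (Q + l) * (i + 1) = l + ((Q + l) * i + Q) by ring, pow_add] at ha
      refine Submodule.mul_induction_on ha (fun x hx y hy => ?_) (fun x y hx hy => ?_)
      · rw [mul_comm, C_mul, mul_smul]; exact h4 x hx y hy
      · rw [C_add, add_smul]; exact Submodule.add_mem _ hx hy
  refine ⟨Q + l, fun i k => ?_⟩
  have h6 : ∀ k i, (∀ a ∈ I ^ ((Q + l) * (i + k)), C a • B.w i ∈ B.NN K k) := by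
    intro k
    induction k with
    | zero => exact fun i => h3 i
    | succ k ih =>
      intro i a ha
      rw [← B.t_w i, ← t_C_smul, t_mem_NN]
      exact ih (i + 1) a (by rwa [show i + 1 + k = i + (k + 1) by ring])
  exact h6 k i
end BData
end BFun

section
open Polynomial
namespace BData
variable {A : Type} [CommRing A] {ι : Type} {δ : ι → Derivation ℤ A A} {f : A}
  {Ω : Type} [AddCommGroup Ω] [Module A[X] Ω] (B : BData δ f Ω) [Module A Ω]
  [IsScalarTower A A[X] Ω]

omit [Module A[X] Ω] in
lemma smul_eq_C_smul [Module A[X] Ω] [IsScalarTower A A[X] Ω] (a : A) (u : Ω) :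
    a • u = (C a : A[X]) • u := by
  rw [← one_smul A[X] u, ← smul_assoc, smul_smul, mul_one, smul_eq_C_mul, mul_one]

/-- Lattices `f⁻ⁱ A[X]` with degree at most `2 i`. -/
def lat (i : ℕ) : Submodule A Ω where
  carrier := {u | ∃ q : A[X], q.natDegree ≤ 2 * i ∧ q • B.w i = u}
  add_mem' := by
    rintro _ _ ⟨q, hq, rfl⟩ ⟨q', hq', rfl⟩
    exact ⟨q + q', natDegree_add_le_of_degree_le hq hq', add_smul _ _ _⟩
  zero_mem' := ⟨0, by simp, zero_smul _ _⟩
  smul_mem' := by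
    rintro a _ ⟨q, hq, rfl⟩
    exact ⟨a • q, (natDegree_smul_le a q).trans hq, smul_assoc _ _ _⟩

lemma smul_w (i j : ℕ) : C f ^ j • B.w (i + j) = B.w i := by
  induction j with
  | zero => simp
  | succ j ih => rw [pow_succ, mul_smul, ← add_assoc, B.f_w, ih]

lemma mem_lat {i j : ℕ} (h : i ≤ j) (q : A[X]) (hq : q.natDegree ≤ 2 * j) :
    q • B.w i ∈ B.lat j := by
  obtain ⟨k, rfl⟩ := Nat.exists_eq_add_of_le h
  refine ⟨q * C f ^ k, ?_, by rw [mul_smul, smul_w]⟩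
  rw [← C_pow]
  exact (natDegree_mul_C_le _ _).trans hq

lemma lat_mono : Monotone B.lat := by
  rintro i j h _ ⟨q, hq, rfl⟩
  exact B.mem_lat h q (by omega)

lemma smul_mem_lat {i g : ℕ} {u : Ω} (hu : u ∈ B.lat i) (p : A[X]) (hp : p.natDegree ≤ g) :
    p • u ∈ B.lat (i + g) := by
  obtain ⟨q, hq, rfl⟩ := hu
  rw [smul_smul]
  exact B.mem_lat (by omega) _ (natDegree_mul_le.trans (by omega))

lemma conn_mem_lat {i : ℕ} {u : Ω} (hu : u ∈ B.lat i) (a : ι) :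
    B.conn.toFun a u ∈ B.lat (i + 1) := by
  obtain ⟨q, hq, rfl⟩ := hu
  rw [B.conn.leib, B.conn_w, smul_smul]
  refine Submodule.add_mem _ (B.mem_lat le_rfl _ ?_) (B.mem_lat (by omega) _ ?_)
  · refine natDegree_mul_le.trans ?_
    have h1 : (C (δ a f) * (X - C (i : A))).natDegree ≤ 1 :=
      (natDegree_C_mul_le _ _).trans (natDegree_X_sub_C_le _)
    omega
  · exact (natDegree_polyDer_le _ _).trans (by omega)

lemma t_mem_lat {i : ℕ} {u : Ω} (hu : u ∈ B.lat i) : B.t u ∈ B.lat i := by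
  obtain ⟨q, hq, rfl⟩ := hu
  have hd : (q.comp (X + 1)).natDegree ≤ 2 * i := by
    refine natDegree_comp_le.trans ?_
    have : (X + 1 : A[X]).natDegree ≤ 1 := by
      rw [← C_1]; exact (natDegree_add_C).le.trans natDegree_X_le
    calc _ ≤ q.natDegree * 1 := Nat.mul_le_mul_left _ this
      _ ≤ _ := by omega
  rw [B.t_smul]
  cases i with
  | zero =>
    rw [t_w_zero, smul_smul, ]
    exact B.mem_lat le_rfl _ ((natDegree_mul_C_le _ _).trans hd)
  | succ i => rw [B.t_w]; exact B.mem_lat i.le_succ _ hd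

/-- The shift as a linear map over constants in the variable. -/
def tLin : Ω →ₗ[A] Ω where
  toFun := B.t
  map_add' := map_add _
  map_smul' a u := by
    rw [smul_eq_C_smul, t_C_smul, RingHom.id_apply, smul_eq_C_smul a (B.t u)]

variable {K : Type} [Field K] [Algebra K A]

omit [Module A Ω] [IsScalarTower A A[X] Ω] in
lemma iter_t_mem_NN (j k : ℕ) (u : Ω) : B.t^[j] u ∈ B.NN K (j + k) ↔ u ∈ B.NN K k := by
  induction j with
  | zero => simp
  | succ j ih =>
    rw [Function.iterate_succ_apply', show j + 1 + k = j + k + 1 by ring, t_mem_NN, ih]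

lemma tLin_pow (j : ℕ) (u : Ω) : (B.tLin ^ j) u = B.t^[j] u := by
  rw [Module.End.pow_apply]; rfl

lemma length_lat_le [IsLocalRing A] (l : List A)
    (hl : Ideal.span {y | y ∈ l} = maximalIdeal A) (Λ : ℕ)
    (hΛ : ∀ i k : ℕ, B.w i ∈ colonPow (maximalIdeal A) (B.NN K k) (Λ * (i + k)))
    (i k : ℕ) :
    Module.length A ((B.lat i).map ((B.NN K k).mkQ.restrictScalars A)) ≤
      ((2 * i + 1) * (Λ * (i + k)) ^ l.length : ℕ) := by
  let x : Fin (2 * i + 1) → Ω ⧸ B.NN K k := fun d => (B.NN K k).mkQ ((X : A[X]) ^ (d : ℕ) • B.w i)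
  have hx : ∀ d, ∀ a ∈ maximalIdeal A ^ (Λ * (i + k)), a • x d = 0 := by
    intro d a ha
    change a • (B.NN K k).mkQ _ = 0
    rw [smul_eq_C_smul, ← map_smul, Submodule.mkQ_apply, Submodule.Quotient.mk_eq_zero, smul_comm]
    exact Submodule.smul_mem _ _ (hΛ i k a ha)
  have h1 := length_span_range_le _ x hx
  have h2 : (B.lat i).map ((B.NN K k).mkQ.restrictScalars A) ≤
      Submodule.span A (Set.range x) := by
    rintro _ ⟨_, ⟨q, hq, rfl⟩, rfl⟩
    change (B.NN K k).mkQ (q • B.w i) ∈ _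
    rw [q.as_sum_range' (2 * i + 1) (by omega), Finset.sum_smul, map_sum]
    refine Submodule.sum_mem _ fun d hd => ?_
    rw [← C_mul_X_pow_eq_monomial, mul_smul, map_smul, ← smul_eq_C_smul]
    exact Submodule.smul_mem _ _ (Submodule.subset_span ⟨⟨d, Finset.mem_range.1 hd⟩, rfl⟩)
  refine (Module.length_le_of_injective (Submodule.inclusion h2)
    (Submodule.inclusion_injective h2)).trans (h1.trans ?_)
  rw [Fintype.card_fin, Nat.cast_mul]
  exact mul_le_mul_right (length_quotient_pow_le l hl _) _

lemma mul_card_le_length {G : Type} (F : Finset G) (x : G → Ω) (rk : G → ℕ) (i : ℕ)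
    (h0 : ∀ g ∈ F, x g ∈ B.NN K 0) (hL : ∀ g ∈ F, x g ∈ B.lat i)
    (hx : ∀ g ∈ F, x g ∉ Submodule.span A (x '' {j | j ∈ F ∧ j ≠ g ∧ rk j ≤ rk g}) ⊔
      (B.NN K 1).restrictScalars A) (k : ℕ) :
    ((k * F.card : ℕ) : ℕ∞) ≤
      Module.length A ((B.lat i).map ((B.NN K k).mkQ.restrictScalars A)) := by
  classical
  set R := F.sup rk + 1
  have hR : ∀ g ∈ F, rk g < R := fun g hg => Nat.lt_succ_of_le (Finset.le_sup (f := rk) hg)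
  let s : Finset (ℕ × G) := Finset.range k ×ˢ F
  let y : ℕ × G → Ω ⧸ B.NN K k := fun j => (B.NN K k).mkQ (B.t^[j.1] (x j.2))
  let r : ℕ × G → ℕ := fun j => (k - j.1) * R + rk j.2
  have hs : s.card = k * F.card := by simp [s]
  have h1 := card_le_length (A := A) s y r ?_
  · rw [hs] at h1
    refine h1.trans ?_
    have h2 : Submodule.span A (y '' s) ≤ (B.lat i).map ((B.NN K k).mkQ.restrictScalars A) := by
      rw [Submodule.span_le]
      rintro _ ⟨⟨j, g⟩, hjg, rfl⟩
      refine ⟨B.t^[j] (x g), ?_, rfl⟩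
      have hg : g ∈ F := (Finset.mem_product.1 hjg).2
      clear hjg
      induction j with
      | zero => exact hL g hg
      | succ j ih => rw [Function.iterate_succ_apply']; exact B.t_mem_lat ih
    exact Module.length_le_of_injective (Submodule.inclusion h2)
      (Submodule.inclusion_injective h2)
  · rintro ⟨j, g⟩ hjg hmem
    obtain ⟨hj, hg⟩ := Finset.mem_product.1 hjg
    have hj := Finset.mem_range.1 hj
    let S1 := Submodule.span A (x '' {j | j ∈ F ∧ j ≠ g ∧ rk j ≤ rk g})
    have h3 : Submodule.span A (y '' {j' | j' ∈ s ∧ j' ≠ (j, g) ∧ r j' ≤ r (j, g)}) ≤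
        (S1.map (B.tLin ^ j) ⊔ (B.NN K (j + 1)).restrictScalars A).map
          ((B.NN K k).mkQ.restrictScalars A) := by
      rw [Submodule.span_le]
      rintro _ ⟨⟨j', g'⟩, ⟨hs', hne, hle⟩, rfl⟩
      obtain ⟨hj', hg'⟩ := Finset.mem_product.1 hs'
      have hj' := Finset.mem_range.1 hj'
      refine ⟨B.t^[j'] (x g'), ?_, rfl⟩
      simp only [r] at hle
      change (k - j') * R + rk g' ≤ (k - j) * R + rk g at hle
      rcases lt_trichotomy j' j with hlt | rfl | hgt
      · exfalso
        have : (k - j + 1) * R ≤ (k - j') * R := Nat.mul_le_mul_right _ (by omega)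
        have := hR g hg
        rw [add_mul, one_mul] at *
        omega
      · refine Submodule.mem_sup_left ⟨x g', Submodule.subset_span ⟨g', ⟨hg', ?_, by omega⟩, rfl⟩,
          B.tLin_pow _ _⟩
        exact fun e => hne (by rw [e])
      · refine Submodule.mem_sup_right ?_
        change _ ∈ B.NN K (j + 1)
        exact B.NN_anti hgt ((B.iter_t_mem_NN j' 0 _).2 (h0 g' hg'))
    obtain ⟨u, hu, e⟩ := h3 hmem
    obtain ⟨_, ⟨u', hu', rfl⟩, n, hn, rfl⟩ := Submodule.mem_sup.1 hu
    refine hx g hg (Submodule.mem_sup.2 ⟨u', hu', x g - u', ?_, by abel⟩)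
    change _ ∈ B.NN K 1
    rw [← B.iter_t_mem_NN j, ← tLin_pow, map_sub]
    have h4 : (B.tLin ^ j) u' + n - B.t^[j] (x g) ∈ B.NN K k :=
      (Submodule.Quotient.eq _).1 e
    have h5 := B.NN_anti (Nat.succ_le_of_lt hj) h4
    have h6 := (B.NN K (j + 1)).sub_mem hn h5
    rw [← tLin_pow] at h6
    convert h6 using 1
    abel

lemma count [IsNoetherianRing A] [IsLocalRing A] (hK : ∀ a (k : K), δ a (algebraMap K A k) = 0)
    (l : List A) (hl : Ideal.span {y | y ∈ l} = maximalIdeal A) (e : ℕ)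
    (he : B.w 0 ∈ colonPow (maximalIdeal A) (B.NN K 1) e) (c r : ℕ)
    (H : ∀ m, ∃ (G : Type) (F : Finset G) (x : G → Ω) (rk : G → ℕ),
      F.card = m ^ (l.length + 1) ∧ (∀ g ∈ F, x g ∈ B.NN K 0) ∧
      (∀ g ∈ F, x g ∈ B.lat (r + c * m)) ∧
      ∀ g ∈ F, x g ∉ Submodule.span A (x '' {j | j ∈ F ∧ j ≠ g ∧ rk j ≤ rk g}) ⊔
      (B.NN K 1).restrictScalars A) : False := by
  obtain ⟨Λ, hΛ⟩ := B.growth hK _ e he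
  set k := (2 * c + 3) * (Λ * (c + 1)) ^ l.length + 1 with hk
  set m := r + k + 1 with hm
  obtain ⟨G, F, x, rk, h1, h2, h3, h4⟩ := H m
  have h5 := (B.mul_card_le_length F x rk _ h2 h3 h4 k).trans (B.length_lat_le l hl Λ hΛ _ k)
  rw [h1] at h5
  have h6 : k * m ^ (l.length + 1) ≤
    (2 * (r + c * m) + 1) * (Λ * (r + c * m + k)) ^ l.length := by exact_mod_cast h5
  have h7 : r + c * m + k ≤ (c + 1) * m := by rw [add_mul]; omega
  have h8 : 2 * (r + c * m) + 1 ≤ (2 * c + 3) * m := by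
    have : (2 * c + 3) * m = 2 * (c * m) + 3 * m := by ring
    omega
  have h9 : (2 * (r + c * m) + 1) * (Λ * (r + c * m + k)) ^ l.length ≤
      ((2 * c + 3) * m) * (Λ * ((c + 1) * m)) ^ l.length := by gcongr
  have h10 : ((2 * c + 3) * m) * (Λ * ((c + 1) * m)) ^ l.length =
      ((2 * c + 3) * (Λ * (c + 1)) ^ l.length) * m ^ (l.length + 1) := by
    rw [← mul_assoc Λ, mul_pow _ m]; ring
  have h11 : 0 < m ^ (l.length + 1) := pow_pos (by omega) _
  have h12 : k * m ^ (l.length + 1) = ((2 * c + 3) * (Λ * (c + 1)) ^ l.length) * m ^ (l.length + 1)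
    + m ^ (l.length + 1) := by rw [hk, add_mul, one_mul]
  omega
end BData
end

section
open Polynomial
namespace BData
variable {A : Type} [CommRing A] {ι : Type} {δ : ι → Derivation ℤ A A} {f : A}
  {Ω : Type} [AddCommGroup Ω] [Module A[X] Ω] (B : BData δ f Ω) [Module A Ω]
  [IsScalarTower A A[X] Ω]
variable {K : Type} [Field K] [Algebra K A]

lemma _root_.LC.der_sum_apply {S ι : Type} [CommRing S] (s : Finset ι) (a : ι → S)
    (δ : ι → Derivation ℤ S S) (p : S) : (∑ i ∈ s, a i • δ i) p = ∑ i ∈ s, a i * δ i p := by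
  classical
  induction s using Finset.induction_on with
  | empty => simp
  | insert i s hi ih =>
    rw [Finset.sum_insert hi, Finset.sum_insert hi, Derivation.add_apply, ih,
      Derivation.smul_apply, smul_eq_mul]

/-- Linear combinations of the operators of a connection. -/
def _root_.LC.Conn.comb {S ι N : Type} [CommRing S] {δ : ι → Derivation ℤ S S} [AddCommGroup N]
    [Module S N] [Fintype ι] (c : Conn δ N) (a : ι → S) : N →+ N :=
  ∑ i, (DistribSMul.toAddMonoidHom N (a i)).comp (c.toFun i)

lemma _root_.LC.Conn.comb_apply {S ι N : Type} [CommRing S] {δ : ι → Derivation ℤ S S}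
    [AddCommGroup N] [Module S N] [Fintype ι] (c : Conn δ N) (a : ι → S) (x : N) :
    c.comb a x = ∑ i, a i • c.toFun i x := by
  simp [Conn.comb]

lemma _root_.LC.Conn.comb_leib {S ι N : Type} [CommRing S] {δ : ι → Derivation ℤ S S}
    [AddCommGroup N] [Module S N] [Fintype ι] (c : Conn δ N) (a : ι → S) (p : S) (x : N) :
    c.comb a (p • x) = p • c.comb a x + (∑ i, a i • δ i) p • x := by
  rw [Conn.comb_apply, Conn.comb_apply, Finset.smul_sum]
  rw [der_sum_apply, Finset.sum_smul, ← Finset.sum_add_distrib]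
  refine Finset.sum_congr rfl fun i _ => ?_
  rw [c.leib, smul_add, smul_comm, mul_smul]

lemma family_of_dual [Fintype ι] (hK : ∀ a (k : K), δ a (algebraMap K A k) = 0)
    {Q : Ideal A[X]} [Q.IsPrime] (p0 : A[X])
    (hv : ∀ q : A[X], (q * p0) • B.w 0 ∈ B.NN K 1 ↔ q ∈ Q)
    {τ : Type} [Fintype τ] [DecidableEq τ] (z : τ → A[X]) (hz : ∀ j, z j ∈ Q)
    (Cf : τ → ι → A[X]) {c : A[X]} (hc : c ∉ Q) (hN : ∀ n : ℕ, n ≠ 0 → (n : A[X]) ∉ Q)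
    (hd : ∀ l j, (∑ i, Cf l i • polyDer (δ i)) (z j) - (if l = j then c else 0) ∈ Q)
    (p : ℕ → A[X]) (hpd : ∀ a, (p a).natDegree ≤ a) :
    ∃ c r : ℕ, ∀ m m' : ℕ, m' ≤ m + 1 →
    (∀ a < m', ∀ w ∈ Submodule.span A (p '' {b | b < a}), p a - w ∉ Q) →
    ∃ (G : Type) (F : Finset G) (x : G → Ω) (rk : G → ℕ),
      F.card = m ^ (Fintype.card τ) * m' ∧ (∀ g ∈ F, x g ∈ B.NN K 0) ∧
      (∀ g ∈ F, x g ∈ B.lat (r + c * m)) ∧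
      ∀ g ∈ F, x g ∉ Submodule.span A (x '' {j | j ∈ F ∧ j ≠ g ∧ rk j ≤ rk g}) ⊔
      (B.NN K 1).restrictScalars A := by
  classical
  set g := ∑ l, ∑ i, (Cf l i).natDegree with hg
  have hCf : ∀ l i, (Cf l i).natDegree ≤ g := fun l i =>
    (Finset.single_le_sum (f := fun i => (Cf l i).natDegree) (fun _ _ => Nat.zero_le _)
      (Finset.mem_univ i)).trans (Finset.single_le_sum
      (f := fun l => ∑ i, (Cf l i).natDegree) (fun _ _ => Nat.zero_le _) (Finset.mem_univ l))
  refine ⟨1 + (g + 1) * Fintype.card τ, p0.natDegree, fun m m' hm hp => ?_⟩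
  let D : τ → Ω →+ Ω := fun l => B.conn.comb (Cf l)
  let v : Ω := p0 • B.w 0
  let x : Multiset τ × ℕ → Ω := fun i => opList D i.1.toList (p i.2 • v)
  let ms : (τ → Fin m) → Multiset τ := fun α =>
    Finsupp.toMultiset (Finsupp.equivFunOnFinite.symm fun l => (α l : ℕ))
  have hms : Function.Injective ms := by
    intro α β h
    funext l
    have := congrArg (Multiset.count l) h
    simp only [ms, Finsupp.count_toMultiset] at this
    exact Fin.ext this
  have hmc : ∀ α, (ms α).card ≤ Fintype.card τ * m := by
    intro α
    simp only [ms, Finsupp.card_toMultiset]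
    rw [Finsupp.sum_fintype _ _ (fun _ => rfl)]
    refine (Finset.sum_le_card_nsmul _ _ m fun l _ => (α l).2.le).trans ?_
    simp
  let F : Finset (Multiset τ × ℕ) := (Finset.univ.image ms) ×ˢ Finset.range m'
  have hcomb : ∀ (N : Submodule A[X] Ω), B.conn.Stable N → ∀ l, ∀ u ∈ N, D l u ∈ N := by
    intro N hN l u hu
    simp only [D, Conn.comb_apply]
    exact Submodule.sum_mem _ fun i _ => N.smul_mem _ (hN i u hu)
  refine ⟨_, F, x, fun i => i.1.card * m' + i.2, ?_, ?_, ?_, ?_⟩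
  · simp [F, Finset.card_image_of_injective _ hms]
  · rintro ⟨s, a⟩ -
    have h0 : p a • v ∈ B.NN K 0 := Submodule.smul_mem _ _ (Submodule.smul_mem _ _
      (le_Sat K _ (by simpa using B.mem_D (B.w 0))))
    change opList D s.toList (p a • v) ∈ _
    induction s.toList with
    | nil => exact h0
    | cons l L ih => exact hcomb _ (B.NN_stable hK 0) l _ ih
  · rintro ⟨s, a⟩ hsa
    obtain ⟨h1, h2⟩ := Finset.mem_product.1 hsa
    obtain ⟨α, -, rfl⟩ := Finset.mem_image.1 h1
    have h2 : a < m' := Finset.mem_range.1 h2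
    change opList D (ms α).toList (p a • v) ∈ _
    have h3 : p a • v ∈ B.lat (p0.natDegree + m) := by
      have := B.smul_mem_lat (B.smul_mem_lat (i := 0) (u := B.w 0)
        (by simpa using B.mem_lat le_rfl 1 (by simp)) p0 le_rfl) (p a) (hpd a)
      exact B.lat_mono (by omega) this
    have h4 : ∀ L : List τ, opList D L (p a • v) ∈
        B.lat (p0.natDegree + m + (g + 1) * L.length) := by
      intro L
      induction L with
      | nil => exact h3
      | cons l L ih =>
        change D l (opList D L _) ∈ _
        simp only [D, Conn.comb_apply]
        refine Submodule.sum_mem _ fun i _ => ?_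
        refine B.lat_mono ?_ (B.smul_mem_lat (B.conn_mem_lat ih i) (Cf l i) (hCf l i))
        rw [List.length_cons, mul_add]; omega
    refine B.lat_mono ?_ (h4 _)
    have := Nat.mul_le_mul_left (g + 1) (hmc α)
    rw [Multiset.length_toList]
    linarith
  · rintro ⟨s, a⟩ hsa hmem
    obtain ⟨h1, h2⟩ := Finset.mem_product.1 hsa
    have h2 : a < m' := Finset.mem_range.1 h2
    let cq := B.conn.quot (B.NN K 1) (B.NN_stable hK 1)
    let Dq : τ → (Ω ⧸ B.NN K 1) →+ (Ω ⧸ B.NN K 1) := fun l => cq.comb (Cf l)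
    have hq : ∀ L : List τ, ∀ u, (B.NN K 1).mkQ (opList D L u) =
        opList Dq L ((B.NN K 1).mkQ u) := by
      intro L u
      induction L with
      | nil => rfl
      | cons l L ih =>
        change (B.NN K 1).mkQ (D l (opList D L u)) = Dq l (opList Dq L _)
        rw [← ih]
        simp only [D, Dq, Conn.comb_apply, map_sum, map_smul]
        exact Finset.sum_congr rfl fun i _ => by rw [B.conn.quot_hor _ (B.NN_stable hK 1)]
    have h5 := opList_strictIndep (A := A) (Q := Q) (D := Dq)
      (d := fun l => ∑ i, Cf l i • polyDer (δ i))
      (fun l q u => cq.comb_leib (Cf l) q u) hz hd hc hN (v := (B.NN K 1).mkQ v) (fun q => by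
        rw [← hv, ← map_smul, Submodule.mkQ_apply, Submodule.Quotient.mk_eq_zero, mul_smul])
      p m' hp s a h2
    refine h5 ?_
    have h6 := Submodule.mem_map_of_mem (f := (B.NN K 1).mkQ.restrictScalars A) hmem
    rw [Submodule.map_sup, Submodule.map_span] at h6
    have h7 : ((B.NN K 1).restrictScalars A).map ((B.NN K 1).mkQ.restrictScalars A) = ⊥ := by
      rw [eq_bot_iff]
      rintro _ ⟨u, hu, rfl⟩
      exact (Submodule.Quotient.mk_eq_zero _).2 hu
    rw [h7, sup_bot_eq] at h6
    have h8 : opList Dq s.toList (p a • (B.NN K 1).mkQ v) =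
        ((B.NN K 1).mkQ.restrictScalars A) (x (s, a)) := by
      rw [← map_smul, ← hq]; rfl
    rw [h8]
    refine Submodule.span_mono ?_ h6
    rintro _ ⟨_, ⟨⟨s', a'⟩, ⟨hF, hne, hle⟩, rfl⟩, rfl⟩
    refine ⟨(s', a'), ⟨Finset.mem_range.1 (Finset.mem_product.1 hF).2, hne, hle⟩, ?_⟩
    change opList Dq s'.toList (p a' • (B.NN K 1).mkQ v) = (B.NN K 1).mkQ (x (s', a'))
    rw [← map_smul, ← hq]
end BData
end

section
open Polynomial

lemma exists_dual {A : Type} [CommRing A] [IsLocalRing A] [IsNoetherianRing A] {ι : Type}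
    [Fintype ι] (δ : ι → Derivation ℤ A A)
    (hJ : ∀ u ∈ maximalIdeal A, (∀ a, δ a u ∈ maximalIdeal A) → u ∈ maximalIdeal A ^ 2) :
    ∃ (h : ℕ) (z : Fin h → A), Ideal.span (Set.range z) = maximalIdeal A ∧
      ∃ Cf : Fin h → ι → A, ∀ l j,
        (∑ a, Cf l a * δ a (z j)) - (if l = j then 1 else 0) ∈ maximalIdeal A := by
  classical
  let b := Module.finBasis (ResidueField A) (CotangentSpace A)
  have hs : ∀ j, ∃ y : maximalIdeal A, (maximalIdeal A).toCotangent y = b j := fun j =>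
    Ideal.toCotangent_surjective _ _
  choose y hy using hs
  refine ⟨_, fun j => (y j : A), ?_, ?_⟩
  · have h1 : Submodule.span (ResidueField A)
        ((maximalIdeal A).toCotangent '' (Set.range y)) = ⊤ := by
      rw [← b.span_eq, ← Set.range_comp]
      congr 1
      ext v; simp [hy]
    rw [CotangentSpace.span_image_eq_top_iff] at h1
    have h2 := congrArg (Submodule.map (maximalIdeal A).subtype) h1
    rw [Submodule.map_span, Submodule.map_top, ← Set.range_comp] at h2
    exact h2.trans (Submodule.range_subtype _)
  · let r : (Fin (Module.finrank (ResidueField A) (CotangentSpace A)) → ResidueField A)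
        →ₗ[ResidueField A] (ι → ResidueField A) :=
      Fintype.linearCombination (ResidueField A) (fun j a => residue A (δ a (y j)))
    have hr : LinearMap.ker r = ⊥ := by
      rw [LinearMap.ker_eq_bot']
      intro c hc
      have hc' : ∀ a, ∑ j, c j * residue A (δ a (y j)) = 0 := by
        intro a
        have := congrFun hc a
        simpa [r, Fintype.linearCombination_apply] using this
      choose c' hcc using fun j => residue_surjective (c j)
      have hu : (∑ j, c' j • y j : maximalIdeal A).1 ∈ maximalIdeal A ^ 2 := by
        refine hJ _ (Subtype.mem _) fun a => ?_
        rw [← residue_eq_zero_iff]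
        simp only [Submodule.coe_sum, Submodule.coe_smul, smul_eq_mul, map_sum,
          Derivation.leibniz, map_add, map_mul]
        rw [← hc' a]
        refine Finset.sum_congr rfl fun j _ => ?_
        rw [hcc, (residue_eq_zero_iff _).2 (y j).2]
        simp
      have h3 := (Ideal.toCotangent_eq_zero (maximalIdeal A) _).2 hu
      rw [map_sum] at h3
      have h4 : ∑ j, c j • b j = 0 := by
        rw [← h3]
        refine Finset.sum_congr rfl fun j _ => ?_
        rw [map_smul, hy, ← hcc]
        rfl
      funext j
      exact Fintype.linearIndependent_iff.1 b.linearIndependent c h4 j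
    obtain ⟨s, hs⟩ := LinearMap.exists_leftInverse_of_injective r hr
    choose Cf hCf using fun l a => residue_surjective (R := A) (s (Pi.single a 1) l)
    refine ⟨Cf, fun l j => ?_⟩
    rw [← residue_eq_zero_iff]
    have h5 := congrFun (LinearMap.congr_fun hs (Pi.single j 1)) l
    rw [LinearMap.comp_apply] at h5
    have h6 : r (Pi.single j 1) = ∑ a, residue A (δ a (y j)) • Pi.single a 1 := by
      simp only [r, Fintype.linearCombination_apply_single, one_smul]
      funext a
      simp [Finset.sum_apply, Pi.single_apply]
    rw [h6, map_sum] at h5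
    simp only [map_smul, Finset.sum_apply, Pi.smul_apply, smul_eq_mul, LinearMap.id_apply] at h5
    rw [map_sub, map_sum]
    simp only [map_mul, hCf]
    rw [Finset.sum_congr rfl (fun a _ => mul_comm _ _), h5, Pi.single_apply]
    split_ifs <;> simp
lemma exists_prime_smul {P Ω : Type} [CommRing P] [IsNoetherianRing P] [AddCommGroup Ω] [Module P Ω]
    (N : Submodule P Ω) (u : Ω) (hu : u ∉ N) :
    ∃ Q : Ideal P, Q.IsPrime ∧ ∃ p0 : P, ∀ q, (q * p0) • u ∈ N ↔ q ∈ Q := by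
  let I : Ideal P := N.comap (LinearMap.toSpanSingleton P Ω u)
  have hI : ∀ p, p ∈ I ↔ p • u ∈ N := fun p => by
    simp [I]
  have h1 : (Ideal.Quotient.mk I 1) ≠ 0 := by
    rw [ne_eq, Ideal.Quotient.eq_zero_iff_mem, hI, one_smul]; exact hu
  obtain ⟨Q, hQ, -⟩ := exists_le_isAssociatedPrime_of_isNoetherianRing P (M := P ⧸ I) _ h1
  rw [isAssociatedPrime_iff] at hQ
  obtain ⟨hp, x, hx⟩ := hQ
  obtain ⟨p0, rfl⟩ := Ideal.Quotient.mk_surjective x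
  refine ⟨Q, hp, p0, fun q => ?_⟩
  rw [hx, Submodule.mem_colon_singleton, Submodule.mem_bot, ← hI, ← Ideal.Quotient.eq_zero_iff_mem,
    map_mul]
  rfl

lemma exists_map_mem_of_monic {A K : Type} [CommRing A] [Field K] [Algebra K A] (Q : Ideal A[X])
    [Q.IsPrime] (G : A[X]) (hG : G.Monic) (hGQ : G ∈ Q)
    (h : ∀ n, ∃ b : K[X], b ≠ 0 ∧ C (aeval (G.coeff n) b) ∈ Q) :
    ∃ b : K[X], b ≠ 0 ∧ b.map (algebraMap K A) ∈ Q := by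
  let φ : A →+* A[X] ⧸ Q := (Ideal.Quotient.mk Q).comp C
  let φ' : A →ₐ[K] A[X] ⧸ Q := { φ with commutes' := fun r => rfl }
  have h1 : ∀ n, (G.map φ).coeff n ∈ (integralClosure K (A[X] ⧸ Q)).toSubring := by
    intro n
    obtain ⟨b, hb, hm⟩ := h n
    have : IsAlgebraic K (φ (G.coeff n)) := by
      refine ⟨b, hb, ?_⟩
      have h2 : aeval (φ' (G.coeff n)) b = φ' (aeval (G.coeff n) b) := aeval_algHom_apply _ _ _
      exact h2.trans (Ideal.Quotient.eq_zero_iff_mem.2 hm)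
    rw [coeff_map]
    exact this.isIntegral
  have h2 : IsIntegral (integralClosure K (A[X] ⧸ Q)) (Ideal.Quotient.mk Q X) := by
    refine ⟨(G.map φ).toSubring (integralClosure K (A[X] ⧸ Q)).toSubring (fun x hx => ?_), ?_, ?_⟩
    · obtain ⟨n, -, rfl⟩ := mem_coeffs_iff.1 hx
      exact h1 n
    · exact (monic_toSubring _ _ _).2 (hG.map φ)
    · rw [← eval_map]
      have := map_toSubring (G.map φ) (integralClosure K (A[X] ⧸ Q)).toSubring (fun x hx => by
        obtain ⟨n, -, rfl⟩ := mem_coeffs_iff.1 hx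
        exact h1 n)
      erw [this]
      rw [eval_map, ← Ideal.Quotient.eq_zero_iff_mem.2 hGQ]
      conv_rhs => rw [← eval₂_C_X (p := G)]
      rw [hom_eval₂]
  have h3 : IsIntegral K (Ideal.Quotient.mk Q X) := isIntegral_trans _ h2
  obtain ⟨b, hb, hb0⟩ := h3
  refine ⟨b, hb.ne_zero, ?_⟩
  rw [← Ideal.Quotient.eq_zero_iff_mem, ← hb0]
  conv_lhs => rw [← eval₂_C_X (p := b.map (algebraMap K A)), eval₂_map]
  rw [hom_eval₂]
  rfl

lemma exists_monic_minimal {A : Type} [CommRing A] [IsLocalRing A] (Q : Ideal A[X])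
    (hQm : ∀ a ∈ maximalIdeal A, C a ∈ Q) (h : ∃ q ∈ Q, ∃ n, q.coeff n ∉ maximalIdeal A) :
    ∃ G ∈ Q, G.Monic ∧ ∀ q ∈ Q, (∀ n, G.natDegree ≤ n → q.coeff n = 0) →
      ∀ n, q.coeff n ∈ maximalIdeal A := by
  classical
  have hker : ∀ q : A[X], (∀ n, q.coeff n ∈ maximalIdeal A) → q ∈ Q := by
    intro q hq
    have : (maximalIdeal A).map C ≤ Q := Ideal.map_le_iff_le_comap.2 hQm
    exact this (Ideal.mem_map_C_iff.2 hq)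
  have hne : ∀ q : A[X], q.map (residue A) ≠ 0 ↔ ∃ n, q.coeff n ∉ maximalIdeal A := by
    intro q
    rw [ne_eq, Polynomial.ext_iff, not_forall]
    simp [coeff_map, residue_eq_zero_iff]
  have hex : ∃ d, ∃ q ∈ Q, q.map (residue A) ≠ 0 ∧ (q.map (residue A)).natDegree = d := by
    obtain ⟨q, hq, h⟩ := h
    exact ⟨_, q, hq, (hne q).2 h, rfl⟩
  obtain ⟨q, hq, hq0, hqd⟩ := Nat.find_spec hex
  have hmin := fun d => Nat.find_min (m := d) hex
  set d := Nat.find hex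
  obtain ⟨c, hc⟩ := residue_surjective (R := A) (q.map (residue A)).leadingCoeff⁻¹
  have hlc : (q.map (residue A)).leadingCoeff ≠ 0 := leadingCoeff_ne_zero.2 hq0
  have hmon : ((C c * q).map (residue A)).Monic := by
    rw [Polynomial.map_mul, map_C, hc, Monic, leadingCoeff_mul, leadingCoeff_C,
      inv_mul_cancel₀ hlc]
  have hdeg : ((C c * q).map (residue A)).natDegree = d := by
    rw [Polynomial.map_mul, map_C, hc, natDegree_C_mul (inv_ne_zero hlc), hqd]
  obtain ⟨G, hG1, hG2, hG3⟩ := lifts_and_natDegree_eq_and_monic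
    ((lifts_iff_coeff_lifts _).2 fun n => residue_surjective _) hmon
  refine ⟨G, ?_, hG3, fun q' hq' hz => ?_⟩
  · have : G - C c * q ∈ Q := by
      refine hker _ fun n => ?_
      rw [← residue_eq_zero_iff, ← coeff_map, Polynomial.map_sub, hG1, sub_self, coeff_zero]
    exact (Submodule.sub_mem_iff_left _ (Q.mul_mem_left _ hq)).1 this
  · by_contra hn
    rw [not_forall] at hn
    have h0 := (hne q').2 hn
    refine hmin _ ?_ ⟨q', hq', h0, rfl⟩
    rw [← hdeg, ← hG2]
    have : (q'.map (residue A)).degree < G.natDegree := by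
      rw [degree_lt_iff_coeff_zero]
      intro n hn
      rw [coeff_map, hz n hn, map_zero]
    exact (natDegree_lt_iff_degree_lt h0).2 this

lemma coeff_sum_C_polyDer {A ι : Type} [CommRing A] [Fintype ι] (δ : ι → Derivation ℤ A A)
    (b : ι → A) (q : A[X]) (n : ℕ) :
    ((∑ a, C (b a) • polyDer (δ a)) q).coeff n = ∑ a, b a * δ a (q.coeff n) := by
  rw [der_sum_apply, finsetSum_coeff]
  exact Finset.sum_congr rfl fun a _ => by rw [coeff_C_mul, coeff_polyDer]

lemma sum_C_polyDer_C {A ι : Type} [CommRing A] [Fintype ι] (δ : ι → Derivation ℤ A A)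
    (b : ι → A) (x : A) :
    (∑ a, C (b a) • polyDer (δ a)) (C x) = C (∑ a, b a * δ a x) := by
  rw [der_sum_apply, map_sum]
  exact Finset.sum_congr rfl fun a _ => by rw [polyDer_C, C_mul]

namespace BData
variable {A : Type} [CommRing A] {ι : Type} {δ : ι → Derivation ℤ A A} {f : A}
  {Ω : Type} [AddCommGroup Ω] [Module A[X] Ω] (B : BData δ f Ω) [Module A Ω]
  [IsScalarTower A A[X] Ω]
variable {K : Type} [Field K] [Algebra K A]

lemma count_of_dual [Fintype ι] [IsNoetherianRing A] [IsLocalRing A]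
    (hK : ∀ a (k : K), δ a (algebraMap K A k) = 0)
    {h : ℕ} (y : Fin h → A) (hy : Ideal.span (Set.range y) = maximalIdeal A) (e : ℕ)
    (he : B.w 0 ∈ colonPow (maximalIdeal A) (B.NN K 1) e)
    {Q : Ideal A[X]} [Q.IsPrime] (p0 : A[X])
    (hv : ∀ q : A[X], (q * p0) • B.w 0 ∈ B.NN K 1 ↔ q ∈ Q)
    {τ : Type} [Fintype τ] [DecidableEq τ] (z : τ → A[X]) (hz : ∀ j, z j ∈ Q)
    (Cf : τ → ι → A[X]) {c : A[X]} (hc : c ∉ Q) (hN : ∀ n : ℕ, n ≠ 0 → (n : A[X]) ∉ Q)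
    (hd : ∀ l j, (∑ i, Cf l i • polyDer (δ i)) (z j) - (if l = j then c else 0) ∈ Q)
    (p : ℕ → A[X]) (hpd : ∀ a, (p a).natDegree ≤ a) (μ : ℕ → ℕ) (hμ : ∀ m, μ m ≤ m + 1)
    (hcard : ∀ m, m ^ (Fintype.card τ) * μ m = m ^ (h + 1))
    (hp : ∀ m, ∀ a < μ m, ∀ w ∈ Submodule.span A (p '' {b | b < a}), p a - w ∉ Q) : False := by
  obtain ⟨cc, r, H⟩ := B.family_of_dual hK p0 hv z hz Cf hc hN hd p hpd
  refine B.count hK (List.ofFn y) ?_ e he cc r fun m => ?_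
  · rw [← hy]; congr 1; ext v; simp
  · obtain ⟨G, F, x, rk, h1, h2⟩ := H m (μ m) (hμ m) (hp m)
    exact ⟨G, F, x, rk, by rw [h1, hcard, List.length_ofFn], h2⟩

theorem local_bfun [Fintype ι] [IsNoetherianRing A] [IsLocalRing A] [CharZero K]
    (hK : ∀ a (k : K), δ a (algebraMap K A k) = 0)
    (hJ : ∀ u ∈ maximalIdeal A, (∀ a, δ a u ∈ maximalIdeal A) → u ∈ maximalIdeal A ^ 2)
    (hConst : ∀ c : A, (∀ b : ι → A, (∀ u ∈ maximalIdeal A, ∑ a, b a * δ a u ∈ maximalIdeal A) →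
      ∑ a, b a * δ a c ∈ maximalIdeal A) → ∃ b : K[X], b ≠ 0 ∧ aeval c b ∈ maximalIdeal A)
    (e : ℕ) (he : B.w 0 ∈ colonPow (maximalIdeal A) (B.NN K 1) e) : B.w 0 ∈ B.NN K 1 := by
  classical
  by_contra hw
  obtain ⟨Q, hQ, p0, hv⟩ := exists_prime_smul _ _ hw
  have hQm : ∀ a ∈ maximalIdeal A, C a ∈ Q := by
    intro a ha
    refine hQ.mem_of_pow_mem e ?_
    rw [← hv, mul_comm, mul_smul, ← C_pow]
    exact Submodule.smul_mem _ _ (he _ (Ideal.pow_mem_pow ha e))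
  have hQK : ∀ b : K[X], b ≠ 0 → b.map (algebraMap K A) ∉ Q := by
    intro b hb hbQ
    refine hQ.ne_top ((Ideal.eq_top_iff_one _).2 ?_)
    rw [← hv, one_mul]
    refine mem_Sat_of_smul hb ?_
    rw [smul_smul]
    exact (hv _).2 hbQ
  have hN : ∀ n : ℕ, n ≠ 0 → (n : A[X]) ∉ Q := by
    intro n hn
    have := hQK (C (n : K)) (by simpa using hn)
    simpa using this
  have hm1 : (1 : A) ∉ maximalIdeal A := (Ideal.ne_top_iff_one _).1 (maximalIdeal.isMaximal A).ne_top
  have hQ1 : (1 : A[X]) ∉ Q := (Ideal.ne_top_iff_one _).1 hQ.ne_top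
  obtain ⟨h, y, hy, Cf, hCf⟩ := exists_dual δ hJ
  have hym : ∀ j, y j ∈ maximalIdeal A := fun j => hy ▸ Ideal.subset_span ⟨j, rfl⟩
  by_cases hcase : ∃ q ∈ Q, ∃ n, q.coeff n ∉ maximalIdeal A
  swap
  · push Not at hcase
    refine B.count_of_dual hK y hy e he p0 hv (τ := Fin h) (fun j => C (y j))
      (fun j => hQm _ (hym j)) (fun l a => C (Cf l a)) (c := 1) hQ1 hN (fun l j => ?_)
      (fun a => X ^ a) (fun a => natDegree_X_pow_le a) (fun m => m) (fun m => Nat.le_succ m)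
      (fun m => by rw [Fintype.card_fin, pow_succ]) ?_
    · have := hQm _ (hCf l j)
      rw [sum_C_polyDer_C]
      rw [C_sub] at this
      convert this using 2
      split_ifs <;> simp
    · intro m a _ w hw hQw
      have hwc : w.coeff a = 0 := by
        have hle : Submodule.span A ((fun a : ℕ => (X ^ a : A[X])) '' {b | b < a}) ≤
            LinearMap.ker (lcoeff A a) := by
          rw [Submodule.span_le]
          rintro _ ⟨b, hb, rfl⟩
          simp only [SetLike.mem_coe, LinearMap.mem_ker, lcoeff_apply, coeff_X_pow]
          rw [if_neg (ne_of_gt hb)]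
        exact hle hw
      have := hcase _ hQw a
      rw [coeff_sub, hwc, coeff_X_pow, if_pos rfl, sub_zero] at this
      exact hm1 this
  · obtain ⟨G, hGQ, hG, hmin⟩ := exists_monic_minimal Q hQm hcase
    by_cases hb : ∃ b : ι → A, (∀ u ∈ maximalIdeal A, ∑ a, b a * δ a u ∈ maximalIdeal A) ∧
      (∑ a, C (b a) • polyDer (δ a)) G ∉ Q
    · obtain ⟨b, hbm, hbG⟩ := hb
      set d := (∑ a, C (b a) • polyDer (δ a)) G with hd
      refine B.count_of_dual hK y hy e he p0 hv (τ := Option (Fin h))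
        (fun j => j.elim G (fun j => C (y j)))
        (fun j => by cases j with
          | none => exact hGQ
          | some j => exact hQm _ (hym j))
        (fun l a => l.elim (C (b a)) fun l => d * C (Cf l a) -
          ((∑ a, C (Cf l a) • polyDer (δ a)) G) * C (b a)) (c := d) hbG hN (fun l j => ?_)
        (fun a => 1) (fun a => by simp) (fun m => 1) (fun m => by omega)
        (fun m => by rw [Fintype.card_option, Fintype.card_fin, mul_one]) ?_
      · cases l with
        | none =>
          cases j with
          | none => simp [← hd]
          | some j =>
            simp only [Option.elim_none, Option.elim_some, sum_C_polyDer_C, reduceCtorEq, if_false,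
              sub_zero]
            exact hQm _ (hbm _ (hym j))
        | some l =>
          have key : ∀ q : A[X], (∑ i, (d * C (Cf l i) -
              ((∑ a, C (Cf l a) • polyDer (δ a)) G) * C (b i)) • polyDer (δ i)) q =
              d * (∑ a, C (Cf l a) • polyDer (δ a)) q -
              ((∑ a, C (Cf l a) • polyDer (δ a)) G) * (∑ a, C (b a) • polyDer (δ a)) q := by
            intro q
            rw [der_sum_apply, der_sum_apply _ _ _ q, der_sum_apply _ (fun a => C (b a)) _ q,
              Finset.mul_sum, Finset.mul_sum, ← Finset.sum_sub_distrib]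
            exact Finset.sum_congr rfl fun a _ => by ring
          cases j with
          | none =>
            simp only [Option.elim_none, Option.elim_some, reduceCtorEq, if_false, sub_zero]
            rw [key, ← hd, mul_comm, sub_self]
            exact Q.zero_mem
          | some j =>
            simp only [Option.elim_some, Option.some.injEq]
            rw [key, sum_C_polyDer_C, sum_C_polyDer_C]
            have h1 := Q.mul_mem_left d (hQm _ (hCf l j))
            have h2 := Q.mul_mem_left ((∑ a, C (Cf l a) • polyDer (δ a)) G)
              (hQm _ (hbm _ (hym j)))
            have h3 := Q.sub_mem h1 h2
            rw [C_sub] at h3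
            convert h3 using 1
            split_ifs
            · rw [C_1]; ring
            · rw [C_0]; ring
      · intro m a ha w hw
        obtain rfl : a = 0 := by omega
        simp only [Nat.not_lt_zero, Set.ofPred_false, Set.image_empty, Submodule.span_empty,
          Submodule.mem_bot] at hw
        rw [hw, sub_zero]
        exact hQ1
    · push Not at hb
      obtain ⟨b, hb0, hbQ⟩ := exists_map_mem_of_monic (K := K) Q G hG hGQ fun n => by
        obtain ⟨b, hb0, h⟩ := hConst (G.coeff n) fun b hbm => by
          have h1 := hmin _ (hb b hbm) fun n hn => by
            rw [coeff_sum_C_polyDer]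
            refine Finset.sum_eq_zero fun a _ => ?_
            rcases hn.eq_or_lt with rfl | hn
            · rw [hG.coeff_natDegree, Derivation.map_one_eq_zero, mul_zero]
            · rw [coeff_eq_zero_of_natDegree_lt hn, map_zero, mul_zero]
          have := h1 n
          rwa [coeff_sum_C_polyDer] at this
        exact ⟨b, hb0, hQm _ h⟩
      exact hQK b hb0 hbQ
end BData
end

section
open Polynomial

/-- Absolute derivations into an algebra. -/
abbrev DerTo (R L : Type) [CommRing R] [CommRing L] [Algebra R L] := Derivation ℤ R L

lemma exists_der_localization {R L : Type} [CommRing R] [CommRing L] [Algebra R L]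
    (M : Submonoid R) [IsLocalization M L] (d : DerTo R L) :
    ∃ d' : Der L, ∀ x, d' (algebraMap R L x) = d x := by
  let g : R →+* TrivSqZeroExt L L :=
    { toFun := fun x => TrivSqZeroExt.inl (algebraMap R L x) + TrivSqZeroExt.inr (d x)
      map_one' := by simp
      map_mul' := fun x y => by
        ext
        · simp
        · simp only [Derivation.leibniz, TrivSqZeroExt.snd_add, TrivSqZeroExt.snd_inl,
            TrivSqZeroExt.snd_inr, zero_add, TrivSqZeroExt.snd_mul, TrivSqZeroExt.fst_add,
            TrivSqZeroExt.fst_inl, TrivSqZeroExt.fst_inr, add_zero, Algebra.smul_def,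
            MulOpposite.smul_eq_mul_unop, MulOpposite.unop_op]
          simp only [Algebra.algebraMap_self, RingHom.id_apply]
          ring
      map_zero' := by simp
      map_add' := fun x y => by
        ext <;> simp }
  have hg : ∀ y : M, IsUnit (g y) := fun y => by
    rw [TrivSqZeroExt.isUnit_iff_isUnit_fst]
    simpa [g] using IsLocalization.map_units L y
  let G : L →+* TrivSqZeroExt L L := IsLocalization.lift hg
  have hG : ∀ x, G (algebraMap R L x) = g x := fun x => IsLocalization.lift_eq hg x
  have hfst : ∀ x, (G x).fst = x := by
    have : (TrivSqZeroExt.fstHom L L L).toRingHom.comp G = RingHom.id L := by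
      refine IsLocalization.ringHom_ext M ?_
      ext x
      simp [hG, g]
    exact fun x => RingHom.congr_fun this x
  refine ⟨{ toLinearMap := (AddMonoidHom.mk' (fun x => (G x).snd) (fun x y => by simp)).toIntLinearMap
            map_one_eq_zero' := ?_
            leibniz' := ?_ }, fun x => ?_⟩
  · change (G 1).snd = 0
    simp
  · intro x y
    change (G (x * y)).snd = x • (G y).snd + y • (G x).snd
    rw [map_mul, TrivSqZeroExt.snd_mul, hfst, hfst]
    simp [mul_comm]
  · change (G _).snd = _
    rw [hG]
    simp [g]

/-- Polynomials over a large field, as a module over smaller polynomial rings. -/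
def Om (E : Type) [Field E] : Type := E[X]

section
variable {E : Type} [Field E]

instance : AddCommGroup (Om E) := inferInstanceAs (AddCommGroup E[X])

/-- The identification of `Om E` with polynomials. -/
def Om.mk : E[X] ≃+ Om E := AddEquiv.refl _

instance {A : Type} [CommRing A] [Algebra A E] : Module A[X] (Om E) :=
  Module.compHom E[X] (mapRingHom (algebraMap A E))

instance {A : Type} [CommRing A] [Algebra A E] : Module A (Om E) :=
  inferInstanceAs (Module A E[X])

lemma Om.smul_def {A : Type} [CommRing A] [Algebra A E] (p : A[X]) (u : Om E) :
    p • u = Om.mk (p.map (algebraMap A E) * Om.mk.symm u) := rfl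

instance {A : Type} [CommRing A] [Algebra A E] : IsScalarTower A A[X] (Om E) :=
  IsScalarTower.of_algebraMap_smul fun a u => by
    rw [Om.smul_def]
    change Om.mk (map (algebraMap A E) (C a) * _) = _
    rw [map_C, ← smul_eq_C_mul]
    exact congrArg Om.mk (algebraMap_smul E a (Om.mk.symm u))

/-- The connection on symbols `u f ^ s`. -/
def omConn (d : Der E) (f : E) : E[X] →+ E[X] where
  toFun u := polyDer d u + X * C (d f / f) * u
  map_zero' := by simp
  map_add' u v := by rw [map_add]; ring

/-- The shift `s ↦ s + 1` on symbols `u f ^ s`. -/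
def omShift (f : E) (hf : f ≠ 0) : E[X] ≃+ E[X] where
  toFun u := C f * u.comp (X + 1)
  invFun u := C f⁻¹ * u.comp (X - 1)
  left_inv u := by
    change C f⁻¹ * (C f * u.comp (X + 1)).comp (X - 1) = u
    rw [mul_comp, C_comp, ← mul_assoc, ← C_mul, inv_mul_cancel₀ hf, comp_assoc]
    simp
  right_inv u := by
    change C f * (C f⁻¹ * u.comp (X - 1)).comp (X + 1) = u
    rw [mul_comp, C_comp, ← mul_assoc, ← C_mul, mul_inv_cancel₀ hf, comp_assoc]
    simp
  map_add' u v := by rw [add_comp]; ring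

lemma polyDer_mapHom {A : Type} [CommRing A] [Algebra A E] {d : Der A} {d' : Der E}
    (h : ∀ x, d' (algebraMap A E x) = algebraMap A E (d x)) (p : A[X]) :
    polyDer d' (p.map (algebraMap A E)) = (polyDer d p).map (algebraMap A E) := by
  ext n
  simp [coeff_polyDer, h]

lemma omConn_apply (d : Der E) (f : E) (u : E[X]) :
    omConn d f u = polyDer d u + X * C (d f / f) * u := rfl

lemma omShift_apply (f : E) (hf : f ≠ 0) (u : E[X]) :
    omShift f hf u = C f * u.comp (X + 1) := rfl

lemma omConn_mul (d : Der E) (f : E) (p u : E[X]) :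
    omConn d f (p * u) = p * omConn d f u + polyDer d p * u := by
  rw [omConn_apply, omConn_apply, Derivation.leibniz, smul_eq_mul, smul_eq_mul]
  ring

lemma omShift_mul (f : E) (hf : f ≠ 0) (p u : E[X]) :
    omShift f hf (p * u) = p.comp (X + 1) * omShift f hf u := by
  rw [omShift_apply, omShift_apply, mul_comp]
  ring

lemma omShift_conn (d : Der E) (f : E) (hf : f ≠ 0) (u : E[X]) :
    omShift f hf (omConn d f u) = omConn d f (omShift f hf u) := by
  rw [omShift_apply, omShift_apply, omConn_apply, omConn_apply, add_comp, mul_comp, mul_comp,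
    X_comp, C_comp, Derivation.leibniz, polyDer_C,
    polyDer_comp d u (X + 1) (by rw [map_add, polyDer_X, Derivation.map_one_eq_zero, add_zero])]
  simp only [smul_eq_mul]
  have : C f * C (d f / f) = C (d f) := by rw [← C_mul, mul_div_cancel₀ _ hf]
  linear_combination (u.comp (X + 1)) * this

lemma omShift_w (f : E) (hf : f ≠ 0) (i : ℕ) :
    omShift f hf (C (f⁻¹ ^ (i + 1))) = C (f⁻¹ ^ i) := by
  rw [omShift_apply, C_comp, ← C_mul, pow_succ', ← mul_assoc, mul_inv_cancel₀ hf, one_mul]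

lemma omConn_w (d : Der E) (f : E) (i : ℕ) :
    omConn d f (C (f⁻¹ ^ i)) = C (d f) * (X - C (i : E)) * C (f⁻¹ ^ (i + 1)) := by
  rw [omConn_apply, polyDer_C, Derivation.leibniz_pow, Derivation.leibniz_inv]
  have e1 : C (d f / f) = C (d f) * C (f⁻¹) := by rw [← C_mul, div_eq_mul_inv]
  rw [e1, pow_succ]
  cases i with
  | zero => simp
            ring
  | succ i =>
    simp only [Nat.add_sub_cancel, smul_eq_mul, nsmul_eq_mul, C_mul, C_pow, C_neg, map_natCast]
    push_cast
    ring

variable {A : Type} [CommRing A] [Algebra A E] {ι : Type} (δ : ι → Der A)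
  (dE : ι → Der E) (hd : ∀ a x, dE a (algebraMap A E x) = algebraMap A E (δ a x)) (f : A)
  (hf : algebraMap A E f ≠ 0)

/-- The symbols `u f ^ s` with `u` a polynomial in `s` over a field. -/
def omData : BData δ f (Om E) where
  conn :=
    { toFun := fun a => (Om.mk.toAddMonoidHom.comp (omConn (dE a) (algebraMap A E f))).comp
        Om.mk.symm.toAddMonoidHom
      leib := fun a p u => congrArg Om.mk
        ((omConn_mul (dE a) (algebraMap A E f) (p.map (algebraMap A E)) (Om.mk.symm u)).trans
          (by rw [polyDer_mapHom (hd a)]; rfl)) }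
  t := (Om.mk.symm.trans (omShift _ hf)).trans Om.mk
  t_smul p u := congrArg Om.mk
    ((omShift_mul _ hf (p.map (algebraMap A E)) (Om.mk.symm u)).trans (by
      have : (p.map (algebraMap A E)).comp (X + 1) = (p.comp (X + 1)).map (algebraMap A E) := by
        rw [Polynomial.map_comp, Polynomial.map_add, map_X, Polynomial.map_one]
      rw [this]; rfl))
  t_conn a u := congrArg Om.mk (omShift_conn _ _ hf (Om.mk.symm u))
  w i := Om.mk (C ((algebraMap A E f)⁻¹ ^ i))
  f_w i := congrArg Om.mk (by
    change map (algebraMap A E) (C f) * C _ = C _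
    rw [map_C, ← C_mul, pow_succ', ← mul_assoc, mul_inv_cancel₀ hf, one_mul])
  t_w i := congrArg Om.mk (omShift_w _ hf i)
  conn_w a i := congrArg Om.mk ((omConn_w (dE a) (algebraMap A E f) i).trans (by
    have : C (dE a (algebraMap A E f)) * (X - C (i : E)) =
        (C (δ a f) * (X - C (i : A))).map (algebraMap A E) := by
      rw [Polynomial.map_mul, Polynomial.map_sub, map_C, map_C, map_X, ← hd,
        map_natCast (algebraMap A E)]
    rw [this]; rfl))

end
end

section
open Polynomial
variable {E : Type} [Field E] {S : Type} [CommRing S] [Algebra S E] {ι : Type} {δ : ι → Der S}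
  {dE : ι → Der E} (hd : ∀ a x, dE a (algebraMap S E x) = algebraMap S E (δ a x)) {f : S}
  (hf : algebraMap S E f ≠ 0)

lemma omData_conn (a : ι) (u : Om E) : (omData δ dE hd f hf).conn.toFun a u =
    Om.mk (omConn (dE a) (algebraMap S E f) (Om.mk.symm u)) := rfl

lemma omData_w (i : ℕ) : (omData δ dE hd f hf).w i = Om.mk (C ((algebraMap S E f)⁻¹ ^ i)) := rfl

variable {A : Type} [CommRing A] [Algebra S A] [Algebra A E] [IsScalarTower S A E]

omit [Algebra S A] [Algebra A E] [IsScalarTower S A E] in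
lemma om_smul_map [Algebra S A] [Algebra A E] [IsScalarTower S A E] (p : S[X]) (u : Om E) :
    p.map (algebraMap S A) • u = p • u := by
  rw [Om.smul_def, Om.smul_def, Polynomial.map_map, ← IsScalarTower.algebraMap_eq]

variable {δA : ι → Der A}
  (hdA : ∀ a x, dE a (algebraMap A E x) = algebraMap A E (δA a x))
  (hfA : algebraMap A E (algebraMap S A f) ≠ 0)

lemma omData_conn_eq (a : ι) (u : Om E) : (omData δA dE hdA _ hfA).conn.toFun a u =
    (omData δ dE hd f hf).conn.toFun a u := by
  rw [omData_conn, omData_conn, ← IsScalarTower.algebraMap_apply]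

lemma omData_D_le (u v : Om E) (hv : v ∈ (omData δ dE hd f hf).D u) :
    v ∈ (omData δA dE hdA _ hfA).D u := by
  let N : Submodule S[X] (Om E) :=
    { carrier := (omData δA dE hdA _ hfA).D u
      add_mem' := Submodule.add_mem _
      zero_mem' := Submodule.zero_mem _
      smul_mem' := fun p x hx => by
        rw [← om_smul_map (A := A)]
        exact Submodule.smul_mem _ _ hx }
  refine (omData δ dE hd f hf).D_le (N := N) (fun a x hx => ?_)
    ((omData δA dE hdA _ hfA).mem_D u) hv
  rw [← omData_conn_eq hd hf hdA hfA]
  exact (omData δA dE hdA _ hfA).D_stable u a x hx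

lemma omData_exists_mem_D (Q : Ideal S) [Q.IsPrime] [IsLocalization.AtPrime A Q] (u v : Om E)
    (hv : v ∈ (omData δA dE hdA _ hfA).D u) :
    ∃ g ∉ Q, (C g : S[X]) • v ∈ (omData δ dE hd f hf).D u := by
  let N : Submodule A[X] (Om E) :=
    { carrier := {v | ∃ g ∉ Q, (C g : S[X]) • v ∈ (omData δ dE hd f hf).D u}
      add_mem' := by
        rintro x y ⟨g, hg, hx⟩ ⟨g', hg', hy⟩
        refine ⟨g * g', fun h => (Ideal.IsPrime.mem_or_mem ‹_› h).elim hg hg', ?_⟩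
        rw [smul_add]
        refine Submodule.add_mem _ ?_ ?_
        · rw [C_mul, mul_comm, mul_smul]; exact Submodule.smul_mem _ _ hx
        · rw [C_mul, mul_smul]; exact Submodule.smul_mem _ _ hy
      zero_mem' := ⟨1, (Ideal.ne_top_iff_one Q).1 Ideal.IsPrime.ne_top', by simp⟩
      smul_mem' := by
        rintro p x ⟨g, hg, hx⟩
        obtain ⟨b, hb⟩ := IsLocalization.integerNormalization_map_to_map Q.primeCompl p
        refine ⟨b * g, fun h => (Ideal.IsPrime.mem_or_mem ‹_› h).elim b.2 hg, ?_⟩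
        have : (C (b * g : S) : S[X]) • p • x =
            (IsLocalization.integerNormalization Q.primeCompl p) • (C g : S[X]) • x := by
          rw [← om_smul_map (A := A) (C (b * g : S)), ← om_smul_map (A := A) (C g : S[X]) x,
            ← om_smul_map (A := A) (IsLocalization.integerNormalization Q.primeCompl p), hb,
            smul_smul, smul_smul]
          congr 1
          rw [map_C, map_C, map_mul, C_mul, Algebra.smul_def, Polynomial.algebraMap_apply]
          ring
        rw [this]
        exact Submodule.smul_mem _ _ hx }
  refine (omData δA dE hdA _ hfA).D_le (N := N) ?_
    ⟨1, (Ideal.ne_top_iff_one Q).1 Ideal.IsPrime.ne_top', ?_⟩ hv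
  · rintro a x ⟨g, hg, hx⟩
    refine ⟨g * g, fun h => (Ideal.IsPrime.mem_or_mem ‹_› h).elim hg hg, ?_⟩
    rw [omData_conn_eq hd hf hdA hfA]
    have h1 := (omData δ dE hd f hf).D_stable u a _ hx
    rw [Conn.leib, polyDer_C] at h1
    have h2 := Submodule.smul_mem _ (C g : S[X]) h1
    rw [smul_add, smul_smul, smul_smul, mul_comm (C g) (C (δ a g)),
      mul_smul (C (δ a g))] at h2
    rw [C_mul]
    exact (Submodule.add_mem_iff_left _ (Submodule.smul_mem _ _ hx)).1 h2
  · rw [C_1, one_smul]; exact BData.mem_D _ _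

lemma local_J {Q : Ideal S} [Q.IsPrime] [IsLocalization.AtPrime A Q] [IsLocalRing A]
    (hδ : ∀ a x, δA a (algebraMap S A x) = algebraMap S A (δ a x))
    (hJ : ∀ u ∈ Q, (∀ a, δ a u ∈ Q) → ∃ g ∉ Q, g * u ∈ Q ^ 2) :
    ∀ u ∈ maximalIdeal A, (∀ a, δA a u ∈ maximalIdeal A) → u ∈ maximalIdeal A ^ 2 := by
  intro u hu hdu
  obtain ⟨⟨x, g⟩, hxg⟩ := IsLocalization.surj Q.primeCompl u
  simp only at hxg
  have hmem : ∀ y : S, algebraMap S A y ∈ maximalIdeal A ↔ y ∈ Q := fun y =>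
    IsLocalization.AtPrime.to_map_mem_maximal_iff A Q y
  have hxQ : x ∈ Q := by
    rw [← hmem, ← hxg]; exact Ideal.mul_mem_right _ _ hu
  have hdx : ∀ a, δ a x ∈ Q := by
    intro a
    rw [← hmem, ← hδ, ← hxg, Derivation.leibniz]
    exact Ideal.add_mem _ (Ideal.mul_mem_right _ _ hu) (Ideal.mul_mem_left _ _ (hdu a))
  obtain ⟨g', hg', hm⟩ := hJ x hxQ hdx
  have h1 : algebraMap S A (g' * x) ∈ maximalIdeal A ^ 2 := by
    have := Ideal.mem_map_of_mem (algebraMap S A) hm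
    rwa [Ideal.map_pow, IsLocalization.AtPrime.map_eq_maximalIdeal Q A] at this
  rw [map_mul, ← hxg] at h1
  have hu1 := IsLocalization.map_units A g
  have hu2 : IsUnit (algebraMap S A g') := IsLocalization.map_units A (⟨g', hg'⟩ : Q.primeCompl)
  rw [Ideal.unit_mul_mem_iff_mem _ hu2, Ideal.mul_unit_mem_iff_mem _ hu1] at h1
  exact h1

lemma local_const {K : Type} [Field K] [Algebra K S] [Algebra K A] [IsScalarTower K S A]
    [Fintype ι] {Q : Ideal S} [Q.IsPrime] [IsLocalization.AtPrime A Q] [IsLocalRing A]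
    (hδ : ∀ a x, δA a (algebraMap S A x) = algebraMap S A (δ a x))
    (hC : ∀ x y : S, y ∉ Q → (∀ b : ι → S, (∀ u ∈ Q, ∑ a, b a * δ a u ∈ Q) →
      y * ∑ a, b a * δ a x - x * ∑ a, b a * δ a y ∈ Q) →
      ∃ b : K[X], b ≠ 0 ∧ ∃ n, b.natDegree ≤ n ∧
        ∑ i ∈ Finset.range (n + 1), algebraMap K S (b.coeff i) * x ^ i * y ^ (n - i) ∈ Q)
    (c : A) (h : ∀ b : ι → A, (∀ u ∈ maximalIdeal A, ∑ a, b a * δA a u ∈ maximalIdeal A) →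
      ∑ a, b a * δA a c ∈ maximalIdeal A) : ∃ b : K[X], b ≠ 0 ∧ aeval c b ∈ maximalIdeal A := by
  have hmem : ∀ y : S, algebraMap S A y ∈ maximalIdeal A ↔ y ∈ Q := fun y =>
    IsLocalization.AtPrime.to_map_mem_maximal_iff A Q y
  obtain ⟨⟨x, y⟩, hxy⟩ := IsLocalization.surj Q.primeCompl c
  simp only at hxy
  have hy := IsLocalization.map_units A y
  obtain ⟨b, hb, n, hn, hQ⟩ := hC x y y.2 fun b hb => by
    have h1 : ∑ a, algebraMap S A (b a) * δA a c ∈ maximalIdeal A := by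
      refine h (fun a => algebraMap S A (b a)) fun u hu => ?_
      obtain ⟨⟨v, g⟩, hvg⟩ := IsLocalization.surj Q.primeCompl u
      simp only at hvg
      have hg := IsLocalization.map_units A g
      have hvQ : v ∈ Q := by rw [← hmem, ← hvg]; exact Ideal.mul_mem_right _ _ hu
      have h2 := (hmem _).2 (hb v hvQ)
      simp only [map_sum, map_mul, ← hδ, ← hvg, Derivation.leibniz, smul_eq_mul, mul_add,
        Finset.sum_add_distrib] at h2
      have h3 : ∑ a, algebraMap S A (b a) * (u * δA a (algebraMap S A g)) ∈ maximalIdeal A :=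
        Ideal.sum_mem _ fun a _ => Ideal.mul_mem_left _ _ (Ideal.mul_mem_right _ _ hu)
      have h4 := (Submodule.add_mem_iff_right _ h3).1 h2
      have h5 : ∑ a, algebraMap S A (b a) * (algebraMap S A g * δA a u) =
        algebraMap S A g * ∑ a, algebraMap S A (b a) * δA a u := by
        rw [Finset.mul_sum]; exact Finset.sum_congr rfl fun a _ => by ring
      rw [h5] at h4
      exact (Ideal.unit_mul_mem_iff_mem _ hg).1 h4
    rw [← hmem]
    have h2 : algebraMap S A (y * ∑ a, b a * δ a x - x * ∑ a, b a * δ a (y : S)) =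
        (algebraMap S A y * algebraMap S A y) * ∑ a, algebraMap S A (b a) * δA a c := by
      simp only [map_sub, map_sum, map_mul, ← hδ, ← hxy, Derivation.leibniz, smul_eq_mul,
        Finset.mul_sum]
      rw [← Finset.sum_sub_distrib]
      exact Finset.sum_congr rfl fun a _ => by ring
    rw [h2]
    exact Ideal.mul_mem_left _ _ h1
  refine ⟨b, hb, ?_⟩
  rw [← hmem] at hQ
  have h3 : algebraMap S A (∑ i ∈ Finset.range (n + 1),
      algebraMap K S (b.coeff i) * x ^ i * (y : S) ^ (n - i)) = algebraMap S A y ^ n * aeval c b := by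
    rw [aeval_eq_sum_range' (Nat.lt_succ_of_le hn), map_sum, Finset.mul_sum]
    refine Finset.sum_congr rfl fun i hi => ?_
    rw [map_mul, map_mul, ← IsScalarTower.algebraMap_apply, map_pow, map_pow, ← hxy, mul_pow,
      Algebra.smul_def]
    have : n = i + (n - i) := by have := Finset.mem_range.1 hi; omega
    conv_rhs => rw [this, pow_add]
    ring
  rw [h3] at hQ
  exact (Ideal.unit_mul_mem_iff_mem _ (hy.pow n)).1 hQ

lemma omData_bfun_step {K : Type} [Field K] [CharZero K] [Algebra K S] [Algebra K A]
    [IsScalarTower K S A] [Fintype ι] [IsNoetherianRing S] [IsLocalRing A]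
    (hK : ∀ a (k : K), δ a (algebraMap K S k) = 0) (Q : Ideal S) [Q.IsPrime]
    [IsLocalization.AtPrime A Q]
    (hJ : ∀ u ∈ Q, (∀ a, δ a u ∈ Q) → ∃ g ∉ Q, g * u ∈ Q ^ 2)
    (hC : ∀ x y : S, y ∉ Q → (∀ b : ι → S, (∀ u ∈ Q, ∑ a, b a * δ a u ∈ Q) →
      y * ∑ a, b a * δ a x - x * ∑ a, b a * δ a y ∈ Q) →
      ∃ b : K[X], b ≠ 0 ∧ ∃ n, b.natDegree ≤ n ∧
        ∑ i ∈ Finset.range (n + 1), algebraMap K S (b.coeff i) * x ^ i * y ^ (n - i) ∈ Q)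
    (I : Ideal S) (hQI : Q ∈ I.minimalPrimes)
    (hI : ∀ g ∈ I, (C g : S[X]) • (omData δ dE hd f hf).w 0 ∈ (omData δ dE hd f hf).NN K 1) :
    ∃ g ∉ Q, (C g : S[X]) • (omData δ dE hd f hf).w 0 ∈ (omData δ dE hd f hf).NN K 1 := by
  have hder : ∀ a, ∃ d' : Der A, ∀ x, d' (algebraMap S A x) = algebraMap S A (δ a x) := fun a =>
    exists_der_localization Q.primeCompl ((Algebra.linearMap S A).compDer (δ a) : DerTo S A)
  choose δA hδ using hder
  have hdA : ∀ a x, dE a (algebraMap A E x) = algebraMap A E (δA a x) := by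
    intro a x
    obtain ⟨⟨s, g⟩, hg⟩ := IsLocalization.surj Q.primeCompl x
    simp only at hg
    have hgu : algebraMap A E (algebraMap S A g) ≠ 0 :=
      ((IsLocalization.map_units A g).map (algebraMap A E)).ne_zero
    have h1 := congrArg (fun z => algebraMap A E (δA a z)) hg
    have h2 := congrArg (fun z => dE a (algebraMap A E z)) hg
    simp only [Derivation.leibniz, hδ, smul_eq_mul, map_add, map_mul] at h1 h2
    rw [← IsScalarTower.algebraMap_apply S A E (s : S), hd, IsScalarTower.algebraMap_apply S A E (δ a s),
      ← h1, ← IsScalarTower.algebraMap_apply S A E (g : S), hd,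
      ← IsScalarTower.algebraMap_apply S A E (δ a g)] at h2
    rw [← IsScalarTower.algebraMap_apply S A E (g : S)] at hgu
    exact mul_left_cancel₀ hgu (add_left_cancel h2)
  have hfA : algebraMap A E (algebraMap S A f) ≠ 0 := by
    rwa [← IsScalarTower.algebraMap_apply]
  have hKA : ∀ a (k : K), δA a (algebraMap K A k) = 0 := fun a k => by
    rw [IsScalarTower.algebraMap_apply K S A, hδ, hK, map_zero]
  have : IsNoetherianRing A := IsLocalization.isNoetherianRing Q.primeCompl A inferInstance
  have hw0 : (omData δA dE hdA _ hfA).w 0 = (omData δ dE hd f hf).w 0 := by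
    rw [omData_w, omData_w, pow_zero, pow_zero]
  have hCw : (C (algebraMap S A f) ^ 1 : A[X]) • (omData δA dE hdA _ hfA).w 0 =
      (C f ^ 1 : S[X]) • (omData δ dE hd f hf).w 0 := by
    rw [hw0, pow_one, pow_one, ← om_smul_map (A := A) (C f : S[X]), map_C]
  have hbm : ∀ (b : K[X]) (v : Om E), b.map (algebraMap K A) • v = b.map (algebraMap K S) • v :=
    fun b v => by
      rw [← om_smul_map (A := A) (b.map (algebraMap K S)), Polynomial.map_map,
        ← IsScalarTower.algebraMap_eq]
  have hNN : ∀ v, v ∈ (omData δ dE hd f hf).NN K 1 → v ∈ (omData δA dE hdA _ hfA).NN K 1 := by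
    rintro v ⟨b, hb, hv⟩
    refine ⟨b, hb, ?_⟩
    rw [hbm, hCw]
    exact omData_D_le hd hf hdA hfA _ _ hv
  have hrad : maximalIdeal A ≤ (I.map (algebraMap S A)).radical := by
    rw [IsLocalization.AtPrime.radical_map_of_mem_minimalPrimes A Q I hQI,
      IsLocalization.AtPrime.map_eq_maximalIdeal Q A]
  obtain ⟨e, he⟩ := Ideal.exists_pow_le_of_le_radical_of_fg hrad (IsNoetherian.noetherian _)
  have hmem : (omData δA dE hdA _ hfA).w 0 ∈
      colonPow (maximalIdeal A) ((omData δA dE hdA _ hfA).NN K 1) e := by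
    intro a ha
    have ha' := he ha
    rw [IsLocalization.mem_map_algebraMap_iff Q.primeCompl A] at ha'
    obtain ⟨⟨x, g⟩, hx⟩ := ha'
    simp only at hx
    have h1 := hNN _ (hI x x.2)
    obtain ⟨z, hz⟩ := IsLocalization.map_units A g
    have h2 := Submodule.smul_mem _ (C (↑z⁻¹ : A)) h1
    rw [← hw0, ← om_smul_map (A := A) (C (x : S)), map_C, ← hx, smul_smul, ← C_mul, ← hz] at h2
    rwa [mul_comm a, Units.inv_mul_cancel_left] at h2
  obtain ⟨b, hb, hv⟩ := (omData δA dE hdA _ hfA).local_bfun hKA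
    (local_J hδ hJ) (local_const hδ hC) e hmem
  rw [hbm, hCw] at hv
  obtain ⟨g, hg, hv⟩ := omData_exists_mem_D hd hf hdA hfA Q _ _ hv
  refine ⟨g, hg, b, hb, ?_⟩
  rw [hw0] at hv
  rw [smul_comm]
  exact hv

theorem omData_bfun {K : Type} [Field K] [CharZero K] [Algebra K S] [Fintype ι]
    [IsNoetherianRing S] [IsDomain S] [IsFractionRing S E]
    (hK : ∀ a (k : K), δ a (algebraMap K S k) = 0)
    (hJ : ∀ Q : Ideal S, Q.IsPrime → ∀ u ∈ Q, (∀ a, δ a u ∈ Q) → ∃ g ∉ Q, g * u ∈ Q ^ 2)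
    (hC : ∀ Q : Ideal S, Q.IsPrime → ∀ x y : S, y ∉ Q →
      (∀ b : ι → S, (∀ u ∈ Q, ∑ a, b a * δ a u ∈ Q) →
        y * ∑ a, b a * δ a x - x * ∑ a, b a * δ a y ∈ Q) →
      ∃ b : K[X], b ≠ 0 ∧ ∃ n, b.natDegree ≤ n ∧
        ∑ i ∈ Finset.range (n + 1), algebraMap K S (b.coeff i) * x ^ i * y ^ (n - i) ∈ Q) :
    (omData δ dE hd f hf).w 0 ∈ (omData δ dE hd f hf).NN K 1 := by
  by_contra hw
  let I : Ideal S :=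
    { carrier := {g | (C g : S[X]) • (omData δ dE hd f hf).w 0 ∈ (omData δ dE hd f hf).NN K 1}
      add_mem' := fun {x y} hx hy => by
        simp only [Set.mem_ofPred_eq, C_add, add_smul] at *
        exact Submodule.add_mem _ hx hy
      zero_mem' := by simp
      smul_mem' := fun c x hx => by
        simp only [Set.mem_ofPred_eq, smul_eq_mul, C_mul, mul_smul] at *
        exact Submodule.smul_mem _ _ hx }
  have hI : I ≠ ⊤ := fun h => hw (by
    have : (1 : S) ∈ I := h ▸ Submodule.mem_top
    have h2 : (C (1 : S) : S[X]) • (omData δ dE hd f hf).w 0 ∈ (omData δ dE hd f hf).NN K 1 := this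
    rwa [C_1, one_smul] at h2)
  obtain ⟨Q, hQ⟩ := Ideal.nonempty_minimalPrimes hI
  have hQp : Q.IsPrime := hQ.1.1
  have hu : ∀ y : Q.primeCompl, IsUnit (algebraMap S E y) := fun y => by
    rw [isUnit_iff_ne_zero, ne_eq, IsFractionRing.to_map_eq_zero_iff]
    rintro h
    exact y.2 (h ▸ Q.zero_mem)
  let φ : Localization.AtPrime Q →+* E := IsLocalization.lift hu
  let _ : Algebra (Localization.AtPrime Q) E := φ.toAlgebra
  have hφ : ∀ x : S, φ (algebraMap S (Localization.AtPrime Q) x) = algebraMap S E x := fun x =>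
    IsLocalization.lift_eq hu x
  have _ : IsScalarTower S (Localization.AtPrime Q) E :=
    IsScalarTower.of_algebraMap_eq fun x => (hφ x).symm
  have _ : IsScalarTower K S (Localization.AtPrime Q) := inferInstance
  obtain ⟨g, hg, h⟩ := omData_bfun_step (A := Localization.AtPrime Q) (K := K) (dE := dE) hd hf
    hK Q (hJ Q hQp) (hC Q hQp) I hQ fun g hg => hg
  exact hg (hQ.1.2 h)

end

section
open Polynomial

section Symbol
variable {S : Type} [CommRing S] {ι : Type} {δ : ι → Derivation ℤ S S} {N : Type} [AddCommGroup N]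
  [Module S N]

/-- Differential operators with polynomial symbols applied to a family of iterated derivatives. -/
def symbolMap (W : (ι →₀ ℕ) → N) : MvPolynomial ι S →ₗ[S] N :=
  (Finsupp.linearCombination S W).comp
    (MvPolynomial.basisMonomials ι S).repr.toLinearMap

lemma symbolMap_monomial (W : (ι →₀ ℕ) → N) (d : ι →₀ ℕ) (s : S) :
    symbolMap W (MvPolynomial.monomial d s) = s • W d := by
  have : MvPolynomial.monomial d s = s • MvPolynomial.basisMonomials ι S d := by
    rw [MvPolynomial.coe_basisMonomials, MvPolynomial.smul_monomial, smul_eq_mul, mul_one]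
  rw [this, map_smul, symbolMap, LinearMap.comp_apply, LinearEquiv.coe_coe, Module.Basis.repr_self,
    Finsupp.linearCombination_single, one_smul]

/-- Coefficientwise extension of a derivation to multivariate polynomials. -/
def mvDer (d : Derivation ℤ S S) : MvPolynomial ι S →+ MvPolynomial ι S :=
  (Finsupp.liftAddHom fun m =>
    (MvPolynomial.monomial m).toAddMonoidHom.comp (d : S →ₗ[ℤ] S).toAddMonoidHom).comp
    (MvPolynomial.basisMonomials ι S).repr.toLinearMap.toAddMonoidHom

lemma mvDer_monomial (d : Derivation ℤ S S) (m : ι →₀ ℕ) (s : S) :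
    mvDer d (MvPolynomial.monomial m s) = MvPolynomial.monomial m (d s) := by
  have : MvPolynomial.monomial m s = s • MvPolynomial.basisMonomials ι S m := by
    rw [MvPolynomial.coe_basisMonomials, MvPolynomial.smul_monomial, smul_eq_mul, mul_one]
  have h2 : (MvPolynomial.basisMonomials ι S).repr (MvPolynomial.monomial m s) =
      Finsupp.single m s := by
    rw [this, map_smul, Module.Basis.repr_self, Finsupp.smul_single, smul_eq_mul, mul_one]
  rw [mvDer, AddMonoidHom.comp_apply]
  erw [h2]
  rw [Finsupp.liftAddHom_apply_single]
  rfl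

lemma coeff_mvDer (d : Derivation ℤ S S) (p : MvPolynomial ι S) (m : ι →₀ ℕ) :
    (mvDer d p).coeff m = d (p.coeff m) := by
  classical
  induction p using MvPolynomial.induction_on' with
  | monomial n s =>
    rw [mvDer_monomial, MvPolynomial.coeff_monomial, MvPolynomial.coeff_monomial]
    split_ifs <;> simp
  | add p q hp hq =>
    rw [map_add, MvPolynomial.coeff_add, hp, hq, MvPolynomial.coeff_add, map_add]

lemma conn_symbolMap (c : Conn δ N) {W : (ι →₀ ℕ) → N}
    (hW : ∀ a m, c.toFun a (W m) = W (m + Finsupp.single a 1)) (a : ι) (P : MvPolynomial ι S) :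
    c.toFun a (symbolMap W P) = symbolMap W (P * MvPolynomial.X a + mvDer (δ a) P) := by
  induction P using MvPolynomial.induction_on' with
  | monomial m s =>
    rw [symbolMap_monomial, c.leib, hW, mvDer_monomial, map_add, symbolMap_monomial,
      MvPolynomial.X, MvPolynomial.monomial_mul, symbolMap_monomial, mul_one]
  | add p q hp hq =>
    have : (p + q) * MvPolynomial.X a + mvDer (δ a) (p + q) =
        (p * MvPolynomial.X a + mvDer (δ a) p) + (q * MvPolynomial.X a + mvDer (δ a) q) := by
      rw [map_add]; ring
    rw [this, map_add (symbolMap W) p q, map_add, hp, hq]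
    exact (map_add (symbolMap W) _ _).symm

/-- The ideal of leading forms of a stable submodule. -/
def symbolIdeal (c : Conn δ N) {W : (ι →₀ ℕ) → N}
    (hW : ∀ a m, c.toFun a (W m) = W (m + Finsupp.single a 1)) (L : Submodule S N)
    (hL : c.Stable L) : Ideal (MvPolynomial ι S) where
  carrier := {P | ∀ n, ∃ P', (∀ d : ι →₀ ℕ, n < d.degree → P'.coeff d = 0) ∧
    (∀ d : ι →₀ ℕ, d.degree = n → P'.coeff d = P.coeff d) ∧ symbolMap W P' ∈ L}
  zero_mem' n := ⟨0, by simp, by simp, by simp⟩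
  add_mem' {P Q} hP hQ n := by
    obtain ⟨P', h1, h2, h3⟩ := hP n
    obtain ⟨Q', k1, k2, k3⟩ := hQ n
    refine ⟨P' + Q', fun d hd => ?_, fun d hd => ?_, ?_⟩
    · rw [MvPolynomial.coeff_add, h1 d hd, k1 d hd, add_zero]
    · rw [MvPolynomial.coeff_add, MvPolynomial.coeff_add, h2 d hd, k2 d hd]
    · rw [map_add]; exact L.add_mem h3 k3
  smul_mem' Q := by
    classical
    induction Q using MvPolynomial.induction_on with
    | C s =>
      intro P hP n
      obtain ⟨P', h1, h2, h3⟩ := hP n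
      refine ⟨s • P', fun d hd => ?_, fun d hd => ?_, ?_⟩
      · rw [MvPolynomial.coeff_smul, h1 d hd, smul_zero]
      · rw [smul_eq_mul, MvPolynomial.coeff_smul, MvPolynomial.coeff_C_mul, h2 d hd, smul_eq_mul]
      · rw [map_smul]; exact L.smul_mem _ h3
    | add p q hp hq =>
      intro P hP n
      obtain ⟨P', h1, h2, h3⟩ := hp hP n
      obtain ⟨Q', k1, k2, k3⟩ := hq hP n
      refine ⟨P' + Q', fun d hd => ?_, fun d hd => ?_, ?_⟩
      · rw [MvPolynomial.coeff_add, h1 d hd, k1 d hd, add_zero]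
      · rw [add_smul, MvPolynomial.coeff_add, MvPolynomial.coeff_add, h2 d hd, k2 d hd]
      · rw [map_add]; exact L.add_mem h3 k3
    | mul_X p a hp =>
      intro P hP n
      have hP' := hp hP
      rw [smul_eq_mul, mul_right_comm]
      rcases n with _ | n
      · refine ⟨0, by simp, fun d hd => ?_, by simp⟩
        rw [Finsupp.degree_eq_zero_iff] at hd
        subst hd
        rw [MvPolynomial.coeff_mul_X']
        simp
      obtain ⟨P', h1, h2, h3⟩ := hP' n
      refine ⟨P' * MvPolynomial.X a + mvDer (δ a) P', fun d hd => ?_, fun d hd => ?_, ?_⟩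
      · rw [MvPolynomial.coeff_add, coeff_mvDer, h1 d (by omega), map_zero, add_zero,
          MvPolynomial.coeff_mul_X']
        split_ifs with h
        · refine h1 _ ?_
          have hle : Finsupp.single a 1 ≤ d := by
            rw [Finsupp.single_le_iff]
            exact Nat.one_le_iff_ne_zero.2 (Finsupp.mem_support_iff.1 h)
          have : (d - Finsupp.single a 1).degree + 1 = d.degree := by
            conv_rhs => rw [← tsub_add_cancel_of_le hle, map_add, Finsupp.degree_single]
          omega
        · rfl
      · rw [MvPolynomial.coeff_add, coeff_mvDer, h1 d (by omega), map_zero, add_zero,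
          MvPolynomial.coeff_mul_X', MvPolynomial.coeff_mul_X']
        split_ifs with h
        · refine h2 _ ?_
          have hle : Finsupp.single a 1 ≤ d := by
            rw [Finsupp.single_le_iff]
            exact Nat.one_le_iff_ne_zero.2 (Finsupp.mem_support_iff.1 h)
          have : (d - Finsupp.single a 1).degree + 1 = d.degree := by
            conv_rhs => rw [← tsub_add_cancel_of_le hle, map_add, Finsupp.degree_single]
          omega
        · rfl
      · rw [← conn_symbolMap c hW]
        exact hL a _ h3

lemma le_of_symbolIdeal (c : Conn δ N) {W : (ι →₀ ℕ) → N}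
    (hW : ∀ a m, c.toFun a (W m) = W (m + Finsupp.single a 1)) {L L' : Submodule S N}
    (hL : c.Stable L) (hL' : c.Stable L') (hLL : L ≤ L')
    (h : symbolIdeal c hW L' hL' ≤ symbolIdeal c hW L hL) (n : ℕ) :
    ∀ P : MvPolynomial ι S, (∀ d : ι →₀ ℕ, n ≤ d.degree → P.coeff d = 0) →
      symbolMap W P ∈ L' → symbolMap W P ∈ L := by
  induction n with
  | zero =>
    intro P hP _
    have : P = 0 := by ext d; simpa using hP d (Nat.zero_le _)
    rw [this, map_zero]; exact L.zero_mem
  | succ n ih =>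
    classical
    intro P hP hPL
    let P0 := MvPolynomial.homogeneousComponent n P
    have hP0 : P0 ∈ symbolIdeal c hW L' hL' := by
      intro m
      by_cases hm : m = n
      · subst hm
        exact ⟨P, fun d hd => hP d hd, fun d hd => by
          rw [MvPolynomial.coeff_homogeneousComponent, if_pos hd], hPL⟩
      · refine ⟨0, by simp, fun d hd => ?_, by simp⟩
        rw [MvPolynomial.coeff_homogeneousComponent, if_neg (by omega), MvPolynomial.coeff_zero]
    obtain ⟨P', h1, h2, h3⟩ := h hP0 n
    have h4 : symbolMap W (P - P') ∈ L := by
      refine ih _ (fun d hd => ?_) ?_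
      · rw [MvPolynomial.coeff_sub]
        rcases hd.lt_or_eq with hd | hd
        · rw [h1 d hd, hP d hd, sub_zero]
        · rw [h2 d hd.symm, MvPolynomial.coeff_homogeneousComponent, if_pos hd.symm, sub_self]
      · rw [map_sub]; exact L'.sub_mem hPL (hLL h3)
    have := L.add_mem h4 h3
    rwa [← map_add, sub_add_cancel] at this

lemma Conn.ACC.of_cyclic [Finite ι] [IsNoetherianRing S] (c : Conn δ N)
    (hc : ∀ a b x, c.toFun a (c.toFun b x) = c.toFun b (c.toFun a x)) (w : N)
    (hw : ∀ L, c.Stable L → w ∈ L → L = ⊤) : c.ACC := by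
  have hlc : LeftCommutative fun a x => c.toFun a x := ⟨hc⟩
  let W : (ι →₀ ℕ) → N := fun m => Multiset.foldr (fun a x => c.toFun a x) w m.toMultiset
  have hW : ∀ a m, c.toFun a (W m) = W (m + Finsupp.single a 1) := by
    intro a m
    simp only [W]
    rw [add_comm, Finsupp.toMultiset_add, Finsupp.toMultiset_single, one_nsmul,
      Multiset.singleton_add, Multiset.foldr_cons]
  have hsurj : LinearMap.range (symbolMap (S := S) W) = ⊤ := by
    refine hw _ ?_ ⟨MvPolynomial.monomial 0 1, ?_⟩
    · rintro a _ ⟨P, rfl⟩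
      exact ⟨_, (conn_symbolMap c hW a P).symm⟩
    · rw [symbolMap_monomial, one_smul]
      simp [W]
  refine Conn.ACC.of_chain fun f hf => ?_
  obtain ⟨n, hn⟩ := monotone_stabilizes_iff_noetherian.2
    (inferInstance : IsNoetherianRing (MvPolynomial ι S))
    ⟨fun n => symbolIdeal c hW (f n) (hf n), fun a b hab P hP n => by
      obtain ⟨P', h1, h2, h3⟩ := hP n
      exact ⟨P', h1, h2, f.monotone hab h3⟩⟩
  refine ⟨n, fun m hm => le_antisymm (f.monotone hm) fun x hx => ?_⟩
  obtain ⟨P, rfl⟩ := LinearMap.range_eq_top.1 hsurj x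
  refine le_of_symbolIdeal c hW (hf n) (hf m) (f.monotone hm) (le_of_eq (hn m hm).symm)
    (P.totalDegree + 1) P (fun d hd => ?_) hx
  refine MvPolynomial.coeff_eq_zero_of_totalDegree_lt ?_
  rw [Finsupp.degree] at hd
  exact hd
end Symbol

section Cyclic
variable {E : Type} [Field E] {S : Type} [CommRing S] [Algebra S E] {ι : Type} {δ : ι → Der S}
  {dE : ι → Der E} (hd : ∀ a x, dE a (algebraMap S E x) = algebraMap S E (δ a x)) {f : S}
  (hf : algebraMap S E f ≠ 0)

/-- Specialization of `u f ^ s` at `s = -m`. -/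
def evalNeg (f : E) (m : ℕ) : Om E →+ E :=
  (AddMonoidHom.mulRight (f⁻¹ ^ m)).comp
    ((evalRingHom (-(m : E))).toAddMonoidHom.comp Om.mk.symm.toAddMonoidHom)

lemma evalNeg_apply (f : E) (m : ℕ) (u : Om E) :
    evalNeg f m u = (Om.mk.symm u).eval (-(m : E)) * f⁻¹ ^ m := rfl

lemma evalNeg_smul (f : E) (m : ℕ) (p : S[X]) (u : Om E) :
    evalNeg f m (p • u) = algebraMap S E (p.eval (-(m : S))) * evalNeg f m u := by
  rw [evalNeg_apply, evalNeg_apply, Om.smul_def, AddEquiv.symm_apply_apply, eval_mul, mul_assoc]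
  congr 1
  rw [← map_natCast (algebraMap S E), ← map_neg, eval_map_algebraMap, aeval_algebraMap_apply]
  rfl

lemma eval_polyDer (d : Der E) (u : E[X]) (x : E) (hx : d x = 0) :
    (polyDer d u).eval x = d (u.eval x) := by
  induction u using Polynomial.induction_on' with
  | add p r hp hr => simp only [eval_add, map_add, hp, hr]
  | monomial n a =>
    rw [← C_mul_X_pow_eq_monomial]
    simp only [Derivation.leibniz, Derivation.leibniz_pow, hx, polyDer_C, polyDer_X, smul_zero,
      smul_eq_mul, mul_zero, zero_add, eval_mul, eval_C, eval_pow, eval_X]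

lemma der_natCast (d : Der E) (m : ℕ) : d (-(m : E)) = 0 := by
  rw [map_neg, Derivation.map_natCast, neg_zero]

lemma evalNeg_conn (a : ι) (m : ℕ) (u : Om E) :
    evalNeg (algebraMap S E f) m ((omData δ dE hd f hf).conn.toFun a u) =
      dE a (evalNeg (algebraMap S E f) m u) := by
  rw [omData_conn, evalNeg_apply, evalNeg_apply, AddEquiv.symm_apply_apply, omConn_apply, eval_add,
    eval_mul, eval_mul, eval_C, eval_X, eval_polyDer _ _ _ (der_natCast _ _), Derivation.leibniz,
    Derivation.leibniz_pow, Derivation.leibniz_inv]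
  rcases m with _ | m
  · simp
  · simp only [smul_eq_mul, nsmul_eq_mul, Nat.add_sub_cancel]
    rw [div_eq_mul_inv]
    ring

lemma inv_pow_mem_of_bfun {K : Type} [Field K] [CharZero K] [Algebra K S]
    (hb : (omData δ dE hd f hf).w 0 ∈ (omData δ dE hd f hf).NN K 1) :
    ∃ k : ℕ, ∀ L : Submodule S E, (∀ a, ∀ x ∈ L, dE a x ∈ L) → (algebraMap S E f)⁻¹ ^ k ∈ L →
      ∀ j, (algebraMap S E f)⁻¹ ^ j ∈ L := by
  classical
  obtain ⟨b, hb0, hb⟩ := hb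
  have hfin : {k : ℕ | b.eval (-(k : K)) = 0}.Finite := by
    refine Set.Finite.of_finite_image (f := fun k : ℕ => -(k : K))
      ((b.roots.toFinset.finite_toSet).subset ?_) fun x _ y _ h => by simpa using h
    rintro _ ⟨k, hk, rfl⟩
    simpa [hb0] using hk
  obtain ⟨k0, hk0⟩ := hfin.bddAbove
  refine ⟨k0, fun L hL h0 => ?_⟩
  have up : ∀ j, (algebraMap S E f)⁻¹ ^ (k0 + j) ∈ L := by
    intro j
    induction j with
    | zero => exact h0
    | succ j ih =>
      let N : Submodule S[X] (Om E) :=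
        { carrier := {u | evalNeg (algebraMap S E f) (k0 + (j + 1)) u ∈ L}
          add_mem' := fun h1 h2 => by
            simp only [Set.mem_ofPred_eq, map_add] at *; exact L.add_mem h1 h2
          zero_mem' := by simp
          smul_mem' := fun p x hx => by
            simp only [Set.mem_ofPred_eq, evalNeg_smul] at *
            rw [← Algebra.smul_def]
            exact L.smul_mem _ hx }
      have h1 : (b.map (algebraMap K S)) • (omData δ dE hd f hf).w 0 ∈ N := by
        refine (omData δ dE hd f hf).D_le (N := N) (fun a x hx => ?_) ?_ hb
        · change evalNeg _ _ _ ∈ L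
          rw [evalNeg_conn]; exact hL a _ hx
        · change evalNeg _ _ _ ∈ L
          rw [omData_w, pow_one, evalNeg_smul, evalNeg_apply, AddEquiv.symm_apply_apply, eval_C,
            pow_zero, eval_C, one_mul, ← add_assoc, pow_succ', ← mul_assoc, mul_inv_cancel₀ hf,
            one_mul]
          exact ih
      have h2 : evalNeg (algebraMap S E f) (k0 + (j + 1))
        ((b.map (algebraMap K S)) • (omData δ dE hd f hf).w 0) ∈ L := h1
      rw [omData_w, evalNeg_smul, evalNeg_apply, AddEquiv.symm_apply_apply, pow_zero, eval_C,
        one_mul, ← Algebra.smul_def, ← map_natCast (algebraMap K S), ← map_neg,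
        eval_map_algebraMap, aeval_algebraMap_apply] at h2
      have h3 : b.eval (-((k0 + (j + 1) : ℕ) : K)) ≠ 0 := fun h => by
        have := hk0 h
        omega
      have h4 := L.smul_mem (algebraMap K S (b.eval (-((k0 + (j + 1) : ℕ) : K)))⁻¹) h2
      rw [smul_smul] at h4
      change ((algebraMap K S _) * algebraMap K S (aeval _ b)) • _ ∈ L at h4
      rwa [coe_aeval_eq_eval, ← map_mul, inv_mul_cancel₀ h3, map_one, one_smul] at h4
  intro j
  have h1 := L.smul_mem (f ^ k0) (up j)
  rwa [Algebra.smul_def, map_pow, pow_add, ← mul_assoc, ← mul_pow, mul_inv_cancel₀ hf, one_pow,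
    one_mul] at h1

end Cyclic

/-- The tautological connection on the base ring. -/
def selfConn {S : Type} [CommRing S] {ι : Type} (δ : ι → Der S) : Conn δ S where
  toFun a := (δ a : S →ₗ[ℤ] S).toAddMonoidHom
  leib a s n := by
    change δ a (s • n) = s • δ a n + δ a s • n
    rw [smul_eq_mul, Derivation.leibniz, smul_eq_mul, smul_eq_mul, smul_eq_mul, mul_comm n]

theorem selfConn_good {K : Type} [Field K] [CharZero K] {S : Type} [CommRing S] [Algebra K S]
    {ι : Type} [Fintype ι] [IsNoetherianRing S] [IsDomain S] (δ : ι → Der S)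
    (hcomm : ∀ a b x, δ a (δ b x) = δ b (δ a x))
    (hK : ∀ a (k : K), δ a (algebraMap K S k) = 0)
    (hJ : ∀ Q : Ideal S, Q.IsPrime → ∀ u ∈ Q, (∀ a, δ a u ∈ Q) → ∃ g ∉ Q, g * u ∈ Q ^ 2)
    (hC : ∀ Q : Ideal S, Q.IsPrime → ∀ x y : S, y ∉ Q →
      (∀ b : ι → S, (∀ u ∈ Q, ∑ a, b a * δ a u ∈ Q) →
        y * ∑ a, b a * δ a x - x * ∑ a, b a * δ a y ∈ Q) →
      ∃ b : K[X], b ≠ 0 ∧ ∃ n, b.natDegree ≤ n ∧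
        ∑ i ∈ Finset.range (n + 1), algebraMap K S (b.coeff i) * x ^ i * y ^ (n - i) ∈ Q) :
    (selfConn δ).Good := by
  obtain ⟨E, _, _, _⟩ : ∃ (E : Type) (_ : Field E) (_ : Algebra S E), IsFractionRing S E :=
    ⟨FractionRing S, inferInstance, inferInstance, inferInstance⟩
  have hder : ∀ a, ∃ d' : Der E, ∀ x, d' (algebraMap S E x) = algebraMap S E (δ a x) := fun a =>
    exists_der_localization (nonZeroDivisors S)
      ((Algebra.linearMap S E).compDer (δ a) : DerTo S E)
  choose dE hd using hder
  intro g N' _ _ φ _ c' hc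
  by_cases hg0 : g = 0
  · subst hg0
    have : Subsingleton N' := by
      refine ⟨fun x y => smul_inj_of_loc (Submonoid.powers (0 : S)) φ
        ⟨0, Submonoid.mem_powers _⟩ ?_⟩
      simp
    refine Conn.ACC.of_chain fun f _ => ⟨0, fun m _ => Subsingleton.elim _ _⟩
  have hg : algebraMap S E g ≠ 0 := by
    rwa [ne_eq, IsFractionRing.to_map_eq_zero_iff]
  have hgpow : ∀ x : Submonoid.powers g, algebraMap S E x ≠ 0 := by
    rintro ⟨_, n, rfl⟩
    simp only [map_pow]
    exact pow_ne_zero _ hg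
  have hunit : ∀ x : Submonoid.powers g, IsUnit (algebraMap S (Module.End S E) x) := by
    intro x
    rw [Module.End.isUnit_iff]
    constructor
    · intro y z h
      simp only [Module.algebraMap_end_apply, Algebra.smul_def] at h
      exact mul_left_cancel₀ (hgpow x) h
    · intro y
      refine ⟨(algebraMap S E x)⁻¹ * y, ?_⟩
      rw [Module.algebraMap_end_apply, Algebra.smul_def, mul_inv_cancel_left₀ (hgpow x)]
  let ψ : N' →ₗ[S] E := IsLocalizedModule.lift (Submonoid.powers g) φ (Algebra.linearMap S E) hunit
  have hψφ : ∀ s, ψ (φ s) = algebraMap S E s := fun s =>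
    IsLocalizedModule.lift_apply (Submonoid.powers g) φ (Algebra.linearMap S E) hunit s
  have hψinj : Function.Injective ψ := by
    rw [injective_iff_map_eq_zero]
    intro x hx
    obtain ⟨⟨s, y⟩, hy⟩ := IsLocalizedModule.surj (Submonoid.powers g) φ x
    have hy : (y : S) • x = φ s := hy
    have h1 : algebraMap S E s = 0 := by rw [← hψφ, ← hy, map_smul, hx, smul_zero]
    rw [IsFractionRing.to_map_eq_zero_iff] at h1
    rw [h1, map_zero] at hy
    exact smul_inj_of_loc (Submonoid.powers g) φ y (by simpa using hy)
  let cE : Conn δ E :=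
    { toFun := fun a => (dE a : E →ₗ[ℤ] E).toAddMonoidHom
      leib := fun a s n => by
        change dE a (s • n) = s • dE a n + δ a s • n
        rw [Algebra.smul_def, Algebra.smul_def, Algebra.smul_def, Derivation.leibniz, hd,
          smul_eq_mul, smul_eq_mul, mul_comm n] }
  have hψ : ∀ a x, ψ (c'.toFun a x) = dE a (ψ x) := by
    refine Conn.Hor.of_loc (Submonoid.powers g) φ (e := cE) hc (fun a x => ?_) fun x y z h => ?_
    · change ψ (φ (δ a x)) = dE a (ψ (φ x))
      rw [hψφ, hψφ, hd]
    · simp only [Algebra.smul_def] at h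
      exact mul_left_cancel₀ (hgpow x) h
  have hdcomm : ∀ a b x, dE a (dE b x) = dE b (dE a x) := by
    intro a b x
    obtain ⟨u, v, hv, rfl⟩ := IsFractionRing.div_surjective (A := S) x
    have hv0 : algebraMap S E v ≠ 0 := by
      rw [ne_eq, IsFractionRing.to_map_eq_zero_iff]; exact nonZeroDivisors.ne_zero hv
    have hD : ∀ s, (⁅dE a, dE b⁆ : Der E) (algebraMap S E s) = 0 := fun s => by
      rw [Derivation.commutator_apply, hd, hd, hd, hd, hcomm, sub_self]
    have h1 := congrArg (⁅dE a, dE b⁆ : Der E) (div_mul_cancel₀ (algebraMap S E u) hv0)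
    rw [Derivation.leibniz, hD, hD, smul_zero, zero_add, smul_eq_mul] at h1
    have h2 := (mul_eq_zero.1 h1).resolve_left hv0
    rw [Derivation.commutator_apply] at h2
    exact sub_eq_zero.1 h2
  obtain ⟨k, hk⟩ := inv_pow_mem_of_bfun hd hg (omData_bfun hd hg hK hJ hC)
  have hinv : ∀ j, ∃ n : N', ψ n = (algebraMap S E g)⁻¹ ^ j := by
    intro j
    obtain ⟨n, hn⟩ := IsLocalizedModule.map_units φ (⟨g ^ j, j, rfl⟩ : Submonoid.powers g) |>
      (Module.End.isUnit_iff _).1 |>.2 (φ 1)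
    refine ⟨n, ?_⟩
    have hn : g ^ j • n = φ 1 := hn
    have h1 := congrArg ψ hn
    rw [map_smul, hψφ, map_one, Algebra.smul_def, map_pow] at h1
    rw [inv_pow]
    exact eq_inv_of_mul_eq_one_right h1
  obtain ⟨w, hw⟩ := hinv k
  refine Conn.ACC.of_cyclic c' (fun a b x => hψinj ?_) w fun L hL hwL => ?_
  · rw [hψ, hψ, hψ, hψ, hdcomm]
  · rw [eq_top_iff]
    rintro x -
    obtain ⟨⟨s, ⟨_, j, rfl⟩⟩, hy⟩ := IsLocalizedModule.surj (Submonoid.powers g) φ x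
    have hy : g ^ j • x = φ s := hy
    obtain ⟨y, hyL, hy2⟩ := hk (L.map ψ) (by
      rintro a _ ⟨y, hy, rfl⟩
      exact ⟨_, hL a y hy, hψ a y⟩) ⟨w, hwL, hw⟩ j
    have : x = s • y := by
      apply hψinj
      have h1 := congrArg ψ hy
      rw [map_smul, hψφ, Algebra.smul_def, map_pow] at h1
      rw [map_smul, hy2, Algebra.smul_def, ← h1, inv_pow, mul_comm, inv_mul_cancel_left₀]
      exact pow_ne_zero _ hg
    rw [this]
    exact L.smul_mem _ hyL
end

section PS
open MvPowerSeries
variable {σ R : Type*} [CommRing R]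

/-- The ideal of a power series ring generated by the variables. -/
abbrev XI (σ R : Type*) [CommRing R] : Ideal (MvPowerSeries σ R) := .span (.range X)

theorem le_order_of_mem_XI_pow {n : ℕ} {w : MvPowerSeries σ R} (h : w ∈ XI σ R ^ n) :
    (n : ℕ∞) ≤ w.order := by
  have h1 : ∀ v ∈ XI σ R, (1 : ℕ∞) ≤ v.order := by
    intro v hv
    have : XI σ R ≤ RingHom.ker (constantCoeff (σ := σ) (R := R)) := by
      rw [Ideal.span_le]
      rintro _ ⟨i, rfl⟩
      simp
    exact one_le_order_iff_constCoeff_eq_zero.2 (this hv)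
  refine Submodule.pow_induction_on_left' (XI σ R)
    (C := fun n w _ => (n : ℕ∞) ≤ w.order) (fun r => by simp) ?_ ?_ h
  · intro x y i hx hy h1 h2
    exact (le_min h1 h2).trans min_order_le_add
  · intro m hm i x hx h2
    have := add_le_add (h1 m hm) h2
    rw [Nat.succ_eq_add_one, Nat.cast_add, add_comm]
    exact (this.trans le_order_mul)

variable [Finite σ]

theorem mem_XI_pow_iff {n : ℕ} {w : MvPowerSeries σ R} :
    w ∈ XI σ R ^ n ↔ ∀ x : σ →₀ ℕ, x.degree < n → coeff x w = 0 := by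
  constructor
  · intro h x hx
    exact coeff_of_lt_order ((by exact_mod_cast hx : (x.degree : ℕ∞) < n).trans_le
      (le_order_of_mem_XI_pow h))
  · intro h
    let I := MvPolynomial.idealOfVars σ R
    have h0 : truncTotal n w = 0 := by
      ext x
      by_cases hx : x.degree < n
      · rw [coeff_truncTotal _ hx, h x hx]; rfl
      · rw [coeff_truncTotal_eq_zero _ (not_lt.1 hx)]; rfl
    have h1 : toAdicCompletion σ R w ∈ (AdicCompletion.eval I (MvPolynomial σ R) n).ker := by
      rw [LinearMap.mem_ker, AdicCompletion.eval_apply, toAdicCompletion_apply_eq_mk_truncTotal, h0]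
      simp
    rw [← AdicCompletion.pow_smul_top_eq_ker_eval (MvPolynomial.idealOfVars_fg σ R)] at h1
    have h2 : (I ^ n • ⊤ : Submodule _ (AdicCompletion I (MvPolynomial σ R))) ≤
        Submodule.comap ((toAdicCompletionAlgEquiv σ R).symm.toLinearMap)
          ((XI σ R ^ n).restrictScalars (MvPolynomial σ R)) := by
      rw [Submodule.smul_le]
      intro r hr y _
      rw [Submodule.mem_comap, map_smul, Submodule.restrictScalars_mem, Algebra.smul_def]
      refine Ideal.mul_mem_right _ _ ?_
      have : I.map (algebraMap (MvPolynomial σ R) (MvPowerSeries σ R)) = XI σ R := by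
        rw [Ideal.map_span, ← Set.range_comp]
        congr 2; ext1
        simp [MvPowerSeries.algebraMap_apply']
      rw [← this, ← Ideal.map_pow]
      exact Ideal.mem_map_of_mem _ hr
    have h3 := h2 h1
    have h4 : (toAdicCompletionAlgEquiv σ R).symm (toAdicCompletion σ R w) = w :=
      (toAdicCompletionAlgEquiv σ R).symm_apply_apply w
    rw [Submodule.mem_comap] at h3
    change (toAdicCompletionAlgEquiv σ R).symm (toAdicCompletion σ R w) ∈ XI σ R ^ n at h3
    rwa [h4] at h3

theorem sub_truncTotal_mem (n : ℕ) (w : MvPowerSeries σ R) :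
    w - (truncTotal n w : MvPolynomial σ R) ∈ XI σ R ^ n := by
  rw [mem_XI_pow_iff]
  intro x hx
  rw [map_sub, MvPolynomial.coeff_coe, coeff_truncTotal _ hx, sub_self]

theorem mem_XI_iff {w : MvPowerSeries σ R} : w ∈ XI σ R ↔ constantCoeff w = 0 := by
  rw [← pow_one (XI σ R), mem_XI_pow_iff]
  constructor
  · intro h; exact h 0 (by simp)
  · intro h x hx
    have : x = 0 := by rw [← Finsupp.degree_eq_zero_iff]; omega
    subst this; exact h

theorem exists_psLift {C : Type*} [CommRing C] [Algebra R C] (I : Ideal C) [IsAdicComplete I C]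
    (c : σ → C) (hc : ∀ i, c i ∈ I) :
    ∃ φ : MvPowerSeries σ R →ₐ[R] C, ∀ i, φ (X i) = c i := by
  classical
  have key : ∀ n, MvPolynomial.idealOfVars σ R ^ n ≤ (I ^ n).comap (MvPolynomial.aeval (R := R) c) := by
    intro n
    rw [← Ideal.map_le_iff_le_comap, Ideal.map_pow]
    refine Ideal.pow_right_mono ?_ n
    rw [Ideal.map_le_iff_le_comap, Ideal.span_le]
    rintro _ ⟨i, rfl⟩
    simpa using hc i
  let f : (n : ℕ) → MvPowerSeries σ R →ₐ[R] C ⧸ I ^ n := fun n =>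
    (Ideal.quotientMapₐ (I ^ n) (MvPolynomial.aeval (R := R) c) (key n)).comp
      ((truncTotalAlgHom σ R n).restrictScalars R)
  have hf : ∀ n w, f n w = Ideal.Quotient.mk (I ^ n) (MvPolynomial.aeval c (truncTotal n w)) := by
    intro n w
    rfl
  have hcomp : ∀ {m n : ℕ} (hle : m ≤ n),
      (Ideal.Quotient.factorₐ R (Ideal.pow_le_pow_right hle)).comp (f n) = f m := by
    intro m n hle
    ext w
    rw [AlgHom.comp_apply, hf, hf]
    rw [Ideal.Quotient.factorₐ_apply_mk, Ideal.Quotient.eq, ← map_sub]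
    exact key m (truncTotal_sub_truncTotal_mem_pow_idealOfVars hle le_rfl w)
  refine ⟨IsAdicComplete.liftAlgHom I f hcomp, fun i => ?_⟩
  apply IsHausdorff.eq_iff_smodEq (I := I) |>.2
  intro n
  have := IsAdicComplete.mk_liftAlgHom I f hcomp n (X i)
  rw [hf] at this
  rw [SModEq.sub_mem, smul_eq_mul, Ideal.mul_top, ← Ideal.Quotient.eq]
  refine this.trans ?_
  rw [Ideal.Quotient.eq, ← MvPolynomial.aeval_X (R := R) c i, ← map_sub]
  apply key
  rw [MvPolynomial.mem_pow_idealOfVars_iff']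
  intro x hx
  rw [MvPolynomial.coeff_sub, coeff_truncTotal _ hx, ← MvPolynomial.coe_X, MvPolynomial.coeff_coe,
    sub_self]

theorem psHom_XI_pow_le {C : Type*} [CommRing C] {I : Ideal C} (φ : MvPowerSeries σ R →+* C)
    (h : ∀ i, φ (X i) ∈ I) (n : ℕ) {w : MvPowerSeries σ R} (hw : w ∈ XI σ R ^ n) : φ w ∈ I ^ n := by
  have h1 : (XI σ R).map φ ≤ I := by
    rw [Ideal.map_le_iff_le_comap, Ideal.span_le]
    rintro _ ⟨i, rfl⟩
    exact h i
  have := Ideal.mem_map_of_mem φ hw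
  rw [Ideal.map_pow] at this
  exact Ideal.pow_right_mono h1 n this

theorem coe_poly_eq_aeval {R : Type*} [CommRing R] {σ : Type*} (P : MvPolynomial σ R) :
    (P : MvPowerSeries σ R) = MvPolynomial.aeval (fun i => (X i : MvPowerSeries σ R)) P := by
  have : (MvPolynomial.coeToMvPowerSeries.algHom R : MvPolynomial σ R →ₐ[R] MvPowerSeries σ R) =
      MvPolynomial.aeval (fun i => (X i : MvPowerSeries σ R)) := by
    ext i : 1
    simp [MvPolynomial.coeToMvPowerSeries.algHom]
  exact DFunLike.congr_fun this P

theorem psHom_ext {C : Type*} [CommRing C] [Algebra R C] (I : Ideal C) [IsHausdorff I C]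
    {φ ψ : MvPowerSeries σ R →ₐ[R] C} (h : ∀ i, φ (X i) = ψ (X i)) (hI : ∀ i, φ (X i) ∈ I) :
    φ = ψ := by
  ext w
  rw [IsHausdorff.eq_iff_smodEq (I := I)]
  intro n
  rw [SModEq.sub_mem, smul_eq_mul, Ideal.mul_top]
  have h1 := psHom_XI_pow_le φ.toRingHom hI n (sub_truncTotal_mem n w)
  have h2 := psHom_XI_pow_le ψ.toRingHom (fun i => by
    change ψ (X i) ∈ I; rw [← h i]; exact hI i) n (sub_truncTotal_mem n w)
  have h3 : φ (truncTotal n w : MvPolynomial σ R) = ψ (truncTotal n w : MvPolynomial σ R) := by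
    rw [coe_poly_eq_aeval]
    rw [← AlgHom.comp_apply, ← AlgHom.comp_apply]
    congr 1
    ext i; simpa using h i
  have h4 := Ideal.sub_mem _ h1 h2
  change φ _ - ψ _ ∈ _ at h4
  rw [map_sub, map_sub, h3] at h4
  simpa using h4

end PS

section
open MvPowerSeries

theorem XI_ne_top {σ R : Type*} [CommRing R] [Finite σ] [Nontrivial R] : XI σ R ≠ ⊤ := by
  rw [Ideal.ne_top_iff_one, mem_XI_iff]
  simp

section Der
variable {σ R : Type*} [CommRing R] [Fintype σ] [IsNoetherianRing R] [IsLocalRing R]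

theorem der_pow_mem {N : Type*} [AddCommGroup N] [Module (MvPowerSeries σ R) N]
    [Module R N] (D : Derivation R (MvPowerSeries σ R) N)
    (N' : Submodule (MvPowerSeries σ R) N) (hD : ∀ w, D w ∈ N') (n : ℕ)
    {w : MvPowerSeries σ R} (hw : w ∈ XI σ R ^ n) : D w ∈ XI σ R ^ (n - 1) • N' := by
  refine Submodule.pow_induction_on_left' (XI σ R)
    (C := fun n w _ => D w ∈ XI σ R ^ (n - 1) • N') (fun r => by simpa using hD _) ?_ ?_ hw
  · intro x y i hx hy h1 h2
    rw [map_add]; exact add_mem h1 h2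
  · intro m hm i x hx h2
    rw [Derivation.leibniz]
    refine add_mem ?_ ?_
    · rcases i with _ | i
      · simpa using N'.smul_mem _ (hD x)
      · have := Submodule.smul_mem_smul hm h2
        rwa [← Submodule.mul_smul, ← pow_succ', Nat.add_sub_cancel] at this
    · exact Submodule.smul_mem_smul hx (hD m)

theorem der_eq_sum {N : Type*} [AddCommGroup N] [Module (MvPowerSeries σ R) N]
    [Module R N] [IsScalarTower R (MvPowerSeries σ R) N]
    (D : Derivation R (MvPowerSeries σ R) N)
    (N' : Submodule (MvPowerSeries σ R) N) (hN : N'.FG) (hD : ∀ w, D w ∈ N')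
    (w : MvPowerSeries σ R) : D w = ∑ i, pderiv R i w • D (X i) := by
  classical
  let D0 : Derivation R (MvPowerSeries σ R) N :=
    ∑ i, ((LinearMap.toSpanSingleton (MvPowerSeries σ R) N (D (X i))).compDer (pderiv R i))
  have hD0 : ∀ w, D0 w = ∑ i, pderiv R i w • D (X i) := by
    intro w
    let ev : Derivation R (MvPowerSeries σ R) N →+ N :=
      { toFun := fun d => d w, map_zero' := rfl, map_add' := fun _ _ => rfl }
    change ev D0 = _
    rw [map_sum ev]
    rfl
  let D1 := D - D0
  have hD1 : ∀ w, D1 w ∈ N' := by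
    intro w
    refine sub_mem (hD w) ?_
    change D0 w ∈ N'
    rw [hD0]
    exact sum_mem fun i _ => N'.smul_mem _ (hD _)
  have hX : ∀ i, D1 (X i) = 0 := by
    intro i
    change D (X i) - D0 (X i) = 0
    rw [hD0, Finset.sum_eq_single i]
    · simp
    · intro j _ hj; rw [pderiv_X_of_ne (Ne.symm hj)]; simp
    · simp
  have hP : ∀ P : MvPolynomial σ R, D1 (P : MvPowerSeries σ R) = 0 := by
    intro P
    induction P using MvPolynomial.induction_on with
    | C a =>
      rw [MvPolynomial.coe_C]
      exact D1.map_algebraMap a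
    | add p q hp hq => rw [MvPolynomial.coe_add, map_add, hp, hq, add_zero]
    | mul_X p i hp => rw [MvPolynomial.coe_mul, MvPolynomial.coe_X, Derivation.leibniz, hp, hX]; simp
  have h0 : D1 w = 0 := by
    have : Module.Finite (MvPowerSeries σ R) N' := Module.Finite.iff_fg.2 hN
    have hK := Ideal.iInf_pow_smul_eq_bot_of_isLocalRing (M := N') (XI σ R) XI_ne_top
    have hm : (⟨D1 w, hD1 w⟩ : N') ∈ (⨅ i, XI σ R ^ i • ⊤ : Submodule (MvPowerSeries σ R) N') := by
      rw [Submodule.mem_iInf]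
      intro n
      have h1 := der_pow_mem D1 N' hD1 (n + 1) (sub_truncTotal_mem (n + 1) w)
      rw [map_sub, hP, sub_zero, Nat.add_sub_cancel] at h1
      have h2 : (XI σ R ^ n • ⊤ : Submodule (MvPowerSeries σ R) N').map N'.subtype =
          XI σ R ^ n • N' := by
        rw [Submodule.map_smul'', Submodule.map_subtype_top]
      rw [← h2] at h1
      obtain ⟨y, hy, hy2⟩ := h1
      have : y = ⟨D1 w, hD1 w⟩ := Subtype.ext hy2
      rwa [← this]
    rw [hK, Submodule.mem_bot] at hm
    exact congr_arg Subtype.val hm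
  have : D w - D0 w = 0 := h0
  rw [← hD0]; exact sub_eq_zero.1 this

end Der

section Dom
variable {σ R : Type*} [CommRing R] [Finite σ]

theorem exists_leading (p : R) {E h : MvPowerSeries σ R} (hE : E = C p - h)
    (hh : h ∈ XI σ R) [IsNoetherianRing R] [IsLocalRing R] (hEu : E ∈ maximalIdeal (MvPowerSeries σ R))
    {f : MvPowerSeries σ R} (hf : f ∉ Ideal.span {E}) :
    ∃ N : ℕ, ∃ f', f - f' ∈ Ideal.span {E} ∧ f' ∈ XI σ R ^ N ∧
      ¬ (((N + 1 : ℕ) : ℕ∞) ≤ (MvPowerSeries.map (Ideal.Quotient.mk (Ideal.span {p})) f').order) := by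
  classical
  by_contra hcon
  push Not at hcon
  have key : ∀ N, f ∈ Ideal.span {E} ⊔ XI σ R ^ N := by
    intro N
    induction N with
    | zero => simp
    | succ N ih =>
      obtain ⟨a, ha, f', hf', hs⟩ := Submodule.mem_sup.1 ih
      have hd := hcon N f' (by rw [← hs, add_sub_cancel_right]; exact ha) hf'
      have hdiv : ∀ x : σ →₀ ℕ, x.degree = N → ∃ c, coeff x f' = p * c := by
        intro x hx
        have h1 : coeff x (MvPowerSeries.map (Ideal.Quotient.mk (Ideal.span {p})) f') = 0 := by
          apply coeff_of_lt_order
          refine lt_of_lt_of_le ?_ hd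
          rw [hx]; exact_mod_cast Nat.lt_succ_self N
        rw [coeff_map, Ideal.Quotient.eq_zero_iff_mem, Ideal.mem_span_singleton] at h1
        exact h1
      choose! c hc using hdiv
      let g : MvPowerSeries σ R := fun x => if x.degree = N then c x else 0
      have hgc : ∀ x, coeff x g = if x.degree = N then c x else 0 := fun x => rfl
      have hg : g ∈ XI σ R ^ N := by
        rw [mem_XI_pow_iff]
        intro x hx
        rw [hgc, if_neg hx.ne]
      have hz : f' - C p * g ∈ XI σ R ^ (N + 1) := by
        rw [mem_XI_pow_iff]
        intro x hx
        rw [map_sub, coeff_C_mul, hgc]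
        split_ifs with h
        · rw [hc x h, sub_self]
        · rw [mul_zero, sub_zero]
          exact mem_XI_pow_iff.1 hf' x (by omega)
      have : f = (a + E * g) + (h * g + (f' - C p * g)) := by rw [← hs, hE]; ring
      rw [this]
      refine Submodule.add_mem_sup (add_mem ha ?_) (add_mem ?_ hz)
      · exact Ideal.mul_mem_right _ _ (Ideal.mem_span_singleton_self E)
      · rw [pow_succ']; exact Ideal.mul_mem_mul hh hg
  apply hf
  have hloc : IsLocalRing (MvPowerSeries σ R ⧸ Ideal.span {E}) := by
    have : Nontrivial (MvPowerSeries σ R ⧸ Ideal.span {E}) := Ideal.Quotient.nontrivial_iff.2 (by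
      intro h
      exact (maximalIdeal.isMaximal (MvPowerSeries σ R)).ne_top
        (top_le_iff.1 (h ▸ (Ideal.span_le.2 (by simpa using hEu)))))
    exact IsLocalRing.of_surjective' (Ideal.Quotient.mk _) Ideal.Quotient.mk_surjective
  let q := Ideal.Quotient.mk (Ideal.span {E})
  have hJ : (XI σ R).map q ≠ ⊤ := by
    intro h
    have h1 : (XI σ R) ⊔ Ideal.span {E} = ⊤ := by
      have := congr_arg (Ideal.comap q) h
      rw [Ideal.comap_map_of_surjective q Ideal.Quotient.mk_surjective, ← RingHom.ker_eq_comap_bot,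
        Ideal.mk_ker, Ideal.comap_top] at this
      exact this
    have h2 : (XI σ R) ⊔ Ideal.span {E} ≤ maximalIdeal (MvPowerSeries σ R) :=
      sup_le (IsLocalRing.le_maximalIdeal XI_ne_top) (Ideal.span_le.2 (by simpa using hEu))
    rw [h1, top_le_iff] at h2
    exact (maximalIdeal.isMaximal (MvPowerSeries σ R)).ne_top h2
  have hK := Ideal.iInf_pow_eq_bot_of_isLocalRing _ hJ
  have : q f ∈ (⨅ i, (XI σ R).map q ^ i) := by
    rw [Submodule.mem_iInf]
    intro N
    obtain ⟨a, ha, b, hb, hs⟩ := Submodule.mem_sup.1 (key N)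
    rw [← hs, map_add, Ideal.Quotient.eq_zero_iff_mem.2 ha, zero_add, ← Ideal.map_pow]
    exact Ideal.mem_map_of_mem _ hb
  rw [hK] at this
  exact Ideal.Quotient.eq_zero_iff_mem.1 this

theorem span_E_isPrime [IsDomain R] [IsNoetherianRing R] [IsLocalRing R] {p : R} (hp : Prime p)
    {E h : MvPowerSeries σ R} (hE : E = C p - h) (hh : h ∈ XI σ R) :
    (Ideal.span {E}).IsPrime := by
  have hEu : E ∈ maximalIdeal (MvPowerSeries σ R) := by
    rw [mem_maximalIdeal, mem_nonunits_iff, MvPowerSeries.isUnit_iff_constantCoeff, hE,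
      map_sub, mem_XI_iff.1 hh, sub_zero, constantCoeff_C]
    exact hp.not_isUnit
  have hE0 : E.order = 0 := by
    by_contra hne
    have := one_le_order_iff_constCoeff_eq_zero.1 (Order.one_le_iff_ne_zero.2 hne)
    rw [hE, map_sub, mem_XI_iff.1 hh, sub_zero, constantCoeff_C] at this
    exact hp.ne_zero this
  refine ⟨fun h => ?_, fun {f g} hfg => ?_⟩
  · exact (maximalIdeal.isMaximal (MvPowerSeries σ R)).ne_top
      (top_le_iff.1 (h ▸ (Ideal.span_le.2 (by simpa using hEu))))
  · by_contra hcon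
    push Not at hcon
    obtain ⟨N, f', hf1, hf2, hf3⟩ := exists_leading p hE hh hEu hcon.1
    obtain ⟨M, g', hg1, hg2, hg3⟩ := exists_leading p hE hh hEu hcon.2
    have hmem : f' * g' ∈ Ideal.span {E} := by
      have : f' * g' = f * g - ((f - f') * g + f' * (g - g')) := by ring
      rw [this]
      exact sub_mem hfg (add_mem (Ideal.mul_mem_right _ _ hf1) (Ideal.mul_mem_left _ _ hg1))
    obtain ⟨c, hc⟩ := Ideal.mem_span_singleton.1 hmem
    have ho : ((N + M : ℕ) : ℕ∞) ≤ c.order := by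
      have h1 : ((N + M : ℕ) : ℕ∞) ≤ (f' * g').order := by
        rw [Nat.cast_add]
        exact (add_le_add (le_order_of_mem_XI_pow hf2) (le_order_of_mem_XI_pow hg2)).trans le_order_mul
      rwa [hc, order_mul, hE0, zero_add] at h1
    have : (Ideal.span {p}).IsPrime := (Ideal.span_singleton_prime hp.ne_zero).2 hp
    let π := MvPowerSeries.map (σ := σ) (Ideal.Quotient.mk (Ideal.span {p}))
    have hmo : ∀ u : MvPowerSeries σ R, u.order ≤ (π u).order := by
      intro u
      apply MvPowerSeries.le_order
      intro x hx
      rw [coeff_map, coeff_of_lt_order hx, map_zero]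
    have hh1 : (1 : ℕ∞) ≤ (π h).order :=
      (one_le_order_iff_constCoeff_eq_zero.2 (mem_XI_iff.1 hh)).trans (hmo h)
    have hEπ : π E = - π h := by
      rw [hE, map_sub]
      have : π (C p) = 0 := by
        rw [MvPowerSeries.map_C, Ideal.Quotient.eq_zero_iff_mem.2 (Ideal.mem_span_singleton_self p),
          map_zero]
      rw [this, zero_sub]
    have h5 : (π f').order + (π g').order = (π h).order + (π c).order := by
      rw [← order_mul, ← order_mul, ← map_mul, hc, map_mul, hEπ, neg_mul, order_neg]
    have h6 : (π f').order < ((N + 1 : ℕ) : ℕ∞) := not_le.1 hf3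
    have h7 : (π g').order < ((M + 1 : ℕ) : ℕ∞) := not_le.1 hg3
    have h8 := add_le_add hh1 (ho.trans (hmo c))
    rw [← h5] at h8
    obtain ⟨a, ha⟩ := ENat.ne_top_iff_exists.1 h6.ne_top
    obtain ⟨b, hb⟩ := ENat.ne_top_iff_exists.1 h7.ne_top
    rw [← ha] at h6 h8
    rw [← hb] at h7 h8
    norm_cast at h6 h7 h8
    omega

end Dom
end

section
open MvPowerSeries
theorem isPrecomplete_pi {A ι : Type*} [CommRing A] [Fintype ι] (I : Ideal A) [IsPrecomplete I A] :
    IsPrecomplete I (ι → A) := by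
  classical
  refine ⟨fun f hf => ?_⟩
  have h1 : ∀ i, ∀ {m n : ℕ}, m ≤ n → f m i ≡ f n i [SMOD (I ^ m • ⊤ : Submodule A A)] := by
    intro i m n hmn
    have := hf hmn
    rw [SModEq.sub_mem] at this ⊢
    have h2 := Submodule.mem_map_of_mem (f := LinearMap.proj (R := A) (φ := fun _ : ι => A) i) this
    rw [Submodule.map_smul''] at h2
    exact Submodule.smul_mono le_rfl le_top h2
  choose L hL using fun i => IsPrecomplete.prec' (I := I) (fun n => f n i) (h1 i)
  refine ⟨L, fun n => ?_⟩
  rw [SModEq.sub_mem]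
  rw [pi_eq_sum_univ' (f n - L)]
  refine sum_mem fun i _ => Submodule.smul_mem_smul ?_ trivial
  have := hL i n
  rw [SModEq.sub_mem, smul_eq_mul, Ideal.mul_top] at this
  exact this

/-- Nakayama's lemma over a complete ring. -/
theorem span_eq_top_of_complete {A M : Type*} [CommRing A] [AddCommGroup M] [Module A M]
    (I : Ideal A) [IsPrecomplete I A] [IsHausdorff I M] (s : Set M) (hs : s.Finite)
    (h : Submodule.span A s ⊔ I • ⊤ = ⊤) : Submodule.span A s = ⊤ := by
  have : Fintype s := hs.fintype
  have := isPrecomplete_pi (ι := s) I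
  let f : (s → A) →ₗ[A] M := Fintype.linearCombination A (fun x : s => (x : M))
  have hr : LinearMap.range f = Submodule.span A s := by
    rw [Fintype.range_linearCombination, Subtype.range_coe]
  rw [← hr, LinearMap.range_eq_top]
  apply surjective_of_mkQ_comp_surjective (I := I)
  rw [← LinearMap.range_eq_top, LinearMap.range_comp, hr]
  apply (Submodule.comap_injective_of_surjective (Submodule.mkQ_surjective (I • ⊤ : Submodule A M)))
  rw [Submodule.comap_map_mkQ, sup_comm, h, Submodule.comap_top]

theorem isHausdorff_of_map_ne_top {A C : Type*} [CommRing A] [CommRing C] [Algebra A C]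
    [IsNoetherianRing C] [IsLocalRing C] (I : Ideal A) (h : I.map (algebraMap A C) ≠ ⊤) :
    IsHausdorff I C :=
  IsHausdorff.map_algebraMap_iff.1 (IsHausdorff.of_isLocalRing _ _ h)

section Fin
variable {V : Type*} [CommRing V] {p : V}
  {σ τ : Type*} [Finite σ] [Fintype τ]

theorem poly_mem_span_add {N : ℕ} (w : MvPowerSeries σ V) :
    ∃ a ∈ Submodule.span V ((fun x : σ →₀ ℕ => (monomial x (1 : V) : MvPowerSeries σ V)) ''
      {x | x.degree < N}), w - a ∈ XI σ V ^ N := by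
  refine ⟨_, ?_, sub_truncTotal_mem N w⟩
  have : (truncTotal N w : MvPowerSeries σ V) =
      ∑ x ∈ (truncTotal N w).support, (coeff x w) • (monomial x (1 : V) : MvPowerSeries σ V) := by
    conv_lhs => rw [(truncTotal N w).as_sum]
    have h1 : ∀ s : Finset (σ →₀ ℕ), ∀ g : (σ →₀ ℕ) → MvPolynomial σ V,
      ((∑ x ∈ s, g x : MvPolynomial σ V) : MvPowerSeries σ V) =
        ∑ x ∈ s, (g x : MvPowerSeries σ V) := fun s g =>
      map_sum (MvPolynomial.coeToMvPowerSeries.ringHom (σ := σ) (R := V)) g s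
    rw [h1]
    refine Finset.sum_congr rfl fun x hx => ?_
    have hd : x.degree < N := by
      by_contra hd
      rw [MvPolynomial.mem_support_iff, coeff_truncTotal_eq_zero _ (not_lt.1 hd)] at hx
      exact hx rfl
    rw [MvPolynomial.coe_monomial, coeff_truncTotal _ hd, ← map_smul, smul_eq_mul, mul_one]
  rw [this]
  refine sum_mem fun x hx => Submodule.smul_mem _ _ (Submodule.subset_span ⟨x, ?_, rfl⟩)
  by_contra hd
  rw [MvPolynomial.mem_support_iff, coeff_truncTotal_eq_zero _ (not_lt.1 hd)] at hx
  exact hx rfl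

variable [IsNoetherianRing V] [IsLocalRing V]
  [IsAdicComplete (Ideal.span {p}) V] (hm : maximalIdeal V = Ideal.span {p})

include hm in
theorem finite_of_params {D : Type*} [CommRing D] [Algebra V D] [IsLocalRing D] [IsNoetherianRing D]
    (π : MvPowerSeries σ V →ₐ[V] D) (hπ : Function.Surjective π)
    (f : MvPowerSeries τ V →ₐ[V] D) (hf : ∀ i, f (X i) ∈ maximalIdeal D) (N : ℕ)
    (hN : ∀ w ∈ XI σ V ^ N, π w ∈ Ideal.span {algebraMap V D p} ⊔
      Ideal.span (Set.range fun i => f (X i))) :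
    f.toRingHom.Finite := by
  classical
  have hpm : p ∈ maximalIdeal V := hm ▸ Ideal.mem_span_singleton_self p
  let _ : Algebra (MvPowerSeries τ V) D := f.toRingHom.toAlgebra
  have htower : IsScalarTower V (MvPowerSeries τ V) D := IsScalarTower.of_algebraMap_eq (by
    intro v
    exact (f.commutes v).symm)
  let I := (XI τ V).map (algebraMap (MvPowerSeries τ V) D)
  have hIs : I = Ideal.span (Set.range fun i => f (X i)) := by
    change Ideal.map _ _ = _
    rw [Ideal.map_span, ← Set.range_comp]
    rfl
  have hIm : I ≤ maximalIdeal D := by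
    rw [hIs, Ideal.span_le]
    rintro _ ⟨i, rfl⟩
    exact hf i
  have hI : I ≠ ⊤ := fun h => (maximalIdeal.isMaximal _).ne_top (top_le_iff.1 (h ▸ hIm))
  have : Nontrivial (D ⧸ I) := Ideal.Quotient.nontrivial_iff.2 hI
  have hDIl : IsLocalRing (D ⧸ I) :=
    IsLocalRing.of_surjective' (Ideal.Quotient.mk I) Ideal.Quotient.mk_surjective
  let s : Set D := (fun x : σ →₀ ℕ => π (monomial x (1 : V))) '' {x | x.degree < N}
  have hs : s.Finite := Set.Finite.image _ (by
    refine (Finsupp.finite_of_degree_le N).subset (fun x hx => ?_)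
    exact le_of_lt (show x.degree < N from hx))
  have hH1 : IsHausdorff (Ideal.span {p}) (D ⧸ I) := by
    refine isHausdorff_of_map_ne_top (C := D ⧸ I) _ ?_
    rw [Ideal.map_span, Set.image_singleton]
    intro h
    rw [Ideal.span_singleton_eq_top] at h
    have h2 : algebraMap V (D ⧸ I) p = Ideal.Quotient.mk I (π (C p)) := by
      have : π (C p) = algebraMap V D p := π.commutes p
      rw [this]; rfl
    rw [h2] at h
    have hu1 := (IsLocalHom.of_surjective (Ideal.Quotient.mk I) Ideal.Quotient.mk_surjective).1 _ h
    have hu2 := (IsLocalHom.of_surjective π.toRingHom hπ).1 _ hu1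
    rw [MvPowerSeries.isUnit_iff_constantCoeff, constantCoeff_C] at hu2
    exact hpm hu2
  have h1 : Submodule.span V ((Ideal.Quotient.mk I) '' s) = ⊤ := by
    apply span_eq_top_of_complete (Ideal.span {p}) _ (hs.image _)
    rw [eq_top_iff]
    intro z _
    obtain ⟨z, rfl⟩ := Ideal.Quotient.mk_surjective z
    obtain ⟨w, rfl⟩ := hπ z
    obtain ⟨a, ha, hb⟩ := poly_mem_span_add (N := N) w
    have hz : w = a + (w - a) := by ring
    rw [hz, map_add, map_add]
    refine Submodule.add_mem_sup ?_ ?_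
    · have := Submodule.mem_map_of_mem (f := ((Ideal.Quotient.mkₐ V I).toLinearMap.comp
        (π.toLinearMap))) ha
      rw [Submodule.map_span, ← Set.image_comp] at this
      rw [← Set.image_comp]
      exact this
    · obtain ⟨b1, hb1, b2, hb2, hbs⟩ := Submodule.mem_sup.1 (hN _ hb)
      rw [← hbs, map_add]
      have e2 : Ideal.Quotient.mk I b2 = 0 := by
        rw [Ideal.Quotient.eq_zero_iff_mem, hIs]
        exact hb2
      rw [e2, add_zero]
      obtain ⟨c, rfl⟩ := Ideal.mem_span_singleton.1 hb1
      have : Ideal.Quotient.mk I (algebraMap V D p * c) = p • Ideal.Quotient.mk I c := by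
        rw [← Algebra.smul_def]; rfl
      rw [this]
      exact Submodule.smul_mem_smul (Ideal.mem_span_singleton_self p) trivial
  have hH2 : IsHausdorff (XI τ V) D := isHausdorff_of_map_ne_top _ hI
  have h2 : Submodule.span (MvPowerSeries τ V) s = ⊤ := by
    apply span_eq_top_of_complete (XI τ V) _ hs
    rw [eq_top_iff]
    intro z _
    have hz : Ideal.Quotient.mk I z ∈ Submodule.span V ((Ideal.Quotient.mk I) '' s) := by
      rw [h1]; trivial
    have : Submodule.span V ((Ideal.Quotient.mk I) '' s) =
        (Submodule.span V s).map (Ideal.Quotient.mkₐ V I).toLinearMap := by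
      rw [Submodule.map_span]; rfl
    rw [this] at hz
    obtain ⟨a, ha, haz⟩ := hz
    have hza : z - a ∈ I := by rw [← Ideal.Quotient.eq]; exact haz.symm
    have : z = a + (z - a) := by ring
    rw [this]
    refine Submodule.add_mem_sup ?_ ?_
    · exact Submodule.span_le_restrictScalars V (MvPowerSeries τ V) s ha
    · rw [Ideal.smul_top_eq_map]; exact hza
  change Module.Finite (MvPowerSeries τ V) D
  exact ⟨⟨hs.toFinset, by rw [hs.coe_toFinset]; exact h2⟩⟩

end Fin
end

section
open MvPowerSeries
theorem ringKrullDim_le_of_isIntegral {A D : Type*} [CommRing A] [CommRing D] (f : A →+* D)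
    (hf : f.IsIntegral) : ringKrullDim D ≤ ringKrullDim A := by
  let _ := f.toAlgebra
  have hi : Algebra.IsIntegral A D := ⟨hf⟩
  refine Order.krullDim_le_of_strictMono (PrimeSpectrum.comap f) ?_
  intro P Q hPQ
  obtain ⟨x, hx, hx'⟩ := Set.exists_of_ssubset (show (P.asIdeal : Set D) ⊂ Q.asIdeal from hPQ)
  have := Ideal.comap_lt_comap_of_integral_mem_sdiff (R := A) (S := D) (I := P.asIdeal)
    (J := Q.asIdeal) hPQ.le ⟨hx, hx'⟩ (hf x)
  exact this

section
variable {V : Type*} [CommRing V] {p : V} [IsNoetherianRing V] [IsLocalRing V]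
  (hm : maximalIdeal V = Ideal.span {p})

include hm in
theorem mem_maximalIdeal_ps_iff {σ : Type*} {w : MvPowerSeries σ V} :
    w ∈ maximalIdeal (MvPowerSeries σ V) ↔ constantCoeff w ∈ Ideal.span {p} := by
  rw [mem_maximalIdeal, mem_nonunits_iff, MvPowerSeries.isUnit_iff_constantCoeff,
    ← mem_nonunits_iff, ← mem_maximalIdeal, hm]

include hm in
theorem ringKrullDim_ps_le (r : ℕ) : ringKrullDim (MvPowerSeries (Fin r) V) ≤ (r + 1 : ℕ) := by
  classical
  refine (ringKrullDim_le_spanFinrank_maximalIdeal _).trans ?_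
  have h1 : maximalIdeal (MvPowerSeries (Fin r) V) =
      Ideal.span (insert (C p) (Set.range (X : Fin r → MvPowerSeries (Fin r) V))) := by
    apply le_antisymm
    · intro w hw
      obtain ⟨c, hc⟩ := Ideal.mem_span_singleton.1 ((mem_maximalIdeal_ps_iff hm).1 hw)
      have hw2 : w = C p * C c + (w - C (constantCoeff w)) := by rw [hc, ← map_mul]; ring
      rw [hw2]
      refine add_mem (Ideal.mul_mem_right _ _ (Ideal.subset_span (Set.mem_insert _ _))) ?_
      have : w - C (constantCoeff w) ∈ XI (Fin r) V := by rw [mem_XI_iff]; simp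
      exact Ideal.span_mono (Set.subset_insert _ _) this
    · rw [Ideal.span_le, Set.insert_subset_iff]
      refine ⟨?_, ?_⟩
      · rw [SetLike.mem_coe, mem_maximalIdeal_ps_iff hm]
        simpa using Ideal.mem_span_singleton_self p
      · rintro _ ⟨i, rfl⟩
        rw [SetLike.mem_coe, mem_maximalIdeal_ps_iff hm]
        simp
  rw [h1]
  have h2 := Submodule.spanFinrank_span_le_ncard_of_finite (R := MvPowerSeries (Fin r) V)
    (s := insert (C p) (Set.range (X : Fin r → MvPowerSeries (Fin r) V)))
    ((Set.finite_range _).insert _)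
  have h3 : (insert (C p) (Set.range (X : Fin r → MvPowerSeries (Fin r) V))).ncard ≤ r + 1 := by
    refine (Set.ncard_insert_le _ _).trans ?_
    have : (Set.range (X : Fin r → MvPowerSeries (Fin r) V)).ncard ≤ r := by
      rw [← Set.image_univ]
      refine (Set.ncard_image_le Set.finite_univ).trans ?_
      simp
    omega
  exact_mod_cast h2.trans h3

variable [IsDomain V] [IsAdicComplete (Ideal.span {p}) V] {σ : Type*} [Finite σ]

include hm in
theorem exists_noether {D : Type*} [CommRing D] [Algebra V D] [IsDomain D] [IsNoetherianRing D]
    [IsLocalRing D] (π : MvPowerSeries σ V →ₐ[V] D) (hπ : Function.Surjective π)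
    (hp : algebraMap V D p ≠ 0) :
    ∃ r : ℕ, ∃ φ : MvPowerSeries (Fin r) V →ₐ[V] MvPowerSeries σ V,
      (∀ i, φ (X i) ∈ XI σ V) ∧ (π.comp φ).toRingHom.Finite ∧ Function.Injective (π.comp φ) := by
  classical
  have hloc : IsLocalHom π.toRingHom := IsLocalHom.of_surjective π.toRingHom hπ
  have hmem : ∀ w, w ∈ maximalIdeal (MvPowerSeries σ V) ↔
      π w ∈ maximalIdeal D := by
    intro w
    rw [mem_maximalIdeal, mem_maximalIdeal, mem_nonunits_iff,
      mem_nonunits_iff]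
    exact not_congr ⟨fun h => h.map π, fun h => hloc.1 _ h⟩
  have hpi : π (C p) = algebraMap V D p := π.commutes p
  have hpD : algebraMap V D p ∈ maximalIdeal D := by
    rw [← hpi, ← hmem, mem_maximalIdeal_ps_iff hm]
    simpa using Ideal.mem_span_singleton_self p
  let D2 := D ⧸ Ideal.span {algebraMap V D p}
  have hne : Ideal.span {algebraMap V D p} ≠ ⊤ := fun h =>
    (maximalIdeal.isMaximal D).ne_top (top_le_iff.1 (h ▸ (by
      rw [Ideal.span_le, Set.singleton_subset_iff]; exact hpD)))
  have : Nontrivial D2 := Ideal.Quotient.nontrivial_iff.2 hne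
  let π2 : D →+* D2 := Ideal.Quotient.mk _
  have hs2 : Function.Surjective π2 := Ideal.Quotient.mk_surjective
  have : IsLocalRing D2 := IsLocalRing.of_surjective' π2 hs2
  have hloc2 : IsLocalHom π2 := IsLocalHom.of_surjective π2 hs2
  have hmem2 : ∀ w, w ∈ maximalIdeal D ↔
      π2 w ∈ maximalIdeal D2 := by
    intro w
    rw [mem_maximalIdeal, mem_maximalIdeal, mem_nonunits_iff,
      mem_nonunits_iff]
    exact not_congr ⟨fun h => h.map π2, fun h => hloc2.1 _ h⟩
  obtain ⟨s, hs, hcard⟩ := Ideal.exists_finset_card_eq_height_of_isNoetherianRing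
    (maximalIdeal D2)
  have hrad : (Ideal.span (s : Set D2)).radical = maximalIdeal D2 := by
    rw [← Ideal.sInf_minimalPrimes]
    have : (Ideal.span (s : Set D2)).minimalPrimes = {maximalIdeal D2} := by
      apply Set.eq_singleton_iff_unique_mem.2 ⟨hs, ?_⟩
      intro P hP
      have hP1 : P ≤ maximalIdeal D2 := IsLocalRing.le_maximalIdeal hP.1.1.ne_top
      exact le_antisymm hP1 (hs.2 hP.1 hP1)
    rw [this, sInf_singleton]
  obtain ⟨N, hN⟩ := Ideal.exists_pow_le_of_le_radical_of_fg hrad.ge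
    (IsNoetherian.noetherian (maximalIdeal D2))
  have hlift : ∀ t ∈ s, ∃ w ∈ XI σ V, π2 (π w) = t := by
    intro t ht
    obtain ⟨d, rfl⟩ := hs2 t
    obtain ⟨w, rfl⟩ := hπ d
    refine ⟨w - C (constantCoeff w), by rw [mem_XI_iff]; simp, ?_⟩
    have h1 : π2 (π w) ∈ maximalIdeal D2 := hs.1.2 (Ideal.subset_span ht)
    rw [← hmem2, ← hmem, mem_maximalIdeal_ps_iff hm, Ideal.mem_span_singleton] at h1
    obtain ⟨c, hc⟩ := h1
    have h2 : π2 (π (C (constantCoeff w))) = 0 := by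
      rw [hc, map_mul, map_mul, hpi]
      exact Ideal.Quotient.eq_zero_iff_mem.2
        (Ideal.mul_mem_right _ _ (Ideal.mem_span_singleton_self _))
    rw [map_sub, map_sub, h2, sub_zero]
  let e := s.equivFin
  choose! y hyX hy using hlift
  obtain ⟨φ, hφ⟩ := exists_psLift (R := V) (XI σ V) (fun i : Fin s.card => y (e.symm i))
    (fun i => hyX _ (e.symm i).2)
  have hrange : π2 '' (Set.range fun i => (π.comp φ) (X i)) = s := by
    ext t
    constructor
    · rintro ⟨_, ⟨i, rfl⟩, rfl⟩
      have : (π.comp φ) (X i) = π (y (e.symm i)) := by rw [← hφ]; rfl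
      beta_reduce
      rw [this, hy _ (e.symm i).2]
      exact (e.symm i).2
    · intro ht
      refine ⟨_, ⟨e ⟨t, ht⟩, rfl⟩, ?_⟩
      have : (π.comp φ) (X (e ⟨t, ht⟩)) = π (y t) := by
        change π (φ _) = _
        rw [hφ]; simp
      beta_reduce
      rw [this, hy _ ht]
  have hfin : (π.comp φ).toRingHom.Finite := by
    refine finite_of_params hm π hπ (π.comp φ) (fun i => ?_) N fun w hw => ?_
    · change π (φ (X i)) ∈ _
      rw [← hmem, mem_maximalIdeal_ps_iff hm, hφ, mem_XI_iff.1 (hyX _ (e.symm i).2)]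
      exact zero_mem _
    · have h1 : (π2.comp π.toRingHom) w ∈ maximalIdeal D2 ^ N := by
        refine psHom_XI_pow_le _ (fun i => ?_) N hw
        change π2 (π (X i)) ∈ _
        rw [← hmem2, ← hmem, mem_maximalIdeal_ps_iff hm]
        simp
      have h2 := hN h1
      rw [← hrange, ← Ideal.map_span] at h2
      have h3 : π w ∈ Ideal.comap π2 (Ideal.map π2
        (Ideal.span (Set.range fun i => (π.comp φ) (X i)))) := h2
      rw [Ideal.comap_map_of_surjective' π2 hs2, Ideal.mk_ker, sup_comm] at h3
      exact h3
  refine ⟨s.card, φ, fun i => by rw [hφ]; exact hyX _ (e.symm i).2, hfin, ?_⟩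
  rw [injective_iff_map_eq_zero]
  intro c hc
  by_contra hc0
  let B := MvPowerSeries (Fin s.card) V
  let f : B ⧸ Ideal.span {c} →+* D := Ideal.Quotient.lift _ (π.comp φ).toRingHom (by
    intro a ha
    obtain ⟨b, rfl⟩ := Ideal.mem_span_singleton.1 ha
    rw [map_mul]
    have : (π.comp φ).toRingHom c = 0 := hc
    rw [this, zero_mul])
  have hf : f.IsIntegral := by
    have h1 : (f.comp (Ideal.Quotient.mk _)).IsIntegral := by
      have : f.comp (Ideal.Quotient.mk _) = (π.comp φ).toRingHom := by ext x; rfl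
      rw [this]; exact hfin.to_isIntegral
    exact RingHom.IsIntegral.tower_top _ _ h1
  have d1 := ringKrullDim_le_of_isIntegral f hf
  have d2 := ringKrullDim_quotient_succ_le_of_nonZeroDivisor
    (mem_nonZeroDivisors_of_ne_zero hc0)
  have d3 := ringKrullDim_ps_le hm s.card
  have d4 := ringKrullDim_quotient_succ_le_of_nonZeroDivisor
    (mem_nonZeroDivisors_of_ne_zero hp)
  have d5 : ringKrullDim D2 = (s.card : ℕ) := by
    rw [← IsLocalRing.maximalIdeal_height_eq_ringKrullDim, ← hcard]; rfl
  change ringKrullDim D2 + 1 ≤ _ at d4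
  rw [d5] at d4
  have d6 : ringKrullDim (B ⧸ Ideal.span {c}) + 1 ≤ (s.card + 1 : ℕ) := d2.trans d3
  have d7 := (add_le_add_left (d4.trans d1) 1).trans d6
  norm_cast at d7
  omega

end
end

section
open MvPowerSeries
variable {V : Type*} [CommRing V] {p : V} [IsNoetherianRing V] [IsLocalRing V]
  (hm : maximalIdeal V = Ideal.span {p})
variable [IsDomain V] [IsAdicComplete (Ideal.span {p}) V] {σ : Type*} [Finite σ]

include hm in
theorem exists_finite_quotient {D : Type*} [CommRing D] [Algebra V D] [IsDomain D]
    [IsNoetherianRing D]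
    [IsLocalRing D] (π : MvPowerSeries σ V →ₐ[V] D) (hπ : Function.Surjective π)
    (hp : algebraMap V D p ≠ 0) :
    ∃ P : Ideal D, P.IsPrime ∧ algebraMap V D p ∉ P ∧ Module.Finite V (D ⧸ P) := by
  obtain ⟨r, φ, -, hfin, hinj⟩ := exists_noether hm π hπ hp
  let B := MvPowerSeries (Fin r) V
  let f : B →ₐ[V] D := π.comp φ
  let _ : Algebra B D := f.toRingHom.toAlgebra
  have hfin' : Module.Finite B D := hfin
  have hinj' : Function.Injective (algebraMap B D) := hinj
  have hX : (XI (Fin r) V) = RingHom.ker (constantCoeff (σ := Fin r) (R := V)) := by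
    ext w; rw [mem_XI_iff, RingHom.mem_ker]
  have hXp : (XI (Fin r) V).IsPrime := by
    rw [hX]; exact RingHom.ker_isPrime _
  have hker : RingHom.ker (algebraMap B D) ≤ XI (Fin r) V := by
    rw [(RingHom.injective_iff_ker_eq_bot _).1 hinj']; exact bot_le
  obtain ⟨P, hP, hPc⟩ := Ideal.exists_ideal_over_prime_of_isIntegral_of_isDomain (S := D)
    (XI (Fin r) V) hker
  refine ⟨P, hP, ?_, ?_⟩
  · intro h
    have h1 : C p ∈ P.comap (algebraMap B D) := by
      have : algebraMap B D (C p) = algebraMap V D p := f.commutes p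
      rw [Ideal.mem_comap, this]; exact h
    rw [hPc, mem_XI_iff, constantCoeff_C] at h1
    exact hp (by rw [h1, map_zero])
  · obtain ⟨s, hs⟩ := hfin'.fg_top
    classical
    refine ⟨⟨s.image (Ideal.Quotient.mk P), ?_⟩⟩
    rw [eq_top_iff]
    intro z _
    obtain ⟨z, rfl⟩ := Ideal.Quotient.mk_surjective z
    have hz : z ∈ Submodule.span B (s : Set D) := by rw [hs]; trivial
    induction hz using Submodule.span_induction with
    | mem x hx => exact Submodule.subset_span (Finset.mem_coe.2 (Finset.mem_image_of_mem _ hx))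
    | zero => rw [map_zero]; exact zero_mem _
    | add x y _ _ h1 h2 => rw [map_add]; exact add_mem (h1 trivial) (h2 trivial)
    | smul b x _ h1 =>
      have h2 : Ideal.Quotient.mk P (b • x) = constantCoeff b • Ideal.Quotient.mk P x := by
        have h3 : constantCoeff b • Ideal.Quotient.mk P x =
            Ideal.Quotient.mk P (algebraMap V D (constantCoeff b) * x) := by
          rw [← Algebra.smul_def]; rfl
        rw [h3, Algebra.smul_def, Ideal.Quotient.eq, ← sub_mul]
        refine Ideal.mul_mem_right _ _ ?_
        have h4 : algebraMap V D (constantCoeff b) = algebraMap B D (C (constantCoeff b)) :=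
          (f.commutes _).symm
        rw [h4, ← map_sub, ← Ideal.mem_comap, hPc, mem_XI_iff]
        simp
      rw [h2]
      exact Submodule.smul_mem _ _ (h1 trivial)
end

/-- An algebraic extension of characteristic zero lifts along square-zero thickenings. -/
theorem exists_section {B κ C : Type*} [CommRing B] [IsDomain B] [Field κ] [CharZero κ] [CommRing C]
    [Algebra B κ] [Algebra.IsAlgebraic B κ] (hinj : Function.Injective (algebraMap B κ))
    (ρ : C →+* κ) (hρ : Function.Surjective ρ) (hn : RingHom.ker ρ ^ 2 = ⊥) (ψ : B →+* C)
    (hψ : ∀ b, ρ (ψ b) = algebraMap B κ b) :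
    ∃ σ : κ →+* C, (∀ z, ρ (σ z) = z) ∧ ∀ b, σ (algebraMap B κ b) = ψ b := by
  have hunit : ∀ y : nonZeroDivisors B, IsUnit (ψ y) := by
    intro y
    have h0 : ρ (ψ y) ≠ 0 := by
      rw [hψ, map_ne_zero_iff _ hinj]
      exact nonZeroDivisors.ne_zero y.2
    obtain ⟨c, hc⟩ := hρ (ρ (ψ y))⁻¹
    have h1 : ψ y * c - 1 ∈ RingHom.ker ρ := by
      rw [RingHom.mem_ker, map_sub, map_mul, hc, mul_inv_cancel₀ h0, map_one, sub_self]
    have h2 : IsNilpotent (ψ y * c - 1) := ⟨2, by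
      have := Ideal.pow_mem_pow h1 2
      rwa [hn, Ideal.mem_bot] at this⟩
    have h3 := h2.isUnit_add_one
    rw [sub_add_cancel] at h3
    exact isUnit_of_mul_isUnit_left h3
  let L := FractionRing B
  let f1 : L →+* κ := IsFractionRing.lift hinj
  let f2 : L →+* C := IsLocalization.lift hunit
  let _ : Algebra L κ := f1.toAlgebra
  let _ : Algebra L C := f2.toAlgebra
  have ht : IsScalarTower B L κ := IsScalarTower.of_algebraMap_eq (fun b =>
    (IsFractionRing.lift_algebraMap hinj b).symm)
  have : Algebra.IsAlgebraic L κ :=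
    (IsFractionRing.comap_isAlgebraic_iff (A := B) (K := L) (C := κ)).1 inferInstance
  have : CharZero L := (algebraMap L κ).charZero
  have := Algebra.FormallyEtale.of_isSeparable L κ
  let g : C →ₐ[L] κ := { ρ with
    commutes' := by
      have : ρ.comp f2 = f1 := by
        apply IsLocalization.ringHom_ext (nonZeroDivisors B)
        ext b
        have e1 : f2 (algebraMap B L b) = ψ b := IsLocalization.lift_eq _ _
        have e2 : f1 (algebraMap B L b) = algebraMap B κ b := IsFractionRing.lift_algebraMap _ _
        simp only [RingHom.comp_apply]
        rw [e1, e2, hψ]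
      exact fun r => DFunLike.congr_fun this r }
  have hg : IsNilpotent (RingHom.ker (g : C →+* κ)) := ⟨2, hn⟩
  let s := Algebra.FormallySmooth.liftOfSurjective (AlgHom.id L κ) g hρ hg
  refine ⟨s.toRingHom, fun z => ?_, fun b => ?_⟩
  · exact Algebra.FormallySmooth.liftOfSurjective_apply (AlgHom.id L κ) g hρ hg z
  · have h1 : algebraMap B κ b = algebraMap L κ (algebraMap B L b) :=
      IsScalarTower.algebraMap_apply B L κ b
    have h2 : s (algebraMap L κ (algebraMap B L b)) = f2 (algebraMap B L b) := s.commutes _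
    rw [h1]
    exact h2.trans (IsLocalization.lift_eq _ _)

/-- Derivations extend to algebraic extensions in characteristic zero. -/
theorem exists_der_extension {B κ : Type*} [CommRing B] [IsDomain B] [Field κ] [CharZero κ]
    [Algebra B κ] [Algebra.IsAlgebraic B κ] (hinj : Function.Injective (algebraMap B κ))
    (d : Derivation ℤ B B) :
    ∃ η : Derivation ℤ κ κ, ∀ b, η (algebraMap B κ b) = algebraMap B κ (d b) := by
  have hfst : ∀ z : κ, TrivSqZeroExt.fst (algebraMap κ (DualNumber κ) z) = z := fun _ => rfl
  let ψ : B →+* TrivSqZeroExt κ κ :=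
    { toFun := fun b => TrivSqZeroExt.inl (algebraMap B κ b) + TrivSqZeroExt.inr (algebraMap B κ (d b))
      map_one' := by ext <;> simp
      map_zero' := by ext <;> simp
      map_add' := fun a b => by ext <;> simp [Algebra.smul_def]
      map_mul' := fun a b => by
        ext
        · simp
        · simp [mul_comm, Algebra.smul_def, add_comm, hfst] }
  let ρ : TrivSqZeroExt κ κ →+* κ := (TrivSqZeroExt.fstHom κ κ κ).toRingHom
  obtain ⟨σ, h1, h2⟩ := exists_section hinj ρ (fun z => ⟨TrivSqZeroExt.inl z, rfl⟩) (by
    rw [eq_bot_iff, pow_two, Ideal.mul_le]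
    intro a ha b hb
    have ha' : a.fst = 0 := ha
    have hb' : b.fst = 0 := hb
    rw [Ideal.mem_bot]
    ext <;> simp [ha', hb']) ψ (fun b => by
      change (TrivSqZeroExt.inl (algebraMap B κ b) + TrivSqZeroExt.inr (algebraMap B κ (d b)) :
        TrivSqZeroExt κ κ).fst = _
      simp)
  have h1' : ∀ z, (σ z).fst = z := h1
  refine ⟨Derivation.mk' (AddMonoidHom.toIntLinearMap
    { toFun := fun z => (σ z).snd
      map_zero' := by simp
      map_add' := fun a b => by simp }) (fun a b => ?_), fun b => ?_⟩
  · change (σ (a * b)).snd = a • (σ b).snd + b • (σ a).snd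
    rw [map_mul, TrivSqZeroExt.snd_mul, h1', h1']
    simp [mul_comm]
  · change (σ _).snd = _
    rw [h2]
    change (TrivSqZeroExt.inl (algebraMap B κ b) + TrivSqZeroExt.inr (algebraMap B κ (d b)) :
        TrivSqZeroExt κ κ).snd = _
    simp [Algebra.smul_def, hfst]

section
open MvPowerSeries
variable {V : Type*} [CommRing V] {p : V} [IsNoetherianRing V] [IsLocalRing V]
  (hm : maximalIdeal V = Ideal.span {p})
variable [IsDomain V] [IsAdicComplete (Ideal.span {p}) V] {σ : Type*} [Fintype σ]

include hm in
theorem exists_noether_prime (q : Ideal (MvPowerSeries σ V)) [q.IsPrime] (hp : C p ∉ q) :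
    ∃ (r : ℕ) (φ : MvPowerSeries (Fin r) V →ₐ[V] MvPowerSeries σ V) (s : Finset (MvPowerSeries σ V)),
      (∀ b, φ b ∈ q → b = 0) ∧ ((Ideal.Quotient.mk q).comp φ.toRingHom).IsIntegral ∧
      ∀ w, ∃ c : MvPowerSeries σ V → MvPowerSeries (Fin r) V, w - ∑ e ∈ s, φ (c e) * e ∈ q := by
  classical
  have : IsLocalRing (MvPowerSeries σ V ⧸ q) :=
    IsLocalRing.of_surjective' (Ideal.Quotient.mk q) Ideal.Quotient.mk_surjective
  have hp' : algebraMap V (MvPowerSeries σ V ⧸ q) p ≠ 0 := by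
    intro h
    exact hp (Ideal.Quotient.eq_zero_iff_mem.1 h)
  obtain ⟨r, φ, -, hfin, hinj⟩ := exists_noether hm (Ideal.Quotient.mkₐ V q)
    Ideal.Quotient.mk_surjective hp'
  let B := MvPowerSeries (Fin r) V
  let f := ((Ideal.Quotient.mkₐ V q).comp φ).toRingHom
  let _ : Algebra B (MvPowerSeries σ V ⧸ q) := f.toAlgebra
  have hfin' : Module.Finite B (MvPowerSeries σ V ⧸ q) := hfin
  obtain ⟨s, hs⟩ := hfin'.fg_top
  refine ⟨r, φ, s.image Quotient.out, ?_, ?_, ?_⟩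
  · intro b hb
    apply hinj
    rw [map_zero]
    exact Ideal.Quotient.eq_zero_iff_mem.2 hb
  · exact hfin.to_isIntegral
  · intro w
    have hw : Ideal.Quotient.mk q w ∈ Submodule.span B (s : Set (MvPowerSeries σ V ⧸ q)) := by
      rw [hs]; trivial
    obtain ⟨c, hc⟩ := Submodule.mem_span_finset.1 hw
    refine ⟨fun e => c (Ideal.Quotient.mk q e), ?_⟩
    have hout : ∀ x : MvPowerSeries σ V ⧸ q, Ideal.Quotient.mk q x.out = x := fun x =>
      Quotient.out_eq' x
    rw [Finset.sum_image (fun a _ b _ h => by rw [← hout a, ← hout b, h]), ← Ideal.Quotient.eq,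
      ← hc.2, map_sum]
    refine Finset.sum_congr rfl fun x _ => ?_
    simp only [map_mul, hout, Algebra.smul_def]
    rfl

theorem isAlgebraic_of_fractions {B W κ : Type*} [CommRing B] [IsDomain B] [CommRing W] [Field κ]
    [Algebra W κ] [Algebra B κ] (hinj : Function.Injective (algebraMap B κ))
    (hi : ∀ w : W, IsIntegral B (algebraMap W κ w))
    (hfrac : ∀ z : κ, ∃ w y : W, z = algebraMap W κ w / algebraMap W κ y) :
    Algebra.IsAlgebraic B κ := by
  refine ⟨fun z => ?_⟩
  obtain ⟨w, y, rfl⟩ := hfrac z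
  have : FaithfulSMul B κ := (faithfulSMul_iff_algebraMap_injective B κ).2 hinj
  rw [div_eq_mul_inv]
  exact (hi w).isAlgebraic.mul (hi y).isAlgebraic.inv

include hm in
theorem jac_aux (q : Ideal (MvPowerSeries σ V)) [q.IsPrime] (hp : C p ∉ q) {κ C2 : Type*} [Field κ]
    [CharZero κ] [Algebra (MvPowerSeries σ V) κ] (hker : ∀ w, algebraMap (MvPowerSeries σ V) κ w = 0 ↔ w ∈ q)
    (hfrac : ∀ z : κ, ∃ w y, z = algebraMap (MvPowerSeries σ V) κ w / algebraMap (MvPowerSeries σ V) κ y)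
    [CommRing C2] [Algebra (MvPowerSeries σ V) C2] [Algebra V C2] [IsScalarTower V (MvPowerSeries σ V) C2]
    (ρ : C2 →+* κ) (hρ : Function.Surjective ρ) (hn : RingHom.ker ρ ^ 2 = ⊥)
    (hρa : ∀ w, ρ (algebraMap (MvPowerSeries σ V) C2 w) = algebraMap (MvPowerSeries σ V) κ w)
    {u : MvPowerSeries σ V} (hu : u ∈ q) (hdu : ∀ i, pderiv V i u ∈ q) :
    algebraMap (MvPowerSeries σ V) C2 u = 0 := by
  classical
  obtain ⟨r, φ, s, hφ, hInt, hs⟩ := exists_noether_prime hm q hp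
  let B := MvPowerSeries (Fin r) V
  let W := MvPowerSeries σ V
  have : IsDomain B := NoZeroDivisors.to_isDomain (MvPowerSeries (Fin r) V)
  let _ : Algebra B κ := ((algebraMap W κ).comp φ.toRingHom).toAlgebra
  have hB : ∀ b : B, algebraMap B κ b = algebraMap W κ (φ b) := fun _ => rfl
  have hinj : Function.Injective (algebraMap B κ) := by
    rw [injective_iff_map_eq_zero]
    intro b hb
    exact hφ b ((hker _).1 hb)
  have hq : ∀ w ∈ q, algebraMap W κ w = 0 := fun w hw => (hker w).2 hw
  have halg : Algebra.IsAlgebraic B κ := by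
    refine isAlgebraic_of_fractions (W := W) hinj (fun w => ?_) hfrac
    obtain ⟨P, hP, hP2⟩ := hInt (Ideal.Quotient.mk q w)
    refine ⟨P, hP, ?_⟩
    have h1 := congrArg (Ideal.Quotient.lift q (algebraMap W κ) hq) hP2
    rw [map_zero, Polynomial.hom_eval₂] at h1
    exact h1
  obtain ⟨τ, hτ, hτB⟩ := exists_section hinj ρ hρ hn
    ((algebraMap W C2).comp φ.toRingHom) (fun b => hρa _)
  have hτB' : ∀ b : B, τ (algebraMap W κ (φ b)) = algebraMap W C2 (φ b) := hτB
  have hV : ∀ v : V, φ (C v) = C v := fun v => φ.commutes v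
  let D0 : W → C2 := fun w => algebraMap W C2 w - τ (algebraMap W κ w)
  have hD0 : ∀ w, D0 w ∈ RingHom.ker ρ := fun w => by
    rw [RingHom.mem_ker, map_sub, hτ, hρa, sub_self]
  have hCV : ∀ v : V, algebraMap V C2 v = algebraMap W C2 (C v) := fun v =>
    IsScalarTower.algebraMap_apply V W C2 v
  let D : Derivation V W C2 := Derivation.mk'
    { toFun := D0
      map_add' := fun a b => by simp only [D0, map_add]; ring
      map_smul' := fun v a => by
        have h1 := hτB' (C v)
        rw [hV] at h1
        simp only [D0, Algebra.smul_def, map_mul, RingHom.id_apply, hCV]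
        change algebraMap W C2 (C v) * _ - τ (algebraMap W κ (C v)) * _ = _
        rw [h1]; ring } (fun a b => by
      change D0 (a * b) = a • D0 b + b • D0 a
      have h1 : D0 a * D0 b = 0 := by
        have := Ideal.mul_mem_mul (hD0 a) (hD0 b)
        rwa [← pow_two, hn, Ideal.mem_bot] at this
      rw [Algebra.smul_def, Algebra.smul_def]
      have e1 : D0 (a * b) = algebraMap W C2 a * algebraMap W C2 b -
        τ (algebraMap W κ a) * τ (algebraMap W κ b) := by simp only [D0, map_mul]
      rw [e1]
      simp only [D0] at h1 ⊢
      linear_combination -h1)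
  let N' : Submodule W C2 := Submodule.span W (insert 1 ((fun e => τ (algebraMap W κ e)) '' s))
  have hN : N'.FG := ⟨insert 1 (s.image fun e => τ (algebraMap W κ e)), by simp [N']⟩
  have hDN : ∀ w, D w ∈ N' := by
    intro w
    obtain ⟨c, hc⟩ := hs w
    have h1 : algebraMap W κ w = ∑ e ∈ s, algebraMap W κ (φ (c e)) * algebraMap W κ e := by
      have := hq _ hc
      rw [map_sub, sub_eq_zero, map_sum] at this
      rw [this]
      exact Finset.sum_congr rfl fun e _ => map_mul _ _ _
    change algebraMap W C2 w - τ (algebraMap W κ w) ∈ N'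
    refine sub_mem ?_ ?_
    · rw [Algebra.algebraMap_eq_smul_one]
      exact Submodule.smul_mem _ _ (Submodule.subset_span (Set.mem_insert _ _))
    · rw [h1, map_sum]
      refine sum_mem fun e he => ?_
      rw [map_mul, hτB', ← Algebra.smul_def]
      exact Submodule.smul_mem _ _ (Submodule.subset_span (Set.mem_insert_of_mem _ ⟨e, he, rfl⟩))
  have hD := der_eq_sum D N' hN hDN u
  have h0 : D u = algebraMap W C2 u := by
    change algebraMap W C2 u - τ (algebraMap W κ u) = _
    rw [hq u hu, map_zero, sub_zero]
  have h2 : algebraMap (MvPowerSeries σ V) C2 u = D u := h0.symm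
  rw [h2, hD]
  refine Finset.sum_eq_zero fun i _ => ?_
  rw [Algebra.smul_def]
  have h3 : algebraMap W C2 (pderiv V i u) ∈ RingHom.ker ρ := by
    rw [RingHom.mem_ker, hρa]; exact hq _ (hdu i)
  have := Ideal.mul_mem_mul h3 (hD0 (X i))
  rwa [← pow_two, hn, Ideal.mem_bot] at this

theorem exists_mul_mem_of_mem_sq {W A : Type*} [CommRing W] (q : Ideal W) [q.IsPrime] [CommRing A]
    [IsLocalRing A] [Algebra W A] [IsLocalization.AtPrime A q] {u : W}
    (h2 : algebraMap W A u ∈ maximalIdeal A ^ 2) : ∃ g ∉ q, g * u ∈ q ^ 2 := by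
  rw [← IsLocalization.AtPrime.map_eq_maximalIdeal q A, ← Ideal.map_pow,
    IsLocalization.mem_map_algebraMap_iff q.primeCompl] at h2
  obtain ⟨⟨a, g⟩, hag⟩ := h2
  rw [← map_mul, IsLocalization.eq_iff_exists q.primeCompl] at hag
  obtain ⟨c, hc⟩ := hag
  refine ⟨c * g, (c * g).2, ?_⟩
  have : (c : W) * g * u = c * (u * g) := by ring
  rw [this, hc]
  exact Ideal.mul_mem_left _ _ a.2

theorem algebraMap_residueField_eq_zero_iff {W A : Type*} [CommRing W] (q : Ideal W) [q.IsPrime]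
    [CommRing A] [IsLocalRing A] [Algebra W A] [IsLocalization.AtPrime A q] (w : W) :
    algebraMap W (ResidueField A) w = 0 ↔ w ∈ q := by
  rw [IsScalarTower.algebraMap_apply W A (ResidueField A),
    ResidueField.algebraMap_eq, IsLocalRing.residue_eq_zero_iff,
    IsLocalization.AtPrime.to_map_mem_maximal_iff A q]

theorem residueField_fraction {W A : Type*} [CommRing W] (q : Ideal W) [q.IsPrime]
    [CommRing A] [IsLocalRing A] [Algebra W A] [IsLocalization.AtPrime A q]
    (z : ResidueField A) : ∃ w y, y ∉ q ∧ z = algebraMap W (ResidueField A) w /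
      algebraMap W (ResidueField A) y := by
  obtain ⟨a, rfl⟩ := IsLocalRing.residue_surjective z
  obtain ⟨w, y, rfl⟩ := IsLocalization.exists_mk'_eq q.primeCompl a
  refine ⟨w, y, y.2, ?_⟩
  rw [eq_div_iff (fun h => y.2 ((algebraMap_residueField_eq_zero_iff (A := A) q _).1 h)),
    IsScalarTower.algebraMap_apply W A (ResidueField A) y,
    IsScalarTower.algebraMap_apply W A (ResidueField A) w,
    ResidueField.algebraMap_eq, ← map_mul, IsLocalization.mk'_spec]

section
variable {A : Type*} [CommRing A] [IsLocalRing A]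

def resSq (A : Type*) [CommRing A] [IsLocalRing A] :
    A ⧸ maximalIdeal A ^ 2 →+* ResidueField A :=
  Ideal.Quotient.lift _ (residue A) (fun a ha => by
    rw [IsLocalRing.residue_eq_zero_iff]; exact Ideal.pow_le_self two_ne_zero ha)

theorem resSq_ker : RingHom.ker (resSq A) ^ 2 = ⊥ := by
  have h : RingHom.ker (resSq A) ≤
      (maximalIdeal A).map (Ideal.Quotient.mk (maximalIdeal A ^ 2)) := by
    intro a ha
    obtain ⟨a, rfl⟩ := Ideal.Quotient.mk_surjective a
    exact Ideal.mem_map_of_mem _ ((IsLocalRing.residue_eq_zero_iff a).1 ha)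
  have h2 := Ideal.map_pow (Ideal.Quotient.mk (maximalIdeal A ^ 2))
    (maximalIdeal A) 2
  rw [Ideal.map_quotient_self] at h2
  rw [eq_bot_iff, h2]
  exact Ideal.pow_right_mono h 2

theorem resSq_surjective : Function.Surjective (resSq A) := by
  intro z
  obtain ⟨a, rfl⟩ := IsLocalRing.residue_surjective z
  exact ⟨Ideal.Quotient.mk _ a, rfl⟩

end

include hm in
theorem charZero_of_ker [CharZero V] (q : Ideal (MvPowerSeries σ V)) [q.IsPrime] (hp : C p ∉ q)
    {κ : Type*} [Field κ] (f : MvPowerSeries σ V →+* κ) (hker : ∀ w, f w = 0 ↔ w ∈ q) :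
    CharZero κ := by
  obtain ⟨r, φ, s, hφ, hInt, hs⟩ := exists_noether_prime hm q hp
  refine ⟨fun a b hab => ?_⟩
  have h1 : f ((a : MvPowerSeries σ V) - b) = 0 := by
    rw [map_sub, map_natCast, map_natCast, hab, sub_self]
  rw [hker] at h1
  have h2 : φ (((a : MvPowerSeries (Fin r) V)) - b) ∈ q := by
    rw [map_sub, map_natCast, map_natCast]; exact h1
  have h3 := congrArg constantCoeff (hφ _ h2)
  rw [map_sub, map_natCast, map_natCast, map_zero, sub_eq_zero] at h3
  exact_mod_cast h3

include hm in
theorem jac_W [CharZero V] (q : Ideal (MvPowerSeries σ V)) [q.IsPrime] (hp : C p ∉ q)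
    {u : MvPowerSeries σ V} (hu : u ∈ q) (hdu : ∀ i, pderiv V i u ∈ q) :
    ∃ g ∉ q, g * u ∈ q ^ 2 := by
  suffices H : ∀ (A : Type _) [CommRing A] [IsLocalRing A] [Algebra (MvPowerSeries σ V) A]
      [IsLocalization.AtPrime A q],
      algebraMap (MvPowerSeries σ V) A u ∈ maximalIdeal A ^ 2 from
    exists_mul_mem_of_mem_sq q (H (Localization.AtPrime q))
  intro A _ _ _ _
  let _ : Algebra V (A ⧸ maximalIdeal A ^ 2) :=
    ((algebraMap (MvPowerSeries σ V) (A ⧸ maximalIdeal A ^ 2)).comp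
      (algebraMap V (MvPowerSeries σ V))).toAlgebra
  have : IsScalarTower V (MvPowerSeries σ V) (A ⧸ maximalIdeal A ^ 2) :=
    IsScalarTower.of_algebraMap_eq fun _ => rfl
  have := charZero_of_ker hm q hp _ (algebraMap_residueField_eq_zero_iff (A := A) q)
  have h := jac_aux hm q hp (algebraMap_residueField_eq_zero_iff (A := A) q)
    (fun z => by obtain ⟨w, y, -, h⟩ := residueField_fraction (A := A) q z; exact ⟨w, y, h⟩)
    (resSq A) resSq_surjective resSq_ker (fun w => rfl) hu hdu
  exact Ideal.Quotient.eq_zero_iff_mem.1 h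
end

section
open MvPowerSeries
section Lex
variable {σ V : Type*} [CommRing V] [LinearOrder σ]

theorem coeff_add_mul_lex {f g : MvPowerSeries σ V} {p q : σ →₀ ℕ}
    (hf : ∀ d, toLex d < toLex p → coeff d f = 0) (hg : ∀ d, toLex d < toLex q → coeff d g = 0) :
    coeff (p + q) (f * g) = coeff p f * coeff q g := by
  rw [coeff_mul, Finset.sum_eq_single_of_mem ⟨p, q⟩ (by simp)]
  rintro ⟨u, v⟩ h h'
  have h : u + v = p + q := Finset.HasAntidiagonal.mem_antidiagonal.1 h
  rcases trichotomy_of_add_eq_add (congrArg toLex h) with h'' | h'' | h''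
  · exact absurd (by rw [h''.1, h''.2]) h'
  · rw [hf u h'', zero_mul]
  · rw [hg v h'', mul_zero]

theorem coeff_X_mul_pderiv (b : σ) (f : MvPowerSeries σ V) (d : σ →₀ ℕ) :
    coeff d (X b * pderiv V b f) = d b * coeff d f := by
  rw [mul_comm, X, coeff_mul_monomial, coeff_pderiv, mul_one]
  split_ifs with h
  · have hb : 1 ≤ d b := by simpa using h b
    rw [tsub_add_cancel_of_le h, mul_comm]
    congr 1
    have : ((d - Finsupp.single b 1 : σ →₀ ℕ)) b + 1 = d b := by simp; omega
    exact_mod_cast congrArg (Nat.cast (R := V)) this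
  · have hb : d b = 0 := by
      by_contra h0
      exact h (Finsupp.single_le_iff.2 (by omega))
    rw [hb]; simp

theorem exists_const_of_pderiv [IsDomain V] [CharZero V] [WellFoundedGT σ] {u v : MvPowerSeries σ V}
    (hv : v ≠ 0) (h : ∀ b, v * pderiv V b u = u * pderiv V b v) :
    ∃ a c : V, c ≠ 0 ∧ C c * u = C a * v := by
  obtain ⟨ν, hν⟩ := exists_finsupp_eq_lexOrder_of_ne_zero hv
  have hvν := coeff_ne_zero_of_lexOrder hν.symm
  refine ⟨coeff ν u, coeff ν v, hvν, ?_⟩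
  by_contra hne
  let w := C (coeff ν v) * u - C (coeff ν u) * v
  have hw : w ≠ 0 := sub_ne_zero.2 hne
  obtain ⟨μ, hμ⟩ := exists_finsupp_eq_lexOrder_of_ne_zero hw
  have hwμ := coeff_ne_zero_of_lexOrder hμ.symm
  have hwν : coeff ν w = 0 := by
    simp only [w, map_sub, coeff_C_mul]; ring
  have key : ∀ b, μ b = ν b := by
    intro b
    have h1 : v * (X b * pderiv V b w) = w * (X b * pderiv V b v) := by
      have : pderiv V b w = C (coeff ν v) * pderiv V b u - C (coeff ν u) * pderiv V b v := by
        simp only [w, ← MvPowerSeries.smul_eq_C_mul, map_sub, Derivation.map_smul]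
      rw [this]
      linear_combination X b * C (coeff ν v) * h b
    have hv0 : ∀ d, toLex d < toLex ν → coeff d v = 0 := fun d hd =>
      coeff_eq_zero_of_lt_lexOrder (by rw [hν]; exact_mod_cast hd)
    have hw0 : ∀ d, toLex d < toLex μ → coeff d w = 0 := fun d hd =>
      coeff_eq_zero_of_lt_lexOrder (by rw [hμ]; exact_mod_cast hd)
    have e1 := coeff_add_mul_lex (g := X b * pderiv V b w) hv0
      (fun d hd => by rw [coeff_X_mul_pderiv, hw0 d hd, mul_zero])
    have e2 := coeff_add_mul_lex (g := X b * pderiv V b v) hw0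
      (fun d hd => by rw [coeff_X_mul_pderiv, hv0 d hd, mul_zero])
    rw [h1, add_comm ν μ, e2, coeff_X_mul_pderiv, coeff_X_mul_pderiv] at e1
    have e3 : ((ν b : V) - μ b) * (coeff ν v * coeff μ w) = 0 := by linear_combination e1
    rcases mul_eq_zero.1 e3 with h3 | h3
    · rw [sub_eq_zero] at h3
      exact_mod_cast h3.symm
    · exact absurd h3 (mul_ne_zero hvν hwμ)
  have : μ = ν := Finsupp.ext key
  rw [this] at hwμ
  exact hwμ hwν
end Lex

/-- Clearing denominators of finitely many fractions. -/
theorem exists_common_denominator {W κ ι : Type*} [CommRing W] [Field κ] (f : W →+* κ)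
    (s : Finset ι) (z : ι → κ) (h : ∀ i, ∃ w y, f y ≠ 0 ∧ f y * z i = f w) :
    ∃ g, f g ≠ 0 ∧ ∃ β : ι → W, ∀ i ∈ s, f (β i) = f g * z i := by
  classical
  choose w y hy hz using h
  refine ⟨∏ i ∈ s, y i, by rw [map_prod]; exact Finset.prod_ne_zero_iff.2 fun i _ => hy i,
    fun i => w i * ∏ j ∈ s.erase i, y j, fun i hi => ?_⟩
  rw [map_mul, ← hz, ← Finset.mul_prod_erase s y hi, map_mul]
  ring

theorem der_aeval_eq_zero {L κ : Type} [Field L] [Field κ] [Algebra L κ] (dL : Der L) (η : Der κ)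
    (hc : ∀ l, algebraMap L κ (dL l) = η (algebraMap L κ l)) {c : κ} (hη : η c = 0)
    (hi : IsIntegral L c) (i : ℕ) : dL ((minpoly L c).coeff i) = 0 := by
  let P := minpoly L c
  let n := P.natDegree
  have hmonic : P.Monic := minpoly.monic hi
  let Q : Polynomial L := ∑ j ∈ Finset.range n, Polynomial.monomial j (dL (P.coeff j))
  have hQc : ∀ j < n, Q.coeff j = dL (P.coeff j) := fun j hj => by
    simp only [Q, Polynomial.finsetSum_coeff, Polynomial.coeff_monomial]
    rw [Finset.sum_ite_eq' (Finset.range n) j, if_pos (Finset.mem_range.2 hj)]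
  have h1 : dL 1 = 0 := dL.map_one_eq_zero
  have hpow : ∀ j : ℕ, η (c ^ j) = 0 := fun j => by
    rw [Derivation.leibniz_pow, hη, smul_zero, smul_zero]
  have hQ : Polynomial.aeval c Q = 0 := by
    have h2 : Polynomial.aeval c P = 0 := minpoly.aeval L c
    rw [Polynomial.aeval_eq_sum_range] at h2
    have h3 := congrArg η h2
    rw [map_zero, map_sum, Finset.sum_range_succ, hmonic.coeff_natDegree, one_smul, hpow, add_zero] at h3
    rw [← h3, map_sum]
    refine Finset.sum_congr rfl fun j _ => ?_
    rw [Polynomial.aeval_monomial, hc, Algebra.smul_def, Derivation.leibniz, hpow, smul_zero, zero_add,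
      smul_eq_mul, mul_comm]
  have hQ0 : Q = 0 := by
    by_contra h0
    have h2 := minpoly.degree_le_of_ne_zero L c h0 hQ
    have h3 : Q.degree < n := by
      refine lt_of_le_of_lt (Polynomial.degree_sum_le _ _) ((Finset.sup_lt_iff (WithBot.bot_lt_coe n)).2 ?_)
      intro j hj
      exact lt_of_le_of_lt (Polynomial.degree_monomial_le _ _)
        (Nat.cast_lt.2 (Finset.mem_range.1 hj))
    rw [Polynomial.degree_eq_natDegree hmonic.ne_zero] at h2
    exact absurd h3 (not_lt.2 h2)
  rcases lt_trichotomy i n with h | h | h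
  · rw [← hQc i h, hQ0, Polynomial.coeff_zero]
  · rw [h]
    have : P.coeff n = 1 := hmonic.coeff_natDegree
    exact (congrArg dL this).trans h1
  · have : P.coeff i = 0 := Polynomial.coeff_eq_zero_of_natDegree_lt h
    exact (congrArg dL this).trans (map_zero _)

/-- The absolute derivation underlying a relative one. -/
def absDer {V B : Type} [CommRing V] [CommRing B] [Algebra V B] (d : Derivation V B B) : Der B :=
  d.restrictScalars ℤ

theorem absDer_apply {V B : Type} [CommRing V] [CommRing B] [Algebra V B] (d : Derivation V B B) (x : B) :
    absDer d x = d x := rfl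

theorem exists_der_fraction {B L : Type} [CommRing B] [Field L] [Algebra B L] (M : Submonoid B)
    [IsLocalization M L] (d : Der B) : ∃ dL : Der L, ∀ x, dL (algebraMap B L x) = algebraMap B L (d x) := by
  obtain ⟨dL, h⟩ := exists_der_localization M (L := L) ((Algebra.linearMap B L).compDer d)
  exact ⟨dL, h⟩

theorem der_compat {B L κ : Type} [CommRing B] [IsDomain B] [Field L] [Algebra B L] [IsFractionRing B L] [Field κ]
    [Algebra B κ] [Algebra L κ] [IsScalarTower B L κ] (d : Der B) (dL : Der L) (η : Der κ)
    (h1 : ∀ x, dL (algebraMap B L x) = algebraMap B L (d x))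
    (h2 : ∀ x, η (algebraMap B κ x) = algebraMap B κ (d x)) (l : L) :
    algebraMap L κ (dL l) = η (algebraMap L κ l) := by
  obtain ⟨x, y, hy, rfl⟩ := IsFractionRing.div_surjective (A := B) l
  have hy0 : algebraMap B L y ≠ 0 := IsFractionRing.to_map_ne_zero_of_mem_nonZeroDivisors hy
  have hyκ : algebraMap L κ (algebraMap B L y) ≠ 0 := by rwa [map_ne_zero]
  set l := algebraMap B L x / algebraMap B L y with hl
  have e : algebraMap B L y * l = algebraMap B L x := by rw [hl]; field_simp
  have e1 := congrArg (fun t => algebraMap L κ (dL t)) e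
  have e2 := congrArg (fun t => η (algebraMap L κ t)) e
  simp only [Derivation.leibniz, map_mul, map_add, smul_eq_mul, h1] at e1 e2
  rw [← IsScalarTower.algebraMap_apply, ← IsScalarTower.algebraMap_apply, ← IsScalarTower.algebraMap_apply] at e1
  rw [← IsScalarTower.algebraMap_apply, ← IsScalarTower.algebraMap_apply, h2, h2, ← e1] at e2
  rw [← IsScalarTower.algebraMap_apply] at hyκ
  have := add_right_cancel e2
  exact (mul_left_cancel₀ hyκ this).symm

theorem exists_const_of_der {r : ℕ} {V L κ : Type} [CommRing V] [IsDomain V] [CharZero V]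
    [Field L] [Algebra (MvPowerSeries (Fin r) V) L] [IsFractionRing (MvPowerSeries (Fin r) V) L] [Field κ]
    [Algebra (MvPowerSeries (Fin r) V) κ] [Algebra L κ] [IsScalarTower (MvPowerSeries (Fin r) V) L κ] {c : κ}
    (hi : IsIntegral L c)
    (h : ∀ b, ∃ η : Der κ, (∀ x, η (algebraMap (MvPowerSeries (Fin r) V) κ x) =
      algebraMap (MvPowerSeries (Fin r) V) κ (pderiv V b x)) ∧ η c = 0) :
    ∃ P : Polynomial V, P ≠ 0 ∧ ∃ n, P.natDegree ≤ n ∧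
      ∑ i ∈ Finset.range (n + 1), algebraMap (MvPowerSeries (Fin r) V) κ (C (P.coeff i)) * c ^ i = 0 := by
  let B := MvPowerSeries (Fin r) V
  have : IsDomain B := NoZeroDivisors.to_isDomain (MvPowerSeries (Fin r) V)
  have hLinj : Function.Injective (algebraMap B L) := IsFractionRing.injective B L
  have h0 : ∀ (i : ℕ), ∃ w y : V, ((algebraMap B L).comp C) y ≠ 0 ∧
      ((algebraMap B L).comp C) y * (minpoly L c).coeff i = ((algebraMap B L).comp C) w := by
    intro i
    obtain ⟨u, v, hv, huv⟩ := IsFractionRing.div_surjective (A := B) ((minpoly L c).coeff i)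
    have hv0 : algebraMap B L v ≠ 0 := IsFractionRing.to_map_ne_zero_of_mem_nonZeroDivisors hv
    have e : algebraMap B L v * (minpoly L c).coeff i = algebraMap B L u := by rw [← huv]; field_simp
    obtain ⟨a, c', hc', hac⟩ := exists_const_of_pderiv (u := u) (v := v) (nonZeroDivisors.ne_zero hv) (fun b => by
      obtain ⟨η, hη, hη0⟩ := h b
      obtain ⟨dL, hdL⟩ := exists_der_fraction (L := L) (nonZeroDivisors B)
        (absDer (B := B) (pderiv V b))
      have hcomp := der_compat (absDer (B := B) (pderiv V b)) dL η hdL hη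
      have hz := der_aeval_eq_zero dL η hcomp hη0 hi i
      simp only [absDer_apply] at hdL
      have e1 := congrArg dL e
      rw [Derivation.leibniz, hz, smul_zero, zero_add, hdL, hdL, smul_eq_mul] at e1
      apply hLinj
      rw [map_mul, map_mul, ← e]
      have e2 : (minpoly L c).coeff i * algebraMap B L (pderiv V b v) = algebraMap B L (pderiv V b u) := e1
      rw [← e2]; ring)
    refine ⟨a, c', ?_, ?_⟩
    · rw [RingHom.comp_apply]
      intro h2
      have h3 : C c' = 0 := hLinj (h2.trans (algebraMap B L).map_zero.symm)
      exact hc' (by have h4 := congrArg constantCoeff h3; rwa [constantCoeff_C, map_zero] at h4)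
    · apply mul_left_cancel₀ hv0
      have e3 := congrArg (algebraMap B L) hac
      rw [map_mul, map_mul, ← e] at e3
      rw [RingHom.comp_apply, RingHom.comp_apply]
      linear_combination e3
  let n := (minpoly L c).natDegree
  obtain ⟨g, hg, β, hβ⟩ := exists_common_denominator ((algebraMap B L).comp C)
    (Finset.range (n + 1)) _ h0
  let P : Polynomial V := ∑ i ∈ Finset.range (n + 1), Polynomial.monomial i (β i)
  have hPc : ∀ j ∈ Finset.range (n + 1), P.coeff j = β j := fun j hj => by
    simp only [P, Polynomial.finsetSum_coeff, Polynomial.coeff_monomial]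
    rw [Finset.sum_ite_eq' (Finset.range (n + 1)) j, if_pos hj]
  refine ⟨P, ?_, n, ?_, ?_⟩
  · intro hP
    have h1 := hβ n (by simp)
    rw [← hPc n (by simp), hP, Polynomial.coeff_zero, map_zero, (minpoly.monic hi).coeff_natDegree, mul_one] at h1
    exact hg h1.symm
  · refine Polynomial.natDegree_sum_le_of_forall_le _ _ fun i hi => ?_
    exact (Polynomial.natDegree_monomial_le _).trans (by simpa [Nat.lt_succ_iff] using hi)
  · have h2 : Polynomial.aeval c (minpoly L c) = 0 := minpoly.aeval L c
    rw [Polynomial.aeval_eq_sum_range] at h2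
    have : ∑ i ∈ Finset.range (n + 1), algebraMap B κ (C (P.coeff i)) * c ^ i =
        algebraMap L κ (((algebraMap B L).comp C) g) *
          ∑ i ∈ Finset.range (n + 1), (minpoly L c).coeff i • c ^ i := by
      rw [Finset.mul_sum]
      refine Finset.sum_congr rfl fun i hi => ?_
      rw [hPc i hi, IsScalarTower.algebraMap_apply B L κ]
      have := congrArg (algebraMap L κ) (hβ i hi)
      rw [RingHom.comp_apply, map_mul] at this
      rw [this, Algebra.smul_def, mul_assoc]
    rw [h2, mul_zero] at this
    exact this
end

section
open MvPowerSeries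
variable {V : Type} [CommRing V] {p : V} [IsNoetherianRing V] [IsLocalRing V]
  (hm : maximalIdeal V = Ideal.span {p})
variable [IsDomain V] [IsAdicComplete (Ideal.span {p}) V] {σ : Type} [Fintype σ]

include hm in
theorem const_aux [CharZero V] (q : Ideal (MvPowerSeries σ V)) [q.IsPrime] (hp : C p ∉ q) {κ : Type} [Field κ]
    [Algebra (MvPowerSeries σ V) κ] [Algebra V κ] [IsScalarTower V (MvPowerSeries σ V) κ]
    (hker : ∀ w, algebraMap (MvPowerSeries σ V) κ w = 0 ↔ w ∈ q)
    (hfrac : ∀ z : κ, ∃ w y, y ∉ q ∧ z = algebraMap (MvPowerSeries σ V) κ w / algebraMap (MvPowerSeries σ V) κ y)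
    {x y : MvPowerSeries σ V} (hy : y ∉ q)
    (h : ∀ b : σ → MvPowerSeries σ V, (∀ u ∈ q, ∑ a, b a * pderiv V a u ∈ q) →
      y * ∑ a, b a * pderiv V a x - x * ∑ a, b a * pderiv V a y ∈ q) :
    ∃ P : Polynomial V, P ≠ 0 ∧ ∃ n, P.natDegree ≤ n ∧
      ∑ i ∈ Finset.range (n + 1), C (P.coeff i) * x ^ i * y ^ (n - i) ∈ q := by
  classical
  have := charZero_of_ker hm q hp _ hker
  obtain ⟨r, φ, s, hφ, hInt, hs⟩ := exists_noether_prime hm q hp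
  let B := MvPowerSeries (Fin r) V
  let W := MvPowerSeries σ V
  have : IsDomain B := NoZeroDivisors.to_isDomain (MvPowerSeries (Fin r) V)
  let _ : Algebra B κ := ((algebraMap W κ).comp φ.toRingHom).toAlgebra
  have hB : ∀ b : B, algebraMap B κ b = algebraMap W κ (φ b) := fun _ => rfl
  have hinj : Function.Injective (algebraMap B κ) := by
    rw [injective_iff_map_eq_zero]
    intro b hb
    exact hφ b ((hker _).1 hb)
  have hq : ∀ w ∈ q, algebraMap W κ w = 0 := fun w hw => (hker w).2 hw
  have halg : Algebra.IsAlgebraic B κ := by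
    refine isAlgebraic_of_fractions (W := W) hinj (fun w => ?_) (fun z => by
      obtain ⟨w, y, -, h⟩ := hfrac z; exact ⟨w, y, h⟩)
    obtain ⟨P, hP, hP2⟩ := hInt (Ideal.Quotient.mk q w)
    refine ⟨P, hP, ?_⟩
    have h1 := congrArg (Ideal.Quotient.lift q (algebraMap W κ) hq) hP2
    rw [map_zero, Polynomial.hom_eval₂] at h1
    exact h1
  have hV : ∀ v : V, φ (C v) = C v := fun v => φ.commutes v
  have hVB : ∀ v : V, algebraMap W κ (C v) = algebraMap B κ (C v) := fun v => by rw [hB, hV]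
  have hy0 : algebraMap W κ y ≠ 0 := fun h => hy ((hker y).1 h)
  let c := algebraMap W κ x / algebraMap W κ y
  have hcy : algebraMap W κ y * c = algebraMap W κ x := by simp only [c]; field_simp
  have key : ∀ b, ∃ η : Der κ, (∀ x, η (algebraMap B κ x) = algebraMap B κ (pderiv V b x)) ∧ η c = 0 := by
    intro b
    obtain ⟨η, hη⟩ := exists_der_extension hinj (absDer (B := B) (pderiv V b))
    simp only [absDer_apply] at hη
    refine ⟨η, hη, ?_⟩
    let D : Derivation V W κ := Derivation.mk'
      { toFun := fun w => η (algebraMap W κ w)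
        map_add' := fun a b => by simp only [map_add]
        map_smul' := fun v a => by
          have h1 : η (algebraMap B κ (C v)) = 0 := by
            rw [hη, pderiv_C, map_zero]
          simp only [RingHom.id_apply]
          rw [MvPowerSeries.smul_eq_C_mul, map_mul, hVB, Derivation.leibniz, h1, smul_zero, add_zero, ← hVB,
            ← IsScalarTower.algebraMap_smul W v, Algebra.smul_def (algebraMap V W v), smul_eq_mul]
          rfl } (fun a b => by
        change η (algebraMap W κ (a * b)) = a • η (algebraMap W κ b) + b • η (algebraMap W κ a)
        rw [map_mul, Derivation.leibniz, Algebra.smul_def a, Algebra.smul_def b]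
        rfl)
    have hDdef : ∀ w, D w = η (algebraMap W κ w) := fun _ => rfl
    let N' : Submodule W κ := Submodule.span W
      ((fun e => algebraMap W κ e) '' s ∪ (fun e => η (algebraMap W κ e)) '' s)
    have hN : N'.FG := ⟨s.image (fun e => algebraMap W κ e) ∪ s.image (fun e => η (algebraMap W κ e)), by
      simp [N']⟩
    have hDN : ∀ w, D w ∈ N' := by
      intro w
      obtain ⟨c, hc⟩ := hs w
      have h1 : algebraMap W κ w = ∑ e ∈ s, algebraMap W κ (φ (c e)) * algebraMap W κ e := by
        have := hq _ hc
        rw [map_sub, sub_eq_zero, map_sum] at this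
        rw [this]
        exact Finset.sum_congr rfl fun e _ => map_mul _ _ _
      rw [hDdef, h1, map_sum]
      refine sum_mem fun e he => ?_
      rw [← hB, Derivation.leibniz, hη, smul_eq_mul, smul_eq_mul, hB, hB, mul_comm (algebraMap W κ e), ← Algebra.smul_def, ← Algebra.smul_def]
      exact add_mem (Submodule.smul_mem _ _ (Submodule.subset_span (Or.inr ⟨e, he, rfl⟩)))
        (Submodule.smul_mem _ _ (Submodule.subset_span (Or.inl ⟨e, he, rfl⟩)))
    have hD := der_eq_sum D N' hN hDN
    obtain ⟨g, hg, β, hβ⟩ := exists_common_denominator (algebraMap W κ) (Finset.univ : Finset σ)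
      (fun a => D (X a)) (fun a => by
        obtain ⟨w, y, hy, hz⟩ := hfrac (D (X a))
        have hy0 : algebraMap W κ y ≠ 0 := fun h => hy ((hker y).1 h)
        exact ⟨w, y, hy0, by rw [hz]; exact mul_div_cancel₀ _ hy0⟩)
    have hsum : ∀ u, algebraMap W κ (∑ a, β a * pderiv V a u) = algebraMap W κ g * D u := by
      intro u
      rw [hD u, map_sum, Finset.mul_sum]
      refine Finset.sum_congr rfl fun a ha => ?_
      rw [map_mul, hβ a ha, Algebra.smul_def]
      ring
    have h2 := hq _ (h β (fun u hu => by
      rw [← hker, hsum, hDdef, hq u hu, map_zero, mul_zero]))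
    rw [map_sub, map_mul, map_mul, hsum, hsum] at h2
    have h3 : algebraMap W κ y * D x = algebraMap W κ x * D y := by
      apply mul_left_cancel₀ hg
      linear_combination h2
    have h4 : algebraMap W κ y * η c + c * D y = D x := by
      rw [hDdef x, ← hcy, Derivation.leibniz]; rfl
    have h5 : algebraMap W κ y * (algebraMap W κ y * η c) = 0 := by
      linear_combination (algebraMap W κ y) * h4 + h3 - D y * hcy
    rcases mul_eq_zero.1 h5 with h6 | h6
    · exact absurd h6 hy0
    · exact (mul_eq_zero.1 h6).resolve_left hy0
  have hfaith : FaithfulSMul B κ := (faithfulSMul_iff_algebraMap_injective B κ).2 hinj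
  let L := FractionRing B
  let _ : Algebra L κ := FractionRing.liftAlgebra B κ
  have hL : IsScalarTower B L κ := inferInstance
  have hInt' : IsIntegral L c := ((IsFractionRing.comap_isAlgebraic_iff (A := B) (K := L) (C := κ)).1 halg).isAlgebraic c |>.isIntegral
  obtain ⟨P, hP, n, hn, hsum⟩ := exists_const_of_der (L := L) hInt' key
  refine ⟨P, hP, n, hn, ?_⟩
  rw [← hker, map_sum]
  have : ∑ i ∈ Finset.range (n + 1), algebraMap W κ (C (P.coeff i) * x ^ i * y ^ (n - i)) =
      algebraMap W κ y ^ n * ∑ i ∈ Finset.range (n + 1), algebraMap B κ (C (P.coeff i)) * c ^ i := by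
    rw [Finset.mul_sum]
    refine Finset.sum_congr rfl fun i hi => ?_
    have hi' : i ≤ n := by simpa [Nat.lt_succ_iff] using hi
    rw [map_mul, map_mul, map_pow, map_pow, hVB, ← hcy, mul_pow]
    have : algebraMap W κ y ^ n = algebraMap W κ y ^ i * algebraMap W κ y ^ (n - i) := by
      rw [← pow_add]; congr 1; omega
    rw [this]; ring
  exact this.trans (by rw [hsum, mul_zero])

include hm in
theorem const_W [CharZero V] (q : Ideal (MvPowerSeries σ V)) [q.IsPrime] (hp : C p ∉ q)
    {x y : MvPowerSeries σ V} (hy : y ∉ q)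
    (h : ∀ b : σ → MvPowerSeries σ V, (∀ u ∈ q, ∑ a, b a * pderiv V a u ∈ q) →
      y * ∑ a, b a * pderiv V a x - x * ∑ a, b a * pderiv V a y ∈ q) :
    ∃ P : Polynomial V, P ≠ 0 ∧ ∃ n, P.natDegree ≤ n ∧
      ∑ i ∈ Finset.range (n + 1), C (P.coeff i) * x ^ i * y ^ (n - i) ∈ q := by
  suffices H : ∀ (A : Type) [CommRing A] [IsLocalRing A] [Algebra (MvPowerSeries σ V) A]
      [IsLocalization.AtPrime A q], ∃ P : Polynomial V, P ≠ 0 ∧ ∃ n, P.natDegree ≤ n ∧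
      ∑ i ∈ Finset.range (n + 1), C (P.coeff i) * x ^ i * y ^ (n - i) ∈ q from
    H (Localization.AtPrime q)
  intro A _ _ _ _
  let _ : Algebra V (ResidueField A) :=
    ((algebraMap (MvPowerSeries σ V) (ResidueField A)).comp
      (algebraMap V (MvPowerSeries σ V))).toAlgebra
  have : IsScalarTower V (MvPowerSeries σ V) (ResidueField A) :=
    IsScalarTower.of_algebraMap_eq fun _ => rfl
  exact const_aux hm q hp (algebraMap_residueField_eq_zero_iff (A := A) q)
    (fun z => residueField_fraction (A := A) q z) hy h
end

section

theorem exists_dedekind {V : Type} [CommRing V] [IsDomain V] [IsDiscreteValuationRing V] [CharZero V] {p : V}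
    (hm : maximalIdeal V = Ideal.span {p})
    {D : Type} [CommRing D] [IsDomain D] [Algebra V D] [Module.Finite V D]
    (hp : algebraMap V D p ≠ 0) :
    ∃ (O : Type) (_ : CommRing O) (_ : IsDomain O) (_ : IsDedekindDomain O) (_ : Algebra V O)
      (_ : Algebra.IsIntegral V O) (f : D →ₐ[V] O), Function.Injective f := by
  have hinj : Function.Injective (algebraMap V D) := by
    rw [injective_iff_map_eq_zero]
    intro v hv
    by_contra h0
    have hirr : Irreducible p := (IsDiscreteValuationRing.irreducible_iff_uniformizer p).2 hm
    obtain ⟨n, u, rfl⟩ := IsDiscreteValuationRing.eq_unit_mul_pow_irreducible h0 hirr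
    rw [map_mul, map_pow] at hv
    exact mul_ne_zero ((u.isUnit.map (algebraMap V D)).ne_zero) (pow_ne_zero n hp) hv
  have : FaithfulSMul V D := (faithfulSMul_iff_algebraMap_injective V D).2 hinj
  have : CharZero D := charZero_of_injective_algebraMap hinj
  let K := FractionRing V
  let L := FractionRing D
  let _ : Algebra K L := FractionRing.liftAlgebra V L
  have : Module.Finite K L := Module.Finite.of_isLocalization V D (nonZeroDivisors V)
  have : CharZero K := inferInstance
  have hO : IsDedekindDomain (integralClosure V L) := integralClosure.isDedekindDomain V K L
  let g : D →ₐ[V] L := IsScalarTower.toAlgHom V D L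
  refine ⟨integralClosure V L, inferInstance, inferInstance, hO, inferInstance, inferInstance,
    g.codRestrict _ (fun d => (Algebra.IsIntegral.isIntegral (R := V) d).map g), ?_⟩
  intro a b hab
  exact IsFractionRing.injective D L (congrArg Subtype.val hab)

theorem exists_dvr {V : Type} [CommRing V] [IsDomain V] [IsDiscreteValuationRing V] [CharZero V] {p : V}
    [IsAlgClosed (ResidueField V)]
    (hm : maximalIdeal V = Ideal.span {p})
    {D : Type} [CommRing D] [IsDomain D] [IsLocalRing D] [Algebra V D] [Module.Finite V D]
    (hp : algebraMap V D p ≠ 0) :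
    ∃ (O : Type) (_ : CommRing O) (_ : IsDomain O) (_ : IsDiscreteValuationRing O)
      (f : D →+* O), Function.Injective f ∧ (∀ d ∈ maximalIdeal D, f d ∈ maximalIdeal O) ∧
      ∀ o, ∃ v, o - f (algebraMap V D v) ∈ maximalIdeal O := by
  obtain ⟨O, _, _, _, _, hInt, f, hf⟩ := exists_dedekind hm hp
  obtain ⟨M, hM⟩ := Ideal.exists_maximal O
  let _ : Algebra D O := f.toRingHom.toAlgebra
  have : IsScalarTower V D O := IsScalarTower.of_algebraMap_eq fun v => (f.commutes v).symm
  have hDint : Algebra.IsIntegral D O := Algebra.IsIntegral.tower_top (R := V)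
  have hMD : (M.comap (algebraMap D O)).IsMaximal := Ideal.isMaximal_comap_of_isIntegral_of_isMaximal M
  have hMV : (M.comap (algebraMap V O)).IsMaximal := Ideal.isMaximal_comap_of_isIntegral_of_isMaximal M
  have hMD' := IsLocalRing.eq_maximalIdeal hMD
  have hMV' := IsLocalRing.eq_maximalIdeal hMV
  have hM0 : M ≠ ⊥ := by
    rintro rfl
    have h1 : p ∈ maximalIdeal V := by rw [hm]; exact Ideal.mem_span_singleton_self p
    rw [← hMV', Ideal.mem_comap, Ideal.mem_bot, IsScalarTower.algebraMap_apply V D O] at h1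
    exact hp (hf (h1.trans (map_zero f).symm))
  have hdvr := IsLocalization.AtPrime.isDiscreteValuationRing_of_dedekind_domain O hM0
    (Localization.AtPrime M)
  have hres : ∀ o : O, ∃ v, o - algebraMap V O v ∈ M := by
    intro o
    have hle : maximalIdeal V ≤ M.comap (algebraMap V O) := hMV'.ge
    let _ : Field (O ⧸ M) := Ideal.Quotient.field M
    let g : ResidueField V →+* O ⧸ M := Ideal.Quotient.lift _ ((Ideal.Quotient.mk M).comp (algebraMap V O))
      (fun a ha => Ideal.Quotient.eq_zero_iff_mem.2 (hle ha))
    let _ : Algebra (ResidueField V) (O ⧸ M) := g.toAlgebra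
    have : IsScalarTower V (ResidueField V) (O ⧸ M) := IsScalarTower.of_algebraMap_eq fun _ => rfl
    have : Algebra.IsIntegral (ResidueField V) (O ⧸ M) := Algebra.IsIntegral.tower_top (R := V)
    obtain ⟨z, hz⟩ := (IsAlgClosed.algebraMap_bijective_of_isIntegral (k := ResidueField V)
      (K := O ⧸ M)).2 (Ideal.Quotient.mk M o)
    obtain ⟨v, rfl⟩ := IsLocalRing.residue_surjective z
    exact ⟨v, Ideal.Quotient.eq.1 hz.symm⟩
  have hmem : ∀ o : O, algebraMap O (Localization.AtPrime M) o ∈ maximalIdeal (Localization.AtPrime M) ↔ o ∈ M :=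
    fun o => IsLocalization.AtPrime.to_map_mem_maximal_iff _ M o
  refine ⟨Localization.AtPrime M, inferInstance, inferInstance, hdvr, (algebraMap O _).comp f.toRingHom, ?_, ?_, ?_⟩
  · exact (IsLocalization.injective _ M.primeCompl_le_nonZeroDivisors).comp hf
  · intro d hd
    rw [RingHom.comp_apply, hmem]
    rw [← hMD'] at hd
    exact hd
  · intro o
    obtain ⟨x, s, rfl⟩ := IsLocalization.exists_mk'_eq M.primeCompl o
    obtain ⟨y, i, hi, hyi⟩ := hM.exists_inv s.2
    obtain ⟨v, hv⟩ := hres (y * x)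
    refine ⟨v, ?_⟩
    have hs : algebraMap O (Localization.AtPrime M) s ∉ maximalIdeal (Localization.AtPrime M) := by
      rw [hmem]; exact s.2
    refine ((maximalIdeal.isMaximal (Localization.AtPrime M)).isPrime.mem_or_mem ?_).resolve_left hs
    have e : (s : O) * (y * x - algebraMap V O v) + i * x = x - s * algebraMap V O v := by
      linear_combination x * hyi
    have e2 : algebraMap O (Localization.AtPrime M) s * (IsLocalization.mk' _ x s -
        ((algebraMap O _).comp f.toRingHom) (algebraMap V D v)) =
        algebraMap O _ (s * (y * x - algebraMap V O v) + i * x) := by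
      rw [e, mul_sub, IsLocalization.mk'_spec', map_sub, map_mul]
      have : f.toRingHom (algebraMap V D v) = algebraMap V O v := f.commutes v
      rw [RingHom.comp_apply, this]
    rw [e2, hmem]
    exact add_mem (Ideal.mul_mem_left _ _ hv) (Ideal.mul_mem_right _ _ hi)
theorem exists_complete_dvr {V : Type} [CommRing V] [IsDomain V] [IsDiscreteValuationRing V] [CharZero V] {p : V}
    [IsAlgClosed (ResidueField V)]
    (hm : maximalIdeal V = Ideal.span {p})
    {D : Type} [CommRing D] [IsDomain D] [IsLocalRing D] [Algebra V D] [Module.Finite V D]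
    (hp : algebraMap V D p ≠ 0) :
    ∃ (O : Type) (_ : CommRing O) (ϖ : O) (_ : IsAdicComplete (Ideal.span {ϖ}) O)
      (f : D →+* O), Function.Injective f ∧ (∀ d ∈ maximalIdeal D, f d ∈ Ideal.span {ϖ}) ∧
      (∀ o, ∃ v, o - f (algebraMap V D v) ∈ Ideal.span {ϖ}) ∧ ∀ n : ℕ, ϖ ^ n ≠ 0 := by
  obtain ⟨O, _, _, _, f, hf, hfm, hfr⟩ := exists_dvr hm hp
  obtain ⟨ϖ, hϖ⟩ := IsDiscreteValuationRing.exists_irreducible O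
  have hmO : maximalIdeal O = Ideal.span {ϖ} := hϖ.maximalIdeal_eq
  let A := AdicCompletion (maximalIdeal O) O
  have hmap : (maximalIdeal O).map (algebraMap O A) = Ideal.span {algebraMap O A ϖ} := by
    have h1 : ∀ I : Ideal O, I = Ideal.span {ϖ} → I.map (algebraMap O A) = Ideal.span {algebraMap O A ϖ} := by
      rintro I rfl
      rw [Ideal.map_span, Set.image_singleton]
    exact h1 _ hmO
  have hfg : (maximalIdeal O).FG := by rw [hmO]; exact ⟨{ϖ}, by simp⟩
  have hinj : Function.Injective (algebraMap O A) := AdicCompletion.of_injective (maximalIdeal O) O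
  refine ⟨A, inferInstance, algebraMap O A ϖ, ?_, (algebraMap O A).comp f, hinj.comp hf, ?_, ?_, ?_⟩
  · rw [← hmap]
    exact AdicCompletion.isAdicComplete_self _ hfg
  · intro d hd
    rw [← hmap]
    exact Ideal.mem_map_of_mem _ (hfm d hd)
  · intro o
    obtain ⟨b, hb⟩ := Ideal.Quotient.mk_surjective (AdicCompletion.evalOneₐ (maximalIdeal O) o)
    obtain ⟨v, hv⟩ := hfr b
    refine ⟨v, ?_⟩
    rw [← hmap, ← AdicCompletion.ker_evalOneₐ_eq_map _ hfg, RingHom.mem_ker, map_sub, sub_eq_zero]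
    exact hb.symm.trans (Ideal.Quotient.eq.2 hv)
  · intro n h
    rw [← map_pow] at h
    exact pow_ne_zero n hϖ.ne_zero (hinj (h.trans (map_zero _).symm))
end

section
open MvPowerSeries
variable {V : Type} [CommRing V] {p : V} [IsDomain V] [IsDiscreteValuationRing V]
  (hm : maximalIdeal V = Ideal.span {p})

include hm in
theorem ker_eq_of_uniformizer {O : Type} [CommRing O] [Algebra V O] {ϖ : O} (hϖ : ∀ n : ℕ, ϖ ^ n ≠ 0)
    (π : MvPowerSeries (Fin 1) V →ₐ[V] O) (hπ : π (X 0) = ϖ) {E h : MvPowerSeries (Fin 1) V}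
    (hE : E = C p - h) (hh : h ∈ XI (Fin 1) V) {f : MvPowerSeries (Fin 1) V}
    (hπE : π E = 0) (hf : π f = 0) : f ∈ Ideal.span {E} := by
  by_contra hfE
  have hp : Prime p := ((IsDiscreteValuationRing.irreducible_iff_uniformizer p).2 hm).prime
  have hprime := span_E_isPrime hp hE hh
  let Y := MvPowerSeries (Fin 1) V
  have hXI : XI (Fin 1) V = Ideal.span {(X 0 : Y)} := by
    have : Set.range (X : Fin 1 → Y) = {X 0} := by
      ext z; simp [eq_comm]
    exact congrArg Ideal.span this
  let I : Ideal (Y ⧸ Ideal.span {E}) := Ideal.span {Ideal.Quotient.mk _ (X 0)}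
  have hnonunit : ∀ g : Y, ¬ IsUnit g → Ideal.Quotient.mk (Ideal.span {E}) g ∈ I := by
    intro g hg
    have h1 := (mem_maximalIdeal_ps_iff hm (w := g)).1 ((mem_maximalIdeal g).2 hg)
    obtain ⟨a, ha⟩ := Ideal.mem_span_singleton'.1 h1
    have h2 : g - C a * C p ∈ XI (Fin 1) V := by
      rw [mem_XI_iff, map_sub, ← map_mul, constantCoeff_C, ha, sub_self]
    have h3 : g - C a * E ∈ XI (Fin 1) V := by
      have : g - C a * E = (g - C a * C p) + C a * h := by rw [hE]; ring
      rw [this]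
      exact add_mem h2 (Ideal.mul_mem_left _ _ hh)
    rw [hXI] at h3
    obtain ⟨t, ht⟩ := Ideal.mem_span_singleton'.1 h3
    have h4 : Ideal.Quotient.mk (Ideal.span {E}) g = Ideal.Quotient.mk (Ideal.span {E}) (t * X 0) := by
      rw [Ideal.Quotient.eq, ht, sub_sub_cancel]
      exact Ideal.mul_mem_left _ _ (Ideal.mem_span_singleton_self E)
    rw [h4, map_mul]
    exact Ideal.mul_mem_left _ _ (Ideal.mem_span_singleton_self _)
  have hlocal : IsLocalRing (Y ⧸ Ideal.span {E}) :=
    IsLocalRing.of_surjective' (Ideal.Quotient.mk _) Ideal.Quotient.mk_surjective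
  have hI : I ≠ ⊤ := by
    intro hI
    rw [Ideal.span_singleton_eq_top] at hI
    have hloc : IsLocalHom (Ideal.Quotient.mk (Ideal.span {E})) :=
      IsLocalHom.of_surjective _ Ideal.Quotient.mk_surjective
    have hu : IsUnit (X 0 : Y) := isUnit_of_map_unit (Ideal.Quotient.mk (Ideal.span {E})) _ hI
    rw [MvPowerSeries.isUnit_iff_constantCoeff, constantCoeff_X] at hu
    exact not_isUnit_zero hu
  have hkr := Ideal.iInf_pow_eq_bot_of_isLocalRing I hI
  have hf0 : Ideal.Quotient.mk (Ideal.span {E}) f ≠ 0 := fun h => hfE (Ideal.Quotient.eq_zero_iff_mem.1 h)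
  have hex : ∃ n, Ideal.Quotient.mk (Ideal.span {E}) f ∉ I ^ n := by
    by_contra hcon
    push Not at hcon
    apply hf0
    rw [← Ideal.mem_bot, ← hkr]
    simpa using hcon
  classical
  let n := Nat.find hex
  have hn : Ideal.Quotient.mk (Ideal.span {E}) f ∉ I ^ n := Nat.find_spec hex
  have hn0 : n ≠ 0 := by
    intro h0; rw [h0] at hn; simp at hn
  obtain ⟨m, hm'⟩ := Nat.exists_eq_succ_of_ne_zero hn0
  have hmem : Ideal.Quotient.mk (Ideal.span {E}) f ∈ I ^ m := not_not.1 (Nat.find_min hex (by omega))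
  rw [hm'] at hn
  rw [Ideal.span_singleton_pow, Ideal.mem_span_singleton'] at hmem
  obtain ⟨u, hu⟩ := hmem
  obtain ⟨u, rfl⟩ := Ideal.Quotient.mk_surjective u
  have hunit : IsUnit u := by
    by_contra hnu
    apply hn
    rw [← hu, Nat.succ_eq_add_one, pow_succ' I]
    exact Ideal.mul_mem_mul (hnonunit u hnu) (Ideal.pow_mem_pow (Ideal.mem_span_singleton_self _) _)
  rw [← map_pow, ← map_mul, Ideal.Quotient.eq] at hu
  obtain ⟨s, hs⟩ := Ideal.mem_span_singleton'.1 hu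
  have h1 := congrArg π hs
  rw [map_mul, hπE, mul_zero, map_sub, hf, sub_zero, map_mul, map_pow, hπ] at h1
  exact hϖ m ((hunit.map π).mul_left_cancel (by rw [mul_zero, ← h1]))

include hm in
theorem exists_pderiv_not_mem [CharZero V] [IsAdicComplete (Ideal.span {p}) V]
    [IsAlgClosed (ResidueField V)] {σ : Type} [Fintype σ] {E h : MvPowerSeries σ V}
    (hE : E = C p - h) (hh : h ∈ XI σ V) (q : Ideal (MvPowerSeries σ V)) [q.IsPrime] (hp : C p ∉ q)
    (hEq : E ∈ q) : ∃ i, pderiv V i E ∉ q := by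
  by_contra hcon
  push Not at hcon
  let W := MvPowerSeries σ V
  let Y := MvPowerSeries (Fin 1) V
  have hlocal : IsLocalRing (W ⧸ q) :=
    IsLocalRing.of_surjective' (Ideal.Quotient.mk _) Ideal.Quotient.mk_surjective
  obtain ⟨P, hP, hpP, hfin⟩ := exists_finite_quotient hm (Ideal.Quotient.mkₐ V q)
    Ideal.Quotient.mk_surjective (fun h => hp (Ideal.Quotient.eq_zero_iff_mem.1 h))
  have hlocal2 : IsLocalRing ((W ⧸ q) ⧸ P) :=
    IsLocalRing.of_surjective' (Ideal.Quotient.mk _) Ideal.Quotient.mk_surjective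
  have hIsom : ∀ v : V, algebraMap V ((W ⧸ q) ⧸ P) v = Ideal.Quotient.mk P (algebraMap V (W ⧸ q) v) := fun _ => rfl
  obtain ⟨O, _, ϖ, hcomp, f, hf, hfm, hfr, hϖ⟩ := exists_complete_dvr (D := (W ⧸ q) ⧸ P) hm
    (fun h => hpP (Ideal.Quotient.eq_zero_iff_mem.1 (by rw [← hIsom, h])))
  let _ : Algebra V O := (f.comp (algebraMap V ((W ⧸ q) ⧸ P))).toAlgebra
  let θ : W →ₐ[V] O := { f.comp ((Ideal.Quotient.mk P).comp (Ideal.Quotient.mk q)) with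
    commutes' := fun v => rfl }
  have hθ : ∀ w, θ w = f (Ideal.Quotient.mk P (Ideal.Quotient.mk q w)) := fun _ => rfl
  let q' : Ideal W := P.comap (Ideal.Quotient.mk q)
  have hq' : q'.IsPrime := hP.comap _
  have hqq : q ≤ q' := fun w hw => by
    rw [Ideal.mem_comap, Ideal.Quotient.eq_zero_iff_mem.2 hw]; exact zero_mem _
  have hθq : ∀ w, θ w = 0 ↔ w ∈ q' := fun w => by
    rw [hθ, map_eq_zero_iff f hf, Ideal.Quotient.eq_zero_iff_mem, Ideal.mem_comap]
  have hpq' : C p ∉ q' := fun h => hpP h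
  obtain ⟨g, hg, hgE⟩ := jac_W hm q' hpq' (hqq hEq) (fun i => hqq (hcon i))
  have hX : ∀ i, θ (X i) ∈ Ideal.span {ϖ} := by
    intro i
    refine hfm _ ?_
    have h1 : (X i : W) ∈ maximalIdeal W := by
      rw [mem_maximalIdeal, mem_nonunits_iff, MvPowerSeries.isUnit_iff_constantCoeff,
        constantCoeff_X]
      exact not_isUnit_zero
    rw [mem_maximalIdeal, mem_nonunits_iff] at h1 ⊢
    intro h2
    have hl1 : IsLocalHom (Ideal.Quotient.mk P) := IsLocalHom.of_surjective _ Ideal.Quotient.mk_surjective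
    have hl2 : IsLocalHom (Ideal.Quotient.mk q) := IsLocalHom.of_surjective _ Ideal.Quotient.mk_surjective
    exact h1 (isUnit_of_map_unit (Ideal.Quotient.mk q) _ (isUnit_of_map_unit (Ideal.Quotient.mk P) _ h2))
  obtain ⟨π, hπ⟩ := exists_psLift (R := V) (Ideal.span {ϖ}) (fun _ : Fin 1 => ϖ)
    (fun _ => Ideal.mem_span_singleton_self _)
  have hmap : (Ideal.span {(X 0 : Y)}).map π.toRingHom = Ideal.span {ϖ} := by
    rw [Ideal.map_span, Set.image_singleton]
    exact congrArg (fun z => Ideal.span {z}) (hπ 0)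
  have hXI : XI (Fin 1) V = Ideal.span {(X 0 : Y)} := by
    have : Set.range (X : Fin 1 → Y) = {X 0} := by
      ext z; simp [eq_comm]
    exact congrArg Ideal.span this
  have hπs : Function.Surjective π := by
    have h1 : IsAdicComplete (XI (Fin 1) V) Y := inferInstance
    rw [hXI] at h1
    have h2 : IsHausdorff ((Ideal.span {(X 0 : Y)}).map π.toRingHom) O := by
      rw [hmap]; infer_instance
    refine surjective_of_mk_map_comp_surjective (I := Ideal.span {(X 0 : Y)}) π.toRingHom ?_
    intro z
    obtain ⟨o, rfl⟩ := Ideal.Quotient.mk_surjective z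
    obtain ⟨v, hv⟩ := hfr o
    refine ⟨C v, ?_⟩
    symm
    refine Ideal.Quotient.eq.2 ?_
    rw [hmap]
    have : π.toRingHom (C v) = f (algebraMap V ((W ⧸ q) ⧸ P) v) := π.commutes v
    rw [this]
    exact hv
  have hγ : ∀ i, ∃ γ : Y, θ (X i) = π (X 0 * γ) := fun i => by
    obtain ⟨c, hc⟩ := Ideal.mem_span_singleton'.1 (hX i)
    obtain ⟨γ, rfl⟩ := hπs c
    exact ⟨γ, by rw [map_mul, hπ, ← hc, mul_comm]⟩
  choose γ hγ using hγ
  have hYX : ∀ i, X 0 * γ i ∈ XI (Fin 1) V := fun i => by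
    rw [hXI]; exact Ideal.mul_mem_right _ _ (Ideal.mem_span_singleton_self _)
  obtain ⟨ψ, hψ⟩ := exists_psLift (R := V) (XI (Fin 1) V) (fun i : σ => X 0 * γ i) hYX
  have hcompat : π.comp ψ = θ := by
    refine psHom_ext (Ideal.span {ϖ}) (fun i => ?_) (fun i => ?_)
    · rw [AlgHom.comp_apply, hψ, hγ]
    · rw [AlgHom.comp_apply, hψ, ← hγ]; exact hX i
  have hcompat' : ∀ w, π (ψ w) = θ w := fun w => DFunLike.congr_fun hcompat w
  have hψh : ψ h ∈ XI (Fin 1) V := by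
    have := psHom_XI_pow_le ψ.toRingHom (I := XI (Fin 1) V) (fun i => by
      have := hYX i; rw [← hψ] at this; exact this) 1 (by rwa [pow_one])
    rwa [pow_one] at this
  have hψE : ψ E = C p - ψ h := by
    rw [hE, map_sub]; congr 1; exact ψ.commutes p
  have hker : ∀ y : Y, π y = 0 → y ∈ Ideal.span {ψ E} := fun y hy =>
    ker_eq_of_uniformizer hm hϖ π (hπ 0) hψE hψh (by rw [hcompat', hθq]; exact hqq hEq) hy
  have hle : q'.map ψ.toRingHom ≤ Ideal.span {ψ E} := by
    rw [Ideal.map_le_iff_le_comap]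
    intro w hw
    exact hker _ ((hcompat' w).trans ((hθq w).2 hw))
  have h3 : ψ (g * E) ∈ Ideal.span {ψ E} ^ 2 := by
    have := Ideal.mem_map_of_mem ψ.toRingHom hgE
    rw [Ideal.map_pow] at this
    exact Ideal.pow_right_mono hle 2 this
  rw [Ideal.span_singleton_pow, Ideal.mem_span_singleton'] at h3
  obtain ⟨s, hs⟩ := h3
  have hY : IsDomain Y := NoZeroDivisors.to_isDomain (MvPowerSeries (Fin 1) V)
  have hE0 : ψ E ≠ 0 := by
    intro h0
    rw [hψE, sub_eq_zero] at h0
    have h4 := congrArg constantCoeff h0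
    rw [constantCoeff_C, mem_XI_iff.1 hψh] at h4
    exact hpq' (by rw [h4, map_zero]; exact zero_mem _)
  have h5 : ψ g = s * ψ E := by
    apply mul_right_cancel₀ hE0
    rw [← map_mul, ← hs]; ring
  apply hg
  rw [← hθq, ← hcompat', h5, map_mul, hcompat', (hθq E).2 (hqq hEq), mul_zero]
end

section
variable {W T S : Type} [CommRing W] [CommRing T] [CommRing S] [Algebra W T] [Algebra T S] [Algebra W S]
  [IsScalarTower W T S]

/-- Descent of a derivation along a surjection. -/
theorem exists_der_quotient (hsurj : Function.Surjective (algebraMap W T)) (d : DerTo W S)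
    (hd : ∀ w, algebraMap W T w = 0 → d w = 0) : ∃ d' : DerTo T S, ∀ w, d' (algebraMap W T w) = d w := by
  have hwd : ∀ w w', algebraMap W T w = algebraMap W T w' → d w = d w' := fun w w' h => by
    rw [← sub_eq_zero, ← map_sub]; exact hd _ (by rw [map_sub, h, sub_self])
  choose s hs using hsurj
  have key : ∀ w, d (s (algebraMap W T w)) = d w := fun w => hwd _ _ (hs _)
  let f : T →+ S := ⟨⟨fun t => d (s t), by rw [← map_zero (algebraMap W T), key, map_zero]⟩, fun a b => by
    change d (s (a + b)) = d (s a) + d (s b)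
    rw [← map_add]; exact hwd _ _ (by rw [map_add, hs, hs, hs])⟩
  have hf : ∀ t, f t = d (s t) := fun _ => rfl
  refine ⟨Derivation.mk' f.toIntLinearMap fun a b => ?_, fun w => key w⟩
  change d (s (a * b)) = a • d (s b) + b • d (s a)
  have h1 : d (s (a * b)) = d (s a * s b) := hwd _ _ (by rw [map_mul, hs, hs, hs])
  rw [h1, Derivation.leibniz]
  conv_rhs => rw [← hs a, ← hs b]
  rw [algebraMap_smul, algebraMap_smul, hs, hs]

variable (W) in
theorem exists_der_chart (hsurj : Function.Surjective (algebraMap W T)) (M : Submonoid T)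
    [IsLocalization M S] {E : W} (hker : ∀ w, algebraMap W T w = 0 → w ∈ Ideal.span {E}) (d : DerTo W S)
    (hE : algebraMap W S E = 0) (hd : d E = 0) : ∃ d' : Der S, ∀ w, d' (algebraMap W S w) = d w := by
  obtain ⟨d1, h1⟩ := exists_der_quotient hsurj d (fun w hw => by
    obtain ⟨a, rfl⟩ := Ideal.mem_span_singleton'.1 (hker w hw)
    rw [Derivation.leibniz, hd, smul_zero, zero_add, Algebra.smul_def, hE, zero_mul])
  obtain ⟨d2, h2⟩ := exists_der_localization M (L := S) d1
  exact ⟨d2, fun w => by rw [IsScalarTower.algebraMap_apply W T S, h2, h1]⟩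

variable (W) in
theorem der_eq_of_chart (hsurj : Function.Surjective (algebraMap W T)) (M : Submonoid T)
    [IsLocalization M S] {d : Der S} (h : ∀ w, d (algebraMap W S w) = 0) : d = 0 := by
  ext s
  obtain ⟨t, u, hu⟩ := IsLocalization.exists_mk'_eq M s
  obtain ⟨w, hw⟩ := hsurj t
  obtain ⟨v, hv⟩ := hsurj u
  have e : algebraMap W S v * s = algebraMap W S w := by
    rw [IsScalarTower.algebraMap_apply W T S, IsScalarTower.algebraMap_apply W T S, hw, hv, ← hu,
      IsLocalization.mk'_spec']
  have h1 := congrArg d e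
  rw [Derivation.leibniz, h, h, smul_zero, add_zero, smul_eq_mul, IsScalarTower.algebraMap_apply W T S,
    hv] at h1
  exact (IsLocalization.map_units S u).mul_left_cancel (h1.trans (mul_zero _).symm)

variable {σ : Type} [Fintype σ] (d : σ → Der W) {E : W} (l : σ)

/-- The derivations `∂ᵢ - (∂ᵢE / ∂ₗE) ∂ₗ` on the chart where `∂ₗE` is invertible. -/
theorem exists_chart_ders (hsurj : Function.Surjective (algebraMap W T)) (M : Submonoid T)
    [IsLocalization M S] (hker : ∀ w, algebraMap W T w = 0 → w ∈ Ideal.span {E})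
    (hE : algebraMap W S E = 0) (he : IsUnit (algebraMap W S (d l E)))
    (hcomm : ∀ a b x, d a (d b x) = d b (d a x)) :
    ∃ δ : σ → Der S, (∀ i w, algebraMap W S (d l E) * δ i (algebraMap W S w) =
      algebraMap W S (d l E * d i w - d i E * d l w)) ∧ ∀ a b x, δ a (δ b x) = δ b (δ a x) := by
  obtain ⟨u, hu⟩ := he
  have hu' : algebraMap W S (d l E) * (↑u⁻¹ : S) = 1 := by rw [← hu]; exact u.mul_inv
  let A := Algebra.linearMap W S
  let D : σ → DerTo W S := fun i => A.compDer (d i) - ((↑u⁻¹ : S) * algebraMap W S (d i E)) • A.compDer (d l)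
  have hD : ∀ i w, D i w = algebraMap W S (d i w) - ((↑u⁻¹ : S) * algebraMap W S (d i E)) * algebraMap W S (d l w) :=
    fun i w => rfl
  have hDE : ∀ i, D i E = 0 := fun i => by
    rw [hD]; linear_combination (-algebraMap W S (d i E)) * hu'
  choose δ hδ using fun i => exists_der_chart W hsurj M hker (D i) hE (hDE i)
  have h1 : ∀ i w, algebraMap W S (d l E) * δ i (algebraMap W S w) =
      algebraMap W S (d l E * d i w - d i E * d l w) := fun i w => by
    rw [hδ, hD, map_sub, map_mul, map_mul]
    linear_combination (-algebraMap W S (d i E) * algebraMap W S (d l w)) * hu'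
  refine ⟨δ, h1, fun a b x => ?_⟩
  obtain ⟨c, hc⟩ : ∃ c : σ → S, ∀ i, c i = (↑u⁻¹ : S) * algebraMap W S (d i E) := ⟨_, fun _ => rfl⟩
  have hδ' : ∀ i w, δ i (algebraMap W S w) = algebraMap W S (d i w) - c i * algebraMap W S (d l w) :=
    fun i w => by rw [hδ, hD, hc]
  have hce : ∀ i, algebraMap W S (d l E) * c i = algebraMap W S (d i E) := fun i => by
    rw [hc]
    linear_combination (algebraMap W S (d i E)) * hu'
  have hec : ∀ i j, algebraMap W S (d l E) * δ j (c i) = algebraMap W S (d j (d i E)) -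
      c j * algebraMap W S (d l (d i E)) - c i * (algebraMap W S (d j (d l E)) - c j * algebraMap W S (d l (d l E))) := by
    intro i j
    have := congrArg (δ j) (hce i)
    rw [Derivation.leibniz, hδ', hδ', smul_eq_mul, smul_eq_mul] at this
    linear_combination this
  have hsym : ∀ i j, δ j (c i) = δ i (c j) := fun i j => by
    have h2 := hec i j
    rw [hcomm j i, hcomm l i, hcomm j l] at h2
    have h3 := hec j i
    rw [hcomm l j, hcomm i l] at h3
    have h4 : algebraMap W S (d l E) * (δ j (c i) - δ i (c j)) = 0 := by
      rw [hcomm l i] at h3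
      rw [hcomm l j] at h2
      linear_combination h2 - h3
    linear_combination (↑u⁻¹ : S) * h4 - (δ j (c i) - δ i (c j)) * hu'
  have hl : ∀ i j w, δ i (c j * algebraMap W S (d l w)) = c j * δ i (algebraMap W S (d l w)) +
      algebraMap W S (d l w) * δ i (c j) := fun i j w => by
    rw [Derivation.leibniz, smul_eq_mul, smul_eq_mul]
  have hbr : ⁅δ a, δ b⁆ = 0 := by
    refine der_eq_of_chart W hsurj M fun w => ?_
    rw [Derivation.commutator_apply, hδ', hδ', map_sub, map_sub, hl, hl,
      hδ', hδ', hδ', hδ', hsym b a,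
      hcomm a b, hcomm a l, hcomm b l]
    ring
  have := DFunLike.congr_fun hbr x
  rw [Derivation.commutator_apply, Derivation.zero_apply, sub_eq_zero] at this
  exact this
end

section
variable {V W T S : Type} [CommRing V] [IsDomain V] [CharZero V] [CommRing W] [CommRing T] [CommRing S]
  [Algebra V W] [Algebra W T] [Algebra T S] [Algebra W S] [Algebra V S]
  [IsScalarTower W T S] [IsScalarTower V W S] [IsNoetherianRing S] [IsDomain S]
  {σ : Type} [Fintype σ] (d : σ → Der W) {E c : W} (l : σ)

theorem sum_smul_der {A : Type} [CommRing A] (b : σ → A) (D : σ → Der A) :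
    ∃ Θ : Der A, ∀ x, Θ x = ∑ a, b a * D a x := by
  refine ⟨∑ a, b a • D a, fun x => ?_⟩
  have h := map_sum (Derivation.coeFnAddMonoidHom (R := ℤ) (A := A) (M := A)) (fun a => b a • D a) Finset.univ
  have h2 := congrFun h x
  rw [Finset.sum_apply] at h2
  exact h2

variable (V) in
theorem exists_chart_good (hsurj : Function.Surjective (algebraMap W T))
    [IsLocalization.Away (algebraMap W T c) S] (hker : ∀ w, algebraMap W T w = 0 → w ∈ Ideal.span {E})
    (hE : algebraMap W T E = 0) (hec : d l E ∣ c) (hcomm : ∀ a b x, d a (d b x) = d b (d a x))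
    (hV : ∀ v : V, v ≠ 0 → IsUnit (algebraMap V S v)) (hdV : ∀ i v, d i (algebraMap V W v) = 0)
    (hJ : ∀ q : Ideal W, q.IsPrime → E ∈ q → c ∉ q → ∀ u ∈ q, (∀ i, d i u ∈ q) → ∃ g ∉ q, g * u ∈ q ^ 2)
    (hC : ∀ q : Ideal W, q.IsPrime → E ∈ q → c ∉ q → ∀ x y : W, y ∉ q →
      (∀ b : σ → W, (∀ u ∈ q, ∑ a, b a * d a u ∈ q) → y * ∑ a, b a * d a x - x * ∑ a, b a * d a y ∈ q) →
      ∃ P : Polynomial V, P ≠ 0 ∧ ∃ n, P.natDegree ≤ n ∧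
        ∑ i ∈ Finset.range (n + 1), algebraMap V W (P.coeff i) * x ^ i * y ^ (n - i) ∈ q) :
    ∃ δ : σ → Der S, (selfConn δ).Good := by
  have hcT : IsUnit (algebraMap W S c) := by
    rw [IsScalarTower.algebraMap_apply W T S]
    exact IsLocalization.Away.algebraMap_isUnit _
  have he : IsUnit (algebraMap W S (d l E)) := isUnit_of_dvd_unit (map_dvd _ hec) hcT
  have hES : algebraMap W S E = 0 := by rw [IsScalarTower.algebraMap_apply W T S, hE, map_zero]
  have hfrac : ∀ s : S, ∃ n w, algebraMap W S c ^ n * s = algebraMap W S w := fun s => by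
    obtain ⟨n, t, ht⟩ := IsLocalization.Away.surj (algebraMap W T c) s
    obtain ⟨w, rfl⟩ := hsurj t
    refine ⟨n, w, ?_⟩
    rw [mul_comm, IsScalarTower.algebraMap_apply W T S, IsScalarTower.algebraMap_apply W T S, ht]
  obtain ⟨δ, hδ, hδc⟩ := exists_chart_ders d l hsurj (Submonoid.powers (algebraMap W T c)) hker hES he hcomm
  refine ⟨δ, ?_⟩
  have hinj : Function.Injective (algebraMap V S) := by
    rw [injective_iff_map_eq_zero]
    intro v hv
    by_contra h
    exact (hV v h).ne_zero hv
  let K := FractionRing V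
  let φ : K →+* S := IsLocalization.lift (M := nonZeroDivisors V) (g := algebraMap V S)
    fun y => hV y (nonZeroDivisors.ne_zero y.2)
  have hφ : ∀ v, φ (algebraMap V K v) = algebraMap V S v := fun v => IsLocalization.lift_eq _ _
  let algKS : Algebra K S := φ.toAlgebra
  have hK0 : CharZero K := charZero_of_injective_algebraMap (IsFractionRing.injective V K)
  have hunit : ∀ {Q : Ideal S}, Q.IsPrime → ∀ {a : S}, IsUnit a → a ∉ Q := fun hQ _ ha h =>
    hQ.ne_top (Ideal.eq_top_of_isUnit_mem _ h ha)
  have hδV : ∀ i v, δ i (algebraMap V S v) = 0 := fun i v => by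
    have := hδ i (algebraMap V W v)
    rw [hdV, hdV, mul_zero, mul_zero, sub_zero, map_zero, ← IsScalarTower.algebraMap_apply] at this
    exact he.mul_right_eq_zero.1 this
  refine selfConn_good (K := K) δ hδc (fun i k => ?_) (fun Q hQ u hu hdu => ?_) (fun Q hQ x y hy hxy => ?_)
  · obtain ⟨v, s, rfl⟩ := IsLocalization.exists_mk'_eq (nonZeroDivisors V) k
    have h1 : algebraMap V S s * φ (IsLocalization.mk' K v s) = algebraMap V S v := by
      rw [← hφ, ← hφ, ← map_mul, IsLocalization.mk'_spec']
    have h2 := congrArg (δ i) h1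
    rw [Derivation.leibniz, hδV, hδV, smul_zero, add_zero, smul_eq_mul] at h2
    exact (hV s (nonZeroDivisors.ne_zero s.2)).mul_right_eq_zero.1 h2
  · let q := Q.comap (algebraMap W S)
    have hq : q.IsPrime := Ideal.comap_isPrime _ _
    have hEq : E ∈ q := by rw [Ideal.mem_comap, hES]; exact Q.zero_mem
    have hcq : c ∉ q := fun h => hunit hQ hcT h
    obtain ⟨n, w, hw⟩ := hfrac u
    have hwQ : algebraMap W S w ∈ Q := hw ▸ Q.mul_mem_left _ hu
    have hdw : ∀ i, δ i (algebraMap W S w) ∈ Q := fun i => by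
      rw [← hw, Derivation.leibniz, smul_eq_mul, smul_eq_mul]
      exact Q.add_mem (Q.mul_mem_left _ (hdu i)) (Q.mul_mem_right _ hu)
    have h1 : d l E * w - d l w * E ∈ q := q.sub_mem (q.mul_mem_left _ hwQ) (q.mul_mem_left _ hEq)
    obtain ⟨g, hg, hgq⟩ := hJ q hq hEq hcq _ h1 fun i => by
      have e : d i (d l E * w - d l w * E) = (d l E * d i w - d i E * d l w) + w * d i (d l E) - E * d i (d l w) := by
        rw [map_sub, Derivation.leibniz, Derivation.leibniz, smul_eq_mul, smul_eq_mul, smul_eq_mul, smul_eq_mul]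
        ring
      rw [e]
      refine q.sub_mem (q.add_mem ?_ (q.mul_mem_right _ hwQ)) (q.mul_mem_right _ hEq)
      rw [Ideal.mem_comap, ← hδ]
      exact Q.mul_mem_left _ (hdw i)
    have h2 : algebraMap W S (g * (d l E * w - d l w * E)) ∈ Q ^ 2 := Ideal.le_comap_pow _ 2 hgq
    refine ⟨algebraMap W S g * (algebraMap W S (d l E) * algebraMap W S c ^ n), fun h => ?_, ?_⟩
    · rcases hQ.mem_or_mem h with h | h
      · exact hg h
      · exact hunit hQ (he.mul (hcT.pow n)) h
    · rw [map_mul, map_sub, map_mul, map_mul, hES, mul_zero, sub_zero, ← hw] at h2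
      rwa [mul_assoc, mul_assoc]
  · let q := Q.comap (algebraMap W S)
    have hq : q.IsPrime := Ideal.comap_isPrime _ _
    have hEq : E ∈ q := by rw [Ideal.mem_comap, hES]; exact Q.zero_mem
    have hcq : c ∉ q := fun h => hunit hQ hcT h
    obtain ⟨N, x', y', hx', hy'⟩ : ∃ N x' y', algebraMap W S c ^ N * x = algebraMap W S x' ∧
        algebraMap W S c ^ N * y = algebraMap W S y' := by
      obtain ⟨n, w, hw⟩ := hfrac x
      obtain ⟨m, z, hz⟩ := hfrac y
      refine ⟨n + m, c ^ m * w, c ^ n * z, ?_, ?_⟩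
      · rw [map_mul, map_pow, ← hw]; ring
      · rw [map_mul, map_pow, ← hz]; ring
    have hyq : y' ∉ q := fun h => by
      have h : algebraMap W S y' ∈ Q := h
      rw [← hy'] at h
      exact (hQ.mem_or_mem h).elim (hunit hQ (hcT.pow N)) hy
    have key : ∀ b : σ → W, (∀ u ∈ q, ∑ a, b a * d a u ∈ q) →
        y' * ∑ a, b a * d a x' - x' * ∑ a, b a * d a y' ∈ q := fun b hb => by
      obtain ⟨θ, hθ⟩ := sum_smul_der b d
      obtain ⟨Θ, hΘ⟩ := sum_smul_der (fun a => algebraMap W S (b a)) δ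
      simp only [← hθ] at hb ⊢
      have h1 : ∀ w, algebraMap W S (d l E) * Θ (algebraMap W S w) =
          algebraMap W S (d l E * θ w - θ E * d l w) := fun w => by
        rw [hΘ, hθ, hθ, Finset.mul_sum, Finset.mul_sum, Finset.sum_mul, ← Finset.sum_sub_distrib, map_sum]
        refine Finset.sum_congr rfl fun a _ => ?_
        rw [mul_left_comm, hδ, ← map_mul]
        congr 1; ring
      have h2 := hxy (fun a => algebraMap W S (b a)) fun u hu => by
        rw [← hΘ]
        obtain ⟨n, w, hw⟩ := hfrac u
        have hwQ : algebraMap W S w ∈ Q := hw ▸ Q.mul_mem_left _ hu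
        have h3 : algebraMap W S (d l E) * Θ (algebraMap W S w) ∈ Q := by
          rw [h1]
          exact q.sub_mem (q.mul_mem_left _ (hb w hwQ)) (q.mul_mem_right _ (hb E hEq))
        have h4 := (hQ.mem_or_mem h3).resolve_left (hunit hQ he)
        rw [← hw, Derivation.leibniz, smul_eq_mul, smul_eq_mul] at h4
        exact (hQ.mem_or_mem ((Q.add_mem_iff_left (Q.mul_mem_right _ hu)).1 h4)).resolve_left
          (hunit hQ (hcT.pow n))
      rw [← hΘ, ← hΘ] at h2
      have h5 : algebraMap W S y' * Θ (algebraMap W S x') - algebraMap W S x' * Θ (algebraMap W S y') ∈ Q := by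
        rw [← hx', ← hy', Derivation.leibniz, Derivation.leibniz]
        simp only [smul_eq_mul]
        have := Q.mul_mem_left (algebraMap W S c ^ N * algebraMap W S c ^ N) h2
        convert this using 1
        ring
      have h6 : algebraMap W S (d l E) * algebraMap W S (y' * θ x' - x' * θ y') ∈ Q := by
        have e : algebraMap W S (d l E) * algebraMap W S (y' * θ x' - x' * θ y') =
            algebraMap W S (d l E) * (algebraMap W S y' * Θ (algebraMap W S x') -
              algebraMap W S x' * Θ (algebraMap W S y')) +
            algebraMap W S (θ E) * algebraMap W S (y' * d l x' - x' * d l y') := by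
          have hx := h1 x'
          have hy := h1 y'
          simp only [map_sub, map_mul] at hx hy ⊢
          linear_combination (-algebraMap W S y') * hx + algebraMap W S x' * hy
        rw [e]
        exact Q.add_mem (Q.mul_mem_left _ h5) (Q.mul_mem_right _ (hb E hEq))
      exact (hQ.mem_or_mem h6).resolve_left (hunit hQ he)
    obtain ⟨P, hP, n, hn, hPq⟩ := hC q hq hEq hcq x' y' hyq key
    refine ⟨P.map (algebraMap V K), (Polynomial.map_ne_zero_iff (IsFractionRing.injective V K)).2 hP, n,
      (Polynomial.natDegree_map_le).trans hn, ?_⟩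
    have h1 : algebraMap W S (∑ i ∈ Finset.range (n + 1), algebraMap V W (P.coeff i) * x' ^ i * y' ^ (n - i)) =
        algebraMap W S c ^ (N * n) * ∑ i ∈ Finset.range (n + 1), algebraMap K S ((P.map (algebraMap V K)).coeff i) *
          x ^ i * y ^ (n - i) := by
      rw [map_sum, Finset.mul_sum]
      refine Finset.sum_congr rfl fun i hi => ?_
      have hi : n = i + (n - i) := (Nat.add_sub_cancel' (Nat.lt_succ_iff.1 (Finset.mem_range.1 hi))).symm
      have e : algebraMap K S ((P.map (algebraMap V K)).coeff i) = algebraMap V S (P.coeff i) := by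
        rw [Polynomial.coeff_map]; exact hφ _
      rw [e, map_mul, map_mul, map_pow, map_pow, ← hx', ← hy', ← IsScalarTower.algebraMap_apply V W S]
      have e2 : algebraMap W S c ^ (N * n) = (algebraMap W S c ^ N) ^ i * (algebraMap W S c ^ N) ^ (n - i) := by
        rw [← pow_add, ← hi, pow_mul]
      rw [e2]; ring
    have h2 : algebraMap W S (∑ i ∈ Finset.range (n + 1), algebraMap V W (P.coeff i) * x' ^ i * y' ^ (n - i)) ∈ Q :=
      hPq
    rw [h1] at h2
    exact (hQ.mem_or_mem h2).resolve_left (hunit hQ (hcT.pow _))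
end

open MvPowerSeries in
theorem pderiv_comm {V σ : Type} [CommRing V] (a b : σ) (f : MvPowerSeries σ V) :
    pderiv V a (pderiv V b f) = pderiv V b (pderiv V a f) := by
  classical
  ext n
  rw [coeff_pderiv, coeff_pderiv, coeff_pderiv, coeff_pderiv, add_right_comm]
  by_cases h : a = b
  · rw [h]
  · simp only [Finsupp.add_apply, Finsupp.single_apply, h, Ne.symm h, if_false, add_zero]
    ring

section
open MvPowerSeries
variable {V : Type} [CommRing V] {p : V} [IsDomain V] [IsDiscreteValuationRing V] [CharZero V]
  (hm : maximalIdeal V = Ideal.span {p}) [IsAdicComplete (Ideal.span {p}) V]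
  {σ : Type} [Fintype σ] {E : MvPowerSeries σ V}
  {R T : Type} [CommRing R] [IsNoetherianRing R] [CommRing T] [IsDomain T] [IsNoetherianRing T]
  [Algebra R T] [Algebra (MvPowerSeries σ V) T]

theorem GoodBC.foldr {R S : Type} [CommRing R] [CommRing S] [Algebra R S] [Module.Flat R S]
    [IsNoetherianRing R] {ι : Type} {δ : ι → Der S} {c : Conn δ S} (hc : c.Good) (l : List (Ideal R × ℕ)) :
    GoodBC R δ (iteratedLocalCohomology l (ModuleCat.of R R)) := by
  induction l with
  | nil => exact GoodBC.self hc
  | cons a l ih => exact GoodBC.localCohomology a.1 a.2 _ ih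

include hm in
theorem finite_ass_chart [Module.Flat R T] (hsurj : Function.Surjective (algebraMap (MvPowerSeries σ V) T))
    (hker : ∀ w, algebraMap (MvPowerSeries σ V) T w = 0 → w ∈ Ideal.span {E})
    (hE : algebraMap (MvPowerSeries σ V) T E = 0) (i : σ) (L : List (Ideal R × ℕ)) :
    {P ∈ associatedPrimes R (iteratedLocalCohomology L (ModuleCat.of R R)) |
      ∃ Q : Ideal T, Q.IsPrime ∧ algebraMap (MvPowerSeries σ V) T (C p * pderiv V i E) ∉ Q ∧
        Q.comap (algebraMap R T) = P}.Finite := by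
  set t := algebraMap (MvPowerSeries σ V) T (C p * pderiv V i E) with ht
  by_cases ht0 : t = 0
  · refine Set.finite_empty.subset ?_
    rintro P ⟨-, Q, -, h, -⟩
    exact h (ht0 ▸ Q.zero_mem)
  let M := Submonoid.powers t
  let S := Localization M
  have hM : M ≤ nonZeroDivisors T := powers_le_nonZeroDivisors_of_noZeroDivisors ht0
  have hdom : IsDomain S := IsLocalization.isDomain_localization hM
  have hnoeth : IsNoetherianRing S := IsLocalization.isNoetherianRing M S inferInstance
  have hflat1 : Module.Flat T S := IsLocalization.flat S M
  have hflat : Module.Flat R S := Module.Flat.trans R T S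
  let algVS : Algebra V S := ((algebraMap (MvPowerSeries σ V) S).comp (algebraMap V (MvPowerSeries σ V))).toAlgebra
  have htower : IsScalarTower V (MvPowerSeries σ V) S := IsScalarTower.of_algebraMap_eq fun _ => rfl
  have hunit : IsUnit (algebraMap T S t) := IsLocalization.map_units S (⟨t, Submonoid.mem_powers t⟩ : M)
  have hCalg : ∀ v : V, algebraMap V (MvPowerSeries σ V) v = C v := fun v => rfl
  have hpS : IsUnit (algebraMap V S p) := by
    rw [IsScalarTower.algebraMap_apply V (MvPowerSeries σ V) S, hCalg]
    refine isUnit_of_dvd_unit ?_ hunit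
    rw [ht, ← IsScalarTower.algebraMap_apply]
    exact map_dvd _ (dvd_mul_right _ _)
  obtain ⟨δ, hδ⟩ := exists_chart_good V (S := S) (fun i => absDer (B := MvPowerSeries σ V) (pderiv V i))
    (c := C p * pderiv V i E) i hsurj hker hE (Dvd.intro_left (C p) rfl) (fun a b x => pderiv_comm a b x)
    (fun v hv => by
      obtain ⟨n, u, rfl⟩ := IsDiscreteValuationRing.eq_unit_mul_pow_irreducible hv
        ((IsDiscreteValuationRing.irreducible_iff_uniformizer p).2 hm)
      rw [map_mul, map_pow]
      exact (u.isUnit.map _).mul (hpS.pow n))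
    (fun i v => by rw [hCalg]; exact pderiv_C)
    (fun q hq _ hc u hu hdu => jac_W hm q (fun h => hc (q.mul_mem_right _ h)) hu hdu)
    (fun q hq _ hc x y hy h => const_W hm q (fun h => hc (q.mul_mem_right _ h)) hy h)
  refine (GoodBC.finite (GoodBC.foldr hδ L)).subset ?_
  rintro P ⟨hP, Q, hQ, htQ, rfl⟩
  have hdisj : Disjoint (M : Set T) Q := (Ideal.disjoint_powers_iff_notMem_of_isPrime t).2 htQ
  refine ⟨hP, Q.map (algebraMap T S), IsLocalization.isPrime_of_isPrime_disjoint M S Q hQ hdisj, ?_⟩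
  rw [IsScalarTower.algebraMap_eq R T S, ← Ideal.comap_comap]
  congr 1
  exact IsLocalization.under_map_of_isPrime_disjoint M S hQ hdisj

include hm in
theorem finite_ass_of_faithfullyFlat [IsAlgClosed (ResidueField V)] [Module.FaithfullyFlat R T]
    (hsurj : Function.Surjective (algebraMap (MvPowerSeries σ V) T))
    (hker : ∀ w, algebraMap (MvPowerSeries σ V) T w = 0 → w ∈ Ideal.span {E})
    (hE0 : algebraMap (MvPowerSeries σ V) T E = 0) {h : MvPowerSeries σ V} (hE : E = C p - h) (hh : h ∈ XI σ V)
    (pR : R) (hpR : algebraMap R T pR = algebraMap (MvPowerSeries σ V) T (C p)) (L : List (Ideal R × ℕ)) :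
    {P ∈ associatedPrimes R (iteratedLocalCohomology L (ModuleCat.of R R)) |
      pR ∉ P}.Finite := by
  refine (Set.finite_iUnion fun i => finite_ass_chart hm hsurj hker hE0 i L).subset ?_
  rintro P ⟨hP, hpP⟩
  have hPp : P.IsPrime := hP.isPrime
  obtain ⟨⟨Q, hQ⟩, hQP⟩ := PrimeSpectrum.comap_surjective_of_faithfullyFlat (A := R) (B := T) ⟨P, hPp⟩
  have hQP : Q.comap (algebraMap R T) = P := congrArg PrimeSpectrum.asIdeal hQP
  have hq : (Q.comap (algebraMap (MvPowerSeries σ V) T)).IsPrime := Ideal.comap_isPrime _ _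
  have hpQ : algebraMap (MvPowerSeries σ V) T (C p) ∉ Q := by
    rw [← hpR]; rwa [← hQP] at hpP
  obtain ⟨i, hi⟩ := exists_pderiv_not_mem hm hE hh (Q.comap (algebraMap (MvPowerSeries σ V) T)) hpQ
    (by rw [Ideal.mem_comap, hE0]; exact Q.zero_mem)
  refine Set.mem_iUnion.2 ⟨i, hP, Q, hQ, fun h => ?_, hQP⟩
  rw [map_mul] at h
  exact (hQ.mem_or_mem h).elim hpQ hi
end

section
variable {R T : Type} [CommRing R] [CommRing T] [Algebra R T]

theorem mem_map_exists_sum {I : Ideal R} {t : T} (h : t ∈ I.map (algebraMap R T)) :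
    ∃ (n : ℕ) (a : Fin n → R) (s : Fin n → T), (∀ j, a j ∈ I) ∧ t = ∑ j, a j • s j := by
  obtain ⟨n, f, g, rfl⟩ := Submodule.mem_span_set'.1 h
  choose a ha hag using fun j => (g j).2
  refine ⟨n, a, f, ha, Finset.sum_congr rfl fun j _ => ?_⟩
  rw [← hag, smul_eq_mul, Algebra.smul_def, mul_comm]

/-- A ring extension commuting with colons by elements is flat. -/
theorem flat_of_colon (h : ∀ (I : Ideal R) (z : R) (t : T), algebraMap R T z * t ∈ I.map (algebraMap R T) →
    t ∈ (I.colon {z}).map (algebraMap R T)) : Module.Flat R T := by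
  refine Module.Flat.of_forall_isTrivialRelation fun {l} => ?_
  induction l with
  | zero => intro f x _; exact ⟨0, fun i => i.elim0, fun i => i.elim0, fun i => i.elim0, fun j => j.elim0⟩
  | succ l ih =>
    intro f x hfx
    rw [Fin.sum_univ_castSucc] at hfx
    let I := Ideal.span (Set.range fun i : Fin l => f i.castSucc)
    have h1 : algebraMap R T (f (Fin.last l)) * x (Fin.last l) ∈ I.map (algebraMap R T) := by
      have e : algebraMap R T (f (Fin.last l)) * x (Fin.last l) = -∑ i : Fin l, f i.castSucc • x i.castSucc := by
        rw [← Algebra.smul_def]; exact eq_neg_of_add_eq_zero_right hfx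
      rw [e]
      refine neg_mem (sum_mem fun i _ => ?_)
      rw [Algebra.smul_def]
      exact Ideal.mul_mem_right _ _ (Ideal.mem_map_of_mem _ (Ideal.subset_span ⟨i, rfl⟩))
    obtain ⟨n, a, s, ha, hs⟩ := mem_map_exists_sum (h I _ _ h1)
    have h2 : ∀ j, ∃ c : Fin l → R, ∑ i, c i * f i.castSucc = a j * f (Fin.last l) := fun j =>
      Ideal.mem_span_range_iff_exists_fun.1 (Submodule.mem_colon_singleton.1 (ha j))
    choose c hc using h2
    obtain ⟨m, b, y, hb, hb0⟩ := ih (f := fun i => f i.castSucc)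
      (x := fun i => x i.castSucc + ∑ j, c j i • s j) (by
        simp only [smul_add, Finset.sum_add_distrib, Finset.smul_sum]
        rw [Finset.sum_comm, ← hfx, hs, Finset.smul_sum]
        congr 1
        refine Finset.sum_congr rfl fun j _ => ?_
        rw [← mul_smul, mul_comm, ← hc, Finset.sum_smul]
        refine Finset.sum_congr rfl fun i _ => ?_
        rw [← mul_smul, mul_comm])
    refine ⟨m + n, fun i => Fin.lastCases (motive := fun _ => Fin (m + n) → R)
      (Fin.append (fun _ => 0) a) (fun i => Fin.append (b i) (fun j => -c j i)) i, Fin.append y s, ?_, ?_⟩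
    · intro i
      rw [Fin.sum_univ_add]
      refine Fin.lastCases ?_ (fun i => ?_) i
      · simp [hs]
      · simp only [Fin.lastCases_castSucc, Fin.append_left, Fin.append_right, neg_smul, Finset.sum_neg_distrib]
        rw [← hb i, add_neg_cancel_right]
    · intro j
      rw [Fin.sum_univ_castSucc]
      refine Fin.addCases (fun j => ?_) (fun j => ?_) j
      · simp [hb0]
      · simp only [Fin.lastCases_castSucc, Fin.lastCases_last, Fin.append_right, mul_neg, Finset.sum_neg_distrib]
        rw [mul_comm (f (Fin.last l)), ← hc j, neg_add_eq_zero]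
        exact Finset.sum_congr rfl fun i _ => mul_comm _ _

/-- For Noetherian local rings it suffices to check colons of ideals containing a power of the
maximal ideal. -/
theorem flat_of_colon_primary [IsNoetherianRing R] [IsNoetherianRing T] [IsLocalRing R] [IsLocalRing T]
    [IsLocalHom (algebraMap R T)]
    (h : ∀ (I : Ideal R) (n : ℕ), maximalIdeal R ^ n ≤ I → ∀ (z : R) (t : T),
      algebraMap R T z * t ∈ I.map (algebraMap R T) → t ∈ (I.colon {z}).map (algebraMap R T)) :
    Module.Flat R T := by
  refine flat_of_colon fun I z t ht => ?_
  let m := maximalIdeal R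
  obtain ⟨k, hk⟩ := Ideal.exists_pow_inf_eq_pow_smul m (Submodule.map (Submodule.mkQ I) (Ideal.span {z}))
  have h1 : ∀ n, (I ⊔ m ^ (n + k)).colon {z} ≤ I.colon {z} ⊔ m ^ n := fun n a ha => by
    rw [Submodule.mem_colon_singleton, smul_eq_mul] at ha
    have h2 : I.mkQ (a * z) ∈ (m ^ (n + k) • ⊤ ⊓ Submodule.map (Submodule.mkQ I) (Ideal.span {z}) :
        Submodule R (R ⧸ I)) := by
      constructor
      · obtain ⟨i, hi, r, hr, hir⟩ := Submodule.mem_sup.1 ha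
        rw [← hir, map_add, (Submodule.Quotient.mk_eq_zero I).2 hi |> (show I.mkQ i = 0 from ·), zero_add]
        have : I.mkQ r = r • I.mkQ 1 := by rw [← map_smul, smul_eq_mul, mul_one]
        rw [this]
        exact Submodule.smul_mem_smul hr trivial
      · exact Submodule.mem_map_of_mem (Ideal.mul_mem_left _ _ (Ideal.mem_span_singleton_self z))
    rw [hk (n + k) (by omega), Nat.add_sub_cancel] at h2
    have h3 : I.mkQ (a * z) ∈ Submodule.map (Submodule.mkQ I) (m ^ n • Ideal.span {z}) := by
      rw [Submodule.map_smul'']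
      exact Submodule.smul_mono le_rfl inf_le_right h2
    obtain ⟨w, hw, hwa⟩ := h3
    obtain ⟨b, hb, rfl⟩ := Ideal.mem_mul_span_singleton.1 (show w ∈ m ^ n * Ideal.span {z} from hw)
    have h4 : a * z - b * z ∈ I := (Submodule.Quotient.eq I).1 hwa.symm
    have h5 : a - b ∈ I.colon {z} := by
      rw [Submodule.mem_colon_singleton, smul_eq_mul, sub_mul]; exact h4
    rw [← sub_add_cancel a b]
    exact Submodule.add_mem_sup h5 hb
  let K := (I.colon {z}).map (algebraMap R T)
  have h6 : ∀ n, t ∈ K ⊔ maximalIdeal T ^ n := fun n => by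
    have h7 := h (I ⊔ m ^ (n + k)) (n + k) le_sup_right z t (Ideal.map_mono le_sup_left ht)
    have h8 := Ideal.map_mono (f := algebraMap R T) (h1 n) h7
    rw [Ideal.map_sup, Ideal.map_pow] at h8
    refine (show K ⊔ Ideal.map (algebraMap R T) m ^ n ≤ _ from sup_le_sup_left (Ideal.pow_right_mono ?_ n) K) h8
    exact Ideal.map_le_iff_le_comap.2 fun x hx hu => hx (isUnit_of_map_unit (algebraMap R T) x hu)
  have h9 : K.mkQ t ∈ (⨅ n : ℕ, maximalIdeal T ^ n • ⊤ : Submodule T (T ⧸ K)) := by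
    refine (Submodule.mem_iInf _).2 fun n => ?_
    obtain ⟨i, hi, r, hr, hir⟩ := Submodule.mem_sup.1 (h6 n)
    have hi0 : K.mkQ i = 0 := (Submodule.Quotient.mk_eq_zero K).2 hi
    have : K.mkQ r = r • K.mkQ 1 := by rw [← map_smul, smul_eq_mul, mul_one]
    rw [← hir, map_add, hi0, zero_add, this]
    exact Submodule.smul_mem_smul hr trivial
  rw [Ideal.iInf_pow_smul_eq_bot_of_isLocalRing _ (maximalIdeal.isMaximal T).ne_top] at h9
  exact (Submodule.Quotient.mk_eq_zero K).1 h9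
end

section
variable {R A : Type} [CommRing R] [IsLocalRing R] [CommRing A] [Algebra R A]

variable (R) in
/-- Modulo `J`, colons of ideals primary to the maximal ideal are preserved by extension to `A`. -/
def ColonExact (J : Ideal A) : Prop :=
  ∀ (I : Ideal R) (n : ℕ), maximalIdeal R ^ n ≤ I → ∀ (z : R) (w : A),
    algebraMap R A z * w ∈ J ⊔ I.map (algebraMap R A) → w ∈ J ⊔ (I.colon {z}).map (algebraMap R A)

theorem exists_socle {I : Ideal R} {n : ℕ} (hn : maximalIdeal R ^ n ≤ I) (hI : I ≠ ⊤) :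
    ∃ z, z ∉ I ∧ ∀ a ∈ maximalIdeal R, a * z ∈ I := by
  induction n with
  | zero => rw [pow_zero, Ideal.one_eq_top, top_le_iff] at hn; exact absurd hn hI
  | succ n ih =>
    by_cases h : maximalIdeal R ^ n ≤ I
    · exact ih h
    · obtain ⟨z, hz, hzI⟩ := Set.not_subset.1 h
      exact ⟨z, hzI, fun a ha => hn (by rw [pow_succ']; exact Ideal.mul_mem_mul ha hz)⟩

theorem ColonExact.regular [IsNoetherianRing R] {J : Ideal A} (hJ : ColonExact R J) {u : A}
    (hu : ∀ w, u * w ∈ J ⊔ (maximalIdeal R).map (algebraMap R A) →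
      w ∈ J ⊔ (maximalIdeal R).map (algebraMap R A)) (I : Ideal R) :
    ∀ n, maximalIdeal R ^ n ≤ I → ∀ w, u * w ∈ J ⊔ I.map (algebraMap R A) →
      w ∈ J ⊔ I.map (algebraMap R A) := by
  induction I using IsNoetherian.induction with
  | hgt I ih =>
    intro n hn w hw
    by_cases hI : I = ⊤
    · rw [hI, Ideal.map_top, sup_top_eq]; trivial
    obtain ⟨z, hz, hzm⟩ := exists_socle hn hI
    have hlt : I < I ⊔ Ideal.span {z} := by
      refine lt_of_le_of_ne le_sup_left fun h => hz ?_
      rw [h]; exact Ideal.mem_sup_right (Ideal.mem_span_singleton_self z)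
    have hle : J ⊔ Ideal.map (algebraMap R A) I ≤ J ⊔ Ideal.map (algebraMap R A) (I ⊔ Ideal.span {z}) :=
      sup_le_sup_left (Ideal.map_mono le_sup_left) J
    have h1 := ih _ hlt n (hn.trans le_sup_left) w (hle hw)
    rw [Ideal.map_sup, ← sup_assoc, Ideal.map_span, Set.image_singleton] at h1
    obtain ⟨i, hi, x, hx, hix⟩ := Submodule.mem_sup.1 h1
    obtain ⟨v, rfl⟩ := Ideal.mem_span_singleton'.1 hx
    have h2 : algebraMap R A z * (u * v) ∈ J ⊔ Ideal.map (algebraMap R A) I := by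
      have e : algebraMap R A z * (u * v) = u * w - u * i := by rw [← hix]; ring
      rw [e]
      exact sub_mem hw (Ideal.mul_mem_left _ _ hi)
    have h3 := hJ I n hn z _ h2
    have h4 : I.colon {z} ≤ maximalIdeal R := by
      refine IsLocalRing.le_maximalIdeal fun h => hz ?_
      have h1 : (1 : R) ∈ I.colon {z} := h ▸ trivial
      rw [Submodule.mem_colon_singleton, one_smul] at h1
      exact h1
    have h5 := hu v (sup_le_sup_left (Ideal.map_mono h4) J h3)
    rw [← hix]
    refine add_mem hi ?_
    obtain ⟨j, hj, y, hy, hjy⟩ := Submodule.mem_sup.1 h5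
    rw [← hjy, add_mul]
    refine Submodule.add_mem_sup (Ideal.mul_mem_right _ _ hj) ?_
    have h6 : y * algebraMap R A z ∈ (maximalIdeal R * Ideal.span {z}).map (algebraMap R A) := by
      rw [Ideal.map_mul]
      exact Ideal.mul_mem_mul hy (Ideal.mem_map_of_mem _ (Ideal.mem_span_singleton_self z))
    refine Ideal.map_mono ?_ h6
    rw [Ideal.mul_le]
    intro a ha b hb
    obtain ⟨c, rfl⟩ := Ideal.mem_span_singleton'.1 hb
    rw [mul_left_comm]
    exact Ideal.mul_mem_left I _ (hzm a ha)

theorem ColonExact.sup_span [IsNoetherianRing R] {J : Ideal A} (hJ : ColonExact R J) {u : A}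
    (hu : ∀ w, u * w ∈ J ⊔ (maximalIdeal R).map (algebraMap R A) →
      w ∈ J ⊔ (maximalIdeal R).map (algebraMap R A)) : ColonExact R (J ⊔ Ideal.span {u}) := by
  intro I n hn z w hw
  rw [sup_assoc, sup_comm (Ideal.span {u}), ← sup_assoc] at hw ⊢
  obtain ⟨i, hi, x, hx, hix⟩ := Submodule.mem_sup.1 hw
  obtain ⟨a, rfl⟩ := Ideal.mem_span_singleton'.1 hx
  have h1 : u * a ∈ J ⊔ (I ⊔ Ideal.span {z}).map (algebraMap R A) := by
    have e : u * a = algebraMap R A z * w - i := by rw [← hix]; ring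
    rw [e]
    refine sub_mem (Ideal.mul_mem_right _ _ ?_) (sup_le_sup_left (Ideal.map_mono le_sup_left) J hi)
    exact Ideal.mem_sup_right (Ideal.mem_map_of_mem _ (Ideal.mem_sup_right (Ideal.mem_span_singleton_self z)))
  have h2 := hJ.regular hu _ n (hn.trans le_sup_left) a h1
  rw [Ideal.map_sup, ← sup_assoc, Ideal.map_span, Set.image_singleton] at h2
  obtain ⟨j, hj, y, hy, hjy⟩ := Submodule.mem_sup.1 h2
  obtain ⟨v, rfl⟩ := Ideal.mem_span_singleton'.1 hy
  have h3 : algebraMap R A z * (w - u * v) ∈ J ⊔ I.map (algebraMap R A) := by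
    have e : algebraMap R A z * (w - u * v) = i + u * j := by
      rw [mul_sub, ← hix, ← hjy]; ring
    rw [e]
    exact add_mem hi (Ideal.mul_mem_left _ _ hj)
  have h4 := hJ I n hn z _ h3
  rw [← sub_add_cancel w (u * v)]
  exact Submodule.add_mem_sup h4 (Ideal.mul_mem_right _ _ (Ideal.mem_span_singleton_self u))

theorem ColonExact.sSup {c : Set (Ideal A)} (hc : DirectedOn (· ≤ ·) c) (hne : c.Nonempty)
    (h : ∀ J ∈ c, ColonExact R J) : ColonExact R (sSup c) := by
  intro I n hn z w hw
  obtain ⟨j, hj, i, hi, hji⟩ := Submodule.mem_sup.1 hw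
  obtain ⟨J, hJ, hjJ⟩ := (Submodule.mem_sSup_of_directed hne hc).1 hj
  exact sup_le_sup_right (le_sSup hJ) _ (h J hJ I n hn z w (hji ▸ Submodule.add_mem_sup hjJ hi))

theorem ColonExact.bot {σ : Type} : ColonExact R (⊥ : Ideal (MvPolynomial σ R)) := by
  intro I n hn z w hw
  rw [bot_sup_eq, MvPolynomial.algebraMap_eq, MvPolynomial.mem_map_C_iff] at hw ⊢
  intro d
  rw [Submodule.mem_colon_singleton, smul_eq_mul, mul_comm]
  have := hw d
  rwa [MvPolynomial.coeff_C_mul] at this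
end

section
open MvPolynomial
variable {R k : Type} [CommRing R] [Field k] [Algebra R k]

open Classical in
variable (R) in
/-- Reduction of the coefficients together with the specialisation of the variables indexed by `Λ`
to the corresponding elements of `k`. -/
def specialize (Λ : Set k) : MvPolynomial k R →+* MvPolynomial k k :=
  eval₂Hom (C.comp (algebraMap R k)) fun a => if a ∈ Λ then C a else X a

theorem specialize_C (Λ : Set k) (r : R) : specialize R Λ (C r) = C (algebraMap R k r) := eval₂_C _ _ _

theorem specialize_X_mem {Λ : Set k} {a : k} (h : a ∈ Λ) : specialize R Λ (X a) = C a := by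
  rw [specialize, coe_eval₂Hom, eval₂_X, if_pos h]

theorem specialize_X_notMem {Λ : Set k} {a : k} (h : a ∉ Λ) : specialize R Λ (X a) = X a := by
  rw [specialize, coe_eval₂Hom, eval₂_X, if_neg h]

theorem ker_specialize_empty : RingHom.ker (specialize R (∅ : Set k)) =
    Ideal.map C (RingHom.ker (algebraMap R k)) := by
  rw [← ker_map]
  congr 1
  refine ringHom_ext (fun r => ?_) (fun x => ?_)
  · simp [specialize_C]
  · rw [specialize_X_notMem (Set.notMem_empty x), map_X]

theorem specialize_univ (f : MvPolynomial k R) : specialize R (Set.univ : Set k) f = C (aeval id f) := by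
  have : specialize R (Set.univ : Set k) = C.comp (aeval (R := R) (id : k → k)).toRingHom := by
    refine ringHom_ext (fun r => ?_) (fun x => ?_)
    · simp [specialize_C]
    · rw [specialize_X_mem (Set.mem_univ x)]; simp
  rw [this]; rfl

theorem ker_specialize_mono {Λ Λ' : Set k} (h : Λ ⊆ Λ') :
    RingHom.ker (specialize R Λ) ≤ RingHom.ker (specialize R Λ') := by
  have : specialize R Λ' = (specialize k Λ').comp (specialize R Λ) := by
    refine ringHom_ext (fun r => ?_) (fun x => ?_)
    · simp [specialize_C]
    · by_cases hx : x ∈ Λ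
      · rw [RingHom.comp_apply, specialize_X_mem hx, specialize_X_mem (h hx), specialize_C]; rfl
      · rw [RingHom.comp_apply, specialize_X_notMem hx]
        by_cases hx' : x ∈ Λ'
        · rw [specialize_X_mem hx', specialize_X_mem hx']
        · rw [specialize_X_notMem hx', specialize_X_notMem hx']
  intro f hf
  rw [RingHom.mem_ker] at hf ⊢
  rw [this, RingHom.comp_apply, hf, map_zero]

theorem specialize_congr {Λ Λ' : Set k} (f : MvPolynomial k R) (h : ∀ a ∈ f.vars, a ∈ Λ ↔ a ∈ Λ') :
    specialize R Λ f = specialize R Λ' f := by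
  refine eval₂Hom_congr' rfl (fun a ha _ => ?_) rfl
  by_cases hx : a ∈ Λ
  · rw [if_pos hx, if_pos ((h a ha).1 hx)]
  · rw [if_neg hx, if_neg fun h' => hx ((h a ha).2 h')]

theorem specialize_insert {κ : Type} [Field κ] [Algebra κ k] [Algebra R κ] [IsScalarTower R κ k]
    (hκ : Function.Surjective (algebraMap R κ)) [Algebra.IsAlgebraic κ k] {Λ : Set k} {b : k} (hb : b ∉ Λ) :
    ∃ u : MvPolynomial k R, specialize R Λ u ≠ 0 ∧
      RingHom.ker (specialize R (insert b Λ)) = RingHom.ker (specialize R Λ) ⊔ Ideal.span {u} := by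
  have : Nontrivial R := (algebraMap R k).domain_nontrivial
  let F := IntermediateField.adjoin κ Λ
  let v : F →+* k := algebraMap F k
  let ψ : MvPolynomial Λ R →+* F := eval₂Hom ((algebraMap κ F).comp (algebraMap R κ))
    fun a => ⟨a, IntermediateField.subset_adjoin κ Λ a.2⟩
  have hψ : Function.Surjective ψ := by
    intro y
    have hy : (y : k) ∈ Algebra.adjoin κ Λ := by
      rw [← IntermediateField.adjoin_toSubalgebra_of_isAlgebraic fun x _ => Algebra.IsAlgebraic.isAlgebraic x]
      exact y.2
    suffices H : ∀ z ∈ Algebra.adjoin κ Λ, ∃ q : MvPolynomial Λ R, v (ψ q) = z by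
      obtain ⟨q, hq⟩ := H y hy
      exact ⟨q, v.injective hq⟩
    intro z hz
    induction hz using Algebra.adjoin_induction with
    | mem x hx => exact ⟨X ⟨x, hx⟩, by simp [ψ, v]⟩
    | algebraMap r =>
      obtain ⟨r, rfl⟩ := hκ r
      exact ⟨C r, by simp [ψ, v]⟩
    | add x y _ _ hx hy =>
      obtain ⟨q, rfl⟩ := hx; obtain ⟨q', rfl⟩ := hy
      exact ⟨q + q', by rw [map_add, map_add]⟩
    | mul x y _ _ hx hy =>
      obtain ⟨q, rfl⟩ := hx; obtain ⟨q', rfl⟩ := hy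
      exact ⟨q * q', by rw [map_mul, map_mul]⟩
  have hbi : IsIntegral F b := (Algebra.IsAlgebraic.isAlgebraic (R := κ) b).isIntegral.tower_top
  let g := minpoly F b
  have hg : g.Monic := minpoly.monic hbi
  obtain ⟨G0, hG0, hdeg, hG0m⟩ := Polynomial.lifts_and_natDegree_eq_and_monic (f := ψ) (p := g)
    ((Polynomial.mem_lifts _).2 (Polynomial.map_surjective _ hψ g)) hg
  let ι : MvPolynomial Λ R →+* MvPolynomial k R := (rename (R := R) (Subtype.val : Λ → k)).toRingHom
  let Nb := {a : k // a ≠ b}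
  let ιb : MvPolynomial Nb R →+* MvPolynomial k R := (rename (R := R) (Subtype.val : Nb → k)).toRingHom
  let inc : MvPolynomial Λ R →+* MvPolynomial Nb R :=
    (rename (R := R) (fun a : Λ => (⟨a, fun h => hb (h ▸ a.2)⟩ : Nb))).toRingHom
  have hinc : ιb.comp inc = ι := by
    refine ringHom_ext (fun r => ?_) (fun x => ?_)
    · simp [ι, ιb, inc]
    · simp [ι, ιb, inc]
  let u := G0.eval₂ ι (X b)
  have hρι : (specialize R Λ).comp ι = (C.comp v).comp ψ := by
    refine ringHom_ext (fun r => ?_) (fun x => ?_)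
    · simp [ι, ψ, v, specialize_C]; exact IsScalarTower.algebraMap_apply R κ k r
    · simp [ι, ψ, v, specialize_X_mem x.2]
  have hρι' : (specialize R (insert b Λ)).comp ι = (C.comp v).comp ψ := by
    refine ringHom_ext (fun r => ?_) (fun x => ?_)
    · simp [ι, ψ, v, specialize_C]; exact IsScalarTower.algebraMap_apply R κ k r
    · simp [ι, ψ, v, specialize_X_mem (Set.mem_insert_of_mem b x.2)]
  refine ⟨u, fun h => ?_, le_antisymm (fun f hf => ?_) (sup_le (ker_specialize_mono (Set.subset_insert b Λ)) ?_)⟩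
  · rw [Polynomial.hom_eval₂, specialize_X_notMem hb, hρι, ← Polynomial.eval₂_map, hG0,
      ← Polynomial.eval₂_map] at h
    exact (hg.map v).ne_zero ((transcendental_iff.1 (transcendental_X k b)) _ h)
  · let G := G0.map inc
    have hG : G.Monic := hG0m.map inc
    let Φ : Polynomial (MvPolynomial Nb R) →+* MvPolynomial k R := Polynomial.eval₂RingHom ιb (X b)
    have hΦ : Function.Surjective Φ := by
      intro f
      induction f using MvPolynomial.induction_on with
      | C a => exact ⟨Polynomial.C (C a), by simp [Φ, ιb]⟩
      | add p q hp hq =>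
        obtain ⟨p, rfl⟩ := hp; obtain ⟨q, rfl⟩ := hq
        exact ⟨p + q, map_add _ _ _⟩
      | mul_X p a hp =>
        obtain ⟨p, rfl⟩ := hp
        by_cases ha : a = b
        · exact ⟨p * Polynomial.X, by rw [map_mul, ha]; simp [Φ]⟩
        · exact ⟨p * Polynomial.C (X ⟨a, ha⟩), by rw [map_mul]; simp [Φ, ιb]⟩
    have hΦG : Φ G = u := by
      change (G0.map inc).eval₂ ιb (X b) = _
      rw [Polynomial.eval₂_map, hinc]
    obtain ⟨f, rfl⟩ := hΦ f
    let P := f %ₘ G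
    have hfP : Φ f = Φ P + u * Φ (f /ₘ G) := by
      conv_lhs => rw [← Polynomial.modByMonic_add_div f G]
      rw [map_add, map_mul, hΦG]
    have huker : specialize R (insert b Λ) u = 0 := by
      rw [Polynomial.hom_eval₂, specialize_X_mem (Set.mem_insert b Λ), hρι', ← Polynomial.eval₂_map, hG0,
        ← Polynomial.hom_eval₂]
      have : g.eval₂ v b = 0 := minpoly.aeval F b
      rw [this, map_zero]
    have hP0 : specialize R (insert b Λ) (Φ P) = 0 := by
      rw [RingHom.mem_ker, hfP, map_add, map_mul, huker, zero_mul, add_zero] at hf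
      exact hf
    rw [hfP]
    refine Submodule.add_mem_sup ?_ (Ideal.mul_mem_right _ _ (Ideal.mem_span_singleton_self u))
    let ρb : MvPolynomial Nb R →+* MvPolynomial k F := by
      classical
      exact eval₂Hom (C.comp ((algebraMap κ F).comp (algebraMap R κ)))
        fun a => if h : (a : k) ∈ Λ then C ⟨a, IntermediateField.subset_adjoin κ Λ h⟩ else X a
    have hρb : ∀ Λ' : Set k, (∀ a : Nb, (a : k) ∈ Λ' ↔ (a : k) ∈ Λ) → (specialize R Λ').comp ιb = (map v).comp ρb := by
      intro Λ' h
      refine ringHom_ext (fun r => ?_) (fun x => ?_)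
      · simp [ιb, ρb, v, specialize_C]; exact IsScalarTower.algebraMap_apply R κ k r
      · by_cases hx : (x : k) ∈ Λ
        · simp [ιb, ρb, v, specialize_X_mem ((h x).2 hx), hx]
        · simp [ιb, ρb, specialize_X_notMem fun h' => hx ((h x).1 h'), hx]
    have hdegP : P.natDegree < g.natDegree := by
      have h1 : G.natDegree = g.natDegree := by rw [hG0m.natDegree_map, hdeg]
      rw [← h1]
      refine Polynomial.natDegree_modByMonic_lt _ hG fun h => ?_
      rw [h, Polynomial.natDegree_one] at h1
      exact (minpoly.natDegree_pos hbi).ne h1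
    have hcoef : ∀ i, i < g.natDegree → ρb (P.coeff i) = 0 := by
      change (specialize R (insert b Λ)) (P.eval₂ ιb (X b)) = 0 at hP0
      rw [Polynomial.hom_eval₂, specialize_X_mem (Set.mem_insert b Λ),
        hρb _ (fun a => ⟨fun h => h.resolve_left a.2, fun h => Set.mem_insert_of_mem _ h⟩),
        Polynomial.eval₂_eq_sum_range' _ hdegP] at hP0
      intro i hi
      ext d
      have h1 := congrArg (coeff d) hP0
      rw [coeff_sum, coeff_zero, Finset.sum_range] at h1
      have h2 := Fintype.linearIndependent_iff.1 (linearIndependent_pow (K := F) b)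
        (fun i => coeff d (ρb (P.coeff i))) (by
          rw [← h1]
          refine Finset.sum_congr rfl fun i _ => ?_
          rw [← map_pow, mul_comm, coeff_C_mul, mul_comm, RingHom.comp_apply, coeff_map]
          rfl) ⟨i, hi⟩
      rw [coeff_zero]; exact congrArg _ h2
    rw [RingHom.mem_ker]
    change specialize R Λ (P.eval₂ ιb (X b)) = 0
    rw [Polynomial.hom_eval₂, hρb Λ (fun a => Iff.rfl), Polynomial.eval₂_eq_sum_range' _ hdegP]
    refine Finset.sum_eq_zero fun i hi => ?_
    rw [RingHom.comp_apply, hcoef i (Finset.mem_range.1 hi), map_zero, zero_mul]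
  · rw [Ideal.span_singleton_le_iff_mem, RingHom.mem_ker, Polynomial.hom_eval₂,
      specialize_X_mem (Set.mem_insert b Λ), hρι', ← Polynomial.eval₂_map, hG0, ← Polynomial.hom_eval₂]
    have : g.eval₂ v b = 0 := minpoly.aeval F b
    rw [this, map_zero]
end

section
open MvPolynomial
variable {R k : Type} [CommRing R] [IsLocalRing R] [IsNoetherianRing R] [Field k] [Algebra R k]

theorem exists_colonExact {κ : Type} [Field κ] [Algebra κ k] [Algebra R κ] [IsScalarTower R κ k]
    (hκ : Function.Surjective (algebraMap R κ)) [Algebra.IsAlgebraic κ k]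
    (hm : RingHom.ker (algebraMap R k) = maximalIdeal R) :
    ∃ J : Ideal (MvPolynomial k R), ColonExact R J ∧
      J ⊔ (maximalIdeal R).map (algebraMap R (MvPolynomial k R)) =
        RingHom.ker (aeval (R := R) (id : k → k)) := by
  let mA := (maximalIdeal R).map (algebraMap R (MvPolynomial k R))
  let S : Set (Set k × Ideal (MvPolynomial k R)) :=
    {x | ColonExact R x.2 ∧ x.2 ⊔ mA = RingHom.ker (specialize R x.1)}
  obtain ⟨⟨Λ, J⟩, -, hmax⟩ := zorn_le_nonempty₀ S (fun c hcS hc y hy => by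
    have hd : DirectedOn (· ≤ ·) c := hc.directedOn
    have hd2 : DirectedOn (· ≤ ·) (Prod.snd '' c) := by
      rintro _ ⟨a, ha, rfl⟩ _ ⟨b, hb, rfl⟩
      obtain ⟨d, hd, h1, h2⟩ := hd a ha b hb
      exact ⟨d.2, ⟨d, hd, rfl⟩, h1.2, h2.2⟩
    have hne : (Prod.snd '' c).Nonempty := ⟨y.2, y, hy, rfl⟩
    refine ⟨(⋃ x ∈ c, x.1, sSup (Prod.snd '' c)), ⟨?_, ?_⟩, fun z hz =>
      ⟨Set.subset_biUnion_of_mem (u := fun x : Set k × Ideal (MvPolynomial k R) => x.1) hz, le_sSup ⟨z, hz, rfl⟩⟩⟩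
    · refine ColonExact.sSup hd2 hne ?_
      rintro _ ⟨a, ha, rfl⟩
      exact (hcS ha).1
    · apply le_antisymm
      · refine sup_le (sSup_le ?_) ?_
        · rintro _ ⟨a, ha, rfl⟩
          refine (le_sup_left.trans (hcS ha).2.le).trans (ker_specialize_mono ?_)
          exact Set.subset_biUnion_of_mem (u := fun x : Set k × Ideal (MvPolynomial k R) => x.1) ha
        · refine (le_sup_right.trans (hcS hy).2.le).trans (ker_specialize_mono ?_)
          exact Set.subset_biUnion_of_mem (u := fun x : Set k × Ideal (MvPolynomial k R) => x.1) hy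
      · intro f hf
        have key : ∀ s : Finset k, ∃ a ∈ c, ∀ x ∈ s, x ∈ (⋃ x ∈ c, x.1) → x ∈ a.1 := by
          intro s
          classical
          induction s using Finset.induction_on with
          | empty => exact ⟨y, hy, fun x hx => absurd hx (Finset.notMem_empty x)⟩
          | insert b s _ ih =>
            obtain ⟨a, ha, hs⟩ := ih
            by_cases hb : b ∈ (⋃ x ∈ c, x.1)
            · obtain ⟨a', ha', hb'⟩ := Set.mem_iUnion₂.1 hb
              obtain ⟨d, hd, h1, h2⟩ := hd a ha a' ha'
              refine ⟨d, hd, fun x hx hx' => ?_⟩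
              rcases Finset.mem_insert.1 hx with rfl | hx
              · exact h2.1 hb'
              · exact h1.1 (hs x hx hx')
            · refine ⟨a, ha, fun x hx hx' => ?_⟩
              rcases Finset.mem_insert.1 hx with rfl | hx
              · exact absurd hx' hb
              · exact hs x hx hx'
        obtain ⟨a, ha, h⟩ := key f.vars
        have h1 : f ∈ RingHom.ker (specialize R a.1) := by
          rw [RingHom.mem_ker] at hf ⊢
          rw [← hf]
          exact specialize_congr f fun x hx => Iff.intro (fun h2 => Set.mem_biUnion ha h2) (h x hx)
        rw [← (hcS ha).2] at h1
        have h2 : a.2 ≤ sSup (Prod.snd '' c) := le_sSup ⟨a, ha, rfl⟩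
        have h3 : a.2 ⊔ mA ≤ sSup (Prod.snd '' c) ⊔ mA := sup_le_sup_right h2 mA
        exact h3 h1)
    (∅, ⊥) ⟨ColonExact.bot, by
      rw [bot_sup_eq, ker_specialize_empty, hm]; rfl⟩
  obtain ⟨hJ, hk⟩ := hmax.prop
  have hΛ : Λ = Set.univ := by
    by_contra hne
    obtain ⟨b, hb⟩ := (Set.ne_univ_iff_exists_notMem Λ).1 hne
    obtain ⟨u, hu0, hu⟩ := specialize_insert (R := R) hκ hb
    have h1 : ColonExact R (J ⊔ Ideal.span {u}) := by
      refine hJ.sup_span fun w hw => ?_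
      have hk' : J ⊔ (maximalIdeal R).map (algebraMap R (MvPolynomial k R)) = _ := hk
      rw [hk', RingHom.mem_ker, map_mul] at hw
      rw [hk', RingHom.mem_ker]
      exact (mul_eq_zero.1 hw).resolve_left hu0
    have h2 : ((insert b Λ, J ⊔ Ideal.span {u}) : Set k × Ideal (MvPolynomial k R)) ∈ S := by
      refine ⟨h1, ?_⟩
      change J ⊔ Ideal.span {u} ⊔ mA = RingHom.ker (specialize R (insert b Λ))
      rw [hu, sup_right_comm]
      exact congrArg (· ⊔ _) hk
    exact hb ((hmax.le_of_ge h2 ⟨Set.subset_insert b Λ, le_sup_left⟩).1 (Set.mem_insert b Λ))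
  refine ⟨J, hJ, ?_⟩
  refine (hk : J ⊔ mA = _).trans ?_
  ext f
  change f ∈ RingHom.ker (specialize R Λ) ↔ _
  rw [hΛ, RingHom.mem_ker, RingHom.mem_ker, specialize_univ, map_eq_zero_iff _ (C_injective k k)]
end

section
open WittVector Ideal
variable {T k : Type} [CommRing T] (I : Ideal T) {p : ℕ} [Fact p.Prime] [CommRing k]

theorem ghostComponent_mem_pow (hp : (p : T) ∈ I) {x : WittVector p T} {n : ℕ} (hx : ∀ i, x.coeff i ∈ I) :
    ghostComponent n x ∈ I ^ (n + 1) := by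
  rw [ghostComponent_apply, aeval_wittPolynomial]
  refine sum_mem fun i hi => ?_
  have h1 := Ideal.mul_mem_mul (Ideal.pow_mem_pow hp i) (Ideal.pow_mem_pow (hx i) (p ^ (n - i)))
  rw [← pow_add] at h1
  refine Ideal.pow_le_pow_right ?_ h1
  have := (n - i).lt_pow_self (Fact.out : p.Prime).one_lt
  omega

theorem exists_wittLift [IsAdicComplete I T] (hp : (p : T) ∈ I) [CharP k p] [PerfectRing k p] (g : k →+* T ⧸ I) :
    ∃ φ : WittVector p k →+* T, ∀ x, Ideal.Quotient.mk I (φ x) = g (x.coeff 0) := by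
  have hsurj : Function.Surjective (WittVector.map (p := p) (Ideal.Quotient.mk I)) :=
    map_surjective _ Ideal.Quotient.mk_surjective
  have hker : ∀ n, RingHom.ker (WittVector.map (p := p) (Ideal.Quotient.mk I)) ≤
      RingHom.ker ((Ideal.Quotient.mk (I ^ (n + 1))).comp (WittVector.ghostComponent (p := p) n)) := by
    intro n x hx
    rw [RingHom.mem_ker] at hx ⊢
    rw [RingHom.comp_apply, Ideal.Quotient.eq_zero_iff_mem]
    refine ghostComponent_mem_pow I hp fun i => ?_
    rw [← Ideal.Quotient.eq_zero_iff_mem, ← map_coeff, hx, zero_coeff]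
  let gh : ∀ n, WittVector p (T ⧸ I) →+* T ⧸ I ^ (n + 1) := fun n =>
    RingHom.liftOfSurjective (WittVector.map (Ideal.Quotient.mk I)) hsurj ⟨_, hker n⟩
  have hgh : ∀ n x, gh n (WittVector.map (Ideal.Quotient.mk I) x) =
      Ideal.Quotient.mk (I ^ (n + 1)) (ghostComponent n x) := fun n x => RingHom.liftOfSurjective_comp_apply ..
  have hght : ∀ n (t : T), gh n (teichmuller p (Ideal.Quotient.mk I t)) = Ideal.Quotient.mk (I ^ (n + 1)) (t ^ p ^ n) := by
    intro n t
    rw [← map_teichmuller, hgh, ghostComponent_teichmuller]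
  let θ : ∀ n, WittVector p k →+* T ⧸ I ^ (n + 1) := fun n =>
    (gh n).comp ((WittVector.map g).comp
      (WittVector.map ((_root_.frobeniusEquiv k p).symm ^ n : k →+* k)))
  have hθ : ∀ n, (Ideal.Quotient.factorPowSucc I (n + 1)).comp (θ (n + 1)) = θ n := by
    intro n
    refine eq_of_apply_teichmuller_eq _ _ ⟨n + 1, ?_⟩ fun x => ?_
    · rw [← map_natCast (Ideal.Quotient.mk (I ^ (n + 1))), ← map_pow, Ideal.Quotient.eq_zero_iff_mem]
      exact Ideal.pow_mem_pow hp _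
    · obtain ⟨s, hs⟩ := Ideal.Quotient.mk_surjective (g (((_root_.frobeniusEquiv k p).symm ^ (n + 1) : k →+* k) x))
      have hs' : Ideal.Quotient.mk I (s ^ p) = g (((_root_.frobeniusEquiv k p).symm ^ n : k →+* k) x) := by
        rw [map_pow, hs, ← map_pow]
        congr 1
        rw [pow_succ']
        exact frobeniusEquiv_symm_pow_p ..
      simp only [θ, RingHom.comp_apply, map_teichmuller]
      rw [← hs, ← hs', hght, hght, ← pow_mul, ← pow_succ']
      rfl
  refine ⟨IsAdicComplete.StrictMono.liftRingHom I Order.succ_strictMono θ (fun {n} => hθ n), fun x => ?_⟩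
  have h := IsAdicComplete.StrictMono.mk_liftRingHom I Order.succ_strictMono θ (fun {n} => hθ n) (n := 0) x
  obtain ⟨y, hy⟩ := hsurj (WittVector.map g x)
  have h0 : θ 0 x = Ideal.Quotient.mk (I ^ (0 + 1)) (y.coeff 0) := by
    have : θ 0 x = gh 0 (WittVector.map g x) := by
      have : ((_root_.frobeniusEquiv k p).symm ^ 0 : k →+* k) = RingHom.id k := rfl
      simp only [θ, RingHom.comp_apply, this, WittVector.map_id]; rfl
    rw [this, ← hy, hgh]
    simp [ghostComponent_apply]
  have h2 := h.trans h0
  rw [← map_coeff, ← hy, map_coeff, Ideal.Quotient.mk_eq_mk_iff_sub_mem]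
  have h3 := (Ideal.Quotient.mk_eq_mk_iff_sub_mem _ _).1 h2
  exact (pow_one I).le h3
end

section
variable {B : Type} [CommRing B] {I : Ideal B}

theorem AdicCompletion.mem_map_pow_iff (fg : I.FG) (n : ℕ) (t : AdicCompletion I B) :
    t ∈ (I ^ n).map (algebraMap B (AdicCompletion I B)) ↔ AdicCompletion.evalₐ I n t = 0 := by
  rw [← Submodule.restrictScalars_mem B, ← Ideal.smul_top_eq_map, AdicCompletion.pow_smul_top_eq_ker_eval fg,
    LinearMap.mem_ker, ← AdicCompletion.factor_evalₐ_eq_eval I t (by simp)]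
  refine map_eq_zero_iff _ ?_
  rw [RingHom.injective_iff_ker_eq_bot, Ideal.Quotient.factor_ker]
  exact Ideal.map_mk_eq_bot_of_le (by simp)

theorem AdicCompletion.algebraMap_mem_map_pow (fg : I.FG) {n : ℕ} {b : B}
    (h : algebraMap B (AdicCompletion I B) b ∈ (I ^ n).map (algebraMap B (AdicCompletion I B))) : b ∈ I ^ n := by
  rw [AdicCompletion.mem_map_pow_iff fg] at h
  rw [← Ideal.Quotient.eq_zero_iff_mem, ← h]
  exact (AdicCompletion.evalₐ_of I n b).symm

theorem AdicCompletion.exists_sub_mem (fg : I.FG) (n : ℕ) (t : AdicCompletion I B) :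
    ∃ b, t - algebraMap B (AdicCompletion I B) b ∈ (I ^ n).map (algebraMap B (AdicCompletion I B)) := by
  obtain ⟨b, hb⟩ := Ideal.Quotient.mk_surjective (AdicCompletion.evalₐ I n t)
  refine ⟨b, ?_⟩
  rw [AdicCompletion.mem_map_pow_iff fg, map_sub, ← hb]
  exact sub_eq_zero.2 (AdicCompletion.evalₐ_of I n b).symm

theorem AdicCompletion.algebraMap_mem_map (fg : I.FG) {K : Ideal B} {n : ℕ} (hn : I ^ n ≤ K) {b : B}
    (h : algebraMap B (AdicCompletion I B) b ∈ K.map (algebraMap B (AdicCompletion I B))) : b ∈ K := by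
  have key : ∀ t ∈ K.map (algebraMap B (AdicCompletion I B)), ∃ c ∈ K,
      t - algebraMap B (AdicCompletion I B) c ∈ (I ^ n).map (algebraMap B (AdicCompletion I B)) := by
    intro t ht
    induction ht using Submodule.span_induction with
    | mem x hx =>
      obtain ⟨c, hc, rfl⟩ := hx
      exact ⟨c, hc, by rw [sub_self]; exact zero_mem _⟩
    | zero => exact ⟨0, zero_mem _, by rw [map_zero, sub_zero]; exact zero_mem _⟩
    | add x y _ _ hx hy =>
      obtain ⟨c, hc, hx⟩ := hx
      obtain ⟨c', hc', hy⟩ := hy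
      refine ⟨c + c', add_mem hc hc', ?_⟩
      rw [map_add, add_sub_add_comm]
      exact add_mem hx hy
    | smul a x _ hx =>
      obtain ⟨c, hc, hx⟩ := hx
      obtain ⟨a', ha⟩ := AdicCompletion.exists_sub_mem fg n a
      refine ⟨a' * c, Ideal.mul_mem_left _ _ hc, ?_⟩
      have e : a • x - algebraMap B (AdicCompletion I B) (a' * c) =
        a * (x - algebraMap B (AdicCompletion I B) c) +
          algebraMap B (AdicCompletion I B) c * (a - algebraMap B (AdicCompletion I B) a') := by
        rw [map_mul, smul_eq_mul]; ring
      rw [e]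
      exact add_mem (Ideal.mul_mem_left _ _ hx) (Ideal.mul_mem_left _ _ ha)
  obtain ⟨c, hc, h1⟩ := key _ h
  rw [← map_sub] at h1
  have h2 := hn (AdicCompletion.algebraMap_mem_map_pow fg h1)
  exact (Submodule.sub_mem_iff_left K hc).1 h2

variable {R : Type} [CommRing R] [IsLocalRing R] [Algebra R B]

theorem ColonExact.adicCompletion (hI : I = (maximalIdeal R).map (algebraMap R B)) (fg : I.FG)
    (h : ColonExact R (⊥ : Ideal B)) (K : Ideal R) (n : ℕ) (hn : maximalIdeal R ^ n ≤ K) (z : R)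
    (t : AdicCompletion I B) (ht : algebraMap R (AdicCompletion I B) z * t ∈ K.map (algebraMap R (AdicCompletion I B))) :
    t ∈ (K.colon {z}).map (algebraMap R (AdicCompletion I B)) := by
  have hle : ∀ L : Ideal R, maximalIdeal R ^ n ≤ L → I ^ n ≤ L.map (algebraMap R B) := by
    intro L hL
    rw [hI, ← Ideal.map_pow]
    exact Ideal.map_mono hL
  have hT : algebraMap R (AdicCompletion I B) = (algebraMap B (AdicCompletion I B)).comp (algebraMap R B) :=
    IsScalarTower.algebraMap_eq R B _
  have hcol : maximalIdeal R ^ n ≤ K.colon {z} := by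
    intro a ha
    rw [Submodule.mem_colon_singleton, smul_eq_mul]
    exact Ideal.mul_mem_right _ _ (hn ha)
  obtain ⟨b, hb⟩ := AdicCompletion.exists_sub_mem fg n t
  rw [hT, ← Ideal.map_map] at ht ⊢
  have h1 : algebraMap R B z * b ∈ K.map (algebraMap R B) := by
    refine AdicCompletion.algebraMap_mem_map fg (hle K hn) ?_
    rw [map_mul]
    have e : algebraMap B (AdicCompletion I B) (algebraMap R B z) * algebraMap B (AdicCompletion I B) b =
      algebraMap B (AdicCompletion I B) (algebraMap R B z) * t - algebraMap B (AdicCompletion I B) (algebraMap R B z) *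
        (t - algebraMap B (AdicCompletion I B) b) := by ring
    rw [e]
    exact sub_mem ht (Ideal.mul_mem_left _ _ (Ideal.map_mono (hle K hn) hb))
  have h2 := h K n hn z b (by rw [bot_sup_eq]; exact h1)
  rw [bot_sup_eq] at h2
  have h3 := add_mem (Ideal.map_mono (f := algebraMap B (AdicCompletion I B)) (hle _ hcol) hb) (Ideal.mem_map_of_mem (algebraMap B (AdicCompletion I B)) h2)
  rw [sub_add_cancel] at h3
  exact h3
end

section

theorem eq_span_of_ringKrullDim {W : Type} [CommRing W] [IsDomain W] {d : ℕ} (hW : ringKrullDim W ≤ (d + 1 : ℕ))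
    {E : W} (hE0 : E ≠ 0) (hE : (Ideal.span {E}).IsPrime) {K : Ideal W} (hK : E ∈ K)
    (hd : (d : WithBot ℕ∞) ≤ ringKrullDim (W ⧸ K)) : K = Ideal.span {E} := by
  by_contra hne
  have hle : Ideal.span {E} ≤ K := (Ideal.span_singleton_le_iff_mem K).2 hK
  obtain ⟨f, hf, hfE⟩ := Set.not_subset.1 fun h => hne (le_antisymm h hle)
  have h1 : ringKrullDim (W ⧸ Ideal.span {E}) + 1 ≤ ringKrullDim W :=
    ringKrullDim_quotient_succ_le_of_nonZeroDivisor (mem_nonZeroDivisors_of_ne_zero hE0)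
  have h2 : ringKrullDim ((W ⧸ Ideal.span {E}) ⧸ Ideal.span {Ideal.Quotient.mk (Ideal.span {E}) f}) + 1 ≤
      ringKrullDim (W ⧸ Ideal.span {E}) := by
    refine ringKrullDim_quotient_succ_le_of_nonZeroDivisor (mem_nonZeroDivisors_of_ne_zero ?_)
    rwa [Ne, Ideal.Quotient.eq_zero_iff_mem]
  have h3 : ringKrullDim (W ⧸ K) ≤
      ringKrullDim ((W ⧸ Ideal.span {E}) ⧸ Ideal.span {Ideal.Quotient.mk (Ideal.span {E}) f}) := by
    have hg : ∀ a ∈ Ideal.span {Ideal.Quotient.mk (Ideal.span {E}) f}, Ideal.Quotient.factor hle a = 0 := by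
      intro a ha
      obtain ⟨b, rfl⟩ := Ideal.mem_span_singleton'.1 ha
      rw [map_mul, Ideal.Quotient.factor_mk, Ideal.Quotient.eq_zero_iff_mem.2 hf, mul_zero]
    exact ringKrullDim_le_of_surjective (Ideal.Quotient.lift _ (Ideal.Quotient.factor hle) hg)
      (Ideal.Quotient.lift_surjective_of_surjective _ _ (Ideal.Quotient.factor_surjective hle))
  have h4 : (d : WithBot ℕ∞) + 1 + 1 ≤ (d + 1 : ℕ) :=
    (add_le_add_left (add_le_add_left (hd.trans h3) 1 |>.trans h2) 1).trans (h1.trans hW)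
  have h5 : ((d + 1 + 1 : ℕ) : WithBot ℕ∞) ≤ (d + 1 : ℕ) := by exact_mod_cast h4
  have h6 : d + 1 + 1 ≤ d + 1 := by exact_mod_cast h5
  omega

theorem ringKrullDim_le_of_flat {R T : Type} [CommRing R] [CommRing T] [IsLocalRing R] [IsLocalRing T]
    [IsNoetherianRing R] [IsNoetherianRing T]
    [Algebra R T] [IsLocalHom (algebraMap R T)] [Module.Flat R T] : ringKrullDim R ≤ ringKrullDim T := by
  rw [← IsLocalRing.maximalIdeal_height_eq_ringKrullDim, ← IsLocalRing.maximalIdeal_height_eq_ringKrullDim,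
    Ideal.height_eq_height_add_of_liesOver_of_hasGoingDown (maximalIdeal R) (maximalIdeal T)]
  exact_mod_cast le_self_add

theorem exists_fin_span_maximalIdeal {R : Type} [CommRing R] [IsLocalRing R] [IsNoetherianRing R] {d : ℕ}
    (hd : Module.finrank (ResidueField R) (CotangentSpace R) = d) :
    ∃ x : Fin d → R, Ideal.span (Set.range x) = maximalIdeal R := by
  rw [← IsLocalRing.spanFinrank_maximalIdeal_eq_finrank_cotangentSpace] at hd
  obtain ⟨s, hs, hspan⟩ := Submodule.FG.exists_span_finset_card_eq_spanFinrank
    (maximalIdeal R).fg_of_isNoetherianRing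
  let e := s.equivFinOfCardEq (hs.trans hd)
  refine ⟨fun i => e.symm i, ?_⟩
  rw [← hspan]
  congr 1
  ext a
  exact ⟨fun ⟨i, hi⟩ => hi ▸ (e.symm i).2, fun ha => ⟨e ⟨a, ha⟩, by simp⟩⟩

instance WittVector.charZero_of_perfect {p : ℕ} [Fact p.Prime] {k : Type} [Field k] [CharP k p] [PerfectRing k p] :
    CharZero (WittVector p k) := by
  have hp : Irreducible (p : WittVector p k) := WittVector.irreducible p
  refine charZero_of_inj_zero fun n hn => ?_
  by_contra h0
  obtain ⟨e, m, hm, rfl⟩ := Nat.exists_eq_pow_mul_and_not_dvd h0 p (Fact.out : p.Prime).ne_one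
  rw [Nat.cast_mul, Nat.cast_pow] at hn
  have h1 : (m : WittVector p k) = 0 := (mul_eq_zero.1 hn).resolve_left (pow_ne_zero _ hp.ne_zero)
  have h2 := congrArg WittVector.constantCoeff h1
  rw [map_natCast, map_zero, CharP.cast_eq_zero_iff k p] at h2
  exact hm h2

theorem WittVector.maximalIdeal_eq {p : ℕ} [Fact p.Prime] {k : Type} [Field k] [CharP k p] [PerfectRing k p] :
    maximalIdeal (WittVector p k) = Ideal.span {(p : WittVector p k)} :=
  (WittVector.irreducible p).maximalIdeal_eq

theorem WittVector.isAlgClosed_residueField {p : ℕ} [Fact p.Prime] {k : Type} [Field k] [CharP k p] [PerfectRing k p]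
    [IsAlgClosed k] : IsAlgClosed (ResidueField (WittVector p k)) := by
  have h : maximalIdeal (WittVector p k) = RingHom.ker (WittVector.constantCoeff (p := p) (R := k)) := by
    rw [WittVector.maximalIdeal_eq, WittVector.ker_constantCoeff]
  have e : ResidueField (WittVector p k) ≃+* k := (Ideal.quotEquivOfEq h).trans
    (RingHom.quotientKerEquivOfSurjective (WittVector.constantCoeff_surjective p))
  exact IsAlgClosed.of_ringEquiv k _ e.symm
end

section
open MvPolynomial

variable {R : Type} [CommRing R] [IsLocalRing R]

theorem ColonExact.quotient {A : Type} [CommRing A] [Algebra R A] {J : Ideal A} (h : ColonExact R J) :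
    ColonExact R (⊥ : Ideal (A ⧸ J)) := by
  intro I n hn z w hw
  obtain ⟨w, rfl⟩ := Ideal.Quotient.mk_surjective w
  have hmap : ∀ K : Ideal R, K.map (algebraMap R (A ⧸ J)) =
      (K.map (algebraMap R A)).map (Ideal.Quotient.mk J) := by
    intro K
    rw [Ideal.map_map]; rfl
  have key : ∀ (K : Ideal R) (a : A), Ideal.Quotient.mk J a ∈ K.map (algebraMap R (A ⧸ J)) ↔
      a ∈ J ⊔ K.map (algebraMap R A) := by
    intro K a
    rw [hmap, ← Ideal.mem_comap, Ideal.comap_map_of_surjective' _ Ideal.Quotient.mk_surjective, Ideal.mk_ker, sup_comm]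
  rw [bot_sup_eq] at hw ⊢
  rw [key]
  refine h I n hn z w ?_
  rw [← key]
  exact hw

/-- A complete local algebra with algebraically closed residue field which is compatible with colons
of ideals primary to the maximal ideal. -/
theorem exists_complete_extension [IsNoetherianRing R] (p : ℕ) [CharP (ResidueField R) p] :
    ∃ (k : Type) (_ : Field k) (_ : CharP k p) (_ : IsAlgClosed k) (T : Type) (_ : CommRing T) (_ : Algebra R T)
      (g : k →+* T ⧸ (maximalIdeal R).map (algebraMap R T)),
      Function.Surjective g ∧ IsAdicComplete ((maximalIdeal R).map (algebraMap R T)) T ∧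
      ((maximalIdeal R).map (algebraMap R T)).IsMaximal ∧
      ∀ (K : Ideal R) (n : ℕ), maximalIdeal R ^ n ≤ K → ∀ (z : R) (t : T),
        algebraMap R T z * t ∈ K.map (algebraMap R T) → t ∈ (K.colon {z}).map (algebraMap R T) := by
  let κ := ResidueField R
  let k := AlgebraicClosure κ
  have hk : CharP k p := charP_of_injective_algebraMap (algebraMap κ k).injective p
  have hker : RingHom.ker (algebraMap R k) = maximalIdeal R := by
    rw [IsScalarTower.algebraMap_eq R κ k, ← RingHom.comap_ker,
      (RingHom.injective_iff_ker_eq_bot _).1 (algebraMap κ k).injective]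
    exact ker_residue
  obtain ⟨J, hJ, hJk⟩ := exists_colonExact (R := R) (k := k) (κ := κ) IsLocalRing.residue_surjective hker
  let A := MvPolynomial k R
  let B := A ⧸ J
  let I : Ideal B := (maximalIdeal R).map (algebraMap R B)
  have fg : I.FG := (maximalIdeal R).fg_of_isNoetherianRing.map _
  let ev : A →+* k := (aeval (R := R) (id : k → k)).toRingHom
  have hev : Function.Surjective ev := fun a => ⟨X a, aeval_X _ _⟩
  have hevJ : ∀ a ∈ J, ev a = 0 := by
    intro a ha
    have : a ∈ RingHom.ker (aeval (R := R) (id : k → k)) := hJk ▸ Ideal.mem_sup_left ha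
    exact this
  let e : B →+* k := Ideal.Quotient.lift J ev hevJ
  have he : Function.Surjective e := Ideal.Quotient.lift_surjective_of_surjective _ _ hev
  have heker : RingHom.ker e = I := by
    have h1 : I = ((maximalIdeal R).map (algebraMap R A)).map (Ideal.Quotient.mk J) := by
      rw [Ideal.map_map]; rfl
    ext b
    obtain ⟨a, rfl⟩ := Ideal.Quotient.mk_surjective b
    have h2 : a ∈ RingHom.ker (aeval (R := R) (id : k → k)) ↔ Ideal.Quotient.mk J a ∈ I := by
      rw [← hJk, h1, ← Ideal.mem_comap (f := Ideal.Quotient.mk J), Ideal.comap_map_of_surjective' _ Ideal.Quotient.mk_surjective, Ideal.mk_ker, sup_comm]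
    rw [← h2]
    rfl
  have hImax : I.IsMaximal := heker ▸ RingHom.ker_isMaximal_of_surjective e he
  let T := AdicCompletion I B
  have hIT : (maximalIdeal R).map (algebraMap R T) = I.map (algebraMap B T) := by
    rw [Ideal.map_map]; rfl
  have hc : IsAdicComplete (I.map (algebraMap B T)) T := AdicCompletion.isAdicComplete_self I fg
  have hmax : (I.map (algebraMap B T)).IsMaximal := AdicCompletion.isMaximal_map_of_le I I le_rfl fg
  let q : B →+* T ⧸ (maximalIdeal R).map (algebraMap R T) := (Ideal.Quotient.mk _).comp (algebraMap B T)
  have hq : Function.Surjective q := by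
    intro y
    obtain ⟨t, rfl⟩ := Ideal.Quotient.mk_surjective y
    obtain ⟨b, hb⟩ := AdicCompletion.exists_sub_mem fg 1 t
    refine ⟨b, ?_⟩
    rw [pow_one, ← hIT] at hb
    exact ((Ideal.Quotient.mk_eq_mk_iff_sub_mem _ _).2 hb).symm
  have hqI : RingHom.ker e ≤ RingHom.ker q := by
    intro b hb
    rw [heker] at hb
    rw [RingHom.mem_ker, RingHom.comp_apply, Ideal.Quotient.eq_zero_iff_mem, hIT]
    exact Ideal.mem_map_of_mem _ hb
  let g := RingHom.liftOfSurjective e he ⟨q, hqI⟩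
  have hg : Function.Surjective g := by
    intro y
    obtain ⟨b, rfl⟩ := hq y
    exact ⟨e b, RingHom.liftOfSurjective_comp_apply ..⟩
  refine ⟨k, inferInstance, hk, inferInstance, T, inferInstance, inferInstance, g, hg, ?_, ?_, ?_⟩
  · rw [hIT]; exact hc
  · rw [hIT]; exact hmax
  · exact ColonExact.adicCompletion rfl fg hJ.quotient
end

section

theorem finite_ass_of_regular {R : Type} [CommRing R] [IsLocalRing R] [IsNoetherianRing R] {d : ℕ}
    (hdim : ringKrullDim R = d)
    (hd : Module.finrank (ResidueField R) (CotangentSpace R) = d)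
    (p : ℕ) [Fact p.Prime] [CharP (ResidueField R) p] (L : List (Ideal R × ℕ)) :
    {P ∈ associatedPrimes R (iteratedLocalCohomology L (ModuleCat.of R R)) | (p : R) ∉ P}.Finite := by
  obtain ⟨k, _, _, _, T, _, _, g, hg, hc, hmax, hcolon⟩ := exists_complete_extension (R := R) p
  let mT := (maximalIdeal R).map (algebraMap R T)
  have hpR : (p : R) ∈ maximalIdeal R := by
    rw [← IsLocalRing.residue_eq_zero_iff, map_natCast, CharP.cast_eq_zero]
  have hpT : (p : T) ∈ mT := by
    rw [← map_natCast (algebraMap R T)]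
    exact Ideal.mem_map_of_mem _ hpR
  let V := WittVector p k
  obtain ⟨φ₀, hφ₀⟩ := exists_wittLift (p := p) mT hpT g
  let _ : Algebra V T := φ₀.toAlgebra
  obtain ⟨x, hx⟩ := exists_fin_span_maximalIdeal hd
  obtain ⟨φ, hφ⟩ := exists_psLift (R := V) mT (fun i => algebraMap R T (x i)) (fun i =>
    Ideal.mem_map_of_mem _ (hx ▸ Ideal.subset_span ⟨i, rfl⟩))
  let W := MvPowerSeries (Fin d) V
  have hφX : (XI (Fin d) V).map φ.toRingHom = mT := by
    change Ideal.map _ (Ideal.span _) = Ideal.map _ _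
    rw [← hx, Ideal.map_span, Ideal.map_span, ← Set.range_comp, ← Set.range_comp]
    congr 2
    exact funext hφ
  have hsurj : Function.Surjective φ.toRingHom := by
    have : IsHausdorff ((XI (Fin d) V).map φ.toRingHom) T := by rw [hφX]; infer_instance
    refine surjective_of_mk_map_comp_surjective (I := XI (Fin d) V) φ.toRingHom ?_
    rw [hφX]
    intro y
    obtain ⟨a, rfl⟩ := hg y
    obtain ⟨v, rfl⟩ := WittVector.constantCoeff_surjective p a
    refine ⟨MvPowerSeries.C v, ?_⟩
    have h1 : φ (MvPowerSeries.C v) = φ₀ v := φ.commutes v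
    exact (congrArg (Ideal.Quotient.mk mT) h1).trans (hφ₀ v)
  let _ : Algebra W T := φ.toRingHom.toAlgebra
  have : IsNoetherianRing T := isNoetherianRing_of_surjective W T φ.toRingHom hsurj
  have : IsLocalRing T := isLocalRing_of_isAdicComplete_maximal mT
  have hmT : mT = maximalIdeal T := IsLocalRing.eq_maximalIdeal hmax
  have : IsLocalHom (algebraMap R T) :=
    ((IsLocalRing.local_hom_TFAE (algebraMap R T)).out 0 2).2 hmT.le
  have hflat : Module.Flat R T := flat_of_colon_primary hcolon
  have : Module.FaithfullyFlat R T := Module.FaithfullyFlat.of_flat_of_isLocalHom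
  have hmV : maximalIdeal V = Ideal.span {(p : V)} := WittVector.maximalIdeal_eq
  obtain ⟨h, hh, hhp⟩ : ∃ h ∈ XI (Fin d) V, φ h = p := by
    rw [← hφX, Ideal.mem_map_iff_of_surjective _ hsurj] at hpT
    exact hpT
  let E : W := MvPowerSeries.C (p : V) - h
  have hφE : φ.toRingHom E = 0 := by
    change φ (MvPowerSeries.C (p : V) - h) = 0
    rw [map_sub, hhp, map_natCast, map_natCast, sub_self]
  have hpV : Prime (p : V) := (WittVector.irreducible p).prime
  have : IsDomain W := NoZeroDivisors.to_isDomain (MvPowerSeries (Fin d) V)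
  have hE0 : E ≠ 0 := by
    intro h0
    have h1 := congrArg MvPowerSeries.constantCoeff h0
    rw [map_sub, mem_XI_iff.1 hh, MvPowerSeries.constantCoeff_C, sub_zero, map_zero] at h1
    exact hpV.ne_zero h1
  have hEp : (Ideal.span {E}).IsPrime := span_E_isPrime hpV rfl hh
  have hdimT : (d : WithBot ℕ∞) ≤ ringKrullDim (W ⧸ RingHom.ker φ.toRingHom) := by
    rw [← hdim, ringKrullDim_eq_of_ringEquiv (RingHom.quotientKerEquivOfSurjective hsurj)]
    exact ringKrullDim_le_of_flat
  have hkerE : RingHom.ker φ.toRingHom = Ideal.span {E} :=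
    eq_span_of_ringKrullDim (ringKrullDim_ps_le hmV d) hE0 hEp hφE hdimT
  have : IsDomain T := by
    have : (RingHom.ker φ.toRingHom).IsPrime := hkerE ▸ hEp
    exact (RingHom.quotientKerEquivOfSurjective hsurj).symm.toMulEquiv.isDomain _
  have : IsAlgClosed (ResidueField V) := WittVector.isAlgClosed_residueField
  refine finite_ass_of_faithfullyFlat (V := V) (σ := Fin d) (E := E) (T := T) (h := h) hmV hsurj
    (fun w hw => hkerE ▸ hw) hφE rfl hh (p : R) ?_ L
  rw [map_natCast, map_natCast, map_natCast]
end

end LC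
end

/-- Let `(R, m, K)` be a commutative Noetherian regular local ring of mixed characteristic
`p > 0` (i.e. `R` has characteristic `0` and its residue field `K` has characteristic `p`).
Then for every finite list of ideals `I₁, …, I_t ⊆ R` and naturals `i₁, …, i_t`, the set of
associated primes `P` of `H^{i₁}_{I₁}(H^{i₂}_{I₂}(⋯ H^{i_t}_{I_t}(R) ⋯))` with `p ∉ P`
is finite. -/
theorem finite_assPrimes_not_mem_iteratedLocalCohomology_of_mixedChar
    {R : Type} [CommRing R] [IsLocalRing R] [IsNoetherianRing R]
    (hreg : IsRegularLocal R) [CharZero R] (p : ℕ) (hp : p.Prime)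
    (hres : CharP (IsLocalRing.ResidueField R) p)
    (l : List (Ideal R × ℕ)) :
    {P ∈ associatedPrimes R (iteratedLocalCohomology l (ModuleCat.of R R)) |
      (p : R) ∉ P}.Finite := by
  have : Fact p.Prime := ⟨hp⟩
  exact LC.finite_ass_of_regular hreg.2 rfl p l
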